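/- Let d ≥ 1, δ ∈ (0,1], p, q ∈ (1,∞) and r ∈ (1, min(p,q)]. Then there exist constants â₀ = â₀(d,δ,p,q,r) > 0 and N = N(d,δ,p,q,r) such that the following holds. Let a : ℝ^{1+d} → 𝕊_δ be measurable with a^♯ ≤ â₀, and let u ∈ 𝕃_{q,p}(C₂) possess weak derivatives u_t = ∂_t u, u_i = D_i u, u_{ij} = D_{ij}u on C₂, all belonging to 𝕃_{q,p}(C₂), and satisfy u_t + Σ_{i,j} a^{ij} u_{ij} = 0 almost everywhere in C₂. Then ‖u‖_{𝕃_{q,p}(C₁)} ≤ N ( ∫_{C₂} |u|^r dx dt )^{1/r}. -/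

import Mathlib

open MeasureTheory Metric Set
open scoped ENNReal NNReal

noncomputable section

abbrev Spc (d : ℕ) : Type := EuclideanSpace ℝ (Fin d)

abbrev Pt (d : ℕ) : Type := ℝ × Spc d

instance matrixMeasurableSpace (d : ℕ) : MeasurableSpace (Matrix (Fin d) (Fin d) ℝ) :=
  (inferInstance : MeasurableSpace (Fin d → Fin d → ℝ))

/-- Membership in `𝕊_δ`: symmetric `d×d` matrices with
`δ|ξ|² ≤ (aξ,ξ) ≤ δ⁻¹|ξ|²`. -/
def inS (d : ℕ) (δ : ℝ) (a : Matrix (Fin d) (Fin d) ℝ) : Prop :=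
  a.IsSymm ∧ ∀ ξ : Fin d → ℝ,
    δ * (∑ i, ξ i ^ 2) ≤ (∑ i, ∑ j, a i j * ξ i * ξ j) ∧
    (∑ i, ∑ j, a i j * ξ i * ξ j) ≤ δ⁻¹ * (∑ i, ξ i ^ 2)

/-- `{a,u} = a^{ij} a^{kr} u_{ik} u_{jr}`. -/
def bra (d : ℕ) (a u : Matrix (Fin d) (Fin d) ℝ) : ℝ :=
  ∑ i, ∑ j, ∑ k, ∑ r, a i j * a k r * u i k * u j r

/-- Frobenius norm of a `d×d` array. -/
def mnorm {d : ℕ} (m : Fin d → Fin d → ℝ) : ℝ :=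
  Real.sqrt (∑ i, ∑ j, m i j ^ 2)

/-- Euclidean norm of a vector given as `Fin d → ℝ`. -/
def vnorm {d : ℕ} (v : Fin d → ℝ) : ℝ :=
  Real.sqrt (∑ i, v i ^ 2)

/-- Parabolic cylinder `C_R(t,x) = (t, t+R²) × B_R(x)`. -/
def cyl (d : ℕ) (R t : ℝ) (x : Spc d) : Set (Pt d) :=
  Ioo t (t + R ^ 2) ×ˢ ball x R

/-- Time derivative `∂_t u`. -/
def Dt {d : ℕ} (u : Pt d → ℝ) (z : Pt d) : ℝ :=
  deriv (fun s => u (s, z.2)) z.1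

/-- Spatial derivative `D_i u`. -/
def Dx {d : ℕ} (i : Fin d) (u : Pt d → ℝ) (z : Pt d) : ℝ :=
  fderiv ℝ (fun y => u (z.1, y)) z.2 (EuclideanSpace.single i 1)

/-- Second spatial derivative `D_{ij} u = D_i D_j u`. -/
def Dxx {d : ℕ} (i j : Fin d) (u : Pt d → ℝ) : Pt d → ℝ :=
  Dx i (Dx j u)

/-- `u ∈ C₀^∞(ℝ^{1+d})`. -/
def CinfC {d : ℕ} (u : Pt d → ℝ) : Prop :=
  ContDiff ℝ (⊤ : ℕ∞) u ∧ HasCompactSupport u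

/-- The kernel `p_{α,k}(s,r)`. -/
def pak (d : ℕ) (α k s r : ℝ) : ℝ :=
  if 0 < s then s ^ (-((d : ℝ) + 2 - α) / 2) * Real.exp (-(r ^ 2) / (k * s)) else 0

/-- Parabolic distance to the origin `ρ(t,x) = |x| + √|t|`. -/
def prho {d : ℕ} (z : Pt d) : ℝ := ‖z.2‖ + Real.sqrt |z.1|

/-- Average of (the positive part of) `g` over `C`, valued in `ℝ≥0∞`. -/
def aveLin {d : ℕ} (C : Set (Pt d)) (g : Pt d → ℝ) : ℝ≥0∞ :=
  (volume C)⁻¹ * ∫⁻ z in C, ENNReal.ofReal (g z)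

/-- Parabolic maximal function `𝕄_β g` (for `g ≥ 0`). -/
def maxF {d : ℕ} (β : ℝ) (g : Pt d → ℝ) (z : Pt d) : ℝ≥0∞ :=
  ⨆ (ρ : ℝ) (_ : 0 < ρ) (t : ℝ) (x : Spc d) (_ : z ∈ cyl d ρ t x),
    ENNReal.ofReal (ρ ^ β) * aveLin (cyl d ρ t x) g

/-- Oscillation of a matrix-valued function over `C`. -/
def oscC {d : ℕ} (C : Set (Pt d)) (g : Pt d → Fin d → Fin d → ℝ) : ℝ :=
  ⨍ z₁ in C, ⨍ z₂ in C, mnorm (fun i j => g z₁ i j - g z₂ i j)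

/-- Mixed norm `‖f‖_{𝕃_{q,p}}` (inner integration in `t`, outer in `x`). -/
def mixedNorm {d : ℕ} (q p : ℝ) (f : Pt d → ℝ) : ℝ :=
  (∫ x : Spc d, (∫ t : ℝ, |f (t, x)| ^ q) ^ (p / q)) ^ (1 / p)

/-- Mixed norm on a set `Γ`. -/
def mixedNormOn {d : ℕ} (q p : ℝ) (Γ : Set (Pt d)) (f : Pt d → ℝ) : ℝ :=
  mixedNorm q p (Γ.indicator f)

/-- Normalized (averaged) mixed norm over the cylinder `C_R(t,x)`, in `ℝ≥0∞`. -/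
def cylNormL {d : ℕ} (q p R t : ℝ) (x : Spc d) (f : Pt d → ℝ) : ℝ≥0∞ :=
  ((volume (ball x R))⁻¹ * ∫⁻ y in ball x R,
      ((volume (Ioo t (t + R ^ 2)))⁻¹ * ∫⁻ s in Ioo t (t + R ^ 2),
        ENNReal.ofReal |f (s, y)| ^ q) ^ (p / q)) ^ (1 / p)

/-- Mixed norm on a set, valued in `ℝ≥0∞`. -/
def mixedNormLe {d : ℕ} (q p : ℝ) (Γ : Set (Pt d)) (f : Pt d → ℝ) : ℝ≥0∞ :=
  (∫⁻ x : Spc d, (∫⁻ t : ℝ, ENNReal.ofReal |Γ.indicator f (t, x)| ^ q) ^ (p / q)) ^ (1 / p)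

/-- `ã_C(t)`: average of `a(t,·)` over the ball of the cylinder. -/
def aTilde {d : ℕ} (a : Pt d → Matrix (Fin d) (Fin d) ℝ) (R : ℝ) (x₀ : Spc d) (t : ℝ)
    (i j : Fin d) : ℝ :=
  ⨍ y in ball x₀ R, a (t, y) i j

/-- The mean oscillation of `a` w.r.t. `x` over one cylinder. -/
def aSharpCyl {d : ℕ} (a : Pt d → Matrix (Fin d) (Fin d) ℝ) (R t₀ : ℝ) (x₀ : Spc d) : ℝ≥0∞ :=
  (volume (cyl d R t₀ x₀))⁻¹ * ∫⁻ z in cyl d R t₀ x₀,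
    ENNReal.ofReal (mnorm (fun i j => a z i j - aTilde a R x₀ z.1 i j))

/-- `a^♯`. -/
def aSharp {d : ℕ} (a : Pt d → Matrix (Fin d) (Fin d) ℝ) : ℝ≥0∞ :=
  ⨆ (R : ℝ) (_ : 0 < R) (t₀ : ℝ) (x₀ : Spc d), aSharpCyl a R t₀ x₀

/-- `a^♯_ρ` (only cylinders of radius `≤ ρa`). -/
def aSharpRho {d : ℕ} (a : Pt d → Matrix (Fin d) (Fin d) ℝ) (ρa : ℝ) : ℝ≥0∞ :=
  ⨆ (R : ℝ) (_ : 0 < R) (_ : R ≤ ρa) (t₀ : ℝ) (x₀ : Spc d), aSharpCyl a R t₀ x₀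

/-- Homogeneous Morrey norm `‖g‖_{Ė_{p,β}}`. -/
def morreyP {d : ℕ} (p β : ℝ) (g : Pt d → ℝ) : ℝ≥0∞ :=
  ⨆ (ρ : ℝ) (_ : 0 < ρ) (t : ℝ) (x : Spc d),
    ENNReal.ofReal (ρ ^ β) *
      ((volume (cyl d ρ t x))⁻¹ * ∫⁻ z in cyl d ρ t x, ENNReal.ofReal |g z| ^ p) ^ (1 / p)

/-- Homogeneous mixed-norm Morrey norm `‖g‖_{Ė_{q,p,β}}`. -/
def morreyQP {d : ℕ} (q p β : ℝ) (g : Pt d → ℝ) : ℝ≥0∞ :=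
  ⨆ (ρ : ℝ) (_ : 0 < ρ) (t : ℝ) (x : Spc d),
    ENNReal.ofReal (ρ ^ β) * cylNormL q p ρ t x g

/-- Inhomogeneous mixed-norm Morrey norm `‖g‖_{E_{q,p,β}}` (radii `ρ ∈ (0,1]`). -/
def morreyI {d : ℕ} (q p β : ℝ) (g : Pt d → ℝ) : ℝ≥0∞ :=
  ⨆ (ρ : ℝ) (_ : 0 < ρ) (_ : ρ ≤ 1) (t : ℝ) (x : Spc d),
    ENNReal.ofReal (ρ ^ β) * cylNormL q p ρ t x g

/-- `b̄_{q',p',ρb}` for a vector field `b`. -/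
def bBar {d : ℕ} (q' p' : ℝ) (b : Pt d → Fin d → ℝ) (ρb : ℝ) : ℝ≥0∞ :=
  ⨆ (R : ℝ) (_ : 0 < R) (_ : R ≤ ρb) (t : ℝ) (x : Spc d),
    ENNReal.ofReal R * cylNormL q' p' R t x (fun z => vnorm (b z))

/-- Test function supported in the open set `Q`. -/
def IsTest {d : ℕ} (Q : Set (Pt d)) (φ : Pt d → ℝ) : Prop :=
  ContDiff ℝ (⊤ : ℕ∞) φ ∧ HasCompactSupport φ ∧ tsupport φ ⊆ Q

/-- `ut` is the weak time derivative of `u` on `Q`. -/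
def WeakDtOn {d : ℕ} (Q : Set (Pt d)) (u ut : Pt d → ℝ) : Prop :=
  ∀ φ, IsTest Q φ → ∫ z in Q, u z * Dt φ z = - ∫ z in Q, ut z * φ z

/-- `ui` is the weak `i`-th spatial derivative of `u` on `Q`. -/
def WeakDxOn {d : ℕ} (Q : Set (Pt d)) (i : Fin d) (u ui : Pt d → ℝ) : Prop :=
  ∀ φ, IsTest Q φ → ∫ z in Q, u z * Dx i φ z = - ∫ z in Q, ui z * φ z

section Aux15
local notation "ℓ" => ENNReal.ofReal
local notation "𝕄" d:max => Matrix (Fin d) (Fin d) ℝ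
local notation "𝔽" d:max => Pt d → ℝ
local notation "𝔸" d:max => Pt d → Matrix (Fin d) (Fin d) ℝ
variable {d : ℕ}
abbrev Sm {d : ℕ} (u : 𝔽 d) : Prop := ContDiff ℝ (⊤ : ℕ∞) u

def et (d : ℕ) : Pt d := (1, 0)
def ex {d : ℕ} (i : Fin d) : Pt d := (0, EuclideanSpace.single i 1)

def DD {d : ℕ} (v : Pt d) (u : 𝔽 d) (z : Pt d) : ℝ := fderiv ℝ u z v

lemma Sm.diff {u : 𝔽 d} (h : Sm u) : Differentiable ℝ u := h.differentiable (by simp)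

lemma Dt_eq {u : 𝔽 d} (h : Sm u) : Dt u = DD (et d) u := by
  ext z
  have h1 : HasDerivAt (fun s : ℝ ↦ ((s, z.2) : Pt d)) (1, 0) z.1 :=
    (hasDerivAt_id z.1).prodMk (hasDerivAt_const _ _)
  exact ((h.diff z).hasFDerivAt.comp_hasDerivAt z.1 h1).deriv

lemma Dx_eq {u : 𝔽 d} (h : Sm u) (i : Fin d) : Dx i u = DD (ex i) u := by
  ext z
  have h1 : HasFDerivAt (fun y : Spc d ↦ ((z.1, y) : Pt d)) (ContinuousLinearMap.inr ℝ ℝ (Spc d)) z.2 :=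
    hasFDerivAt_prodMk_right z.1 z.2
  have := ((h.diff z).hasFDerivAt.comp z.2 h1).fderiv
  simp only [Function.comp_def] at this
  simp only [Dx, DD, this, ex]
  simp

lemma Sm.dd {u : 𝔽 d} (h : Sm u) (v : Pt d) : Sm (DD v u) :=
  (h.fderiv_right (m := (⊤ : ℕ∞)) (by simp)).clm_apply contDiff_const

lemma Sm.dt {u : 𝔽 d} (h : Sm u) : Sm (Dt u) := by rw [Dt_eq h]; exact h.dd _
lemma Sm.dx {u : 𝔽 d} (h : Sm u) (i : Fin d) : Sm (Dx i u) := by rw [Dx_eq h]; exact h.dd _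
lemma Sm.dxx {u : 𝔽 d} (h : Sm u) (i j : Fin d) : Sm (Dxx i j u) := (h.dx j).dx i

lemma DD_supp (v : Pt d) {u : 𝔽 d} (h : HasCompactSupport u) : HasCompactSupport (DD v u) :=
  h.fderiv_apply ℝ v

lemma CinfC.sm {u : 𝔽 d} (h : CinfC u) : Sm u := h.1
lemma CinfC.dd {u : 𝔽 d} (h : CinfC u) (v : Pt d) : CinfC (DD v u) := ⟨h.sm.dd v, DD_supp v h.2⟩
lemma CinfC.dt {u : 𝔽 d} (h : CinfC u) : CinfC (Dt u) := by rw [Dt_eq h.1]; exact h.dd _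
lemma CinfC.dx {u : 𝔽 d} (h : CinfC u) (i : Fin d) : CinfC (Dx i u) := by rw [Dx_eq h.1]; exact h.dd _
lemma CinfC.dxx {u : 𝔽 d} (h : CinfC u) (i j : Fin d) : CinfC (Dxx i j u) := (h.dx j).dx i
lemma CinfC.add {u v : 𝔽 d} (h : CinfC u) (h' : CinfC v) : CinfC (fun z ↦ u z + v z) := ⟨h.1.add h'.1, h.2.add h'.2⟩
lemma CinfC.neg {u : 𝔽 d} (h : CinfC u) : CinfC (fun z ↦ - u z) := ⟨h.1.neg, HasCompactSupport.neg h.2⟩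
lemma CinfC.sub {u v : 𝔽 d} (h : CinfC u) (h' : CinfC v) : CinfC (fun z ↦ u z - v z) := by
  simpa [sub_eq_add_neg] using h.add h'.neg
lemma CinfC.mul_sm {u v : 𝔽 d} (h : CinfC u) (h' : Sm v) : CinfC (fun z ↦ u z * v z) :=
  ⟨h.1.mul h', h.2.mul_right⟩
lemma CinfC.sm_mul {u v : 𝔽 d} (h : CinfC u) (h' : Sm v) : CinfC (fun z ↦ v z * u z) :=
  ⟨h'.mul h.1, h.2.mul_left⟩
lemma CinfC.cont {u : 𝔽 d} (h : CinfC u) : Continuous u := h.1.continuous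
lemma CinfC.meas {u : 𝔽 d} (h : CinfC u) : Measurable u := h.1.continuous.measurable
lemma CinfC.integrable {u : 𝔽 d} (h : CinfC u) : Integrable u := h.cont.integrable_of_hasCompactSupport h.2
lemma CinfC.bdd {u : 𝔽 d} (h : CinfC u) : ∃ C, ∀ z, |u z| ≤ C := by
  simpa using h.cont.bounded_above_of_compact_support h.2
lemma CinfC.memLp {u : 𝔽 d} (h : CinfC u) (p : ℝ≥0∞) : MemLp u p := h.cont.memLp_of_hasCompactSupport h.2

lemma DD_add (v : Pt d) {f g : 𝔽 d} (hf : Sm f) (hg : Sm g) (z : Pt d) :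
    DD v (fun z ↦ f z + g z) z = DD v f z + DD v g z := by
  simp only [DD]; rw [fderiv_fun_add (hf.diff z) (hg.diff z)]; simp
lemma DD_sub (v : Pt d) {f g : 𝔽 d} (hf : Sm f) (hg : Sm g) (z : Pt d) :
    DD v (fun z ↦ f z - g z) z = DD v f z - DD v g z := by
  simp only [DD]; rw [fderiv_fun_sub (hf.diff z) (hg.diff z)]; simp
lemma DD_mul (v : Pt d) {f g : 𝔽 d} (hf : Sm f) (hg : Sm g) (z : Pt d) :
    DD v (fun z ↦ f z * g z) z = DD v f z * g z + f z * DD v g z := by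
  simp only [DD]; rw [fderiv_fun_mul (hf.diff z) (hg.diff z)]; simp; ring
lemma DD_cmul (v : Pt d) {f : 𝔽 d} (c : ℝ) (z : Pt d) :
    DD v (fun z ↦ c * f z) z = c * DD v f z := by
  simp only [DD]
  have : (fun z ↦ c * f z) = c • f := by ext; simp
  rw [this, fderiv_const_smul_field]; simp

lemma DD_comm (v v' : Pt d) {f : 𝔽 d} (hf : Sm f) : DD v (DD v' f) = DD v' (DD v f) := by
  ext z
  have h2 : Differentiable ℝ (fderiv ℝ f) :=
    (hf.fderiv_right (m := (⊤ : ℕ∞)) (by simp)).differentiable (by simp)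
  have key : ∀ a b : Pt d, fderiv ℝ (fun y ↦ fderiv ℝ f y a) z b = fderiv ℝ (fderiv ℝ f) z b a := by
    intro a b
    rw [fderiv_clm_apply (h2 z) (differentiableAt_const a)]; simp
  have hs : IsSymmSndFDerivAt ℝ f z := by
    refine (hf.contDiffAt (x := z)).isSymmSndFDerivAt ?_
    simp only [minSmoothness_of_isRCLikeNormedField]
    exact WithTop.coe_le_coe.2 le_top
  change fderiv ℝ (fun y ↦ fderiv ℝ f y v') z v = fderiv ℝ (fun y ↦ fderiv ℝ f y v) z v'
  rw [key, key]
  exact hs _ _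

lemma Dxx_eq {u : 𝔽 d} (h : Sm u) (i j : Fin d) : Dxx i j u = DD (ex i) (DD (ex j) u) := by
  rw [Dxx, Dx_eq (h.dx j), Dx_eq h]

lemma Dxx_symm {u : 𝔽 d} (h : Sm u) (i j : Fin d) : Dxx i j u = Dxx j i u := by
  rw [Dxx_eq h, Dxx_eq h, DD_comm _ _ h]

lemma Dx_comm {u : 𝔽 d} (h : Sm u) (i j : Fin d) : Dx i (Dx j u) = Dx j (Dx i u) := Dxx_symm h i j

lemma Dt_Dx {u : 𝔽 d} (h : Sm u) (i : Fin d) : Dt (Dx i u) = Dx i (Dt u) := by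
  rw [Dt_eq (h.dx i), Dx_eq h, Dx_eq h.dt, Dt_eq h, DD_comm _ _ h]

def Lop (a : 𝔸 d) (w : 𝔽 d) (z : Pt d) : ℝ :=
  Dt w z + ∑ i, ∑ j, a z i j * Dxx i j w z

lemma Lop_sub (a : 𝔸 d) {u v : 𝔽 d} (hu : Sm u) (hv : Sm v) (z : Pt d) :
    Lop a (fun z ↦ u z - v z) z = Lop a u z - Lop a v z := by
  have hs : Sm (fun z ↦ u z - v z) := hu.sub hv
  have e : ∀ v', DD v' (fun z ↦ u z - v z) = fun z ↦ DD v' u z - DD v' v z := fun v' ↦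
    funext (DD_sub v' hu hv)
  simp only [Lop, Dt_eq hs, Dt_eq hu, Dt_eq hv, Dxx_eq hs, Dxx_eq hu, Dxx_eq hv, e]
  simp only [DD_sub _ (hu.dd _) (hv.dd _), mul_sub, Finset.sum_sub_distrib]
  ring

lemma Lop_add (a : 𝔸 d) {u v : 𝔽 d} (hu : Sm u) (hv : Sm v) (z : Pt d) :
    Lop a (fun z ↦ u z + v z) z = Lop a u z + Lop a v z := by
  have hs : Sm (fun z ↦ u z + v z) := hu.add hv
  have e : ∀ v', DD v' (fun z ↦ u z + v z) = fun z ↦ DD v' u z + DD v' v z := fun v' ↦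
    funext (DD_add v' hu hv)
  simp only [Lop, Dt_eq hs, Dt_eq hu, Dt_eq hv, Dxx_eq hs, Dxx_eq hu, Dxx_eq hv, e]
  simp only [DD_add _ (hu.dd _) (hv.dd _), mul_add, Finset.sum_add_distrib]
  ring

lemma Dxx_mul {u v : 𝔽 d} (hu : Sm u) (hv : Sm v) (i j : Fin d) (z : Pt d) :
    Dxx i j (fun z ↦ u z * v z) z = Dxx i j u z * v z + u z * Dxx i j v z + Dx i u z * Dx j v z
      + Dx j u z * Dx i v z := by
  have hs : Sm (fun z ↦ u z * v z) := hu.mul hv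
  have e : ∀ v', DD v' (fun z ↦ u z * v z) = fun z ↦ DD v' u z * v z + u z * DD v' v z := fun v' ↦
    funext (DD_mul v' hu hv)
  simp only [Dxx_eq hs, Dxx_eq hu, Dxx_eq hv, Dx_eq hu, Dx_eq hv, e]
  rw [DD_add _ ((hu.dd _).mul hv) (hu.mul (hv.dd _)), DD_mul _ (hu.dd _) hv, DD_mul _ hu (hv.dd _)]
  ring



lemma Dt_mul {u v : 𝔽 d} (hu : Sm u) (hv : Sm v) (z : Pt d) :
    Dt (fun z ↦ u z * v z) z = Dt u z * v z + u z * Dt v z := by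
  rw [Dt_eq (hu.mul hv), Dt_eq hu, Dt_eq hv, DD_mul _ hu hv]

lemma inS.symm' {δ : ℝ} {a : 𝕄 d} (h : inS d δ a) (i j : Fin d) : a i j = a j i := by
  have := congrFun (congrFun h.1 j) i
  simpa [Matrix.transpose] using this

lemma Lop_mul {δ : ℝ} {a : 𝔸 d} (ha : ∀ z, inS d δ (a z))
    {u v : 𝔽 d} (hu : Sm u) (hv : Sm v) (z : Pt d) :
    Lop a (fun z ↦ u z * v z) z = Lop a u z * v z + u z * Lop a v z
      + 2 * ∑ i, ∑ j, a z i j * (Dx i u z * Dx j v z) := by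
  simp only [Lop, Dt_mul hu hv, Dxx_mul hu hv, mul_add, add_mul, Finset.sum_add_distrib]
  have e1 : ∑ i, ∑ j, a z i j * (Dx j u z * Dx i v z) = ∑ i, ∑ j, a z i j * (Dx i u z * Dx j v z) := by
    rw [Finset.sum_comm]
    refine Finset.sum_congr rfl fun i _ ↦ Finset.sum_congr rfl fun j _ ↦ ?_
    rw [(ha z).symm' j i]
  rw [e1]
  simp only [Finset.mul_sum, Finset.sum_mul]
  have e2 : ∑ i, ∑ j, a z i j * (Dxx i j u z * v z) = ∑ i, ∑ j, a z i j * Dxx i j u z * v z := by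
    simp only [mul_assoc]
  have e3 : ∑ i, ∑ j, a z i j * (u z * Dxx i j v z) = ∑ i, ∑ j, u z * (a z i j * Dxx i j v z) := by
    refine Finset.sum_congr rfl fun i _ ↦ Finset.sum_congr rfl fun j _ ↦ ?_
    ring
  rw [e2, e3]
  simp only [← Finset.mul_sum]
  ring

lemma inS.bound {δ : ℝ} (hδ : 0 < δ) {a : 𝕄 d} (h : inS d δ a) (i j : Fin d) :
    |a i j| ≤ δ⁻¹ := by
  have key : ∀ s t : ℝ, (0:ℝ) ≤ s ^ 2 * a i i + t ^ 2 * a j j + 2 * s * t * a i j ∧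
      s ^ 2 * a i i + t ^ 2 * a j j + 2 * s * t * a i j ≤ δ⁻¹ * (if i = j then (s + t) ^ 2 else s ^ 2 + t ^ 2) := by
    intro s t
    have h2 := h.2 (fun k ↦ s * (if k = i then 1 else 0) + t * (if k = j then 1 else 0))
    have e1 : ∑ k, ∑ l, a k l * (s * (if k = i then 1 else 0) + t * (if k = j then 1 else 0)) *
        (s * (if l = i then 1 else 0) + t * (if l = j then 1 else 0))
        = s ^ 2 * a i i + t ^ 2 * a j j + 2 * s * t * a i j := by
      simp [mul_add, add_mul, Finset.sum_add_distrib, h.symm' j i]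
      ring
    have e2 : ∑ k, (s * (if k = i then 1 else 0) + t * (if k = j then (1:ℝ) else 0)) ^ 2
        = if i = j then (s + t) ^ 2 else s ^ 2 + t ^ 2 := by
      have e3 : ∀ k, (s * (if k = i then 1 else 0) + t * (if k = j then (1:ℝ) else 0)) ^ 2
          = (s ^ 2 * if k = i then 1 else 0) + (t ^ 2 * if k = j then 1 else 0)
            + (2 * s * t * if k = i then (if k = j then 1 else 0) else 0) := by
        intro k; split_ifs <;> ring
      simp only [e3, Finset.sum_add_distrib, ← Finset.mul_sum, Finset.sum_ite_eq', Finset.mem_univ, if_true]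
      split_ifs <;> ring
    rw [e1, e2] at h2
    refine ⟨le_trans ?_ h2.1, h2.2⟩
    split_ifs <;> positivity
  have hi := (key 1 0).2
  have hj := (key 0 1).2
  have h1 := key 1 1
  have h2 := key 1 (-1)
  have hp : 0 < δ⁻¹ := by positivity
  have := (key 1 0).1
  have := (key 0 1).1
  rw [abs_le]
  by_cases hij : i = j
  · subst hij; simp at *; constructor <;> linarith
  · simp [hij] at *; constructor <;> linarith [h1.1, h1.2, h2.1, h2.2]

def muT (d : ℕ) (T : ℝ) : Measure (Pt d) := volume.restrict {z | T < z.1}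

lemma measSet_T (T : ℝ) : MeasurableSet {z : Pt d | T < z.1} :=
  measurableSet_lt measurable_const measurable_fst

lemma muT_le (T : ℝ) : muT d T ≤ volume := Measure.restrict_le_self

lemma meas_entry {a : 𝔸 d} (ha : Measurable a) (i j : Fin d) :
    Measurable fun z ↦ a z i j := by
  have h1 : Measurable fun m : Fin d → Fin d → ℝ ↦ m i j := by fun_prop
  exact h1.comp ha

lemma Lop_meas {a : 𝔸 d} (ha : Measurable a) {w : 𝔽 d} (hw : CinfC w) :
    Measurable (Lop a w) := by
  unfold Lop
  refine hw.dt.meas.add ?_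
  refine Finset.measurable_sum _ fun i _ ↦ Finset.measurable_sum _ fun j _ ↦ ?_
  exact (meas_entry ha i j).mul (hw.dxx i j).meas

lemma Lop_supp {a : 𝔸 d} {w : 𝔽 d} (hw : CinfC w) {z : Pt d}
    (hz : z ∉ tsupport w) : Lop a w z = 0 := by
  have hd : ∀ v, DD v w z = 0 := fun v ↦ by
    simp only [DD]; rw [fderiv_of_notMem_tsupport ℝ hz]; simp
  have h2 : ∀ v v', DD v (DD v' w) z = 0 := fun v v' ↦ by
    have : z ∉ tsupport (DD v' w) := fun h ↦ hz (tsupport_fderiv_apply_subset ℝ v' h)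
    rw [DD, fderiv_of_notMem_tsupport ℝ this]; simp
  simp [Lop, Dt_eq hw.1, Dxx_eq hw.1, hd, h2]

lemma Lop_hcs {a : 𝔸 d} {w : 𝔽 d} (hw : CinfC w) :
    HasCompactSupport (Lop a w) := by
  refine HasCompactSupport.intro hw.2 fun z hz ↦ Lop_supp hw hz

lemma Lop_bdd {δ : ℝ} (hδ : 0 < δ) {a : 𝔸 d} (ha : ∀ z, inS d δ (a z))
    {w : 𝔽 d} (hw : CinfC w) : ∃ M, ∀ z, |Lop a w z| ≤ M := by
  obtain ⟨C0, h0⟩ := hw.dt.bdd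
  choose C hC using fun i j ↦ (hw.dxx i j).bdd
  refine ⟨C0 + ∑ i, ∑ j, δ⁻¹ * C i j, fun z ↦ (abs_add_le _ _).trans (add_le_add (h0 z) ?_)⟩
  refine (Finset.abs_sum_le_sum_abs _ _).trans (Finset.sum_le_sum fun i _ ↦ ?_)
  refine (Finset.abs_sum_le_sum_abs _ _).trans (Finset.sum_le_sum fun j _ ↦ ?_)
  rw [abs_mul]
  exact mul_le_mul ((ha z).bound hδ i j) (hC i j z) (abs_nonneg _) (by positivity)

def BC (f : 𝔽 d) : Prop := AEStronglyMeasurable f volume ∧ (∃ M, ∀ z, |f z| ≤ M) ∧ HasCompactSupport f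

lemma BC.memLp {f : 𝔽 d} (h : BC f) (p : ℝ≥0∞) : MemLp f p := by
  obtain ⟨hm, ⟨M, hM⟩, hs⟩ := h
  have hb : MemLp (fun _ : Pt d ↦ M) p (volume.restrict (tsupport f)) := by
    have : IsFiniteMeasure (volume.restrict (tsupport f)) :=
      ⟨by simpa using (hs.measure_lt_top)⟩
    exact memLp_const M
  have h1 : MemLp f p (volume.restrict (tsupport f)) :=
    hb.mono hm.restrict (ae_of_all _ fun z ↦ by simpa using (hM z).trans (le_abs_self M))
  have h2 := (memLp_indicator_iff_restrict (isClosed_tsupport f).measurableSet).2 h1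
  rwa [show (tsupport f).indicator f = f from by
    rw [indicator_eq_self]; exact subset_tsupport f] at h2

lemma Lop_BC {δ : ℝ} (hδ : 0 < δ) {a : 𝔸 d} (ham : Measurable a)
    (ha : ∀ z, inS d δ (a z)) {w : 𝔽 d} (hw : CinfC w) : BC (Lop a w) :=
  ⟨(Lop_meas ham hw).aestronglyMeasurable, Lop_bdd hδ ha hw, Lop_hcs hw⟩

lemma CinfC.bc {w : 𝔽 d} (hw : CinfC w) : BC w := ⟨hw.meas.aestronglyMeasurable, hw.bdd, hw.2⟩

def AP (s : ℝ) (a : 𝔸 d) (N : ℝ≥0) : Prop :=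
  ∀ T : ℝ, ∀ w, CinfC w → ∀ i j, eLpNorm (Dxx i j w) (ℓ s) (muT d T) ≤
    N * eLpNorm (Lop a w) (ℓ s) (muT d T)

def Dn (T T0 s1 s2 : ℝ) (a : 𝔸 d) : Prop :=
  ∀ f, BC f → (∀ z : Pt d, T0 ≤ z.1 → f z = 0) → ∀ ε : ℝ≥0∞, ε ≠ 0 →
    ∃ w, CinfC w ∧ (∀ z : Pt d, T0 ≤ z.1 → w z = 0) ∧
      eLpNorm (fun z ↦ Lop a w z - f z) (ℓ s1) (muT d T) ≤ ε ∧
      eLpNorm (fun z ↦ Lop a w z - f z) (ℓ s2) (muT d T) ≤ ε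

instance volHaar : (volume : Measure (Pt d)).IsAddHaarMeasure :=
  inferInstanceAs ((volume : Measure ℝ).prod (volume : Measure (Spc d))).IsAddHaarMeasure

lemma integrable_c {c : ℝ → ℝ} (hc : Measurable c) {M : ℝ} (hM : ∀ t, |c t| ≤ M) {f : 𝔽 d}
    (hf : Integrable f) : Integrable fun z ↦ c z.1 * f z := by
  refine hf.bdd_mul (c := M) (hc.comp measurable_fst).aestronglyMeasurable (ae_of_all _ fun z ↦ ?_)
  simpa using hM z.1

lemma ibp_x {c : ℝ → ℝ} (hc : Measurable c) {M : ℝ} (hM : ∀ t, |c t| ≤ M) {f g : 𝔽 d}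
    (hf : CinfC f) (hg : CinfC g) (i : Fin d) :
    ∫ z, c z.1 * (Dx i f z * g z) = - ∫ z, c z.1 * (f z * Dx i g z) := by
  have hd : ∀ {u : 𝔽 d}, CinfC u → ∀ z, HasLineDerivAt ℝ u (Dx i u z) z (ex i) := by
    intro u hu z
    rw [Dx_eq hu.1]
    exact (hu.sm.diff z).hasFDerivAt.hasLineDerivAt _
  have h := integral_bilinear_hasLineDerivAt_right_eq_neg_left_of_integrable
    (μ := (volume : Measure (Pt d))) (B := ContinuousLinearMap.mul ℝ ℝ) (v := ex i)
    (f := fun z ↦ c z.1 * g z) (f' := fun z ↦ c z.1 * Dx i g z) (g := f) (g' := Dx i f)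
    (by simpa [mul_assoc] using integrable_c hc hM ((hg.dx i).mul_sm hf.1).integrable)
    (by simpa [mul_assoc] using integrable_c hc hM (hg.mul_sm (hf.dx i).1).integrable)
    (by simpa [mul_assoc] using integrable_c hc hM (hg.mul_sm hf.1).integrable)
    (fun z _ ↦ by
      have := (hd hg z)
      unfold HasLineDerivAt at this ⊢
      have h2 := this.const_mul (c z.1)
      refine h2.congr_of_eventuallyEq (Filter.Eventually.of_forall fun t ↦ ?_)
      simp [ex])
    (fun z _ ↦ hd hf z)
  simp only [ContinuousLinearMap.mul_apply'] at h
  calc _ = ∫ z, c z.1 * g z * Dx i f z := by congr 1; ext z; ring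
    _ = _ := h
    _ = _ := by congr 2; ext z; ring

lemma ibp_t {f g : 𝔽 d} (hf : CinfC f) (hg : CinfC g) :
    ∫ z, Dt f z * g z = - ∫ z, f z * Dt g z := by
  have h := integral_mul_fderiv_eq_neg_fderiv_mul_of_integrable (𝕜 := ℝ) (μ := (volume : Measure (Pt d)))
    (f := g) (g := f) (v := et d) ((hg.dd (et d)).mul_sm hf.1).integrable
    (hg.mul_sm (hf.dd (et d)).1).integrable (hg.mul_sm hf.1).integrable
    (fun z _ ↦ hg.sm.diff z) (fun z _ ↦ hf.sm.diff z)
  rw [Dt_eq hf.1, Dt_eq hg.1]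
  calc _ = ∫ z, g z * fderiv ℝ f z (et d) := by congr 1; ext z; simp only [DD]; ring
    _ = _ := h
    _ = _ := by congr 2; ext z; simp only [DD]; ring

lemma ibp2 {c : ℝ → ℝ} (hc : Measurable c) {M : ℝ} (hM : ∀ t, |c t| ≤ M) {f g : 𝔽 d}
    (hf : CinfC f) (hg : CinfC g) (k l i j : Fin d) :
    ∫ z, c z.1 * (Dxx k l f z * Dxx i j g z) = ∫ z, c z.1 * (Dxx i l f z * Dxx k j g z) := by
  have h1 := ibp_x hc hM (hf.dx l) (hg.dxx i j) k
  have h2 := ibp_x hc hM (hf.dx l) (hg.dxx k j) i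
  have e : Dx k (Dxx i j g) = Dx i (Dxx k j g) := Dx_comm (hg.dx j).1 k i
  rw [e] at h1
  exact h1.trans h2.symm

lemma eLpNorm_two_le {μ : Measure (Pt d)} {f g : 𝔽 d} (hf : MemLp f 2 μ) (hg : MemLp g 2 μ) {C : ℝ≥0}
    (h : ∫ z, f z ^ 2 ∂μ ≤ (C:ℝ) ^ 2 * ∫ z, g z ^ 2 ∂μ) : eLpNorm f 2 μ ≤ C * eLpNorm g 2 μ := by
  rw [hf.eLpNorm_eq_integral_rpow_norm (by norm_num) (by norm_num),
    hg.eLpNorm_eq_integral_rpow_norm (by norm_num) (by norm_num), ← ENNReal.ofReal_coe_nnreal,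
    ← ENNReal.ofReal_mul (by positivity)]
  refine ENNReal.ofReal_le_ofReal ?_
  simp only [ENNReal.toReal_ofNat, Real.norm_eq_abs]
  have e : ∀ u : Pt d → ℝ, ∫ z, |u z| ^ (2:ℝ) ∂μ = ∫ z, u z ^ 2 ∂μ := fun u ↦ by
    congr 1; ext z; rw [show (2:ℝ) = (2:ℕ) by norm_num, Real.rpow_natCast, sq_abs]
  rw [e, e, show ((2:ℝ)⁻¹) = 1/2 by norm_num, ← Real.sqrt_eq_rpow, ← Real.sqrt_eq_rpow]
  refine (Real.sqrt_le_sqrt h).trans_eq ?_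
  rw [Real.sqrt_mul (by positivity), Real.sqrt_sq (by positivity)]

lemma sq_time (T : ℝ) {v : 𝔽 d} (hv : CinfC v) : ∫ z in {z : Pt d | T < z.1}, Dt v z * v z ≤ 0 := by
  have hset : {z : Pt d | T < z.1} = Ioi T ×ˢ univ := by ext; simp
  have hi : Integrable (fun z ↦ Dt v z * v z) := (hv.dt.mul_sm hv.1).integrable
  rw [hset, Measure.volume_eq_prod, ← Measure.prod_restrict, Measure.restrict_univ,
    integral_prod_symm]
  · refine integral_nonpos fun x ↦ ?_
    have hs : ContDiff ℝ 1 fun t ↦ v (t, x) := (hv.1.comp (contDiff_prodMk_left x)).of_le (by exact_mod_cast le_top)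
    have hcs : HasCompactSupport fun t ↦ v (t, x) := by
      refine HasCompactSupport.intro (hv.2.image continuous_fst) fun t ht ↦ ?_
      by_contra h
      exact ht ⟨(t, x), subset_tsupport _ h, rfl⟩
    have h1 := HasCompactSupport.integral_Ioi_deriv_eq (f := fun t ↦ v (t, x) * v (t, x) / 2)
      ((hs.mul hs).div_const 2) (by
        have := (hcs.mul_right (f' := fun t ↦ v (t, x) / 2))
        simp only [mul_div_assoc]
        exact this) T
    have h2 : ∀ t, deriv (fun t ↦ v (t, x) * v (t, x) / 2) t = Dt v (t, x) * v (t, x) := by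
      intro t
      have h3 : HasDerivAt (fun t ↦ v (t, x)) (Dt v (t, x)) t :=
        (hs.differentiable one_ne_zero t).hasDerivAt
      have := ((h3.mul h3).div_const 2).deriv
      rw [show (fun t ↦ v (t, x) * v (t, x) / 2) = fun t ↦ (((fun t ↦ v (t, x)) * fun t ↦ v (t, x)) t) / 2 from rfl, this]
      ring
    simp only [h2] at h1
    rw [h1]
    simp only [Pi.zero_apply]
    nlinarith [mul_self_nonneg (v (T, x))]
  · rw [← Measure.restrict_univ (μ := (volume : Measure (Spc d))), Measure.prod_restrict]
    exact hi.integrableOn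

lemma sum_restrict {c : ℝ → ℝ} (T : ℝ) (g : 𝔽 d) :
    ∫ z in {z : Pt d | T < z.1}, c z.1 * g z = ∫ z, ((Ioi T).indicator c z.1) * g z := by
  rw [← integral_indicator (measSet_T T)]
  congr 1; ext z
  by_cases h : T < z.1 <;> simp [indicator, h]

theorem AP_two {δ : ℝ} (hδ : 0 < δ) : ∃ N : ℝ≥0, ∀ b : ℝ → 𝕄 d, Measurable b →
    (∀ t, inS d δ (b t)) → AP 2 (fun z : Pt d ↦ b z.1) N := by
  refine ⟨⟨Real.sqrt (d / δ ^ 2), Real.sqrt_nonneg _⟩, fun b hbm hb T w hw i0 j0 ↦ ?_⟩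
  set S := {z : Pt d | T < z.1} with hS
  rw [show ℓ 2 = 2 by norm_num]
  have ham : Measurable (fun z : Pt d ↦ b z.1) := hbm.comp measurable_fst
  have hL : BC (Lop (fun z : Pt d ↦ b z.1) w) := Lop_BC hδ ham (fun z ↦ hb z.1) hw
  have hmu : ∀ {f : 𝔽 d}, MemLp f 2 → MemLp f 2 (muT d T) := fun h ↦ h.mono_measure (muT_le T)
  refine eLpNorm_two_le (hmu ((hw.dxx i0 j0).memLp 2)) (hmu (hL.memLp 2)) ?_
  have hsq : ∀ {f : 𝔽 d}, MemLp f 2 → Integrable (fun z ↦ f z ^ 2) (muT d T) := fun h ↦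
    (hmu h).integrable_sq
  have hmul : ∀ {f g : 𝔽 d}, MemLp f 2 → MemLp g 2 → Integrable (fun z ↦ f z * g z) (muT d T) := fun h h' ↦
    (hmu h).integrable_mul (hmu h')
  set L := Lop (fun z : Pt d ↦ b z.1) w with hLdef
  have hbnd : ∀ k l, ∀ t, |b t k l| ≤ δ⁻¹ := fun k l t ↦ (hb t).bound hδ k l
  have hbme : ∀ k l, Measurable fun t ↦ b t k l := fun k l ↦ by
    have h1 : Measurable fun m : Fin d → Fin d → ℝ ↦ m k l := by fun_prop
    exact h1.comp hbm

  have hbint : ∀ k l, ∀ {f : 𝔽 d}, Integrable f → Integrable (fun z ↦ b z.1 k l * f z) (muT d T) :=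
    fun k l f hf ↦ (integrable_c (hbme k l) (hbnd k l) hf).mono_measure (muT_le T)
  have hswap : ∀ k l i, ∫ z, b z.1 k l * (Dxx k l w z * Dxx i i w z) ∂muT d T
      = ∫ z, b z.1 k l * (Dxx i l w z * Dxx k i w z) ∂muT d T := by
    intro k l i
    have hm : Measurable ((Ioi T).indicator fun t ↦ b t k l) := (hbme k l).indicator measurableSet_Ioi
    have hM : ∀ t, |(Ioi T).indicator (fun t ↦ b t k l) t| ≤ δ⁻¹ := fun t ↦ by
      by_cases h : t ∈ Ioi T
      · simpa [h] using hbnd k l t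
      · simp only [h, not_false_eq_true, indicator_of_notMem, abs_zero]; positivity
    have := ibp2 hm hM hw hw k l i i
    simp only [muT]
    rw [sum_restrict (c := fun t ↦ b t k l) T, sum_restrict (c := fun t ↦ b t k l) T]
    exact this
  have htime : ∀ i, 0 ≤ ∫ z, Dt w z * Dxx i i w z ∂muT d T := by
    intro i
    have h1 := sum_restrict (c := fun _ ↦ (1:ℝ)) T (fun z ↦ Dxx i i w z * Dt w z)
    have hm : Measurable ((Ioi T).indicator fun _ ↦ (1:ℝ)) := measurable_const.indicator measurableSet_Ioi
    have hM : ∀ t, |(Ioi T).indicator (fun _ ↦ (1:ℝ)) t| ≤ 1 := fun t ↦ by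
      by_cases h : t ∈ Ioi T <;> simp [h]
    have h2 := ibp_x hm hM (hw.dx i) hw.dt i
    have h3 := sum_restrict (c := fun _ ↦ (1:ℝ)) T (fun z ↦ Dx i w z * Dx i (Dt w) z)
    have h4 := sq_time T (hw.dx i)
    rw [Dt_Dx hw.1] at h4
    simp only [one_mul] at h1 h3
    have e : ∫ z, Dt w z * Dxx i i w z ∂muT d T = ∫ z in S, Dxx i i w z * Dt w z := by
      simp only [muT]; congr 1; ext z; ring
    rw [e, h1]
    change 0 ≤ ∫ z, (Ioi T).indicator (fun _ ↦ (1:ℝ)) z.1 * (Dx i (Dx i w) z * Dt w z)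
    rw [h2, ← h3]
    have e2 : ∫ z in S, Dx i w z * Dx i (Dt w) z = ∫ z in S, Dx i (Dt w) z * Dx i w z := by
      congr 1; ext z; ring
    rw [e2]; linarith
  have hID : ∀ i j, MemLp (Dxx i j w) 2 := fun i j ↦ (hw.dxx i j).memLp 2
  have hIB : ∀ k l i j i' j', Integrable (fun z ↦ b z.1 k l * (Dxx i j w z * Dxx i' j' w z)) (muT d T) :=
    fun k l i j i' j' ↦ hbint k l ((hw.dxx i j).mul_sm (hw.dxx i' j').1).integrable
  have hmain : ∀ i, δ * ∫ z, ∑ k, Dxx k i w z ^ 2 ∂muT d T ≤ ∫ z, L z * Dxx i i w z ∂muT d T := by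
    intro i
    have e1 : ∫ z, L z * Dxx i i w z ∂muT d T = ∫ z, Dt w z * Dxx i i w z ∂muT d T +
        ∫ z, ∑ k, ∑ l, b z.1 k l * (Dxx i l w z * Dxx k i w z) ∂muT d T := by
      have e2 : ∀ z, L z * Dxx i i w z = Dt w z * Dxx i i w z + ∑ k, ∑ l, b z.1 k l * (Dxx k l w z * Dxx i i w z) := by
        intro z
        simp only [hLdef, Lop, add_mul, Finset.sum_mul, mul_assoc]
      simp only [e2]
      rw [integral_add (hmul (hw.dt.memLp 2) (hID i i))
        (integrable_finsetSum _ fun k _ ↦ integrable_finsetSum _ fun l _ ↦ hIB k l k l i i)]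
      congr 1
      rw [integral_finsetSum _ fun k _ ↦ integrable_finsetSum _ fun l _ ↦ hIB k l k l i i,
        integral_finsetSum _ fun k _ ↦ integrable_finsetSum _ fun l _ ↦ hIB k l i l k i]
      refine Finset.sum_congr rfl fun k _ ↦ ?_
      rw [integral_finsetSum _ fun l _ ↦ hIB k l k l i i, integral_finsetSum _ fun l _ ↦ hIB k l i l k i]
      exact Finset.sum_congr rfl fun l _ ↦ hswap k l i
    rw [e1, ← integral_const_mul]
    refine le_trans ?_ (le_add_of_nonneg_left (htime i))
    refine integral_mono ((integrable_finsetSum _ fun k _ ↦ hsq (hID k i)).const_mul δ)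
      (integrable_finsetSum _ fun k _ ↦ integrable_finsetSum _ fun l _ ↦ hIB k l i l k i) fun z ↦ ?_
    refine ((hb z.1).2 (fun k ↦ Dxx k i w z)).1.trans_eq ?_
    refine Finset.sum_congr rfl fun k _ ↦ Finset.sum_congr rfl fun l _ ↦ ?_
    rw [Dxx_symm hw.1 i l]; ring

  have hsum : δ * ∫ z, ∑ i, ∑ k, Dxx k i w z ^ 2 ∂muT d T ≤ ∫ z, ∑ i, L z * Dxx i i w z ∂muT d T := by
    rw [integral_finsetSum _ fun i _ ↦ integrable_finsetSum _ fun k _ ↦ hsq (hID k i),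
      integral_finsetSum _ fun i _ ↦ hmul (hL.memLp 2) (hID i i), Finset.mul_sum]
    exact Finset.sum_le_sum fun i _ ↦ hmain i
  have hIX : Integrable (fun z ↦ ∑ i, ∑ k, Dxx k i w z ^ 2) (muT d T) :=
    integrable_finsetSum _ fun i _ ↦ integrable_finsetSum _ fun k _ ↦ hsq (hID k i)
  have hpt : ∫ z, ∑ i, L z * Dxx i i w z ∂muT d T ≤
      ∫ z, (d / (2 * δ) * L z ^ 2 + δ / 2 * ∑ i, ∑ k, Dxx k i w z ^ 2) ∂muT d T := by
    refine integral_mono (integrable_finsetSum _ fun i _ ↦ hmul (hL.memLp 2) (hID i i))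
      (((hsq (hL.memLp 2)).const_mul _).add (hIX.const_mul _)) fun z ↦ ?_
    simp only
    have h1 : ∀ i : Fin d, L z * Dxx i i w z ≤ 1 / (2 * δ) * L z ^ 2 + δ / 2 * Dxx i i w z ^ 2 := by
      intro i
      have : 0 ≤ 1 / (2 * δ) * (L z - δ * Dxx i i w z) ^ 2 := by positivity
      have e : 1 / (2 * δ) * (L z - δ * Dxx i i w z) ^ 2 = 1 / (2 * δ) * L z ^ 2 + δ / 2 * Dxx i i w z ^ 2
        - L z * Dxx i i w z := by field_simp; ring
      linarith
    refine (Finset.sum_le_sum fun i _ ↦ h1 i).trans ?_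
    rw [Finset.sum_add_distrib, ← Finset.mul_sum, ← Finset.mul_sum, Finset.sum_const, Finset.card_univ, Fintype.card_fin]
    refine add_le_add (le_of_eq (by simp; ring)) ?_
    refine mul_le_mul_of_nonneg_left (Finset.sum_le_sum fun i _ ↦ ?_) (half_pos hδ).le
    exact Finset.single_le_sum (f := fun k ↦ Dxx k i w z ^ 2) (fun k _ ↦ sq_nonneg _) (Finset.mem_univ i)
  rw [integral_add ((hsq (hL.memLp 2)).const_mul _) (hIX.const_mul _), integral_const_mul,
    integral_const_mul] at hpt
  have hone : ∫ z, Dxx i0 j0 w z ^ 2 ∂muT d T ≤ ∫ z, ∑ i, ∑ k, Dxx k i w z ^ 2 ∂muT d T := by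
    refine integral_mono (hsq (hID i0 j0)) hIX fun z ↦ ?_
    refine (Finset.single_le_sum (f := fun k ↦ Dxx k j0 w z ^ 2) (fun k _ ↦ sq_nonneg _) (Finset.mem_univ i0)).trans ?_
    exact Finset.single_le_sum (f := fun i ↦ ∑ k, Dxx k i w z ^ 2)
      (fun k _ ↦ Finset.sum_nonneg fun _ _ ↦ sq_nonneg _) (Finset.mem_univ j0)
  refine hone.trans ?_
  change _ ≤ Real.sqrt (d / δ ^ 2) ^ 2 * _
  rw [Real.sq_sqrt (by positivity)]
  have h5 : δ / 2 * ∫ z, ∑ i, ∑ k, Dxx k i w z ^ 2 ∂muT d T ≤ d / (2 * δ) * ∫ z, L z ^ 2 ∂muT d T := by linarith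
  have h6 := mul_le_mul_of_nonneg_left h5 (show 0 ≤ 2 / δ by positivity)
  calc _ = 2 / δ * (δ / 2 * ∫ z, ∑ i, ∑ k, Dxx k i w z ^ 2 ∂muT d T) := by field_simp
    _ ≤ _ := h6
    _ = _ := by field_simp

def Av {Ω : Type*} [MeasurableSpace Ω] (ν : Measure Ω) (k : Ω → ℝ) (g : Ω → Pt d) (f : 𝔽 d) (z : Pt d) : ℝ :=
  ∫ y, k y * f (z - g y) ∂ν

section AvSec
variable {Ω : Type*} [MeasurableSpace Ω] {ν : Measure Ω} {k : Ω → ℝ} {g : Ω → Pt d}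

lemma Av_int (hk : Integrable k ν) (hg : Measurable g) {f : 𝔽 d} (hf : CinfC f) (z : Pt d) :
    Integrable (fun y ↦ k y * f (z - g y)) ν := by
  obtain ⟨C, hC⟩ := hf.bdd
  refine hk.mul_bdd (c := C) ?_ (ae_of_all _ fun y ↦ by simpa using hC _)
  exact (hf.meas.comp (measurable_const.sub hg)).aestronglyMeasurable

lemma Av_hasFDerivAt (hk : Integrable k ν) (hg : Measurable g) {f : 𝔽 d} (hf : CinfC f) (z : Pt d) :
    HasFDerivAt (Av ν k g f) (∫ y, k y • fderiv ℝ f (z - g y) ∂ν) z := by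
  have hcf : Continuous (fderiv ℝ f) := hf.1.continuous_fderiv (by simp)
  obtain ⟨C, hC⟩ := hcf.bounded_above_of_compact_support (hf.2.fderiv ℝ)
  have hfm : ∀ z, AEStronglyMeasurable (fun y ↦ fderiv ℝ f (z - g y)) ν := fun z ↦
    hcf.stronglyMeasurable.comp_measurable (measurable_const.sub hg) |>.aestronglyMeasurable
  refine hasFDerivAt_integral_of_dominated_of_fderiv_le (F := fun z y ↦ k y * f (z - g y))
    (F' := fun z y ↦ k y • fderiv ℝ f (z - g y)) (bound := fun y ↦ ‖k y‖ * C) (s := univ)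
    Filter.univ_mem (Filter.Eventually.of_forall fun z ↦ (Av_int hk hg hf z).aestronglyMeasurable)
    (Av_int hk hg hf z) (hk.aestronglyMeasurable.smul (hfm z)) ?_ (hk.norm.mul_const C) ?_
  · refine ae_of_all _ fun y z _ ↦ ?_
    rw [norm_smul]
    exact mul_le_mul_of_nonneg_left (hC _) (norm_nonneg _)
  · refine ae_of_all _ fun y z _ ↦ ?_
    have h1 : HasFDerivAt (fun z ↦ f (z - g y)) (fderiv ℝ f (z - g y)) z := by
      have h2 := (hf.sm.diff (z - g y)).hasFDerivAt
      exact h2.comp z ((hasFDerivAt_id z).sub_const (g y))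
    exact h1.const_mul (k y)

lemma DD_Av (hk : Integrable k ν) (hg : Measurable g) {f : 𝔽 d} (hf : CinfC f) (v : Pt d) :
    DD v (Av ν k g f) = Av ν k g (DD v f) := by
  ext z
  have hcf : Continuous (fderiv ℝ f) := hf.1.continuous_fderiv (by simp)
  obtain ⟨C, hC⟩ := hcf.bounded_above_of_compact_support (hf.2.fderiv ℝ)
  rw [DD, (Av_hasFDerivAt hk hg hf z).fderiv, ContinuousLinearMap.integral_apply]
  · simp [Av, DD]
  · have hm : AEStronglyMeasurable (fun y ↦ fderiv ℝ f (z - g y)) ν :=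
      hcf.stronglyMeasurable.comp_measurable (measurable_const.sub hg) |>.aestronglyMeasurable
    refine (hk.norm.mul_const C).mono' (hk.aestronglyMeasurable.smul hm) (ae_of_all _ fun y ↦ ?_)
    rw [norm_smul]
    exact mul_le_mul_of_nonneg_left (hC _) (norm_nonneg _)

lemma Av_sm (hk : Integrable k ν) (hg : Measurable g) {f : 𝔽 d} (hf : CinfC f) : Sm (Av ν k g f) := by
  rw [Sm, contDiff_infty]
  intro n
  induction n generalizing f with
  | zero => exact contDiff_zero.2 (continuous_iff_continuousAt.2 fun z ↦ (Av_hasFDerivAt hk hg hf z).continuousAt)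
  | succ n ih =>
    have := (contDiff_succ_iff_fderiv_apply (𝕜 := ℝ) (f := Av ν k g f) (n := n)).2
      ⟨fun z ↦ (Av_hasFDerivAt hk hg hf z).differentiableAt, by simp, fun v ↦ by
        have := ih (hf.dd v)
        rw [← DD_Av hk hg hf v] at this
        exact this⟩
    exact_mod_cast this

lemma Dt_Av (hk : Integrable k ν) (hg : Measurable g) {f : 𝔽 d} (hf : CinfC f) :
    Dt (Av ν k g f) = Av ν k g (Dt f) := by
  rw [Dt_eq (Av_sm hk hg hf), Dt_eq hf.1, DD_Av hk hg hf]
lemma Dx_Av (hk : Integrable k ν) (hg : Measurable g) {f : 𝔽 d} (hf : CinfC f) (i : Fin d) :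
    Dx i (Av ν k g f) = Av ν k g (Dx i f) := by
  rw [Dx_eq (Av_sm hk hg hf), Dx_eq hf.1, DD_Av hk hg hf]
lemma Dxx_Av (hk : Integrable k ν) (hg : Measurable g) {f : 𝔽 d} (hf : CinfC f) (i j : Fin d) :
    Dxx i j (Av ν k g f) = Av ν k g (Dxx i j f) := by
  rw [Dxx, Dx_Av hk hg hf, Dx_Av hk hg (hf.dx j)]; rfl

lemma Av_hcs {K : Set (Pt d)} (hK : IsCompact K) (hkK : ∀ y, k y ≠ 0 → g y ∈ K) {f : 𝔽 d}
    (hf : HasCompactSupport f) : HasCompactSupport (Av ν k g f) := by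
  refine HasCompactSupport.intro (hf.isCompact.add hK) fun z hz ↦ ?_
  refine integral_eq_zero_of_ae (ae_of_all _ fun y ↦ ?_)
  simp only [Pi.zero_apply, mul_eq_zero]
  by_contra! h
  exact hz ⟨z - g y, subset_tsupport _ h.2, g y, hkK y h.1, by simp⟩

lemma lintegral_jensen {m : Measure Ω} {h : Ω → ℝ≥0∞} (hh : AEMeasurable h m) {s : ℝ} (hs : 1 ≤ s) :
    (∫⁻ y, h y ∂m) ^ s ≤ (m univ) ^ (s - 1) * ∫⁻ y, h y ^ s ∂m := by
  rcases eq_or_lt_of_le hs with rfl | hs1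
  · simp
  have hc : s.HolderConjugate (s / (s - 1)) := Real.HolderConjugate.conjExponent hs1
  have h1 := ENNReal.lintegral_mul_le_Lp_mul_Lq m hc hh (aemeasurable_const (b := (1:ℝ≥0∞)))
  simp only [Pi.mul_apply, mul_one, ENNReal.one_rpow, lintegral_const, one_mul] at h1
  refine (ENNReal.rpow_le_rpow h1 (by linarith)).trans_eq ?_
  rw [ENNReal.mul_rpow_of_nonneg _ _ (by linarith), ← ENNReal.rpow_mul, ← ENNReal.rpow_mul, mul_comm]
  have : s - 1 ≠ 0 := by linarith
  have h0 : s ≠ 0 := by linarith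
  congr 1
  · congr 1; field_simp
  · rw [one_div_mul_cancel h0, ENNReal.rpow_one]

lemma Av_norm [SFinite ν] (hk : Measurable k) (hg : Measurable g) {f : 𝔽 d} (hf : Measurable f)
    {S S' : Set (Pt d)} (hS : MeasurableSet S) (hS' : MeasurableSet S')
    (hSS : ∀ y, k y ≠ 0 → ∀ z ∈ S, z - g y ∈ S') {s : ℝ} (hs : 1 ≤ s) (hfin : ∫⁻ y, ‖k y‖ₑ ∂ν ≠ ⊤) :
    eLpNorm (Av ν k g f) (ℓ s) (volume.restrict S) ≤
      (∫⁻ y, ‖k y‖ₑ ∂ν) * eLpNorm f (ℓ s) (volume.restrict S') := by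
  have hs0 : 0 < s := by linarith
  set M := ∫⁻ y, ‖k y‖ₑ ∂ν with hM
  have e1 : ∀ (h : 𝔽 d) (μ : Measure (Pt d)), eLpNorm h (ℓ s) μ = (∫⁻ z, ‖h z‖ₑ ^ s ∂μ) ^ (1 / s) := by
    intro h μ
    rw [eLpNorm_eq_lintegral_rpow_enorm_toReal (by simpa using hs0) (by simp), ENNReal.toReal_ofReal hs0.le]
  rw [e1, e1]
  have hMs : M = (M ^ s) ^ (1 / s) := by rw [← ENNReal.rpow_mul, mul_one_div_cancel hs0.ne', ENNReal.rpow_one]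
  rw [hMs, ← ENNReal.mul_rpow_of_nonneg _ _ (by positivity)]
  refine ENNReal.rpow_le_rpow ?_ (by positivity)
  set m := ν.withDensity fun y ↦ ‖k y‖ₑ with hm
  have hkm : Measurable fun y ↦ ‖k y‖ₑ := hk.enorm
  have hmM : m univ = M := by rw [hm, withDensity_apply _ MeasurableSet.univ, Measure.restrict_univ]
  have hfin' : IsFiniteMeasure m := ⟨by rw [hmM]; exact hfin.lt_top⟩
  have hfm : Measurable fun p : Pt d × Ω ↦ ‖f (p.1 - g p.2)‖ₑ ^ s :=
    ((hf.comp (measurable_fst.sub (hg.comp measurable_snd))).enorm).pow_const s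
  have hpt : ∀ z, ‖Av ν k g f z‖ₑ ^ s ≤ M ^ (s - 1) * ∫⁻ y, ‖f (z - g y)‖ₑ ^ s ∂m := by
    intro z
    rw [← hmM]
    have hmz : Measurable fun y ↦ ‖f (z - g y)‖ₑ := (hf.comp (measurable_const.sub hg)).enorm
    refine le_trans (ENNReal.rpow_le_rpow ?_ hs0.le) (lintegral_jensen hmz.aemeasurable hs)
    rw [hm, lintegral_withDensity_eq_lintegral_mul _ hkm hmz]
    refine (enorm_integral_le_lintegral_enorm _).trans_eq ?_
    simp [enorm_mul]
  calc ∫⁻ z in S, ‖Av ν k g f z‖ₑ ^ s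
      ≤ ∫⁻ z in S, M ^ (s - 1) * ∫⁻ y, ‖f (z - g y)‖ₑ ^ s ∂m := lintegral_mono hpt
    _ = M ^ (s - 1) * ∫⁻ y, (∫⁻ z in S, ‖f (z - g y)‖ₑ ^ s) ∂m := by
        rw [lintegral_const_mul _ hfm.lintegral_prod_right', lintegral_lintegral_swap hfm.aemeasurable]
    _ ≤ M ^ (s - 1) * ∫⁻ y, (∫⁻ z in S', ‖f z‖ₑ ^ s) ∂m := by
        refine mul_le_mul' le_rfl (lintegral_mono_ae ?_)
        have hae : ∀ᵐ y ∂m, k y ≠ 0 := by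
          rw [hm, ae_withDensity_iff hkm]
          exact ae_of_all _ fun y hy h ↦ hy (by simp [h])
        filter_upwards [hae] with y hy
        rw [← lintegral_indicator hS, ← lintegral_indicator hS',
          ← lintegral_sub_right_eq_self (μ := volume) (S'.indicator fun z ↦ ‖f z‖ₑ ^ s) (g y)]
        refine lintegral_mono fun z ↦ ?_
        by_cases hz : z ∈ S
        · simp [hz, hSS y hy z hz]
        · simp [hz]
    _ = M ^ s * ∫⁻ z in S', ‖f z‖ₑ ^ s := by
        rw [lintegral_const, hmM, mul_comm _ M, ← mul_assoc]
        congr 1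
        by_cases h0 : M = 0
        · simp [h0, hs0]
        · nth_rewrite 2 [← ENNReal.rpow_one M]
          rw [← ENNReal.rpow_add _ _ h0 hfin]; simp
end AvSec

lemma eLp_supp {K : Set (Pt d)} (hK : volume K ≠ ⊤) {s1 s : ℝ} (hs1 : 0 < s1) (h1 : s1 ≤ s) :
    ∃ C : ℝ≥0, ∀ h : Pt d → ℝ, AEStronglyMeasurable h volume → Function.support h ⊆ K →
      eLpNorm h (ℓ s1) volume ≤ C * eLpNorm h (ℓ s) volume := by
  have hfin : volume K ^ (1 / s1 - 1 / s) ≠ ⊤ :=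
    ENNReal.rpow_ne_top_of_nonneg (sub_nonneg.2 (one_div_le_one_div_of_le hs1 h1)) hK
  refine ⟨(volume K ^ (1 / s1 - 1 / s)).toNNReal, fun h hm hs ↦ ?_⟩
  have := eLpNorm_le_eLpNorm_mul_rpow_measure_univ (μ := volume.restrict K) (f := h)
    (ENNReal.ofReal_le_ofReal h1) hm.restrict
  rw [eLpNorm_restrict_eq_of_support_subset hs, eLpNorm_restrict_eq_of_support_subset hs,
    Measure.restrict_apply_univ, ENNReal.toReal_ofReal hs1.le, ENNReal.toReal_ofReal (by linarith)] at this
  rwa [ENNReal.coe_toNNReal hfin, mul_comm]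

lemma approx_one {f : 𝔽 d} (hf : BC f) {T0 : ℝ} (hz : ∀ z : Pt d, T0 ≤ z.1 → f z = 0) :
    ∃ K : Set (Pt d), IsCompact K ∧ tsupport f ⊆ K ∧ ∀ s : ℝ, 1 ≤ s → ∀ ε : ℝ, 0 < ε →
      ∃ g, CinfC g ∧ tsupport g ⊆ K ∧ (∀ z : Pt d, T0 ≤ z.1 → g z = 0) ∧
        eLpNorm (fun z ↦ g z - f z) (ℓ s) volume ≤ ℓ ε := by
  obtain ⟨R, hR⟩ := hf.2.2.isCompact.isBounded.subset_closedBall (0 : Pt d)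
  let B : ContDiffBump (0 : Pt d) := ⟨|R| + 1, |R| + 2, by positivity, by linarith⟩
  refine ⟨closedBall 0 (|R| + 2), isCompact_closedBall _ _, hR.trans (closedBall_subset_closedBall ?_), ?_⟩
  · linarith [le_abs_self R]
  intro s hs ε hε
  have hs' : (1:ℝ≥0∞) ≤ ℓ s := by simpa using hs
  obtain ⟨δ, hδ, hA⟩ := (hf.memLp (ℓ s)).eLpNorm_indicator_le hs' (by simp) (half_pos hε)
  set V := (volume (closedBall (0:Spc d) |R|)).toReal with hV
  have hVfin : volume (closedBall (0:Spc d) |R|) ≠ ⊤ := measure_closedBall_lt_top.ne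
  set h := δ / (V + 1) with hh
  have hV0 : 0 ≤ V := ENNReal.toReal_nonneg
  have hh0 : 0 < h := by positivity
  set A : Set (Pt d) := Ioo (T0 - h) T0 ×ˢ closedBall (0:Spc d) |R| with hAdef
  have hAm : MeasurableSet A := measurableSet_Ioo.prod isClosed_closedBall.measurableSet
  have hAv : volume A ≤ ℓ δ := by
    rw [hAdef, Measure.volume_eq_prod, Measure.prod_prod, Real.volume_Ioo, ← ENNReal.ofReal_toReal hVfin,
      ← ENNReal.ofReal_mul (by linarith)]
    refine ENNReal.ofReal_le_ofReal ?_
    rw [← hV, show T0 - (T0 - h) = h by ring, hh, div_mul_eq_mul_div, div_le_iff₀ (by positivity)]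
    nlinarith
  have hf1 : MemLp (Aᶜ.indicator f) (ℓ s) volume := (hf.memLp _).indicator hAm.compl
  obtain ⟨g, hg1, hg2, hg3⟩ := hf1.exist_eLpNorm_sub_le (by simp) hs' (half_pos hε)
  let η : Pt d → ℝ := fun z ↦ B z * Real.smoothTransition ((T0 - z.1) / h)
  have hη : Sm η := by
    refine B.contDiff.mul (Real.smoothTransition.contDiff.comp ?_)
    exact (contDiff_const.sub contDiff_fst).div_const h
  have hη01 : ∀ z, |η z| ≤ 1 := fun z ↦ by
    rw [abs_mul, abs_of_nonneg B.nonneg, abs_of_nonneg (Real.smoothTransition.nonneg _)]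
    exact mul_le_one₀ B.le_one (Real.smoothTransition.nonneg _) (Real.smoothTransition.le_one _)
  have hη1 : ∀ z, Aᶜ.indicator f z ≠ 0 → η z = 1 := by
    intro z hz1
    have hzA : z ∉ A := fun h ↦ hz1 (by simp [h])
    have hfz : f z ≠ 0 := fun h ↦ hz1 (by simp [indicator, h])
    have hzR : ‖z‖ ≤ R := by simpa using hR (subset_tsupport _ hfz)
    have h2 : ‖z.2‖ ≤ |R| := (norm_snd_le z).trans (hzR.trans (le_abs_self R))
    have h1 : z.1 < T0 := by by_contra hc; exact hfz (hz z (not_lt.1 hc))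
    have h3 : z.1 ≤ T0 - h := by
      by_contra hc
      exact hzA ⟨⟨not_le.1 hc, h1⟩, by simpa using h2⟩
    have e1 : B z = 1 := B.one_of_mem_closedBall (by
      simp only [mem_closedBall, dist_zero_right]; change ‖z‖ ≤ |R| + 1; linarith [le_abs_self R])
    have e2 : Real.smoothTransition ((T0 - z.1) / h) = 1 := Real.smoothTransition.one_of_one_le (by
      rw [le_div_iff₀ hh0]; linarith)
    simp [η, e1, e2]
  have hgC : CinfC g := ⟨hg2, hg1⟩
  refine ⟨fun z ↦ η z * g z, hgC.sm_mul hη, ?_, ?_, ?_⟩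
  · refine closure_minimal (fun z hz ↦ ?_) isClosed_closedBall
    have : B z ≠ 0 := fun h ↦ hz (by simp [η, h])
    have h2 := B.support_eq ▸ (show z ∈ Function.support B from this)
    exact ball_subset_closedBall h2
  · intro z hz
    simp [η, Real.smoothTransition.zero_of_nonpos (div_nonpos_of_nonpos_of_nonneg (sub_nonpos.2 hz) hh0.le)]
  · have e : (fun z ↦ η z * g z - f z) = (fun z ↦ η z * g z - Aᶜ.indicator f z) + (fun z ↦ - A.indicator f z) := by
      ext z
      by_cases hzA : z ∈ A <;> simp [hzA, sub_eq_add_neg]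
    have hfm := hf.1
    rw [e, show ℓ ε = ℓ (ε/2) + ℓ (ε/2) by
      rw [← ENNReal.ofReal_add (by linarith) (by linarith)]; ring_nf]
    refine (eLpNorm_add_le (((hgC.sm_mul hη).meas.aestronglyMeasurable).sub (hfm.indicator hAm.compl))
      (hfm.indicator hAm).neg hs').trans (add_le_add ?_ ?_)
    · refine le_trans (eLpNorm_mono fun z ↦ ?_) hg3
      change ‖η z * g z - Aᶜ.indicator f z‖ ≤ ‖Aᶜ.indicator f z - g z‖
      by_cases hz0 : Aᶜ.indicator f z = 0
      · rw [hz0, sub_zero, zero_sub, norm_neg, norm_mul]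
        exact mul_le_of_le_one_left (norm_nonneg _) (hη01 z)
      · rw [hη1 z hz0, one_mul, norm_sub_rev]
    · have := hA A hAm hAv
      rw [← eLpNorm_neg] at this
      exact this

lemma ofReal_pick {C ε : ℝ≥0∞} (hC : C ≠ ⊤) (hε : ε ≠ 0) : ∃ e : ℝ, 0 < e ∧ C * ℓ e ≤ ε := by
  rcases eq_or_ne ε ⊤ with rfl | ht
  · exact ⟨1, one_pos, le_top⟩
  have h0 : 0 < ε.toReal := ENNReal.toReal_pos hε ht
  have hc : 0 ≤ C.toReal := ENNReal.toReal_nonneg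
  refine ⟨ε.toReal / (C.toReal + 1), by positivity, ?_⟩
  rw [← ENNReal.ofReal_toReal hC, ← ENNReal.ofReal_mul (by positivity), ENNReal.ofReal_toReal hC]
  refine ENNReal.ofReal_le_of_le_toReal ?_
  rw [mul_div_assoc', div_le_iff₀ (by positivity)]
  nlinarith

lemma approx_BC {f : 𝔽 d} (hf : BC f) {T0 : ℝ} (hz : ∀ z : Pt d, T0 ≤ z.1 → f z = 0)
    {s1 s2 : ℝ} (h1 : 1 ≤ s1) (h2 : 1 ≤ s2) {ε : ℝ≥0∞} (hε : ε ≠ 0) :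
    ∃ g, CinfC g ∧ (∀ z : Pt d, T0 ≤ z.1 → g z = 0) ∧
      eLpNorm (fun z ↦ g z - f z) (ℓ s1) volume ≤ ε ∧
      eLpNorm (fun z ↦ g z - f z) (ℓ s2) volume ≤ ε := by
  obtain ⟨K, hK, hfK, H⟩ := approx_one hf hz
  obtain ⟨C1, hC1⟩ := eLp_supp (d := d) hK.measure_lt_top.ne (s1 := s1) (s := max s1 s2) (by linarith) (le_max_left _ _)
  obtain ⟨C2, hC2⟩ := eLp_supp (d := d) hK.measure_lt_top.ne (s1 := s2) (s := max s1 s2) (by linarith) (le_max_right _ _)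
  obtain ⟨e, he, hCe⟩ := ofReal_pick (C := ((max C1 C2 : ℝ≥0) : ℝ≥0∞)) ENNReal.coe_ne_top hε
  obtain ⟨g, hg, hgK, hg0, hgn⟩ := H (max s1 s2) (h1.trans (le_max_left _ _)) e he
  have hsup : Function.support (fun z ↦ g z - f z) ⊆ K := fun z hz ↦ by
    by_contra hc
    refine hz ?_
    have e1 : g z = 0 := by by_contra h; exact hc (hgK (subset_tsupport _ h))
    have e2 : f z = 0 := by by_contra h; exact hc (hfK (subset_tsupport _ h))
    simp [e1, e2]
  have hm : AEStronglyMeasurable (fun z ↦ g z - f z) volume := hg.meas.aestronglyMeasurable.sub hf.1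
  refine ⟨g, hg, hg0, (hC1 _ hm hsup).trans (le_trans ?_ hCe), (hC2 _ hm hsup).trans (le_trans ?_ hCe)⟩
  · exact mul_le_mul' (by exact_mod_cast le_max_left _ _) hgn
  · exact mul_le_mul' (by exact_mod_cast le_max_right _ _) hgn

lemma tayG {D : 𝔽 d} (hD : CinfC D) (v : Pt d) {S : Set (Pt d)} (hS : MeasurableSet S)
    (hSv : ∀ z ∈ S, ∀ θ ∈ Ioc (0:ℝ) 1, z + θ • v ∈ S) {s : ℝ} (hs : 1 ≤ s) {k : ℝ → ℝ} (hk : Continuous k)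
    (hk1 : ∀ θ ∈ Ioc (0:ℝ) 1, |k θ| ≤ 1) {rem : 𝔽 d}
    (hrem : ∀ z, rem z = ∫ θ in (0:ℝ)..1, k θ * D (z + θ • v)) :
    eLpNorm rem (ℓ s) (volume.restrict S) ≤ eLpNorm D (ℓ s) (volume.restrict S) := by
  have e : rem = Av (volume.restrict (Ioc (0:ℝ) 1)) ((Ioc (0:ℝ) 1).indicator k) (fun θ ↦ - (θ • v)) D := by
    ext z
    rw [hrem, intervalIntegral.integral_of_le zero_le_one, Av]
    refine setIntegral_congr_fun measurableSet_Ioc fun θ hθ ↦ ?_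
    simp [hθ, sub_neg_eq_add]
  have hle : ∫⁻ θ in Ioc (0:ℝ) 1, ‖(Ioc (0:ℝ) 1).indicator k θ‖ₑ ≤ 1 := by
    calc _ ≤ ∫⁻ θ in Ioc (0:ℝ) 1, (1:ℝ≥0∞) := by
          refine setLIntegral_mono measurable_const fun θ hθ ↦ ?_
          rw [indicator_of_mem hθ, Real.enorm_eq_ofReal_abs]
          simpa using hk1 θ hθ
      _ = 1 := by simp
  rw [e]
  refine (Av_norm (hk.measurable.indicator measurableSet_Ioc) (by fun_prop) hD.meas hS hS ?_ hs
    (hle.trans_lt ENNReal.one_lt_top).ne).trans (mul_le_of_le_one_left zero_le hle)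
  intro θ hθ z hz
  rw [sub_neg_eq_add]
  exact hSv z hz θ (by by_contra h; exact hθ (by simp [h]))

lemma hasDeriv_line {f : 𝔽 d} (hf : Sm f) (z v : Pt d) (θ : ℝ) :
    HasDerivAt (fun θ : ℝ ↦ f (z + θ • v)) (DD v f (z + θ • v)) θ := by
  have h1 : HasDerivAt (fun θ : ℝ ↦ z + θ • v) v θ := by
    simpa using ((hasDerivAt_id θ).smul_const v).const_add z
  exact (hf.diff (z + θ • v)).hasFDerivAt.comp_hasDerivAt θ h1

lemma cont_line {f : 𝔽 d} (hf : CinfC f) (z v : Pt d) : Continuous fun θ : ℝ ↦ f (z + θ • v) :=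
  hf.cont.comp (by fun_prop)

lemma tay1 {f : 𝔽 d} (hf : CinfC f) (v : Pt d) {S : Set (Pt d)} (hS : MeasurableSet S)
    (hSv : ∀ z ∈ S, ∀ θ ∈ Ioc (0:ℝ) 1, z + θ • v ∈ S) {s : ℝ} (hs : 1 ≤ s) :
    eLpNorm (fun z ↦ f (z + v) - f z) (ℓ s) (volume.restrict S) ≤
      eLpNorm (DD v f) (ℓ s) (volume.restrict S) := by
  refine tayG (hf.dd v) v hS hSv hs (k := fun _ ↦ 1) continuous_const (by simp) fun z ↦ ?_
  rw [intervalIntegral.integral_eq_sub_of_hasDerivAt (f := fun θ : ℝ ↦ f (z + θ • v))]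
  · simp
  · intro θ _
    simpa using hasDeriv_line hf.1 z v θ
  · exact (continuous_const.mul (cont_line (hf.dd v) z v)).intervalIntegrable _ _

lemma tay2 {f : 𝔽 d} (hf : CinfC f) (v : Pt d) {S : Set (Pt d)} (hS : MeasurableSet S)
    (hSv : ∀ z ∈ S, ∀ θ ∈ Ioc (0:ℝ) 1, z + θ • v ∈ S) {s : ℝ} (hs : 1 ≤ s) :
    eLpNorm (fun z ↦ f (z + v) - f z - DD v f z) (ℓ s) (volume.restrict S) ≤
      eLpNorm (DD v (DD v f)) (ℓ s) (volume.restrict S) := by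
  refine tayG ((hf.dd v).dd v) v hS hSv hs (k := fun θ ↦ 1 - θ) (by fun_prop)
    (fun θ hθ ↦ abs_le.2 ⟨by linarith [hθ.2], by linarith [hθ.1]⟩) fun z ↦ ?_
  rw [intervalIntegral.integral_eq_sub_of_hasDerivAt (f := fun θ : ℝ ↦ f (z + θ • v) + (1 - θ) * DD v f (z + θ • v))]
  · simp; ring
  · intro θ _
    have := (hasDeriv_line hf.1 z v θ).add (((hasDerivAt_id θ).const_sub 1).mul (hasDeriv_line (hf.dd v).1 z v θ))
    refine this.congr_deriv ?_
    simp
  · exact ((by fun_prop : Continuous fun θ : ℝ ↦ 1 - θ).mul (cont_line ((hf.dd v).dd v) z v)).intervalIntegrable _ _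

lemma tay3 {f : 𝔽 d} (hf : CinfC f) (v : Pt d) {S : Set (Pt d)} (hS : MeasurableSet S)
    (hSv : ∀ z ∈ S, ∀ θ ∈ Ioc (0:ℝ) 1, z + θ • v ∈ S) {s : ℝ} (hs : 1 ≤ s) :
    eLpNorm (fun z ↦ f (z + v) - f z - DD v f z - 1 / 2 * DD v (DD v f) z) (ℓ s) (volume.restrict S) ≤
      eLpNorm (DD v (DD v (DD v f))) (ℓ s) (volume.restrict S) := by
  refine tayG (((hf.dd v).dd v).dd v) v hS hSv hs (k := fun θ ↦ (1 - θ) ^ 2 / 2) (by fun_prop)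
    (fun θ hθ ↦ abs_le.2 ⟨by nlinarith [hθ.1, hθ.2], by nlinarith [hθ.1, hθ.2]⟩) fun z ↦ ?_
  rw [intervalIntegral.integral_eq_sub_of_hasDerivAt (f := fun θ : ℝ ↦ f (z + θ • v) + (1 - θ) * DD v f (z + θ • v)
    + (1 - θ) ^ 2 / 2 * DD v (DD v f) (z + θ • v))]
  · simp; ring
  · intro θ _
    have := ((hasDeriv_line hf.1 z v θ).add (((hasDerivAt_id θ).const_sub 1).mul (hasDeriv_line (hf.dd v).1 z v θ))).add
      (((((hasDerivAt_id θ).const_sub 1).pow 2).div_const 2).mul (hasDeriv_line ((hf.dd v).dd v).1 z v θ))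
    refine this.congr_deriv ?_
    simp; ring
  · exact ((by fun_prop : Continuous fun θ : ℝ ↦ (1 - θ) ^ 2 / 2).mul
      (cont_line (((hf.dd v).dd v).dd v) z v)).intervalIntegrable _ _

def shv (h : ℝ) (p : Fin d × Bool) : Pt d :=
  (-h, EuclideanSpace.single p.1 ((if p.2 then (1:ℝ) else -1) * Real.sqrt (2 * d * h)))

def Sop (h : ℝ) (f : 𝔽 d) : Pt d → ℝ := Av Measure.count (fun _ : Fin d × Bool ↦ 1 / (2 * (d:ℝ))) (shv h) f

lemma Sop_apply (h : ℝ) (f : 𝔽 d) (z : Pt d) :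
    Sop h f z = ∑ p : Fin d × Bool, 1 / (2 * (d:ℝ)) * f (z - shv h p) := by
  simp [Sop, Av, integral_fintype, Measure.count_singleton, Measure.real]

lemma Sop_int : Integrable (fun _ : Fin d × Bool ↦ 1 / (2 * (d:ℝ))) Measure.count := .of_finite
lemma shv_meas (h : ℝ) : Measurable (shv (d := d) h) := measurable_of_finite _

lemma Sop_C {f : 𝔽 d} (hf : CinfC f) (h : ℝ) : CinfC (Sop h f) :=
  ⟨Av_sm Sop_int (shv_meas h) hf, Av_hcs (Set.finite_range (shv h)).isCompact (fun y _ ↦ mem_range_self y) hf.2⟩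

lemma Sop_norm (hd : 1 ≤ d) {f : 𝔽 d} (hf : Measurable f) (h : ℝ) {s : ℝ} (hs : 1 ≤ s) :
    eLpNorm (Sop h f) (ℓ s) volume ≤ eLpNorm f (ℓ s) volume := by
  have e : ∫⁻ _ : Fin d × Bool, ‖1 / (2 * (d:ℝ))‖ₑ ∂Measure.count = 1 := by
    rw [lintegral_const, Measure.count_univ]
    have hd' : (d:ℝ) ≠ 0 := by positivity
    rw [Real.enorm_eq_ofReal (by positivity)]
    simp only [ENat.card_eq_coe_fintype_card, Fintype.card_prod, Fintype.card_fin, Fintype.card_bool]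
    rw [show ((((d * 2 : ℕ) : ℕ∞)) : ℝ≥0∞) = ℓ (2 * d) by
      rw [ENNReal.ofReal_mul (by norm_num)]; simp [mul_comm], ← ENNReal.ofReal_mul (by positivity)]
    rw [one_div_mul_cancel (by positivity)]; simp
  have := Av_norm (ν := Measure.count) (k := fun _ : Fin d × Bool ↦ 1 / (2 * (d:ℝ))) measurable_const (shv_meas h) hf
    MeasurableSet.univ MeasurableSet.univ (fun _ _ _ _ ↦ mem_univ _) hs (by rw [e]; simp)
  rw [e, one_mul, Measure.restrict_univ] at this
  exact this

lemma DD_smul (c : ℝ) (v : Pt d) (f : 𝔽 d) : DD (c • v) f = fun z ↦ c * DD v f z := by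
  ext z; simp [DD]

lemma DD_cmul' (v : Pt d) (f : 𝔽 d) (c : ℝ) : DD v (fun z ↦ c * f z) = fun z ↦ c * DD v f z :=
  funext fun z ↦ DD_cmul v c z

def oneM (d : ℕ) : Pt d → 𝕄 d := fun _ ↦ 1

lemma Lop_one (f : 𝔽 d) (z : Pt d) : Lop (oneM d) f z = Dt f z + ∑ i, Dxx i i f z := by
  simp [Lop, oneM, Matrix.one_apply]

lemma Lop_one_C {f : 𝔽 d} (hf : CinfC f) : CinfC (Lop (oneM d) f) := by
  refine ⟨?_, Lop_hcs hf⟩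
  rw [show Lop (oneM d) f = fun z ↦ Dt f z + ∑ i, Dxx i i f z from funext (Lop_one f)]
  exact hf.dt.1.add (ContDiff.sum fun i _ ↦ (hf.dxx i i).1)

lemma Sop_Lop {f : 𝔽 d} (hf : CinfC f) (h : ℝ) : Lop (oneM d) (Sop h f) = Sop h (Lop (oneM d) f) := by
  ext z
  rw [Lop_one, Sop, Dt_Av Sop_int (shv_meas h) hf]
  simp_rw [Dxx_Av Sop_int (shv_meas h) hf]
  have e : ∀ g : Pt d → ℝ, Av Measure.count (fun _ : Fin d × Bool ↦ 1 / (2 * (d:ℝ))) (shv h) g = Sop h g := fun _ ↦ rfl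
  simp_rw [e, Sop_apply, Lop_one, mul_add, Finset.mul_sum]
  rw [Finset.sum_add_distrib, Finset.sum_comm]

def Eop (h : ℝ) (f : 𝔽 d) (z : Pt d) : ℝ := (Sop h f z - f z) / h - Lop (oneM d) f z

lemma Eop_bound (hd : 1 ≤ d) {f : 𝔽 d} (hf : CinfC f) {s : ℝ} (hs : 1 ≤ s) :
    ∃ C : ℝ≥0∞, C ≠ ⊤ ∧ ∀ h : ℝ, 0 < h → h ≤ 1 →
      eLpNorm (Eop h f) (ℓ s) volume ≤ C * ℓ (Real.sqrt h) := by
  have hs' : (1:ℝ≥0∞) ≤ ℓ s := by simpa using hs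
  set p := ℓ s
  let C1 : ℝ≥0∞ := eLpNorm (DD (et d) (DD (et d) f)) p volume
  let C2 : Fin d → ℝ≥0∞ := fun i ↦ eLpNorm (DD (et d) (Dxx i i f)) p volume
  let C3 : Fin d → ℝ≥0∞ := fun i ↦ eLpNorm (DD (ex i) (DD (ex i) (DD (ex i) f))) p volume
  have hd0 : (0:ℝ) < d := by exact_mod_cast hd
  set M := Real.sqrt (2 * d) with hM
  refine ⟨C1 + ∑ i, (C2 i + ℓ M * C3 i + ℓ M * C3 i), ?_, ?_⟩
  · have f1 : C1 ≠ ⊤ := (((hf.dd _).dd _).memLp p).eLpNorm_ne_top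
    have f2 : ∀ i, C2 i ≠ ⊤ := fun i ↦ (((hf.dxx i i).dd _).memLp p).eLpNorm_ne_top
    have f3 : ∀ i, C3 i ≠ ⊤ := fun i ↦ ((((hf.dd _).dd _).dd _).memLp p).eLpNorm_ne_top
    refine ENNReal.add_ne_top.2 ⟨f1, ENNReal.sum_ne_top.2 fun i _ ↦ ?_⟩
    refine ENNReal.add_ne_top.2 ⟨ENNReal.add_ne_top.2 ⟨f2 i, ?_⟩, ?_⟩ <;>
      exact ENNReal.mul_ne_top ENNReal.ofReal_ne_top (f3 i)
  intro h h0 h1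
  set ρ := Real.sqrt (2 * d * h) with hρ
  have hρ2 : ρ ^ 2 = 2 * d * h := Real.sq_sqrt (by positivity)
  have hρM : ρ = M * Real.sqrt h := Real.sqrt_mul (by positivity) h
  have hh : h ≤ Real.sqrt h := by
    have h2 : Real.sqrt h ≤ 1 := Real.sqrt_le_one.2 h1
    nlinarith [Real.mul_self_sqrt h0.le, Real.sqrt_nonneg h]
  let A : Pt d → ℝ := fun z ↦ h⁻¹ * (f (z + h • et d) - f z - DD (h • et d) f z)
  let B : Fin d → Pt d → ℝ := fun i z ↦ Dxx i i f (z + h • et d) - Dxx i i f z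
  let R : ℝ → Fin d → Pt d → ℝ := fun σ i z ↦
    f (z + (σ * ρ) • ex i) - f z - DD ((σ * ρ) • ex i) f z - 1 / 2 * DD ((σ * ρ) • ex i) (DD ((σ * ρ) • ex i) f) z
  let R' : ℝ → Fin d → Pt d → ℝ := fun σ i z ↦ (2 * d * h)⁻¹ * R σ i (z + h • et d)
  have hA : CinfC f := hf
  have key : Eop h f = A + ∑ i, (B i + R' 1 i + R' (-1) i) := by
    ext z
    have e1 : ∀ i, z - shv h (i, true) = z + h • et d + (-1 * ρ) • ex i := fun i ↦ by
      refine Prod.ext (by simp [shv, et, ex]) ?_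
      ext j
      by_cases hj : j = i <;> simp [shv, et, ex, hj, ← hρ, sub_eq_add_neg]
    have e2 : ∀ i, z - shv h (i, false) = z + h • et d + (1 * ρ) • ex i := fun i ↦ by
      refine Prod.ext (by simp [shv, et, ex]) ?_
      ext j
      by_cases hj : j = i <;> simp [shv, et, ex, hj, ← hρ, sub_eq_add_neg]
    have e3 : ∀ i, B i z + R' 1 i z + R' (-1) i z = 1 / (2 * d) * (f (z - shv h (i, true)) + f (z - shv h (i, false))) / h
        - 1 / d * (f (z + h • et d) / h) - Dxx i i f z := by
      intro i
      simp only [B, R', R, DD_smul, DD_cmul', e1, e2, Dxx_eq hf.1]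
      have : (1 * ρ * (1 * ρ * DD (ex i) (DD (ex i) f) (z + h • et d))) = 2 * d * h * DD (ex i) (DD (ex i) f) (z + h • et d) := by
        rw [← hρ2]; ring
      have h' : (-1 * ρ * (-1 * ρ * DD (ex i) (DD (ex i) f) (z + h • et d))) = 2 * d * h * DD (ex i) (DD (ex i) f) (z + h • et d) := by
        rw [← hρ2]; ring
      rw [this, h']
      field_simp
      ring
    simp only [Pi.add_apply, Finset.sum_apply, e3, A, Finset.sum_sub_distrib, Finset.sum_const, Finset.card_univ,
      Fintype.card_fin, nsmul_eq_mul, DD_smul]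
    rw [Eop, Lop_one, Sop_apply, Fintype.sum_prod_type, ← Finset.sum_div, Dt_eq hf.1]
    simp only [Fintype.sum_bool, mul_add]
    field_simp
    ring
  have tr : ∀ {g : 𝔽 d} (c : Pt d), AEStronglyMeasurable g volume →
      eLpNorm (fun z ↦ g (z + c)) p volume = eLpNorm g p volume := fun c hg ↦
    eLpNorm_comp_measurePreserving hg (measurePreserving_add_right volume c)
  have nA : eLpNorm A p volume ≤ C1 * ℓ (Real.sqrt h) := by
    have h2 := tay2 hf (h • et d) MeasurableSet.univ (fun _ _ _ _ ↦ mem_univ _) hs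
    rw [Measure.restrict_univ] at h2
    simp only [A]
    have := eLpNorm_const_smul (μ := volume) (p := p) h⁻¹ (fun z ↦ f (z + h • et d) - f z - DD (h • et d) f z)
    rw [show (fun z ↦ h⁻¹ * (f (z + h • et d) - f z - DD (h • et d) f z)) = h⁻¹ • (fun z ↦ f (z + h • et d) - f z - DD (h • et d) f z) from rfl, this]
    refine (mul_le_mul' le_rfl h2).trans ?_
    simp only [DD_smul, DD_cmul']
    rw [show (fun z ↦ h * (h * DD (et d) (DD (et d) f) z)) = (h * h) • DD (et d) (DD (et d) f) from by
      ext z; simp [mul_assoc], eLpNorm_const_smul, ← mul_assoc, ← enorm_mul, mul_comm C1]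
    refine mul_le_mul' ?_ le_rfl
    rw [Real.enorm_eq_ofReal (by positivity)]
    refine ENNReal.ofReal_le_ofReal (le_trans (le_of_eq ?_) hh)
    field_simp
  have nB : ∀ i, eLpNorm (B i) p volume ≤ C2 i * ℓ (Real.sqrt h) := by
    intro i
    have h2 := tay1 (hf.dxx i i) (h • et d) MeasurableSet.univ (fun _ _ _ _ ↦ mem_univ _) hs
    rw [Measure.restrict_univ] at h2
    refine h2.trans ?_
    rw [DD_smul, show (fun z ↦ h * DD (et d) (Dxx i i f) z) = h • DD (et d) (Dxx i i f) from rfl, eLpNorm_const_smul, mul_comm]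
    refine mul_le_mul' le_rfl ?_
    rw [Real.enorm_eq_ofReal (by positivity)]
    exact ENNReal.ofReal_le_ofReal hh
  have hRm : ∀ σ i, Continuous (R σ i) := fun σ i ↦ by
    have c1 := hf.cont
    have c2 := (hf.dd ((σ * ρ) • ex i)).cont
    have c3 := ((hf.dd ((σ * ρ) • ex i)).dd ((σ * ρ) • ex i)).cont
    simp only [R]
    fun_prop
  have nR : ∀ σ i, |σ| = 1 → eLpNorm (R' σ i) p volume ≤ ℓ M * C3 i * ℓ (Real.sqrt h) := by
    intro σ i hσ
    have h2 := tay3 hf ((σ * ρ) • ex i) MeasurableSet.univ (fun _ _ _ _ ↦ mem_univ _) hs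
    rw [Measure.restrict_univ] at h2
    rw [show R' σ i = (2 * d * h)⁻¹ • fun z ↦ R σ i (z + h • et d) from rfl, eLpNorm_const_smul,
      tr _ (hRm σ i).aestronglyMeasurable]
    refine (mul_le_mul' le_rfl h2).trans ?_
    simp only [DD_smul, DD_cmul']
    rw [show (fun z ↦ σ * ρ * (σ * ρ * (σ * ρ * DD (ex i) (DD (ex i) (DD (ex i) f)) z))) =
      ((σ * ρ) * (σ * ρ) * (σ * ρ)) • DD (ex i) (DD (ex i) (DD (ex i) f)) from by
      ext z; simp [mul_assoc], eLpNorm_const_smul, ← mul_assoc, ← enorm_mul, mul_right_comm (ℓ M)]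
    refine mul_le_mul' ?_ le_rfl
    rw [Real.enorm_eq_ofReal_abs, ← ENNReal.ofReal_mul (by positivity)]
    refine ENNReal.ofReal_le_ofReal (le_of_eq ?_)
    have hρ0 : 0 ≤ ρ := Real.sqrt_nonneg _
    rw [abs_mul, abs_mul, abs_mul, abs_mul, hσ, abs_of_nonneg hρ0, abs_of_nonneg (by positivity), ← hρM, ← hρ2]
    have : ρ ≠ 0 := by rw [hρ]; positivity
    field_simp
  have mA : AEStronglyMeasurable A volume := by
    have c1 := hf.cont
    have c2 := (hf.dd (h • et d)).cont
    exact (by simp only [A]; fun_prop : Continuous A).aestronglyMeasurable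
  have mB : ∀ i, AEStronglyMeasurable (B i) volume := fun i ↦ by
    have c1 := (hf.dxx i i).cont
    exact (by simp only [B]; fun_prop : Continuous (B i)).aestronglyMeasurable
  have mR : ∀ σ i, AEStronglyMeasurable (R' σ i) volume := fun σ i ↦ by
    have c1 := hRm σ i
    exact (by simp only [R']; fun_prop : Continuous (R' σ i)).aestronglyMeasurable
  rw [key, add_mul, Finset.sum_mul]
  refine (eLpNorm_add_le mA (Finset.aestronglyMeasurable_sum _ fun i _ ↦ ((mB i).add (mR _ i)).add (mR _ i)) hs').trans
    (add_le_add nA ?_)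
  refine (eLpNorm_sum_le (fun i _ ↦ ((mB i).add (mR _ i)).add (mR _ i)) hs').trans (Finset.sum_le_sum fun i _ ↦ ?_)
  rw [add_mul, add_mul]
  refine (eLpNorm_add_le ((mB i).add (mR _ i)) (mR _ i) hs').trans (add_le_add ?_ (nR _ i (by simp)))
  exact (eLpNorm_add_le (mB i) (mR _ i) hs').trans (add_le_add (nB i) (nR _ i (by simp)))

lemma iter_C {f : 𝔽 d} (hf : CinfC f) (h : ℝ) (n : ℕ) : CinfC ((Sop h)^[n] f) := by
  induction n with
  | zero => exact hf
  | succ n ih => rw [Function.iterate_succ_apply']; exact Sop_C ih h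

lemma iter_norm (hd : 1 ≤ d) {f : 𝔽 d} (hf : CinfC f) (h : ℝ) {s : ℝ} (hs : 1 ≤ s) (n : ℕ) :
    eLpNorm ((Sop h)^[n] f) (ℓ s) volume ≤ eLpNorm f (ℓ s) volume := by
  induction n with
  | zero => exact le_rfl
  | succ n ih => rw [Function.iterate_succ_apply']; exact (Sop_norm hd (iter_C hf h n).meas h hs).trans ih



lemma iter_supp {f : 𝔽 d} {T0 : ℝ} (hz : ∀ z : Pt d, T0 ≤ z.1 → f z = 0) {h : ℝ} (n : ℕ) (z : Pt d) 
    (hz' : T0 ≤ z.1 + n * h) : (Sop h)^[n] f z = 0 := by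
  induction n generalizing z with
  | zero => exact hz z (by simpa using hz')
  | succ n ih =>
    rw [Function.iterate_succ_apply', Sop_apply]
    refine Finset.sum_eq_zero fun p _ ↦ ?_
    rw [ih, mul_zero]
    simp only [shv, Prod.fst_sub]
    push_cast at hz'
    linarith

lemma iter_Eop {f : 𝔽 d} (hf : CinfC f) (h : ℝ) (n : ℕ) :
    Eop h ((Sop h)^[n] f) = (Sop h)^[n] (Eop h f) := by
  induction n with
  | zero => rfl
  | succ n ih =>
    rw [Function.iterate_succ_apply', Function.iterate_succ_apply', ← ih]
    set g := (Sop h)^[n] f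
    ext z
    rw [Eop, Sop_Lop (iter_C hf h n : CinfC g), Sop_apply h (Eop h g), Sop_apply h (Sop h g), Sop_apply h g,
      Sop_apply h (Lop _ g), ← Finset.sum_sub_distrib, Finset.sum_div, ← Finset.sum_sub_distrib]
    refine Finset.sum_congr rfl fun p _ ↦ ?_
    rw [Eop]; ring

lemma Lop_cmul (a : 𝔸 d) {u : 𝔽 d} (hu : Sm u) (c : ℝ) (z : Pt d) :
    Lop a (fun z ↦ c * u z) z = c * Lop a u z := by
  have hs : Sm (fun z ↦ c * u z) := contDiff_const.mul hu
  simp only [Lop, Dt_eq hs, Dt_eq hu, Dxx_eq hs, Dxx_eq hu, DD_cmul', mul_add, Finset.mul_sum]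
  congr 1
  exact Finset.sum_congr rfl fun i _ ↦ Finset.sum_congr rfl fun j _ ↦ by ring

lemma sum_C {n : ℕ} {g : ℕ → Pt d → ℝ} (hg : ∀ k, CinfC (g k)) : CinfC (fun z ↦ ∑ k ∈ Finset.range n, g k z) := by
  induction n with
  | zero => simpa using ⟨contDiff_const, HasCompactSupport.zero⟩
  | succ n ih => simp only [Finset.sum_range_succ]; exact ih.add (hg n)

lemma Lop_sum (a : 𝔸 d) {n : ℕ} {g : ℕ → Pt d → ℝ} (hg : ∀ k, CinfC (g k)) (z : Pt d) :
    Lop a (fun z ↦ ∑ k ∈ Finset.range n, g k z) z = ∑ k ∈ Finset.range n, Lop a (g k) z := by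
  induction n with
  | zero =>
    have := Lop_cmul a (u := fun _ : Pt d ↦ (0:ℝ)) contDiff_const 0 z
    simpa using this
  | succ n ih => simp only [Finset.sum_range_succ]; rw [Lop_add a (sum_C hg).1 (hg n).1, ih]

lemma heat_smooth (hd : 1 ≤ d) {T T0 : ℝ} {f : 𝔽 d} (hf : CinfC f) (hz : ∀ z : Pt d, T0 ≤ z.1 → f z = 0)
    {s1 s2 : ℝ} (h1 : 1 ≤ s1) (h2 : 1 ≤ s2) {ε : ℝ≥0∞} (hε : ε ≠ 0) :
    ∃ w, CinfC w ∧ (∀ z : Pt d, T0 ≤ z.1 → w z = 0) ∧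
      eLpNorm (fun z ↦ Lop (oneM d) w z - f z) (ℓ s1) (muT d T) ≤ ε ∧
      eLpNorm (fun z ↦ Lop (oneM d) w z - f z) (ℓ s2) (muT d T) ≤ ε := by
  obtain ⟨C1, hC1, H1⟩ := Eop_bound hd hf h1
  obtain ⟨C2, hC2, H2⟩ := Eop_bound hd hf h2
  set R := |T0 - T| + 1 with hR
  have hR0 : 0 < R := by positivity
  obtain ⟨e, he, hCe⟩ := ofReal_pick (C := ℓ R * max C1 C2) (ENNReal.mul_ne_top ENNReal.ofReal_ne_top
    (max_lt hC1.lt_top hC2.lt_top).ne) hε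
  obtain ⟨n, hn⟩ := exists_nat_gt (max R (R / e ^ 2))
  have hnR : R < n := (le_max_left _ _).trans_lt hn
  have hn0 : (0:ℝ) < n := hR0.trans hnR
  set h := R / n with hh
  have hh0 : 0 < h := by positivity
  have hh1 : h ≤ 1 := (div_le_one hn0).2 hnR.le
  have hhe : Real.sqrt h ≤ e := by
    rw [Real.sqrt_le_left he.le, hh, div_le_iff₀ hn0]
    have := (le_max_right _ _).trans_lt hn
    rw [div_lt_iff₀ (by positivity)] at this
    linarith
  have hnh : n * h = R := by rw [hh]; field_simp
  let w : Pt d → ℝ := fun z ↦ (-h) * ∑ k ∈ Finset.range n, (Sop h)^[k] f z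
  have hwC : CinfC w := (sum_C fun k ↦ iter_C hf h k).sm_mul (v := fun _ ↦ -h) contDiff_const
  have key : ∀ z : Pt d, T < z.1 → Lop (oneM d) w z - f z = h * ∑ k ∈ Finset.range n, (Sop h)^[k] (Eop h f) z := by
    intro z hz1
    have e1 : (Sop h)^[n] f z = 0 := iter_supp hz n z (by rw [hnh, hR]; linarith [le_abs_self (T0 - T)])
    have e2 := Finset.sum_range_sub (fun k ↦ (Sop h)^[k] f z) n
    rw [e1] at e2
    simp only [Function.iterate_succ_apply', Function.iterate_zero, id] at e2
    simp only [w]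
    rw [Lop_cmul _ (sum_C fun k ↦ iter_C hf h k).1, Lop_sum _ fun k ↦ iter_C hf h k]
    simp only [← iter_Eop hf, Eop, Finset.sum_sub_distrib, ← Finset.sum_div]
    rw [← Finset.sum_sub_distrib, e2]
    simp
    field_simp
    ring
  have hEC : CinfC (Eop h f) := by
    have := (((Sop_C hf h).sub hf).sm_mul (v := fun _ ↦ h⁻¹) contDiff_const).sub (Lop_one_C hf)
    convert this using 1
    ext z; simp only [Eop]; ring
  have fin : ∀ {s : ℝ} (_ : 1 ≤ s) {C : ℝ≥0∞} (_ : C ≤ max C1 C2), eLpNorm (Eop h f) (ℓ s) volume ≤ C * ℓ (Real.sqrt h) →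
      eLpNorm (fun z ↦ Lop (oneM d) w z - f z) (ℓ s) (muT d T) ≤ ε := by
    intro s hs C hC hE
    have hs' : (1:ℝ≥0∞) ≤ ℓ s := by simpa using hs
    calc _ = eLpNorm (h • fun z ↦ ∑ k ∈ Finset.range n, (Sop h)^[k] (Eop h f) z) (ℓ s) (muT d T) := by
          refine eLpNorm_congr_ae ?_
          filter_upwards [ae_restrict_mem (measSet_T T)] with z hz
          exact key z hz
      _ ≤ eLpNorm (h • fun z ↦ ∑ k ∈ Finset.range n, (Sop h)^[k] (Eop h f) z) (ℓ s) volume :=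
          eLpNorm_mono_measure _ (muT_le T)
      _ ≤ ℓ h * ∑ k ∈ Finset.range n, eLpNorm ((Sop h)^[k] (Eop h f)) (ℓ s) volume := by
          rw [eLpNorm_const_smul, Real.enorm_eq_ofReal hh0.le]
          refine mul_le_mul' le_rfl ?_
          have := eLpNorm_sum_le (μ := volume) (s := Finset.range n) (f := fun k ↦ (Sop h)^[k] (Eop h f)) (fun k _ ↦ (iter_C hEC h k).meas.aestronglyMeasurable) hs'
          rwa [show (∑ k ∈ Finset.range n, (Sop h)^[k] (Eop h f)) = fun z ↦ ∑ k ∈ Finset.range n, (Sop h)^[k] (Eop h f) z from by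
            funext z; rw [Finset.sum_apply]] at this
      _ ≤ ℓ h * ∑ k ∈ Finset.range n, eLpNorm (Eop h f) (ℓ s) volume := by
          gcongr with k _
          exact iter_norm hd hEC h hs k
      _ = ℓ R * eLpNorm (Eop h f) (ℓ s) volume := by
          rw [Finset.sum_const, Finset.card_range, nsmul_eq_mul, ← mul_assoc, ← hnh, ENNReal.ofReal_mul (by positivity), ENNReal.ofReal_natCast, mul_comm (n:ℝ≥0∞)]
      _ ≤ ℓ R * (max C1 C2 * ℓ e) := by
          refine mul_le_mul' le_rfl (hE.trans (mul_le_mul' hC (ENNReal.ofReal_le_ofReal hhe)))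
      _ ≤ ε := by rw [← mul_assoc]; exact hCe
  refine ⟨w, hwC, ?_, fin h1 (le_max_left _ _) (H1 h hh0 hh1), fin h2 (le_max_right _ _) (H2 h hh0 hh1)⟩
  intro z hz1
  simp only [w]
  rw [Finset.sum_eq_zero, mul_zero]
  intro k _
  exact iter_supp hz k z (by have : 0 ≤ k * h := by positivity
                             linarith)

lemma Dn_heat (hd : 1 ≤ d) (T T0 : ℝ) {s1 s2 : ℝ} (h1 : 1 ≤ s1) (h2 : 1 ≤ s2) : Dn T T0 s1 s2 (oneM d) := by
  intro f hf hz ε hε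
  have hε2 : ε / 2 ≠ 0 := by simpa using hε
  obtain ⟨g, hg, hg0, n1, n2⟩ := approx_BC hf hz h1 h2 hε2
  obtain ⟨w, hw, hw0, m1, m2⟩ := heat_smooth hd (T := T) hg hg0 h1 h2 hε2
  have fin : ∀ {s : ℝ} (_ : 1 ≤ s), eLpNorm (fun z ↦ g z - f z) (ℓ s) volume ≤ ε / 2 →
      eLpNorm (fun z ↦ Lop (oneM d) w z - g z) (ℓ s) (muT d T) ≤ ε / 2 →
      eLpNorm (fun z ↦ Lop (oneM d) w z - f z) (ℓ s) (muT d T) ≤ ε := by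
    intro s hs h3 h4
    have e : (fun z ↦ Lop (oneM d) w z - f z) = (fun z ↦ Lop (oneM d) w z - g z) + fun z ↦ g z - f z := by
      ext z; simp
    rw [e, ← ENNReal.add_halves ε]
    refine (eLpNorm_add_le ?_ ?_ (by simpa using hs)).trans (add_le_add h4 ((eLpNorm_mono_measure _ (muT_le T)).trans h3))
    · exact ((Lop_one_C hw).sub hg).meas.aestronglyMeasurable
    · exact (hg.meas.aestronglyMeasurable.sub hf.1).mono_measure (muT_le T)
  exact ⟨w, hw, hw0, fin h1 n1 m1, fin h2 n2 m2⟩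

lemma DD_zero_T0 {T0 : ℝ} {w : 𝔽 d} (hw : Sm w) (h : ∀ z : Pt d, T0 ≤ z.1 → w z = 0) (v : Pt d) :
    ∀ z : Pt d, T0 ≤ z.1 → DD v w z = 0 := by
  have h1 : ∀ z : Pt d, T0 < z.1 → DD v w z = 0 := by
    intro z hz
    have : w =ᶠ[nhds z] fun _ ↦ 0 := by
      filter_upwards [(isOpen_lt continuous_const continuous_fst).mem_nhds hz] with y hy
      exact h y (le_of_lt hy)
    rw [DD, this.fderiv_eq]; simp
  intro z hz
  have hc : Continuous fun ε : ℝ ↦ DD v w (z + ε • et d) := (hw.dd v).continuous.comp (by fun_prop)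
  have h2 := (hc.tendsto 0).mono_left (nhdsWithin_le_nhds (s := Ioi 0))
  have h3 : Filter.Tendsto (fun ε : ℝ ↦ DD v w (z + ε • et d)) (nhdsWithin 0 (Ioi 0)) (nhds 0) := by
    refine tendsto_const_nhds.congr' ?_
    filter_upwards [self_mem_nhdsWithin] with ε hε
    exact (h1 _ (by simp [et]; linarith [mem_Ioi.1 hε])).symm
  simpa using tendsto_nhds_unique h2 h3

lemma Lop_zero_T0 {a : 𝔸 d} {T0 : ℝ} {w : 𝔽 d} (hw : Sm w)
    (h : ∀ z : Pt d, T0 ≤ z.1 → w z = 0) : ∀ z : Pt d, T0 ≤ z.1 → Lop a w z = 0 := by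
  intro z hz
  have h1 := fun v v' ↦ DD_zero_T0 (hw.dd v) (DD_zero_T0 hw h v) v' z hz
  simp [Lop, Dt_eq hw, Dxx_eq hw, h1, DD_zero_T0 hw h _ z hz]

lemma Lop_pert {a a' : 𝔸 d} {κ : ℝ} (hκ : ∀ z i j, |a' z i j - a z i j| ≤ κ)
    {s : ℝ} (hs : 1 ≤ s) {μ : Measure (Pt d)} {w : 𝔽 d} (hw : CinfC w) :
    eLpNorm (fun z ↦ Lop a' w z - Lop a w z) (ℓ s) μ ≤
      ∑ i, ∑ j, ℓ κ * eLpNorm (Dxx i j w) (ℓ s) μ := by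
  have hs' : (1:ℝ≥0∞) ≤ ℓ s := by simpa using hs
  have hm : ∀ i j, AEStronglyMeasurable (fun z ↦ κ * ‖Dxx i j w z‖) μ := fun i j ↦ by
    have := (hw.dxx i j).cont
    exact (by fun_prop : Continuous fun z ↦ κ * ‖Dxx i j w z‖).aestronglyMeasurable
  calc _ ≤ eLpNorm (∑ i, ∑ j, fun z ↦ κ * ‖Dxx i j w z‖) (ℓ s) μ := by
        refine eLpNorm_mono fun z ↦ ?_
        simp only [Finset.sum_apply, Lop, add_sub_add_left_eq_sub, ← Finset.sum_sub_distrib, ← sub_mul]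
        refine le_trans ?_ (le_abs_self _)
        refine (Finset.abs_sum_le_sum_abs _ _).trans (Finset.sum_le_sum fun i _ ↦ ?_)
        refine (Finset.abs_sum_le_sum_abs _ _).trans (Finset.sum_le_sum fun j _ ↦ ?_)
        rw [abs_mul]
        exact mul_le_mul_of_nonneg_right (hκ z i j) (abs_nonneg _)
    _ ≤ ∑ i, ∑ j, eLpNorm (fun z ↦ κ * ‖Dxx i j w z‖) (ℓ s) μ := by
        refine (eLpNorm_sum_le (fun i _ ↦ ?_) hs').trans (Finset.sum_le_sum fun i _ ↦ ?_)
        · exact Finset.aestronglyMeasurable_sum _ fun j _ ↦ hm i j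
        · exact eLpNorm_sum_le (fun j _ ↦ hm i j) hs'
    _ ≤ _ := by
        refine Finset.sum_le_sum fun i _ ↦ Finset.sum_le_sum fun j _ ↦ ?_
        have hk : 0 ≤ κ := (abs_nonneg _).trans (hκ 0 i j)
        have := eLpNorm_const_smul (μ := μ) (p := ℓ s) κ (fun z ↦ ‖Dxx i j w z‖)
        rw [eLpNorm_norm, Real.enorm_eq_ofReal hk] at this
        exact this.le

lemma Dn_pert {δ : ℝ} (hδ : 0 < δ) {a a' : 𝔸 d} (ham : Measurable a) (ha : ∀ z, inS d δ (a z))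
    (ham' : Measurable a') (ha' : ∀ z, inS d δ (a' z)) {κ : ℝ} (hκ : ∀ z i j, |a' z i j - a z i j| ≤ κ)
    {s1 s2 T T0 : ℝ} (h1 : 1 ≤ s1) (h2 : 1 ≤ s2) {N : ℝ≥0} (A1 : AP s1 a N) (A2 : AP s2 a N)
    (hN : (d * d : ℝ≥0∞) * (ℓ κ * N) ≤ 1 / 2) (hD : Dn T T0 s1 s2 a) : Dn T T0 s1 s2 a' := by
  intro f hf hf0 ε hε
  set E := max (eLpNorm f (ℓ s1) volume) (eLpNorm f (ℓ s2) volume) with hE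
  have hEt : E ≠ ⊤ := (max_lt (hf.memLp _).2 (hf.memLp _).2).ne
  clear_value E
  by_cases hεt : ε = ⊤
  · exact ⟨fun _ ↦ 0, ⟨contDiff_const, HasCompactSupport.zero⟩, fun _ _ ↦ rfl, by simp [hεt], by simp [hεt]⟩
  have step : ∀ n : ℕ, ∃ w, CinfC w ∧ (∀ z : Pt d, T0 ≤ z.1 → w z = 0) ∧
      eLpNorm (fun z ↦ Lop a' w z - f z) (ℓ s1) (muT d T) ≤ (1/2) ^ n * E + ε / 2 ∧
      eLpNorm (fun z ↦ Lop a' w z - f z) (ℓ s2) (muT d T) ≤ (1/2) ^ n * E + ε / 2 := by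
    intro n
    induction n with
    | zero =>
      have e : ∀ z, Lop a' (fun _ ↦ 0) z = 0 := fun z ↦ by simp [Lop, Dt, Dxx, Dx]
      refine ⟨fun _ ↦ 0, ⟨contDiff_const, HasCompactSupport.zero⟩, fun _ _ ↦ rfl, ?_, ?_⟩ <;>
      · simp only [e, zero_sub, pow_zero, one_mul]
        rw [show (fun z ↦ -f z) = -f from rfl, eLpNorm_neg]
        refine (eLpNorm_mono_measure _ (muT_le T)).trans (le_add_right ?_)
        first | exact hE ▸ le_max_left _ _ | exact hE ▸ le_max_right _ _
    | succ n ih =>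
      obtain ⟨w0, hw0, z0, b1, b2⟩ := ih
      have hL0 := Lop_BC hδ ham' ha' hw0
      obtain ⟨w, hw, zw, c1, c2⟩ := hD (fun z ↦ f z - Lop a' w0 z)
        ⟨hf.1.sub hL0.1, by
          obtain ⟨M, hM⟩ := hf.2.1
          obtain ⟨M', hM'⟩ := hL0.2.1
          exact ⟨M + M', fun z ↦ (abs_sub _ _).trans (add_le_add (hM z) (hM' z))⟩, by
          simp only [sub_eq_add_neg]; exact hf.2.2.add (HasCompactSupport.neg hL0.2.2)⟩
        (fun z hz ↦ by simp [hf0 z hz, Lop_zero_T0 hw0.1 z0 z hz]) (ε / 8) (by simpa using hε)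
      have fin : ∀ {s : ℝ} (_ : 1 ≤ s), AP s a N →
          eLpNorm (fun z ↦ Lop a' w0 z - f z) (ℓ s) (muT d T) ≤ (1/2) ^ n * E + ε / 2 →
          eLpNorm (fun z ↦ Lop a w z - (f z - Lop a' w0 z)) (ℓ s) (muT d T) ≤ ε / 8 →
          eLpNorm (fun z ↦ Lop a' (fun z ↦ w z + w0 z) z - f z) (ℓ s) (muT d T) ≤ (1/2) ^ (n+1) * E + ε / 2 := by
        intro s hs hA hb hc
        have hs' : (1:ℝ≥0∞) ≤ ℓ s := by simpa using hs
        have mL : AEStronglyMeasurable (Lop a w) (muT d T) := (Lop_meas ham hw).aestronglyMeasurable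
        have mL' : AEStronglyMeasurable (Lop a' w) (muT d T) := (Lop_meas ham' hw).aestronglyMeasurable
        have m0 : AEStronglyMeasurable (Lop a' w0) (muT d T) := (Lop_meas ham' hw0).aestronglyMeasurable
        have mf : AEStronglyMeasurable f (muT d T) := hf.1.mono_measure (muT_le T)
        have p1 : eLpNorm (Lop a w) (ℓ s) (muT d T) ≤ ε / 8 + ((1/2) ^ n * E + ε / 2) := by
          have e : Lop a w = (fun z ↦ Lop a w z - (f z - Lop a' w0 z)) - fun z ↦ Lop a' w0 z - f z := by
            ext z; simp only [Pi.sub_apply]; ring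
          rw [e]
          exact (eLpNorm_sub_le (mL.sub (mf.sub m0)) (m0.sub mf) hs').trans (add_le_add hc hb)
        have p2 : eLpNorm (fun z ↦ Lop a' w z - Lop a w z) (ℓ s) (muT d T) ≤ 1 / 2 * (ε / 8 + ((1/2) ^ n * E + ε / 2)) := by
          refine (Lop_pert hκ hs hw).trans ?_
          calc _ ≤ ∑ i : Fin d, ∑ j : Fin d, ℓ κ * (N * eLpNorm (Lop a w) (ℓ s) (muT d T)) := by
                gcongr with i _ j _
                exact hA T w hw i j
            _ = (d * d : ℝ≥0∞) * (ℓ κ * N) * eLpNorm (Lop a w) (ℓ s) (muT d T) := by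
                simp; ring
            _ ≤ _ := mul_le_mul' hN p1
        have e : (fun z ↦ Lop a' (fun z ↦ w z + w0 z) z - f z) = (fun z ↦ Lop a' w z - Lop a w z) +
            fun z ↦ Lop a w z - (f z - Lop a' w0 z) := by
          ext z; simp only [Pi.add_apply]; rw [Lop_add _ hw.1 hw0.1]; ring
        rw [e]
        refine (eLpNorm_add_le (mL'.sub mL) (mL.sub (mf.sub m0)) hs').trans ((add_le_add p2 hc).trans ?_)
        lift ε to ℝ≥0 using hεt
        lift E to ℝ≥0 using hEt
        rw [show (1/2 : ℝ≥0∞) = ((1/2 : ℝ≥0) : ℝ≥0∞) by simp, show (ε/2 : ℝ≥0∞) = ((ε/2 : ℝ≥0) : ℝ≥0∞) by simp,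
          show (ε/8 : ℝ≥0∞) = ((ε/8 : ℝ≥0) : ℝ≥0∞) by simp]
        norm_cast
        rw [← NNReal.coe_le_coe]; push_cast
        have : 0 ≤ (ε:ℝ) := ε.2
        rw [pow_succ]; linarith
      refine ⟨fun z ↦ w z + w0 z, hw.add hw0, fun z hz ↦ by simp [zw z hz, z0 z hz], fin h1 A1 b1 c1, fin h2 A2 b2 c2⟩
  have hlim : Filter.Tendsto (fun n : ℕ ↦ (1/2 : ℝ≥0∞) ^ n * E) Filter.atTop (nhds (0 * E)) :=
    ENNReal.Tendsto.mul_const (ENNReal.tendsto_pow_atTop_nhds_zero_of_lt_one (by simp)) (Or.inr hEt)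
  rw [zero_mul] at hlim
  obtain ⟨n, hn⟩ := (hlim.eventually (gt_mem_nhds (show 0 < ε / 2 by simpa [pos_iff_ne_zero] using hε))).exists
  obtain ⟨w, hw, z, b1, b2⟩ := step n
  have : (1/2) ^ n * E + ε / 2 ≤ ε := (add_le_add hn.le le_rfl).trans (ENNReal.add_halves ε).le
  exact ⟨w, hw, z, b1.trans this, b2.trans this⟩

def pathM (a : 𝔸 d) (τ : ℝ) (z : Pt d) : 𝕄 d :=
  fun i j ↦ (1 - τ) * oneM d z i j + τ * a z i j

lemma oneM_inS {δ : ℝ} (hδ : 0 < δ) (hδ1 : δ ≤ 1) (z : Pt d) : inS d δ (oneM d z) := by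
  refine ⟨by simp [oneM, Matrix.IsSymm], fun ξ ↦ ?_⟩
  have e : ∑ i, ∑ j, oneM d z i j * ξ i * ξ j = ∑ i, ξ i ^ 2 := by
    simp [oneM, Matrix.one_apply, sq]
  have h0 : 0 ≤ ∑ i, ξ i ^ 2 := Finset.sum_nonneg fun i _ ↦ sq_nonneg _
  have h1 : 1 ≤ δ⁻¹ := (one_le_inv₀ hδ).2 hδ1
  rw [e]; constructor <;> nlinarith

lemma pathM_inS {δ : ℝ} (hδ : 0 < δ) (hδ1 : δ ≤ 1) {a : 𝔸 d} (ha : ∀ z, inS d δ (a z))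
    {τ : ℝ} (h0 : 0 ≤ τ) (h1 : τ ≤ 1) (z : Pt d) : inS d δ (pathM a τ z) := by
  have o := oneM_inS hδ hδ1 z
  refine ⟨?_, fun ξ ↦ ?_⟩
  · ext i j; simp only [Matrix.transpose_apply, pathM]; rw [o.symm' i j, (ha z).symm' i j]
  have e : ∑ i, ∑ j, pathM a τ z i j * ξ i * ξ j = (1 - τ) * (∑ i, ∑ j, oneM d z i j * ξ i * ξ j) + τ * ∑ i, ∑ j, a z i j * ξ i * ξ j := by
    simp only [Finset.mul_sum, ← Finset.sum_add_distrib, pathM]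
    refine Finset.sum_congr rfl fun i _ ↦ Finset.sum_congr rfl fun j _ ↦ by ring
  have i1 := o.2 ξ
  have i2 := (ha z).2 ξ
  rw [e]; constructor <;> nlinarith

lemma pathM_meas {a : 𝔸 d} (ham : Measurable a) (τ : ℝ) : Measurable (pathM a τ) := by
  refine measurable_pi_lambda _ fun i ↦ measurable_pi_lambda _ fun j ↦ ?_
  have := meas_entry ham i j
  simp only [pathM, oneM]
  fun_prop

lemma Dn_cont (hd : 1 ≤ d) {δ : ℝ} (hδ : 0 < δ) (hδ1 : δ ≤ 1) {a : 𝔸 d} (ham : Measurable a) (ha : ∀ z, inS d δ (a z))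
    {s1 s2 : ℝ} (T T0 : ℝ) (h1 : 1 ≤ s1) (h2 : 1 ≤ s2) {N1 N2 : ℝ≥0}
    (A1 : ∀ τ, 0 ≤ τ → τ ≤ 1 → AP s1 (pathM a τ) N1) (A2 : ∀ τ, 0 ≤ τ → τ ≤ 1 → AP s2 (pathM a τ) N2) :
    Dn T T0 s1 s2 a := by
  set N := max N1 N2 with hN
  have B1 : ∀ τ, 0 ≤ τ → τ ≤ 1 → AP s1 (pathM a τ) N := fun τ p q T w hw i j ↦
    (A1 τ p q T w hw i j).trans (by gcongr; exact le_max_left _ _)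
  have B2 : ∀ τ, 0 ≤ τ → τ ≤ 1 → AP s2 (pathM a τ) N := fun τ p q T w hw i j ↦
    (A2 τ p q T w hw i j).trans (by gcongr; exact le_max_right _ _)
  obtain ⟨e, he, hCe⟩ := ofReal_pick (C := (d * d : ℝ≥0∞) * N * ℓ (2 * δ⁻¹)) (ε := 1/2)
    (by finiteness) (by simp)
  obtain ⟨n, hn⟩ := exists_nat_gt (max 1 e⁻¹)
  have hn0 : (0:ℝ) < n := lt_of_lt_of_le one_pos ((le_max_left _ _).trans hn.le)
  have hne : 1 / (n:ℝ) ≤ e := by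
    rw [one_div]; exact inv_le_of_inv_le₀ he ((le_max_right _ _).trans hn.le)
  have key : ∀ k : ℕ, k ≤ n → Dn T T0 s1 s2 (pathM a (k / n)) := by
    intro k
    induction k with
    | zero =>
      intro _
      have : pathM a ((0:ℕ) / n) = oneM d := by ext z i j; simp [pathM]
      rw [this]; exact Dn_heat hd T T0 h1 h2
    | succ k ih =>
      intro hk
      have q1 : ((k:ℝ) / n) ≤ 1 := (div_le_one hn0).2 (by exact_mod_cast (by omega : k ≤ n))
      have q2 : (((k+1:ℕ):ℝ) / n) ≤ 1 := (div_le_one hn0).2 (by exact_mod_cast hk)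
      refine Dn_pert (κ := 1 / n * (2 * δ⁻¹)) hδ (pathM_meas ham _) (pathM_inS hδ hδ1 ha (by positivity) q1) (pathM_meas ham _)
        (pathM_inS hδ hδ1 ha (by positivity) q2) ?_ h1 h2 (B1 _ (by positivity) q1) (B2 _ (by positivity) q1) ?_ (ih (by omega))
      · intro z i j
        rw [show pathM a (((k+1:ℕ):ℝ) / n) z i j - pathM a (k / n) z i j = 1 / n * (a z i j - oneM d z i j) by
          simp only [pathM]; push_cast; ring, abs_mul, abs_of_pos (by positivity : (0:ℝ) < 1 / n)]
        have := (ha z).bound hδ i j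
        have := (oneM_inS hδ hδ1 z).bound hδ i j
        have := abs_sub (a z i j) (oneM d z i j)
        gcongr; linarith
      · refine le_trans (le_of_eq ?_) ((mul_le_mul' le_rfl (ENNReal.ofReal_le_ofReal hne)).trans hCe)
        rw [ENNReal.ofReal_mul (by positivity)]; ring
  have := key n le_rfl
  rwa [show pathM a ((n:ℝ) / n) = a from by ext z i j; simp [pathM, hn0.ne']] at this

def Rv (z : Pt d) : Pt d := (-z.1, z.2)

lemma Rv_mp : MeasurePreserving (Rv (d := d)) volume volume := by
  rw [Measure.volume_eq_prod]
  exact (Measure.measurePreserving_neg (volume : Measure ℝ)).prod (MeasurePreserving.id _)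

lemma Rv_Rv (z : Pt d) : Rv (Rv z) = z := by simp [Rv]

lemma Rv_C {v : 𝔽 d} (hv : CinfC v) : CinfC (fun z ↦ v (Rv z)) := by
  have h1 : ContDiff ℝ (⊤ : ℕ∞) (Rv (d := d)) := by unfold Rv; fun_prop
  refine ⟨hv.1.comp h1, HasCompactSupport.intro (hv.2.isCompact.image h1.continuous) fun z hz ↦ ?_⟩
  by_contra h
  exact hz ⟨Rv z, subset_tsupport _ h, Rv_Rv z⟩

lemma Dt_Rv (v : 𝔽 d) (z : Pt d) : Dt (fun z ↦ v (Rv z)) z = - Dt v (Rv z) := by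
  simp only [Dt, Rv]
  exact deriv_comp_neg (fun s ↦ v (s, z.2)) z.1

lemma Dxx_Rv (v : 𝔽 d) (i j : Fin d) (z : Pt d) : Dxx i j (fun z ↦ v (Rv z)) z = Dxx i j v (Rv z) := by
  simp only [Dxx, Dx, Rv]

lemma enorm_int_le {μ : Measure (Pt d)} {f g : 𝔽 d} (hf : AEStronglyMeasurable f μ) (hg : AEStronglyMeasurable g μ)
    {P s : ℝ} (hPs : P.HolderConjugate s) :
    ‖∫ z, f z * g z ∂μ‖ₑ ≤ eLpNorm f (ℓ P) μ * eLpNorm g (ℓ s) μ := by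
  have : ENNReal.HolderTriple (ℓ P) (ℓ s) 1 := by
    have := hPs.ennrealOfReal
    exact this
  have h := eLpNorm_smul_le_mul_eLpNorm (p := ℓ P) (q := ℓ s) (r := 1) hg hf
  refine (enorm_integral_le_lintegral_enorm _).trans ?_
  rw [← eLpNorm_one_eq_lintegral_enorm]
  exact h

lemma adj_id {δ : ℝ} (hδ : 0 < δ) {b : ℝ → 𝕄 d} (hbm : Measurable b)
    (hb : ∀ t, inS d δ (b t)) {v w : 𝔽 d} (hv : CinfC v) (hw : CinfC w) (i j : Fin d) :
    ∫ z, (- Dt v z + ∑ k, ∑ l, b z.1 k l * Dxx k l v z) * Dxx i j w z = ∫ z, Dxx i j v z * Lop (fun z ↦ b z.1) w z := by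
  have hm : ∀ k l, Measurable fun t ↦ b t k l := fun k l ↦ by
    have h1 : Measurable fun m : Fin d → Fin d → ℝ ↦ m k l := by fun_prop
    exact h1.comp hbm
  have hM : ∀ k l, ∀ t, |b t k l| ≤ δ⁻¹ := fun k l t ↦ (hb t).bound hδ k l
  have one : Measurable fun _ : ℝ ↦ (1:ℝ) := measurable_const
  have one' : ∀ _ : ℝ, |(1:ℝ)| ≤ 1 := by simp
  have e1 : ∫ z, Dt v z * Dxx i j w z = - ∫ z, Dxx i j v z * Dt w z := by
    rw [ibp_t hv (hw.dxx i j)]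
    have h1 : Dt (Dxx i j w) = Dx i (Dx j (Dt w)) := by
      rw [Dxx, Dt_Dx (hw.dx j).1, Dt_Dx hw.1]
    have h2 := ibp_x one one' hv (hw.dt.dx j) i
    have h3 := ibp_x one one' (hv.dx i) hw.dt j
    simp only [one_mul] at h2 h3
    rw [h1, ← neg_eq_iff_eq_neg.2 h2, neg_neg, ← neg_eq_iff_eq_neg.2 h3, Dx_comm hv.1 j i, Dxx]
  have i1 : Integrable (fun z ↦ Dt v z * Dxx i j w z) := (hv.dt.mul_sm (hw.dxx i j).1).integrable
  have i2 : Integrable (fun z ↦ Dxx i j v z * Dt w z) := ((hv.dxx i j).mul_sm hw.dt.1).integrable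
  have i3 : ∀ k l, Integrable (fun z ↦ b z.1 k l * (Dxx k l v z * Dxx i j w z)) := fun k l ↦
    integrable_c (hm k l) (hM k l) ((hv.dxx k l).mul_sm (hw.dxx i j).1).integrable
  have i4 : ∀ k l, Integrable (fun z ↦ b z.1 k l * (Dxx i j v z * Dxx k l w z)) := fun k l ↦
    integrable_c (hm k l) (hM k l) ((hv.dxx i j).mul_sm (hw.dxx k l).1).integrable
  have e2 : ∀ k l, ∫ z, b z.1 k l * (Dxx k l v z * Dxx i j w z) = ∫ z, b z.1 k l * (Dxx i j v z * Dxx k l w z) := by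
    intro k l
    rw [ibp2 (hm k l) (hM k l) hv hw k l i j, Dxx_symm hv.1 i l, Dxx_symm hw.1 k j,
      ibp2 (hm k l) (hM k l) hv hw l i j k, Dxx_symm hv.1 j i, Dxx_symm hw.1 l k]
  have e3 : ∀ z, (- Dt v z + ∑ k, ∑ l, b z.1 k l * Dxx k l v z) * Dxx i j w z = - (Dt v z * Dxx i j w z) + ∑ k, ∑ l, b z.1 k l * (Dxx k l v z * Dxx i j w z) := by
    intro z; simp only [add_mul, Finset.sum_mul, mul_assoc, neg_mul]
  have e4 : ∀ z, Dxx i j v z * Lop (fun z ↦ b z.1) w z = Dxx i j v z * Dt w z + ∑ k, ∑ l, b z.1 k l * (Dxx i j v z * Dxx k l w z) := by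
    intro z; simp only [Lop, mul_add, Finset.mul_sum]
    congr 1; refine Finset.sum_congr rfl fun k _ ↦ Finset.sum_congr rfl fun l _ ↦ by ring
  simp only [e3, e4]
  rw [integral_add (f := fun z ↦ -(Dt v z * Dxx i j w z)) i1.neg (integrable_finsetSum _ fun k _ ↦ integrable_finsetSum _ fun l _ ↦ i3 k l),
    integral_add i2 (integrable_finsetSum _ fun k _ ↦ integrable_finsetSum _ fun l _ ↦ i4 k l),
    integral_neg, e1, neg_neg]
  congr 1
  rw [integral_finsetSum _ fun k _ ↦ integrable_finsetSum _ fun l _ ↦ i3 k l,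
    integral_finsetSum _ fun k _ ↦ integrable_finsetSum _ fun l _ ↦ i4 k l]
  refine Finset.sum_congr rfl fun k _ ↦ ?_
  rw [integral_finsetSum _ fun l _ ↦ i3 k l, integral_finsetSum _ fun l _ ↦ i4 k l]
  exact Finset.sum_congr rfl fun l _ ↦ e2 k l

def Hb (d : ℕ) (δ s : ℝ) : Prop := ∃ N : ℝ≥0, ∀ b : ℝ → 𝕄 d, Measurable b →
    (∀ t, inS d δ (b t)) → AP s (fun z : Pt d ↦ b z.1) N

lemma Dn_b (hd : 1 ≤ d) {δ : ℝ} (hδ : 0 < δ) (hδ1 : δ ≤ 1) {s1 s2 : ℝ} (h1 : 1 ≤ s1) (h2 : 1 ≤ s2)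
    (H1 : Hb d δ s1) (H2 : Hb d δ s2) {b : ℝ → 𝕄 d} (hbm : Measurable b)
    (hb : ∀ t, inS d δ (b t)) (T T0 : ℝ) : Dn T T0 s1 s2 (fun z : Pt d ↦ b z.1) := by
  obtain ⟨N1, A1⟩ := H1
  obtain ⟨N2, A2⟩ := H2
  have ham : Measurable fun z : Pt d ↦ b z.1 := hbm.comp measurable_fst
  have key : ∀ τ, 0 ≤ τ → τ ≤ 1 → ∃ c : ℝ → 𝕄 d, Measurable c ∧ (∀ t, inS d δ (c t)) ∧
      pathM (fun z : Pt d ↦ b z.1) τ = fun z ↦ c z.1 := by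
    intro τ t0 t1
    have e : ∀ z : Pt d, pathM (fun z : Pt d ↦ b z.1) τ z = pathM (fun z : Pt d ↦ b z.1) τ (z.1, 0) := fun z ↦ by
      ext i j; simp only [pathM, oneM]
    have hm := (pathM_meas ham τ).comp (measurable_prodMk_right (y := (0 : Spc d)))
    have hi := fun t : ℝ ↦ pathM_inS hδ hδ1 (a := fun z : Pt d ↦ b z.1) (fun z ↦ hb _) t0 t1 (t, 0)
    generalize pathM (fun z : Pt d ↦ b z.1) τ = p at *
    exact ⟨fun t ↦ p (t, 0), hm, hi, funext e⟩
  refine Dn_cont (N1 := N1) (N2 := N2) hd hδ hδ1 ham (fun z ↦ hb _) T T0 h1 h2 (fun τ t0 t1 ↦ ?_) (fun τ t0 t1 ↦ ?_)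
  · obtain ⟨c, hc, hi, e⟩ := key τ t0 t1
    rw [e]; exact A1 c hc hi
  · obtain ⟨c, hc, hi, e⟩ := key τ t0 t1
    rw [e]; exact A2 c hc hi

lemma CinfC.t_bound {w : 𝔽 d} (hw : CinfC w) : ∃ M : ℝ, ∀ z : Pt d, M ≤ z.1 → w z = 0 := by
  obtain ⟨M, hM⟩ := (hw.2.isCompact.image continuous_fst).bddAbove
  refine ⟨M + 1, fun z hz ↦ ?_⟩
  by_contra h
  linarith [hM ⟨z, subset_tsupport _ h, rfl⟩]

theorem duality (hd : 1 ≤ d) {δ : ℝ} (hδ : 0 < δ) (hδ1 : δ ≤ 1) {P s : ℝ} (hPs : P.HolderConjugate s)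
    (H : Hb d δ P) : Hb d δ s := by
  obtain ⟨N, hN⟩ := id H
  refine ⟨N, fun b hbm hb T w hw i j ↦ ?_⟩
  have hP1 : 1 < P := hPs.lt
  have hs1 : 1 < s := hPs.symm.lt
  have hs0 : 0 < s := hPs.symm.pos
  set G := Dxx i j w with hG
  have hGC : CinfC G := hw.dxx i j
  set B := eLpNorm (Lop (fun z ↦ b z.1) w) (ℓ s) (muT d T) with hB
  set A := eLpNorm G (ℓ s) (muT d T) with hA
  have ham : Measurable fun z : Pt d ↦ b z.1 := hbm.comp measurable_fst
  have hBt : B ≠ ⊤ := (((Lop_BC hδ ham (fun z ↦ hb _) hw).memLp _).mono_measure (muT_le T)).2.ne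
  have hAt : A ≠ ⊤ := ((hGC.memLp _).mono_measure (muT_le T)).2.ne
  have ps0 : ℓ s ≠ 0 := by simpa using hs0
  set X := ∫⁻ z, ‖G z‖ₑ ^ s ∂(muT d T) with hX
  have hAX : A = X ^ (1 / s) := by
    rw [hA, eLpNorm_eq_lintegral_rpow_enorm_toReal ps0 ENNReal.ofReal_ne_top, ENNReal.toReal_ofReal hs0.le]
  have hXA : X = A ^ s := by rw [hAX, ← ENNReal.rpow_mul]; simp [hs0.ne']
  have hXt : X ≠ ⊤ := by rw [hXA]; exact ENNReal.rpow_ne_top_of_nonneg hs0.le hAt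

  let φ : Pt d → ℝ := fun z ↦ if T < z.1 then (SignType.sign (G z) : ℝ) * |G z| ^ (s - 1) else 0
  have hφabs : ∀ z, T < z.1 → |φ z| = |G z| ^ (s - 1) := by
    intro z hz
    simp only [φ, hz, if_true]
    rcases lt_trichotomy (G z) 0 with h | h | h
    · simp [h, abs_of_nonneg (Real.rpow_nonneg (abs_nonneg (G z)) _)]
    · simp [h, Real.zero_rpow (by linarith : s - 1 ≠ 0)]
    · simp [h, abs_of_nonneg (Real.rpow_nonneg (abs_nonneg (G z)) _)]
  have hφG : ∀ z, T < z.1 → φ z * G z = |G z| ^ s := by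
    intro z hz
    simp only [φ, hz, if_true]
    rw [mul_right_comm, sign_mul_self]
    by_cases h : G z = 0
    · simp [h, Real.zero_rpow hs0.ne']
    · rw [← Real.rpow_one_add' (abs_nonneg _) (by linarith)]; congr 1; ring
  have hφ0 : ∀ z, ¬ T < z.1 → φ z = 0 := fun z hz ↦ by simp [φ, hz]
  have hφm : Measurable φ := by
    refine Measurable.ite (measSet_T T) ?_ measurable_const
    have h1 : Measurable fun x : ℝ ↦ ((SignType.sign x : SignType) : ℝ) := by
      have : (fun x : ℝ ↦ ((SignType.sign x : SignType) : ℝ)) = fun x ↦ if 0 < x then 1 else if x < 0 then -1 else 0 := by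
        ext x
        rcases lt_trichotomy x 0 with h | h | h
        · simp [h, not_lt.2 h.le]
        · simp [h]
        · simp [h]
      rw [this]
      exact Measurable.ite measurableSet_Ioi measurable_const (Measurable.ite measurableSet_Iio measurable_const measurable_const)
    exact (h1.comp hGC.meas).mul ((hGC.meas.norm).pow_const (s - 1))
  have hφBC : BC (fun z ↦ φ (Rv z)) := by
    refine ⟨(hφm.comp Rv_mp.measurable).aestronglyMeasurable, ?_, ?_⟩
    · obtain ⟨M, hM⟩ := hGC.bdd
      refine ⟨M ^ (s - 1), fun z ↦ ?_⟩
      have hM0 : 0 ≤ M := (abs_nonneg _).trans (hM z)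
      show |φ (Rv z)| ≤ _
      by_cases h : T < (Rv z).1
      · rw [hφabs _ h]; exact Real.rpow_le_rpow (abs_nonneg _) (hM _) (by linarith)
      · rw [hφ0 _ h]; simp; positivity
    · refine HasCompactSupport.intro (Rv_C hGC).2 fun z hz ↦ ?_
      have : G (Rv z) = 0 := image_eq_zero_of_notMem_tsupport (f := fun z ↦ G (Rv z)) hz
      simp [φ, this]
  obtain ⟨M, hM⟩ := hw.t_bound
  have hGM : ∀ z : Pt d, M ≤ z.1 → G z = 0 := fun z hz ↦ by
    rw [hG, Dxx_eq hw.1]; exact DD_zero_T0 (hw.sm.dd _) (DD_zero_T0 hw.1 hM _) _ z hz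
  have hb'm : Measurable fun t ↦ b (-t) := hbm.comp measurable_neg
  have hb' : ∀ t, inS d δ (b (-t)) := fun t ↦ hb _
  have hφn : eLpNorm (fun z ↦ φ (Rv z)) (ℓ P) volume = X ^ (1 / P) := by
    have := eLpNorm_comp_measurePreserving (p := ℓ P) hφm.aestronglyMeasurable (Rv_mp (d := d))
    rw [show (φ ∘ Rv) = fun z ↦ φ (Rv z) from rfl] at this
    rw [this, eLpNorm_eq_lintegral_rpow_enorm_toReal (by simpa using hPs.pos) ENNReal.ofReal_ne_top, ENNReal.toReal_ofReal hPs.nonneg]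
    congr 1
    rw [hX, muT, ← lintegral_indicator (measSet_T T)]
    refine lintegral_congr fun z ↦ ?_
    by_cases h : T < z.1
    · rw [indicator_of_mem (by exact h), Real.enorm_eq_ofReal_abs, hφabs z h, Real.enorm_eq_ofReal_abs,
        ENNReal.ofReal_rpow_of_nonneg (by positivity) hPs.nonneg, ENNReal.ofReal_rpow_of_nonneg (by positivity) hs0.le, ← Real.rpow_mul (abs_nonneg _)]
      congr 2
      have := hPs.symm.sub_one_mul_conj
      linarith
    · rw [indicator_of_notMem (by exact h), hφ0 z h]; simp [hPs.pos]
  have main : ∀ ε : ℝ≥0∞, ε ≠ 0 → X ≤ N * (X ^ (1 / P) + ε) * B + ε * A := by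
    intro ε hε
    obtain ⟨v, hv, hv0, c1, -⟩ := Dn_b hd hδ hδ1 hP1.le hP1.le H H hb'm hb' (-M) (-T) (fun z ↦ φ (Rv z)) hφBC
      (fun z hz ↦ hφ0 _ (by simp [Rv]; linarith)) ε hε
    set L := Lop (fun z ↦ b (-z.1)) v with hL
    have hLm : Measurable L := Lop_meas (hb'm.comp measurable_fst) hv
    have hvL : eLpNorm L (ℓ P) (muT d (-M)) ≤ X ^ (1 / P) + ε := by
      have e : L = (fun z ↦ φ (Rv z)) + fun z ↦ L z - φ (Rv z) := by ext z; simp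
      rw [e]
      refine (eLpNorm_add_le (hφBC.1.mono_measure (muT_le _)) ?_ (by simpa using hP1.le)).trans (add_le_add ?_ c1)
      · exact hLm.aestronglyMeasurable.sub (hφBC.1.mono_measure (muT_le _))
      · rw [← hφn]; exact eLpNorm_mono_measure _ (muT_le _)
    have hvD := (hN _ hb'm hb' (-M) v hv i j).trans (mul_le_mul' le_rfl hvL)

    have tr : ∀ g : Pt d → ℝ, Measurable g → eLpNorm (fun z ↦ g (Rv z)) (ℓ P) (volume.restrict (Rv ⁻¹' {z | -M < z.1})) =
        eLpNorm g (ℓ P) (muT d (-M)) := fun g hg ↦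
      eLpNorm_comp_measurePreserving hg.aestronglyMeasurable ((Rv_mp (d := d)).restrict_preimage (measSet_T (-M)))
    have hLv : ∀ z, L (Rv z) = - Dt (fun z ↦ v (Rv z)) z + ∑ k, ∑ l, b z.1 k l * Dxx k l (fun z ↦ v (Rv z)) z := by
      intro z
      simp only [Dxx_Rv, Dt_Rv, hL, Lop]
      simp [Rv]
    set S := Rv ⁻¹' {z : Pt d | -M < z.1} with hS
    have hSm : ∀ z, z ∈ S ↔ z.1 < M := fun z ↦ by simp [hS, Rv]
    have hSmeas : MeasurableSet S := Rv_mp.measurable (measSet_T (-M))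
    have LR0 : ∀ z : Pt d, ¬ T < z.1 → L (Rv z) = 0 := fun z hz ↦ Lop_zero_T0 hv.1 hv0 _ (by simp [Rv]; linarith)
    have D0 : ∀ z : Pt d, ¬ T < z.1 → Dxx i j v (Rv z) = 0 := fun z hz ↦ by
      rw [Dxx_eq hv.1]; exact DD_zero_T0 (hv.sm.dd _) (DD_zero_T0 hv.1 hv0 _) _ _ (by simp [Rv]; linarith)
    have id1 : ∫ z, L (Rv z) * G z = ∫ z, Dxx i j v (Rv z) * Lop (fun z ↦ b z.1) w z := by
      simp only [hLv]
      rw [adj_id hδ hbm hb (Rv_C hv) hw i j]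
      simp only [Dxx_Rv]

    have Ho : ∀ f g : Pt d → ℝ, Measurable f → Measurable g → (∀ z : Pt d, ¬ T < z.1 → f (Rv z) = 0) → (∀ z : Pt d, M ≤ z.1 → g z = 0) →
        ‖∫ z, f (Rv z) * g z‖ₑ ≤ eLpNorm f (ℓ P) (muT d (-M)) * eLpNorm g (ℓ s) (muT d T) := by
      intro f g hf hg hf0 hg0
      have e : ∫ z, f (Rv z) * g z = ∫ z in S ∩ {z | T < z.1}, f (Rv z) * g z := by
        refine (setIntegral_eq_integral_of_forall_compl_eq_zero fun z hz ↦ ?_).symm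
        by_cases h : T < z.1
        · have : M ≤ z.1 := by by_contra h'; exact hz ⟨(hSm z).2 (not_le.1 h'), h⟩
          simp [hg0 z this]
        · simp [hf0 z h]
      rw [e]
      refine (enorm_int_le (hf.comp Rv_mp.measurable).aestronglyMeasurable hg.aestronglyMeasurable hPs).trans (mul_le_mul' ?_ ?_)
      · rw [← tr f hf]; exact eLpNorm_mono_measure _ (Measure.restrict_mono inter_subset_left le_rfl)
      · exact eLpNorm_mono_measure _ (Measure.restrict_mono inter_subset_right le_rfl)
    have LwM : ∀ z : Pt d, M ≤ z.1 → Lop (fun z ↦ b z.1) w z = 0 := Lop_zero_T0 hw.1 hM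
    have t1 := Ho _ _ (hv.dxx i j).meas (Lop_meas ham hw) D0 LwM
    have t2 := Ho (fun z ↦ φ (Rv z) - L z) G ((hφm.comp Rv_mp.measurable).sub hLm) hGC.meas (fun z hz ↦ by
      simp [Rv_Rv, hφ0 z hz, LR0 z hz]) hGM
    simp only [Rv_Rv] at t2
    have t3 : eLpNorm (fun z ↦ φ (Rv z) - L z) (ℓ P) (muT d (-M)) ≤ ε := by
      refine le_trans (le_of_eq ?_) c1
      rw [← eLpNorm_neg]; congr 1; ext z; simp
    have ia : Integrable fun z ↦ φ z * G z := by
      have h1 : BC φ := by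
        have := hφBC.2.1
        refine ⟨hφm.aestronglyMeasurable, ?_, HasCompactSupport.intro hGC.2 fun z hz ↦ ?_⟩
        · obtain ⟨C, hC⟩ := this
          exact ⟨C, fun z ↦ by simpa [Rv_Rv] using hC (Rv z)⟩
        · simp [φ, image_eq_zero_of_notMem_tsupport hz]
      exact (h1.memLp 2).integrable_mul (hGC.memLp 2)
    have ib : Integrable fun z ↦ L (Rv z) * G z := by
      have h1 := ((Lop_BC hδ (hb'm.comp measurable_fst) (fun z ↦ hb' _) hv).memLp 2).comp_measurePreserving (Rv_mp (d := d))
      exact h1.integrable_mul (hGC.memLp 2)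
    have e1 : ∫ z, φ z * G z = (∫ z, Dxx i j v (Rv z) * Lop (fun z ↦ b z.1) w z) + ∫ z, (φ z - L (Rv z)) * G z := by
      rw [← id1, ← integral_add ib (by simp only [sub_mul]; exact ia.sub ib)]
      congr 1; ext z; ring
    have e2 : X = ‖∫ z, φ z * G z‖ₑ := by
      have h1 : ∀ z, 0 ≤ φ z * G z := fun z ↦ by
        by_cases h : T < z.1
        · rw [hφG z h]; positivity
        · simp [hφ0 z h]
      rw [Real.enorm_eq_ofReal (integral_nonneg h1), ofReal_integral_eq_lintegral_ofReal ia (ae_of_all _ h1), hX, muT,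
        ← lintegral_indicator (measSet_T T)]
      refine lintegral_congr fun z ↦ ?_
      by_cases h : T < z.1
      · rw [indicator_of_mem (by exact h), hφG z h, Real.enorm_eq_ofReal_abs, ENNReal.ofReal_rpow_of_nonneg (by positivity) hs0.le]
      · rw [indicator_of_notMem (by exact h), hφ0 z h]; simp
    calc X = _ := e2
      _ ≤ _ := by rw [e1]; exact enorm_add_le _ _
      _ ≤ _ := add_le_add (t1.trans (mul_le_mul' hvD le_rfl)) (t2.trans (mul_le_mul' t3 le_rfl))
  have main2 : X ≤ N * X ^ (1 / P) * B := by
    refine ENNReal.le_of_forall_pos_le_add fun η hη _ ↦ ?_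
    obtain ⟨e, he, hC⟩ := ofReal_pick (C := N * B + A) (ε := η) (by finiteness) (by simpa using hη.ne')
    refine (main (ℓ e) (by simpa using he)).trans ?_
    calc _ = N * X ^ (1 / P) * B + (N * B + A) * ℓ e := by ring
      _ ≤ _ := by gcongr
  by_cases hX0 : X = 0
  · rw [hAX, hX0, ENNReal.zero_rpow_of_pos (by positivity)]; exact zero_le
  · have h1 : X = X ^ (1 / P) * X ^ (1 / s) := by
      rw [← ENNReal.rpow_add _ _ hX0 hXt, one_div, one_div, hPs.inv_add_inv_eq_one, ENNReal.rpow_one]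
    have h2 : X ^ (1 / P) * X ^ (1 / s) ≤ X ^ (1 / P) * (N * B) := by
      rw [← h1]; refine main2.trans (le_of_eq (by ring))
    rw [hAX]
    refine (ENNReal.mul_le_mul_iff_right ?_ ?_).1 h2
    · simp [hX0, hXt]
    · exact ENNReal.rpow_ne_top_of_nonneg (by simpa using hPs.nonneg) hXt

def QQ (ρ : ℝ) (z : Pt d) : Set (Pt d) := Ioo (z.1 - ρ ^ 2) (z.1 + ρ ^ 2) ×ˢ ball z.2 ρ

lemma QQ_open (ρ : ℝ) (z : Pt d) : IsOpen (QQ ρ z) := isOpen_Ioo.prod isOpen_ball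
lemma QQ_meas (ρ : ℝ) (z : Pt d) : MeasurableSet (QQ ρ z) := (QQ_open ρ z).measurableSet
lemma mem_QQ {ρ : ℝ} {z y : Pt d} : y ∈ QQ ρ z ↔ |y.1 - z.1| < ρ ^ 2 ∧ dist y.2 z.2 < ρ := by
  simp only [QQ, mem_prod, mem_Ioo, mem_ball, abs_lt]
  constructor
  · rintro ⟨⟨h1, h2⟩, h3⟩; exact ⟨⟨by linarith, by linarith⟩, h3⟩
  · rintro ⟨⟨h1, h2⟩, h3⟩; exact ⟨⟨by linarith, by linarith⟩, h3⟩
lemma QQ_self {ρ : ℝ} (hρ : 0 < ρ) (z : Pt d) : z ∈ QQ ρ z := by rw [mem_QQ]; simp [hρ, hρ.ne']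
lemma QQ_mono {ρ ρ' : ℝ} (h0 : 0 ≤ ρ) (h : ρ ≤ ρ') (z : Pt d) : QQ ρ z ⊆ QQ ρ' z := fun y hy ↦ by
  rw [mem_QQ] at *
  exact ⟨hy.1.trans_le (by gcongr), hy.2.trans_le h⟩

lemma vol_QQ {ρ : ℝ} (hρ : 0 < ρ) (z : Pt d) : volume (QQ ρ z) = ℓ (ρ ^ (d + 2)) * volume (QQ 1 (0 : Pt d)) := by
  simp only [QQ]
  rw [Measure.volume_eq_prod, Measure.prod_prod, Measure.prod_prod, Real.volume_Ioo, Real.volume_Ioo,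
    Measure.addHaar_ball_of_pos volume z.2 hρ, ← mul_assoc, ← ENNReal.ofReal_mul (by nlinarith [sq_nonneg ρ]), ← mul_assoc,
    ← ENNReal.ofReal_mul (by positivity)]
  simp
  congr 2
  ring

lemma vol_Q1_pos : volume (QQ 1 (0 : Pt d)) ≠ 0 :=
  ((QQ_open 1 0).measure_pos volume ⟨0, QQ_self one_pos 0⟩).ne'
lemma vol_Q1_top : volume (QQ 1 (0 : Pt d)) ≠ ⊤ := by
  simp only [QQ]
  rw [Measure.volume_eq_prod, Measure.prod_prod]
  exact ENNReal.mul_ne_top (by simp) measure_ball_lt_top.ne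

lemma vol_QQ_top {ρ : ℝ} (hρ : 0 < ρ) (z : Pt d) : volume (QQ ρ z) ≠ ⊤ := by
  rw [vol_QQ hρ]; exact ENNReal.mul_ne_top ENNReal.ofReal_ne_top vol_Q1_top

lemma QQ_cover {ρ ρ' : ℝ} (h0 : 0 < ρ) (h : ρ ≤ 2 * ρ') {z z' : Pt d} (hn : (QQ ρ z ∩ QQ ρ' z').Nonempty) :
    z ∈ QQ (5 * ρ') z' := by
  obtain ⟨y, h1, h2⟩ := hn
  rw [mem_QQ] at *
  constructor
  · have e : z.1 - z'.1 = (y.1 - z'.1) - (y.1 - z.1) := by ring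
    rw [e]
    refine (abs_sub _ _).trans_lt ?_
    nlinarith
  · have := dist_triangle z.2 y.2 z'.2
    rw [dist_comm z.2 y.2] at this
    linarith

lemma good_lambda {σ N1 η : ℝ} (hσ : 1 ≤ σ) (hN1 : 1 ≤ N1) {F g : 𝔽 d} (hF0 : ∀ z, 0 ≤ F z) (hg0 : ∀ z, 0 ≤ g z)
    (hFl : LowerSemicontinuous F) (hgm : Measurable g)
    (hFi : ∫⁻ z, ℓ (F z ^ σ) ≠ ⊤) (hgi : ∫⁻ z, ℓ (g z ^ σ) ≠ ⊤)
    (H : ∀ (z : Pt d) (ρ lam : ℝ), 0 < ρ → 0 < lam →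
      ∫⁻ y in QQ (4 * ρ) z, ℓ (F y ^ σ) ≤ ℓ (lam ^ σ) * volume (QQ (4 * ρ) z) →
      ∫⁻ y in QQ (4 * ρ) z, ℓ (g y ^ σ) ≤ ℓ (lam ^ σ) * volume (QQ (4 * ρ) z) →
      volume ({y | N1 * lam < F y} ∩ QQ ρ z) ≤ ℓ η * volume (QQ ρ z))
    {lam : ℝ} (hl : 0 < lam) :
    ℓ (lam ^ σ) * volume {y | N1 * lam < F y} ≤ ℓ η * ℓ (5 ^ (d + 2)) * 2 *
      ((∫⁻ z in {z | lam < 4 * F z}, ℓ (F z ^ σ)) + ∫⁻ z in {z | lam < 4 * g z}, ℓ (g z ^ σ)) := by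
  have hFm : Measurable F := hFl.measurable
  set f1 : Pt d → ℝ≥0∞ := fun z ↦ ℓ (F z ^ σ) with hf1
  set f2 : Pt d → ℝ≥0∞ := fun z ↦ ℓ (g z ^ σ) with hf2
  have mf1 : Measurable f1 := (hFm.pow_const σ).ennreal_ofReal
  have mf2 : Measurable f2 := (hgm.pow_const σ).ennreal_ofReal
  set Λ := ℓ (lam ^ σ) with hΛ
  have hlσ : 0 < lam ^ σ := by positivity
  have hΛ0 : Λ ≠ 0 := by simpa [hΛ] using hlσ
  set R : Pt d → Set ℝ := fun z ↦ {ρ | 0 < ρ ∧ Λ * volume (QQ ρ z) ≤ (∫⁻ y in QQ ρ z, f1 y) + ∫⁻ y in QQ ρ z, f2 y} with hR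
  set Itot := (∫⁻ z, f1 z) + ∫⁻ z, f2 z with hI
  have hIt : Itot ≠ ⊤ := ENNReal.add_ne_top.2 ⟨hFi, hgi⟩
  obtain ⟨M, hM⟩ : ∃ M, ∀ z, ∀ ρ ∈ R z, ρ ≤ M := by
    refine ⟨max 1 (Itot / (Λ * volume (QQ 1 (0 : Pt d)))).toReal, fun z ρ hρ ↦ ?_⟩
    by_contra hlt
    push Not at hlt
    have h1 : 1 < ρ := (le_max_left _ _).trans_lt hlt
    have h2 : (Itot / (Λ * volume (QQ 1 (0 : Pt d)))).toReal < ρ := (le_max_right _ _).trans_lt hlt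
    have h3 : Λ * volume (QQ ρ z) ≤ Itot := hρ.2.trans (add_le_add (setLIntegral_le_lintegral _ _) (setLIntegral_le_lintegral _ _))
    rw [vol_QQ hρ.1] at h3
    have hc0 : Λ * volume (QQ 1 (0 : Pt d)) ≠ 0 := mul_ne_zero hΛ0 vol_Q1_pos
    have hct : Λ * volume (QQ 1 (0 : Pt d)) ≠ ⊤ := ENNReal.mul_ne_top ENNReal.ofReal_ne_top vol_Q1_top
    have h4 : ℓ (ρ ^ (d + 2)) ≤ Itot / (Λ * volume (QQ 1 (0 : Pt d))) := by
      rw [ENNReal.le_div_iff_mul_le (Or.inl hc0) (Or.inl hct)]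
      refine le_trans (le_of_eq (by ring)) h3
    rw [ENNReal.ofReal_le_iff_le_toReal (ENNReal.div_ne_top hIt hc0)] at h4
    have h5 : ρ ≤ ρ ^ (d + 2) := le_self_pow₀ h1.le (by omega)
    linarith
  have hne : ∀ z, lam < F z → (R z).Nonempty := by
    intro z hz
    have h1 := hFl z lam hz
    obtain ⟨e, he, hsub⟩ := Metric.eventually_nhds_iff_ball.1 h1
    refine ⟨min 1 (e / 2), by positivity, ?_⟩
    have hb : QQ (min 1 (e / 2)) z ⊆ ball z e := fun y hy ↦ by
      rw [mem_QQ] at hy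
      have a1 : min 1 (e/2) ≤ e / 2 := min_le_right _ _
      have a2 : min 1 (e/2) ≤ 1 := min_le_left _ _
      have a0 : 0 < min 1 (e/2) := by positivity
      rw [mem_ball, Prod.dist_eq, Real.dist_eq]
      exact max_lt (by nlinarith) (by linarith)
    refine le_trans ?_ le_self_add
    rw [← setLIntegral_const]
    refine setLIntegral_mono mf1 fun y hy ↦ ?_
    refine ENNReal.ofReal_le_ofReal (Real.rpow_le_rpow hl.le (hsub y (hb hy)).le (by linarith))
  have hpick : ∀ z, lam < F z → ∃ ρ ∈ R z, ∀ ρ' ∈ R z, ρ' < 2 * ρ := by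
    intro z hz
    have hbd : BddAbove (R z) := ⟨M, fun ρ hρ ↦ hM z ρ hρ⟩
    obtain ⟨ρ0, h0⟩ := hne z hz
    have hs : 0 < sSup (R z) := h0.1.trans_le (le_csSup hbd h0)
    obtain ⟨ρ, h1, h2⟩ := exists_lt_of_lt_csSup (hne z hz) (show sSup (R z) / 2 < sSup (R z) by linarith)
    exact ⟨ρ, h1, fun ρ' h' ↦ (le_csSup hbd h').trans_lt (by linarith)⟩
  choose! rad hrad hrad2 using hpick
  obtain ⟨u, hut, hud, hucov⟩ := Vitali.exists_disjoint_subfamily_covering_enlargement (fun z ↦ QQ (rad z) z) {z | lam < F z} rad 2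
    (by norm_num) (fun z hz ↦ (hrad z hz).1.le) M (fun z hz ↦ hM z _ (hrad z hz)) (fun z hz ↦ ⟨z, QQ_self (hrad z hz).1 z⟩)
  have huc : u.Countable := hud.countable_of_isOpen (fun z _ ↦ QQ_open _ _) (fun z hz ↦ ⟨z, QQ_self (hrad z (hut hz)).1 z⟩)
  have hsub : {y | N1 * lam < F y} ⊆ ⋃ z ∈ u, ({y | N1 * lam < F y} ∩ QQ (5 * rad z) z) := by
    intro y hy
    have hy' : lam < F y := lt_of_le_of_lt (by nlinarith) hy
    obtain ⟨b, hb, hn, hle⟩ := hucov y hy'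
    exact mem_biUnion hb ⟨hy, QQ_cover (hrad y hy').1 hle hn⟩
  have key : ∀ z ∈ u, Λ * volume ({y | N1 * lam < F y} ∩ QQ (5 * rad z) z) ≤ ℓ η * ℓ (5 ^ (d + 2)) * 2 *
      ∫⁻ y in QQ (rad z) z, ({z | lam < 4 * F z}.indicator f1 y + {z | lam < 4 * g z}.indicator f2 y) := by
    intro z hz
    have hr := hrad z (hut hz)
    have hr0 := hr.1
    have hnot : 4 * (5 * rad z) ∉ R z := fun h ↦ by have := hrad2 z (hut hz) _ h; linarith
    have hlt : (∫⁻ y in QQ (4 * (5 * rad z)) z, f1 y) + ∫⁻ y in QQ (4 * (5 * rad z)) z, f2 y ≤ Λ * volume (QQ (4 * (5 * rad z)) z) := by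
      by_contra h'
      exact hnot ⟨by positivity, (not_le.1 h').le⟩
    have h1 := H z (5 * rad z) lam (by positivity) hl (le_self_add.trans hlt) (le_add_self.trans hlt)
    have h2 : volume (QQ (5 * rad z) z) = ℓ (5 ^ (d + 2)) * volume (QQ (rad z) z) := by
      rw [vol_QQ (by positivity), vol_QQ hr0, mul_pow, ENNReal.ofReal_mul (by positivity), mul_assoc]
    have h3 : Λ * volume (QQ (rad z) z) ≤ 2 * ∫⁻ y in QQ (rad z) z, ({z | lam < 4 * F z}.indicator f1 y + {z | lam < 4 * g z}.indicator f2 y) := by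
      have p : ∀ (G : 𝔽 d), (∀ y, 0 ≤ G y) → ∀ y, ℓ (G y ^ σ) ≤ {z | lam < 4 * G z}.indicator (fun z ↦ ℓ (G z ^ σ)) y + Λ * (1 / 4) := by
        intro G hG y
        by_cases hy : lam < 4 * G y
        · rw [indicator_of_mem (by exact hy)]; exact le_self_add
        · rw [indicator_of_notMem (by exact hy), zero_add, hΛ, show (1/4 : ℝ≥0∞) = ℓ (1/4) by
            rw [ENNReal.ofReal_div_of_pos (by norm_num)]; simp, ← ENNReal.ofReal_mul hlσ.le]
          refine ENNReal.ofReal_le_ofReal ?_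
          have a1 : G y ≤ lam * (1/4) := by linarith
          calc G y ^ σ ≤ (lam * (1/4)) ^ σ := Real.rpow_le_rpow (hG y) a1 (by linarith)
            _ = lam ^ σ * (1/4) ^ σ := Real.mul_rpow hl.le (by norm_num)
            _ ≤ lam ^ σ * (1/4) := by
              gcongr
              calc ((1:ℝ)/4) ^ σ ≤ (1/4) ^ (1:ℝ) := Real.rpow_le_rpow_of_exponent_ge (by norm_num) (by norm_num) hσ
                _ = 1/4 := by simp
      have h4 : (∫⁻ y in QQ (rad z) z, f1 y) + ∫⁻ y in QQ (rad z) z, f2 y ≤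
          (∫⁻ y in QQ (rad z) z, ({z | lam < 4 * F z}.indicator f1 y + {z | lam < 4 * g z}.indicator f2 y)) + Λ * volume (QQ (rad z) z) / 2 := by
        rw [← lintegral_add_left mf1]
        calc _ ≤ ∫⁻ y in QQ (rad z) z, (({z | lam < 4 * F z}.indicator f1 y + {z | lam < 4 * g z}.indicator f2 y) + Λ * (1/2)) := by
              refine lintegral_mono fun y ↦ ?_
              refine (add_le_add (p F hF0 y) (p g hg0 y)).trans (le_of_eq ?_)
              have : Λ * (1/2) = Λ * (1/4) + Λ * (1/4) := by
                rw [← mul_add]; congr 1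
                rw [show (1/4 : ℝ≥0∞) = ((1/4 : ℝ≥0) : ℝ≥0∞) by simp, show (1/2 : ℝ≥0∞) = ((1/2 : ℝ≥0) : ℝ≥0∞) by simp, ← ENNReal.coe_add]
                congr 1; rw [← NNReal.coe_inj]; push_cast; norm_num
              rw [this]
              ring
            _ = _ := by
              rw [lintegral_add_right _ measurable_const, setLIntegral_const]; congr 1
              rw [mul_assoc, mul_comm (1/2 : ℝ≥0∞), ← mul_assoc]; simp [div_eq_mul_inv]
      have h5 := hr.2.trans h4
      have ht : Λ * volume (QQ (rad z) z) ≠ ⊤ := ENNReal.mul_ne_top ENNReal.ofReal_ne_top (vol_QQ_top hr0 z)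
      generalize (∫⁻ y in QQ (rad z) z, ({z | lam < 4 * F z}.indicator f1 y + {z | lam < 4 * g z}.indicator f2 y)) = J at *
      generalize Λ * volume (QQ (rad z) z) = V at *
      have h6 : V / 2 ≤ J := by
        have : V / 2 + V / 2 ≤ J + V / 2 := by rw [ENNReal.add_halves]; exact h5
        exact (ENNReal.add_le_add_iff_right (ENNReal.div_ne_top ht (by simp))).1 this
      calc V = 2 * (V / 2) := by rw [ENNReal.mul_div_cancel] <;> simp
        _ ≤ _ := by gcongr
    calc _ ≤ Λ * (ℓ η * (ℓ (5 ^ (d + 2)) * volume (QQ (rad z) z))) := by rw [← h2]; gcongr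
      _ = ℓ η * ℓ (5 ^ (d + 2)) * (Λ * volume (QQ (rad z) z)) := by ring
      _ ≤ _ := by rw [mul_assoc (ℓ η * ℓ (5 ^ (d + 2)))]; gcongr
  calc Λ * volume {y | N1 * lam < F y} ≤ Λ * ∑' z : u, volume ({y | N1 * lam < F y} ∩ QQ (5 * rad z) z) := by
        gcongr
        exact (measure_mono hsub).trans (measure_biUnion_le _ huc _)
    _ = ∑' z : u, Λ * volume ({y | N1 * lam < F y} ∩ QQ (5 * rad z) z) := ENNReal.tsum_mul_left.symm
    _ ≤ ∑' z : u, ℓ η * ℓ (5 ^ (d + 2)) * 2 *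
      ∫⁻ y in QQ (rad z) z, ({z | lam < 4 * F z}.indicator f1 y + {z | lam < 4 * g z}.indicator f2 y) := ENNReal.tsum_le_tsum fun z ↦ key z z.2
    _ = ℓ η * ℓ (5 ^ (d + 2)) * 2 * ∫⁻ y in ⋃ z ∈ u, QQ (rad z) z, ({z | lam < 4 * F z}.indicator f1 y + {z | lam < 4 * g z}.indicator f2 y) := by
        rw [ENNReal.tsum_mul_left, lintegral_biUnion huc (fun z _ ↦ QQ_meas _ _) hud]
    _ ≤ _ := by
        gcongr
        refine (setLIntegral_le_lintegral _ _).trans (le_of_eq ?_)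
        have s1 : MeasurableSet {z | lam < 4 * F z} := measurableSet_lt measurable_const (hFm.const_mul 4)
        have s2 : MeasurableSet {z | lam < 4 * g z} := measurableSet_lt measurable_const (hgm.const_mul 4)
        rw [lintegral_add_left (mf1.indicator s1), lintegral_indicator s1, lintegral_indicator s2]

theorem RV {σ N1 η P : ℝ} (hσ : 1 ≤ σ) (hσP : σ < P) (hN1 : 1 ≤ N1) (hη : 0 ≤ η)
    (hsm : N1 ^ P * P * (η * 5 ^ (d + 2) * 2) * (4 ^ (P - σ) / (P - σ)) ≤ 1 / 2)
    {F g : 𝔽 d} (hF0 : ∀ z, 0 ≤ F z) (hg0 : ∀ z, 0 ≤ g z)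
    (hFl : LowerSemicontinuous F) (hgm : Measurable g)
    (hFi : ∫⁻ z, ℓ (F z ^ σ) ≠ ⊤) (hgi : ∫⁻ z, ℓ (g z ^ σ) ≠ ⊤)
    (hFP : ∫⁻ z, ℓ (F z ^ P) ≠ ⊤)
    (H : ∀ (z : Pt d) (ρ lam : ℝ), 0 < ρ → 0 < lam →
      ∫⁻ y in QQ (4 * ρ) z, ℓ (F y ^ σ) ≤ ℓ (lam ^ σ) * volume (QQ (4 * ρ) z) →
      ∫⁻ y in QQ (4 * ρ) z, ℓ (g y ^ σ) ≤ ℓ (lam ^ σ) * volume (QQ (4 * ρ) z) →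
      volume ({y | N1 * lam < F y} ∩ QQ ρ z) ≤ ℓ η * volume (QQ ρ z)) :
    ∫⁻ z, ℓ (F z ^ P) ≤ ∫⁻ z, ℓ (g z ^ P) := by
  have hP : 0 < P := by linarith
  have hPσ : 0 < P - σ := by linarith
  have hFm : Measurable F := hFl.measurable
  have hN0 : 0 < N1 := by linarith
  set c := ℓ η * ℓ (5 ^ (d + 2)) * 2 with hc
  have lay : ∀ G : Pt d → ℝ, (∀ z, 0 ≤ G z) → Measurable G →
      ∫⁻ t in Ioi (0:ℝ), (∫⁻ z in {z | t < 4 * G z}, ℓ (G z ^ σ)) * ℓ (t ^ (P - σ - 1)) =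
      ℓ (4 ^ (P - σ) / (P - σ)) * ∫⁻ z, ℓ (G z ^ P) := by
    intro G hG hGm
    have hm : Measurable fun z ↦ ℓ (G z ^ σ) := (hGm.pow_const σ).ennreal_ofReal
    set ν := (volume : Measure (Pt d)).withDensity fun z ↦ ℓ (G z ^ σ) with hν
    have h1 := lintegral_rpow_eq_lintegral_meas_lt_mul ν (f := fun z ↦ 4 * G z) (ae_of_all _ fun z ↦ by simpa using hG z)
      (hGm.const_mul 4).aemeasurable hPσ
    have h2 : ∀ t, ν {a | t < 4 * G a} = ∫⁻ z in {z | t < 4 * G z}, ℓ (G z ^ σ) := fun t ↦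
      withDensity_apply _ (measurableSet_lt measurable_const (hGm.const_mul 4))
    simp only [h2] at h1
    have h3 : ∫⁻ z, ℓ ((4 * G z) ^ (P - σ)) ∂ν = ℓ (4 ^ (P - σ)) * ∫⁻ z, ℓ (G z ^ P) := by
      rw [hν, lintegral_withDensity_eq_lintegral_mul _ hm ((hGm.const_mul 4).pow_const _).ennreal_ofReal,
        ← lintegral_const_mul _ (hGm.pow_const P).ennreal_ofReal]
      refine lintegral_congr fun z ↦ ?_
      simp only [Pi.mul_apply]
      rw [← ENNReal.ofReal_mul (Real.rpow_nonneg (hG z) _), ← ENNReal.ofReal_mul (by positivity), Real.mul_rpow (by norm_num) (hG z)]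
      congr 1
      rw [mul_left_comm, ← Real.rpow_add' (hG z) (by linarith)]
      congr 2; ring
    rw [h3] at h1
    rw [ENNReal.ofReal_div_of_pos hPσ, ENNReal.div_eq_inv_mul, mul_assoc, h1, ← mul_assoc,
      ENNReal.inv_mul_cancel (by simpa using hPσ) ENNReal.ofReal_ne_top, one_mul]
  have msr : ∀ G : Pt d → ℝ, Measurable fun t : ℝ ↦ (∫⁻ z in {z | t < 4 * G z}, ℓ (G z ^ σ)) * ℓ (t ^ (P - σ - 1)) := by
    intro G
    refine Measurable.mul (Antitone.measurable fun t t' h ↦ ?_) (measurable_id.pow_const _).ennreal_ofReal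
    exact lintegral_mono_set fun z hz ↦ lt_of_le_of_lt h hz
  have l1 := lintegral_rpow_eq_lintegral_meas_lt_mul volume (f := fun z ↦ F z / N1) (ae_of_all _ fun z ↦ div_nonneg (hF0 z) hN0.le)
      (hFm.div_const N1).aemeasurable hP
  set X := ∫⁻ z, ℓ (F z ^ P) with hX
  set Y := ∫⁻ z, ℓ (g z ^ P) with hY
  have l2 : X = ℓ (N1 ^ P) * ∫⁻ z, ℓ ((F z / N1) ^ P) := by
    rw [← lintegral_const_mul _ ((hFm.div_const N1).pow_const P).ennreal_ofReal]
    refine lintegral_congr fun z ↦ ?_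
    rw [← ENNReal.ofReal_mul (by positivity), ← Real.mul_rpow hN0.le (div_nonneg (hF0 z) hN0.le), mul_div_cancel₀ _ hN0.ne']
  have l3 : ∫⁻ t in Ioi (0:ℝ), volume {a | t < F a / N1} * ℓ (t ^ (P - 1)) ≤
      c * (ℓ (4 ^ (P - σ) / (P - σ)) * (X + Y)) := by
    rw [mul_add, ← lay F hF0 hFm, ← lay g hg0 hgm, ← lintegral_add_left', ← lintegral_const_mul'']
    · refine setLIntegral_mono' measurableSet_Ioi fun t ht ↦ ?_
      have ht0 : 0 < t := ht
      have h1 := good_lambda hσ hN1 hF0 hg0 hFl hgm hFi hgi H ht0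
      have h2 : {a | t < F a / N1} = {y | N1 * t < F y} := by
        ext y; simp only [mem_setOf_eq]; rw [lt_div_iff₀ hN0, mul_comm]
      rw [h2, ← add_mul, ← mul_assoc]
      have h3 : ℓ (t ^ (P - 1)) = ℓ (t ^ σ) * ℓ (t ^ (P - σ - 1)) := by
        rw [← ENNReal.ofReal_mul (by positivity), ← Real.rpow_add ht0]; congr 2; ring
      rw [h3, ← mul_assoc, mul_comm (volume _)]
      gcongr
    · exact ((msr F).add (msr g)).aemeasurable
    · exact (msr F).aemeasurable
  have fin : X ≤ 1 / 2 * (X + Y) := by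
    calc X = ℓ (N1 ^ P) * (ℓ P * ∫⁻ t in Ioi (0:ℝ), volume {a | t < F a / N1} * ℓ (t ^ (P - 1))) := by
          rw [← l1, l2]
      _ ≤ ℓ (N1 ^ P) * (ℓ P * (c * (ℓ (4 ^ (P - σ) / (P - σ)) * (X + Y)))) := by gcongr
      _ = ℓ (N1 ^ P * P * (η * 5 ^ (d + 2) * 2) * (4 ^ (P - σ) / (P - σ))) * (X + Y) := by
          rw [ENNReal.ofReal_mul (by positivity), ENNReal.ofReal_mul (by positivity), ENNReal.ofReal_mul (by positivity),
            ENNReal.ofReal_mul (by positivity), ENNReal.ofReal_mul (by positivity), hc]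
          simp; ring
      _ ≤ _ := by
          gcongr
          refine (ENNReal.ofReal_le_ofReal hsm).trans (le_of_eq ?_)
          rw [ENNReal.ofReal_div_of_pos (by norm_num)]; simp
  have h2X : X / 2 ≤ Y / 2 := by
    have : X / 2 + X / 2 ≤ Y / 2 + X / 2 := by
      rw [ENNReal.add_halves]; refine fin.trans (le_of_eq ?_)
      rw [mul_add, add_comm]; simp [div_eq_mul_inv, mul_comm]
    exact (ENNReal.add_le_add_iff_right (ENNReal.div_ne_top hFP (by simp))).1 this
  calc X = 2 * (X / 2) := by rw [ENNReal.mul_div_cancel] <;> simp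
    _ ≤ 2 * (Y / 2) := by gcongr
    _ = Y := by rw [ENNReal.mul_div_cancel] <;> simp

lemma fderiv_bd {w : 𝔽 d} (hw : Sm w) (z : Pt d) : ‖fderiv ℝ w z‖ ≤ |Dt w z| + ∑ i, |Dx i w z| := by
  refine ContinuousLinearMap.opNorm_le_bound _ (by positivity) fun v ↦ ?_
  have hv : v = v.1 • et d + ∑ i, v.2 i • ex i := by
    refine Prod.ext (by simp [et, ex, Prod.fst_sum]) ?_
    ext j
    simp [et, ex, Prod.snd_sum, Pi.single_apply]
  have h1 : fderiv ℝ w z v = v.1 * Dt w z + ∑ i, v.2 i * Dx i w z := by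
    conv_lhs => rw [hv]
    simp only [map_add, map_sum, map_smul, smul_eq_mul, Dt_eq hw, Dx_eq hw, DD]
  rw [h1, add_mul, Finset.sum_mul]
  refine (norm_add_le _ _).trans (add_le_add ?_ ((norm_sum_le _ _).trans (Finset.sum_le_sum fun i _ ↦ ?_)))
  · rw [norm_mul, mul_comm]; exact mul_le_mul_of_nonneg_left (norm_fst_le v) (abs_nonneg _)
  · rw [norm_mul, mul_comm]; exact mul_le_mul_of_nonneg_left ((PiLp.norm_apply_le v.2 i).trans (norm_snd_le v)) (abs_nonneg _)

def Phi (T ε : ℝ) (z : Pt d) : Pt d := (T + √((z.1 - T) ^ 2 + ε ^ 2), z.2)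

lemma Phi_close {h : 𝔽 d} (hh : CinfC h) (T : ℝ) {s : ℝ} (hs : 1 ≤ s) {e : ℝ≥0∞} (he : e ≠ 0) :
    ∀ᶠ ε in nhdsWithin (0:ℝ) (Ioi 0), eLpNorm (fun z ↦ h (Phi T ε z) - h (Phi T 0 z)) (ℓ s) volume ≤ e := by
  obtain ⟨M, hM⟩ := hh.2.isCompact.isBounded.exists_norm_le
  have hM' : ∀ z, h z ≠ 0 → ‖z‖ ≤ M := fun z hz ↦ hM z (subset_tsupport _ hz)
  obtain ⟨L, hL⟩ := ContDiff.lipschitzWith_of_hasCompactSupport hh.2 hh.1 (by simp)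
  set K : Set (Pt d) := closedBall T (M + |T|) ×ˢ closedBall 0 M with hK
  have hKc : volume K ≠ ⊤ := ((isCompact_closedBall _ _).prod (isCompact_closedBall _ _)).measure_ne_top
  have hsup : ∀ ε z, h (Phi T ε z) ≠ 0 → z ∈ K := by
    intro ε z hz
    have h1 := hM' _ hz
    have h2 := (norm_fst_le _).trans h1
    have h3 := (norm_snd_le _).trans h1
    simp only [Phi, Real.norm_eq_abs] at h2 h3
    refine ⟨?_, by simpa using h3⟩
    rw [mem_closedBall, Real.dist_eq]
    have h4 : |z.1 - T| ≤ √((z.1 - T) ^ 2 + ε ^ 2) := Real.abs_le_sqrt (by nlinarith)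
    have h5 := (abs_le.1 h2).2
    have := neg_abs_le T
    linarith
  obtain ⟨e', he', hee⟩ := ofReal_pick (C := (volume K) ^ (s⁻¹) * L) (ENNReal.mul_ne_top (ENNReal.rpow_ne_top_of_nonneg (by positivity) hKc) (by simp)) he
  filter_upwards [Ioo_mem_nhdsGT he'] with ε hε
  have hsub : Function.support (fun z ↦ h (Phi T ε z) - h (Phi T 0 z)) ⊆ K := by
    intro z hz
    by_contra hc
    refine hz ?_
    have h1 : h (Phi T ε z) = 0 := by by_contra h'; exact hc (hsup _ _ h')
    have h2 : h (Phi T 0 z) = 0 := by by_contra h'; exact hc (hsup _ _ h')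
    simp [h1, h2]
  rw [← eLpNorm_restrict_eq_of_support_subset hsub]
  refine (eLpNorm_le_of_ae_bound (C := L * ε) (ae_of_all _ fun z ↦ ?_)).trans (le_trans ?_ hee)
  · have h1 := hL.dist_le_mul (Phi T ε z) (Phi T 0 z)
    rw [Real.dist_eq] at h1
    refine h1.trans (mul_le_mul_of_nonneg_left ?_ L.2)
    rw [Prod.dist_eq]
    refine max_le ?_ (by simp [Phi, hε.1.le])
    simp only [Phi, Real.dist_eq, add_sub_add_left_eq_sub]
    have a1 : √((z.1 - T) ^ 2 + 0 ^ 2) = |z.1 - T| := by rw [zero_pow two_ne_zero, add_zero, Real.sqrt_sq_eq_abs]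
    have a2 : |z.1 - T| ≤ √((z.1 - T) ^ 2 + ε ^ 2) := Real.abs_le_sqrt (by nlinarith)
    have a3 : √((z.1 - T) ^ 2 + ε ^ 2) ≤ |z.1 - T| + ε := by
      rw [← sq_abs (z.1 - T)]
      exact Real.sqrt_le_iff.2 ⟨by have := hε.1; positivity, by nlinarith [abs_nonneg (z.1 - T), hε.1]⟩
    rw [a1, abs_of_nonneg (by linarith)]; linarith
  · rw [Measure.restrict_apply_univ, ENNReal.toReal_ofReal (by linarith), ENNReal.ofReal_mul NNReal.zero_le_coe, ENNReal.ofReal_coe_nnreal, mul_assoc]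
    gcongr
    exact hε.2.le

lemma Phi_refl {h : 𝔽 d} (hh : Measurable h) (T : ℝ) {s : ℝ} (hs : 1 ≤ s) :
    eLpNorm (fun z ↦ h (Phi T 0 z)) (ℓ s) volume ≤ 2 * eLpNorm h (ℓ s) (muT d T) := by
  set A : Set (Pt d) := {z | T < z.1}
  have hA : MeasurableSet A := measSet_T T
  have hPm : Measurable (Phi (d := d) T 0) := by unfold Phi; fun_prop
  have hm : Measurable (fun z ↦ h (Phi T 0 z)) := hh.comp hPm
  have e : (fun z ↦ h (Phi T 0 z)) = A.indicator (fun z ↦ h (Phi T 0 z)) + Aᶜ.indicator (fun z ↦ h (Phi T 0 z)) :=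
    (indicator_self_add_compl A _).symm
  rw [e, two_mul]
  refine (eLpNorm_add_le (hm.indicator hA).aestronglyMeasurable (hm.indicator hA.compl).aestronglyMeasurable (by simpa using hs)).trans (add_le_add ?_ ?_)
  · rw [eLpNorm_indicator_eq_eLpNorm_restrict hA]
    refine le_of_eq (eLpNorm_congr_ae ((ae_restrict_iff' hA).2 (ae_of_all _ fun z (hz : T < z.1) ↦ ?_)))
    simp only [Phi, zero_pow two_ne_zero, add_zero, Real.sqrt_sq_eq_abs, abs_of_pos (sub_pos.2 hz)]
    congr 1; ext <;> simp
  · rw [eLpNorm_indicator_eq_eLpNorm_restrict hA.compl]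
    set R : Pt d → Pt d := fun z ↦ (2 * T - z.1, z.2) with hR
    have hRp : MeasurePreserving R volume volume := by
      rw [Measure.volume_eq_prod]
      exact (Measure.measurePreserving_sub_left (volume : Measure ℝ) (2 * T)).prod (MeasurePreserving.id _)
    have hset : (Aᶜ : Set (Pt d)) =ᵐ[volume] R ⁻¹' A := by
      have h0 : volume ({T} ×ˢ (univ : Set (Spc d)) : Set (Pt d)) = 0 := by
        rw [Measure.volume_eq_prod, Measure.prod_prod]; simp
      have h1 : ∀ᵐ z : Pt d, z ∉ ({T} ×ˢ (univ : Set (Spc d)) : Set (Pt d)) := measure_eq_zero_iff_ae_notMem.1 h0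
      filter_upwards [h1] with z hz
      have hz' : z.1 ≠ T := fun h ↦ hz ⟨h, trivial⟩
      refine propext ?_
      show ¬ (T < z.1) ↔ T < 2 * T - z.1
      constructor
      · intro h; have := lt_of_le_of_ne (not_lt.1 h) hz'; linarith
      · intro h; linarith
    rw [Measure.restrict_congr_set hset]
    have h2 := eLpNorm_comp_measurePreserving (p := ℓ s) hh.aestronglyMeasurable (hRp.restrict_preimage hA)
    refine le_of_eq (Eq.trans (eLpNorm_congr_ae ((ae_restrict_iff' (hRp.measurable hA)).2 (ae_of_all _ fun z (hz : T < 2 * T - z.1) ↦ ?_))) h2)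
    simp only [Phi, zero_pow two_ne_zero, add_zero, Real.sqrt_sq_eq_abs, Function.comp, hR]
    rw [abs_of_neg (by linarith)]
    congr 1; ext <;> simp; ring

lemma Phi_comp {w : 𝔽 d} (hw : CinfC w) (T : ℝ) {ε : ℝ} (hε : 0 < ε) :
    ContDiff ℝ 1 (fun z ↦ w (Phi T ε z)) ∧ ∀ z, ‖fderiv ℝ (fun z ↦ w (Phi T ε z)) z‖ ≤
      |Dt w (Phi T ε z)| + ∑ i, |Dx i w (Phi T ε z)| := by
  have hpos : ∀ t : ℝ, 0 < (t - T) ^ 2 + ε ^ 2 := fun t ↦ by positivity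
  constructor
  · have h1 : ContDiff ℝ 1 (Phi (d := d) T ε) :=
      (contDiff_const.add (ContDiff.sqrt (by fun_prop) fun z ↦ (hpos z.1).ne')).prodMk contDiff_snd
    exact (hw.1.of_le (by exact_mod_cast le_top)).comp h1
  · intro z
    have hd : HasDerivAt (fun t : ℝ ↦ T + √((t - T) ^ 2 + ε ^ 2)) ((z.1 - T) / √((z.1 - T) ^ 2 + ε ^ 2)) z.1 := by
      have h2 : HasDerivAt (fun t : ℝ ↦ (t - T) ^ 2 + ε ^ 2) (2 * (z.1 - T)) z.1 := by
        have := (((hasDerivAt_id z.1).sub_const T).pow 2).add_const (ε ^ 2)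
        refine this.congr_deriv ?_
        simp
      refine ((h2.sqrt (hpos _).ne').const_add T).congr_deriv ?_
      rw [mul_div_mul_left _ _ two_ne_zero]
    set c := (z.1 - T) / √((z.1 - T) ^ 2 + ε ^ 2)
    have hc : |c| ≤ 1 := by
      rw [abs_div, abs_of_nonneg (Real.sqrt_nonneg _), div_le_one (Real.sqrt_pos.2 (hpos _))]
      exact Real.abs_le_sqrt (by nlinarith)
    have hP : HasFDerivAt (Phi (d := d) T ε) ((c • ContinuousLinearMap.fst ℝ ℝ (Spc d)).prod (ContinuousLinearMap.snd ℝ ℝ (Spc d))) z := by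
      refine HasFDerivAt.prodMk ?_ hasFDerivAt_snd
      exact hd.comp_hasFDerivAt z hasFDerivAt_fst
    have h3 := ((hw.sm.diff (Phi T ε z)).hasFDerivAt.comp z hP).fderiv
    simp only [Function.comp_def] at h3
    rw [h3]
    refine le_trans ?_ (fderiv_bd hw.sm _)
    refine (ContinuousLinearMap.opNorm_comp_le _ _).trans (mul_le_of_le_one_right (norm_nonneg _) ?_)
    refine ContinuousLinearMap.opNorm_le_bound _ zero_le_one fun v ↦ ?_
    rw [one_mul]
    refine max_le ?_ (norm_snd_le v)
    show ‖c * v.1‖ ≤ _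
    rw [norm_mul]
    exact (mul_le_of_le_one_left (norm_nonneg _) hc).trans (norm_fst_le v)

lemma DD_supp_sub {K : Set (Pt d)} (hK : IsClosed K) {w : 𝔽 d} (hw : ∀ z, w z ≠ 0 → z ∈ K) (v : Pt d) :
    ∀ z, DD v w z ≠ 0 → z ∈ K := by
  intro z hz
  have h1 : z ∈ tsupport w := by
    by_contra hc
    apply hz
    have : fderiv ℝ w z = 0 := by
      by_contra h'
      exact hc (support_fderiv_subset ℝ h')
    simp [DD, this]
  exact closure_minimal (fun z hz ↦ hw z hz) hK h1

theorem Sob (hd : 1 ≤ d) {s : ℝ} (hs : 1 ≤ s) (B : ℝ) : ∃ C : ℝ≥0, ∀ (T : ℝ) (w : 𝔽 d), CinfC w →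
    (∀ z, w z ≠ 0 → z ∈ QQ B 0) → eLpNorm w (ℓ ((d + 1) / d * s)) (muT d T) ≤
      C * (eLpNorm (Dt w) (ℓ s) (muT d T) + ∑ i, eLpNorm (Dx i w) (ℓ s) (muT d T)) := by
  have hd0 : (0:ℝ) < d := by exact_mod_cast hd
  set S : Set (Pt d) := closedBall 0 (3 * B ^ 2) ×ˢ closedBall 0 B with hS
  have hScl : IsClosed S := isClosed_closedBall.prod isClosed_closedBall
  have hSc : IsCompact S := (isCompact_closedBall _ _).prod (isCompact_closedBall _ _)
  set p0 : ℝ := (d + 1) * s / (d + s) with hp0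
  set q0 : ℝ := (d + 1) / d * s with hq0
  have hq1 : 1 ≤ q0 := by
    rw [hq0, div_mul_eq_mul_div, le_div_iff₀ hd0]; nlinarith
  have hp1 : 1 ≤ p0 := by rw [hp0, le_div_iff₀ (by positivity)]; nlinarith
  have hps : p0 ≤ s := by rw [hp0, div_le_iff₀ (by positivity)]; nlinarith
  have hpn : p0 < d + 1 := by rw [hp0, div_lt_iff₀ (by positivity)]; nlinarith
  obtain ⟨C2, hC2⟩ := eLp_supp (d := d) hSc.measure_ne_top (s1 := p0) (by linarith) hps
  set C1 : ℝ≥0 := eLpNormLESNormFDerivOfLeConst ℝ (volume : Measure (Pt d)) S p0.toNNReal q0.toNNReal with hC1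
  have core : ∀ (T : ℝ) (w : 𝔽 d), |T| ≤ B ^ 2 → CinfC w →
    (∀ z, w z ≠ 0 → z ∈ QQ B 0) → eLpNorm w (ℓ q0) (muT d T) ≤
      (C1 * C2 * 2 : ℝ≥0) * (eLpNorm (Dt w) (ℓ s) (muT d T) + ∑ i, eLpNorm (Dx i w) (ℓ s) (muT d T)) := by
    intro T w hT hw hsup
    have hsup2 : ∀ z, w z ≠ 0 → z ∈ (closedBall 0 (B ^ 2) ×ˢ closedBall 0 B : Set (Pt d)) := by
      intro z hz
      have := mem_QQ.1 (hsup z hz)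
      refine ⟨?_, ?_⟩
      · rw [mem_closedBall, Real.dist_eq]; simpa using this.1.le
      · rw [mem_closedBall]; simpa using this.2.le
    have hPhiS : ∀ ε z, Phi T ε z ∈ (closedBall 0 (B ^ 2) ×ˢ closedBall 0 B : Set (Pt d)) → z ∈ S := by
      rintro ε z ⟨h1, h2⟩
      refine ⟨?_, h2⟩
      rw [mem_closedBall, Real.dist_eq, sub_zero] at h1 ⊢
      simp only [Phi] at h1
      have h4 : |z.1 - T| ≤ √((z.1 - T) ^ 2 + ε ^ 2) := Real.abs_le_sqrt (by nlinarith)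
      have h5 := (abs_le.1 h1).2
      have h6 := abs_le.1 hT
      have h7 := abs_le.1 (h4.trans (by linarith : _ ≤ 2 * B ^ 2))
      exact abs_le.2 ⟨by linarith, by linarith⟩
    have hcl : IsClosed (closedBall 0 (B ^ 2) ×ˢ closedBall 0 B : Set (Pt d)) := isClosed_closedBall.prod isClosed_closedBall
    have hDt : ∀ z, Dt w z ≠ 0 → z ∈ (closedBall 0 (B ^ 2) ×ˢ closedBall 0 B : Set (Pt d)) := by
      rw [Dt_eq hw.1]; exact DD_supp_sub hcl hsup2 _
    have hDx : ∀ i z, Dx i w z ≠ 0 → z ∈ (closedBall 0 (B ^ 2) ×ˢ closedBall 0 B : Set (Pt d)) := by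
      intro i; rw [Dx_eq hw.1]; exact DD_supp_sub hcl hsup2 _
    refine ENNReal.le_of_forall_pos_le_add fun e he _ ↦ ?_
    obtain ⟨e', he', hee⟩ := ofReal_pick (C := 1 + C1 * C2 * (1 + d)) (by finiteness) (ε := e) (by simpa using he.ne')
    have hE : ℓ e' ≠ 0 := by simpa using he'
    have hev := ((Phi_close hw T hq1 hE).and ((Phi_close hw.dt T hs hE).and ((Filter.eventually_all.2 fun i ↦
      Phi_close (hw.dx i) T hs hE)))).and self_mem_nhdsWithin
    obtain ⟨ε, ⟨e1, e2, e3⟩, hε⟩ := hev.exists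
    have hε : 0 < ε := hε
    obtain ⟨cd, fb⟩ := Phi_comp hw T hε
    have hPc : Continuous (Phi (d := d) T ε) := by unfold Phi; fun_prop
    have hPc0 : Continuous (Phi (d := d) T 0) := by unfold Phi; fun_prop
    have tri : ∀ {h : 𝔽 d} {p : ℝ}, CinfC h → 1 ≤ p → eLpNorm (fun z ↦ h (Phi T ε z) - h (Phi T 0 z)) (ℓ p) volume ≤ ℓ e' →
        eLpNorm (fun z ↦ h (Phi T ε z)) (ℓ p) volume ≤ ℓ e' + 2 * eLpNorm h (ℓ p) (muT d T) := by
      intro h p hh hp hle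
      have : (fun z ↦ h (Phi T ε z)) = (fun z ↦ h (Phi T ε z) - h (Phi T 0 z)) + fun z ↦ h (Phi T 0 z) := by ext; simp
      rw [this]
      exact (eLpNorm_add_le ((hh.cont.comp hPc).sub (hh.cont.comp hPc0)).aestronglyMeasurable (hh.cont.comp hPc0).aestronglyMeasurable (by simpa using hp)).trans
        (add_le_add hle (Phi_refl hh.meas T hp))
    have s1 : eLpNorm w (ℓ q0) (muT d T) ≤ ℓ e' + eLpNorm (fun z ↦ w (Phi T ε z)) (ℓ q0) volume := by
      have h1 : eLpNorm w (ℓ q0) (muT d T) = eLpNorm (fun z ↦ w (Phi T 0 z)) (ℓ q0) (muT d T) := by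
        refine eLpNorm_congr_ae ((ae_restrict_iff' (measSet_T T)).2 (ae_of_all _ fun z (hz : T < z.1) ↦ ?_))
        simp only [Phi, zero_pow two_ne_zero, add_zero, Real.sqrt_sq_eq_abs, abs_of_pos (sub_pos.2 hz)]
        congr 1; ext <;> simp
      rw [h1]
      refine (eLpNorm_mono_measure _ (muT_le T)).trans ?_
      have : (fun z ↦ w (Phi T 0 z)) = (fun z ↦ w (Phi T ε z)) - (fun z ↦ w (Phi T ε z) - w (Phi T 0 z)) := by ext; simp
      rw [this, add_comm]
      exact (eLpNorm_sub_le (hw.cont.comp hPc).aestronglyMeasurable ((hw.cont.comp hPc).sub (hw.cont.comp hPc0)).aestronglyMeasurable (by simpa using hq1)).trans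
        (add_le_add le_rfl e1)
    set H : Pt d → ℝ := fun z ↦ |Dt w (Phi T ε z)| + ∑ i, |Dx i w (Phi T ε z)| with hH
    have hHc : Continuous H := ((hw.dt.cont.comp hPc).abs).add (continuous_finsetSum _ fun i _ ↦ ((hw.dx i).cont.comp hPc).abs)
    have hH0 : ∀ z, 0 ≤ H z := fun z ↦ by positivity
    have fr : Module.finrank ℝ (Pt d) = d + 1 := by simp [add_comm]
    have s2 : eLpNorm (fun z ↦ w (Phi T ε z)) (ℓ q0) volume ≤ C1 * eLpNorm H (ℓ p0) volume := by
      have := eLpNorm_le_eLpNorm_fderiv_of_le (F := ℝ) (volume : Measure (Pt d)) cd (s := S) (fun z hz ↦ hPhiS ε z (hsup2 _ hz)) (p := p0.toNNReal) (q := q0.toNNReal)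
        (by simpa using hp1) (by rw [fr, ← NNReal.coe_lt_coe, Real.coe_toNNReal _ (by linarith)]; push_cast; exact hpn)
        (by
          rw [fr, Real.coe_toNNReal _ (by linarith)]
          rw [NNReal.coe_inv, Real.coe_toNNReal _ (by linarith)]
          rw [hp0, hq0]; push_cast
          refine le_of_eq ?_
          field_simp; ring) hSc.isBounded
      refine this.trans ?_
      gcongr
      exact eLpNorm_mono fun z ↦ (fb z).trans (le_abs_self _)
    have s3 : eLpNorm H (ℓ p0) volume ≤ C2 * eLpNorm H (ℓ s) volume := by
      refine hC2 H hHc.aestronglyMeasurable fun z hz ↦ ?_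
      by_contra hc
      apply hz
      have h1 : Dt w (Phi T ε z) = 0 := by by_contra h'; exact hc (hPhiS ε z (hDt _ h'))
      have h2 : ∀ i, Dx i w (Phi T ε z) = 0 := fun i ↦ by by_contra h'; exact hc (hPhiS ε z (hDx i _ h'))
      simp [hH, h1, h2]
    have s4 : eLpNorm H (ℓ s) volume ≤ (ℓ e' + 2 * eLpNorm (Dt w) (ℓ s) (muT d T)) +
        ∑ i, (ℓ e' + 2 * eLpNorm (Dx i w) (ℓ s) (muT d T)) := by
      have hs' : (1:ℝ≥0∞) ≤ ℓ s := by simpa using hs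
      have : H = (fun z ↦ |Dt w (Phi T ε z)|) + ∑ i, fun z ↦ |Dx i w (Phi T ε z)| := by ext z; simp [hH]
      rw [this]
      refine (eLpNorm_add_le (hw.dt.cont.comp hPc).abs.aestronglyMeasurable
        (Continuous.aestronglyMeasurable (by simpa [Finset.sum_fn] using continuous_finsetSum _ fun i _ ↦ ((hw.dx i).cont.comp hPc).abs)) hs').trans
        (add_le_add ?_ ((eLpNorm_sum_le (fun i _ ↦ ((hw.dx i).cont.comp hPc).abs.aestronglyMeasurable) hs').trans (Finset.sum_le_sum fun i _ ↦ ?_)))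
      · exact (eLpNorm_norm (fun z ↦ Dt w (Phi T ε z))).le.trans (tri hw.dt hs e2)
      · exact (eLpNorm_norm (fun z ↦ Dx i w (Phi T ε z))).le.trans (tri (hw.dx i) hs (e3 i))
    calc _ ≤ ℓ e' + C1 * (C2 * _) := s1.trans (add_le_add le_rfl (s2.trans (mul_le_mul_right (s3.trans (mul_le_mul_right s4 _)) _)))
      _ = (1 + C1 * C2 * (1 + d)) * ℓ e' + (C1 * C2 * 2 : ℝ≥0) * (eLpNorm (Dt w) (ℓ s) (muT d T) + ∑ i, eLpNorm (Dx i w) (ℓ s) (muT d T)) := by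
          rw [Finset.sum_add_distrib, ← Finset.mul_sum]; simp; ring
      _ ≤ _ := by rw [add_comm]; gcongr
  refine ⟨C1 * C2 * 2, fun T w hw hsup ↦ ?_⟩
  rcases le_or_gt (B ^ 2) T with hT | hT
  · have : eLpNorm w (ℓ q0) (muT d T) = 0 := by
      rw [← eLpNorm_zero (ε := ℝ) (p := ℓ q0) (μ := muT d T)]
      refine eLpNorm_congr_ae ((ae_restrict_iff' (measSet_T T)).2 (ae_of_all _ fun z (hz : T < z.1) ↦ ?_))
      by_contra h
      have := (mem_QQ.1 (hsup z h)).1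
      simp only [Prod.fst_zero, sub_zero] at this
      linarith [(abs_lt.1 this).2]
    rw [this]; exact zero_le
  rcases le_or_gt (-B ^ 2) T with hT2 | hT2
  · exact core T w (abs_le.2 ⟨hT2, hT.le⟩) hw hsup
  · have hsub : Function.support w ⊆ {z : Pt d | -B ^ 2 < z.1} := fun z hz ↦ by
      have := (mem_QQ.1 (hsup z hz)).1
      simp only [Prod.fst_zero, sub_zero] at this
      exact (abs_lt.1 this).1
    have h1 : eLpNorm w (ℓ q0) (muT d T) ≤ eLpNorm w (ℓ q0) (muT d (-B^2)) := by
      unfold muT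
      rw [eLpNorm_restrict_eq_of_support_subset hsub]
      exact eLpNorm_mono_measure _ Measure.restrict_le_self
    have hss : {z : Pt d | -B ^ 2 < z.1} ⊆ {z : Pt d | T < z.1} := fun z hz ↦ hT2.trans hz
    have hle : muT d (-B^2) ≤ muT d T := Measure.restrict_mono hss le_rfl
    refine (h1.trans (core (-B^2) w (by rw [abs_neg, abs_of_nonneg (by positivity)]) hw hsup)).trans ?_
    gcongr <;> exact eLpNorm_mono_measure _ hle

lemma interp {w : 𝔽 d} (hw : CinfC w) (i : Fin d) {H : ℝ} (hH : 0 < H) (T : ℝ) {s : ℝ} (hs : 1 ≤ s) :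
    eLpNorm (Dx i w) (ℓ s) (muT d T) ≤ ℓ (2 / H) * eLpNorm w (ℓ s) (muT d T) +
      ℓ H * eLpNorm (Dxx i i w) (ℓ s) (muT d T) := by
  have hs' : (1:ℝ≥0∞) ≤ ℓ s := by simpa using hs
  set v : Pt d := H • ex i with hv
  have h1 := tay2 hw v (measSet_T T) (fun z (hz : T < z.1) θ _ ↦ by show T < _; simpa [hv, ex] using hz) hs
  have hsh : eLpNorm (fun z ↦ w (z + v)) (ℓ s) (muT d T) = eLpNorm w (ℓ s) (muT d T) := by
    have hp := (measurePreserving_add_right (volume : Measure (Pt d)) v).restrict_preimage (measSet_T T)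
    have he : (fun z ↦ z + v) ⁻¹' {z : Pt d | T < z.1} = {z | T < z.1} := by ext z; simp [hv, ex]
    rw [he] at hp
    exact eLpNorm_comp_measurePreserving hw.meas.aestronglyMeasurable hp
  have e : Dx i w = fun z ↦ H⁻¹ * (w (z + v) - w z - (w (z + v) - w z - DD v w z)) := by
    ext z
    rw [Dx_eq hw.1, hv, DD_smul]; field_simp; ring
  have e2 : DD v (DD v w) = fun z ↦ (H * H) * Dxx i i w z := by
    rw [Dxx_eq hw.1, hv, DD_smul, DD_smul, DD_cmul']; ext z; ring
  have c0 : Continuous fun z ↦ w (z + v) := hw.cont.comp (by fun_prop)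
  have c1 : Continuous fun z ↦ w (z + v) - w z - DD v w z := (c0.sub hw.cont).sub (hw.dd v).cont
  rw [e2] at h1
  have cm : ∀ (c : ℝ) (f : 𝔽 d), eLpNorm (fun z ↦ c * f z) (ℓ s) (muT d T) = ℓ |c| * eLpNorm f (ℓ s) (muT d T) := by
    intro c f
    have := eLpNorm_const_smul c f (ℓ s) (muT d T)
    rw [Real.enorm_eq_ofReal_abs] at this
    exact this
  change _ ≤ eLpNorm _ _ (muT d T) at h1
  rw [cm] at h1
  rw [e, cm, abs_of_pos (by positivity)]
  calc _ ≤ ℓ H⁻¹ * ((eLpNorm w (ℓ s) (muT d T) + eLpNorm w (ℓ s) (muT d T)) +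
        ℓ |H * H| * eLpNorm (Dxx i i w) (ℓ s) (muT d T)) := by
        gcongr
        refine (eLpNorm_sub_le (c0.sub hw.cont).aestronglyMeasurable c1.aestronglyMeasurable hs').trans (add_le_add ?_ h1)
        refine (eLpNorm_sub_le c0.aestronglyMeasurable hw.cont.aestronglyMeasurable hs').trans (add_le_add hsh.le le_rfl)
    _ = _ := by
        rw [mul_add, ← two_mul, ← mul_assoc, ← mul_assoc, ← ENNReal.ofReal_mul (by positivity), abs_of_pos (by positivity), inv_mul_cancel_left₀ hH.ne']
        congr 2
        rw [div_eq_inv_mul, ENNReal.ofReal_mul (by positivity)]; simp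

def thet (s : ℝ) : ℝ := 1 - Real.smoothTransition s

lemma thet_sm : ContDiff ℝ (⊤ : ℕ∞) thet := contDiff_const.sub Real.smoothTransition.contDiff

lemma thet_bd : ∃ K : ℝ, 0 < K ∧ ∀ s, |deriv thet s| ≤ K ∧ |deriv (deriv thet) s| ≤ K := by
  have h1 : ContDiff ℝ (⊤ : ℕ∞) (deriv thet) := by
    have := (contDiff_infty_iff_deriv (𝕜 := ℝ)).1 thet_sm
    exact this.2
  have h2 : ContDiff ℝ (⊤ : ℕ∞) (deriv (deriv thet)) := by
    have := (contDiff_infty_iff_deriv (𝕜 := ℝ)).1 h1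
    exact this.2
  have hc : HasCompactSupport (deriv thet) := by
    refine HasCompactSupport.intro (isCompact_Icc (a := (0:ℝ)) (b := 1)) fun s hs ↦ ?_
    rcases not_and_or.1 (show ¬ (0 ≤ s ∧ s ≤ 1) from hs) with h | h
    · have : thet =ᶠ[nhds s] fun _ ↦ 1 := by
        filter_upwards [Iio_mem_nhds (not_le.1 h)] with t ht
        simp [thet, Real.smoothTransition.zero_of_nonpos (le_of_lt ht)]
      rw [this.deriv_eq]; simp
    · have : thet =ᶠ[nhds s] fun _ ↦ 0 := by
        filter_upwards [Ioi_mem_nhds (not_le.1 h)] with t ht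
        simp [thet, Real.smoothTransition.one_of_one_le (le_of_lt ht)]
      rw [this.deriv_eq]; simp
  obtain ⟨K1, hK1⟩ := h1.continuous.bounded_above_of_compact_support hc
  obtain ⟨K2, hK2⟩ := h2.continuous.bounded_above_of_compact_support hc.deriv
  exact ⟨max 1 (max K1 K2), by positivity, fun s ↦ ⟨(hK1 s).trans ((le_max_left _ _).trans (le_max_right _ _)), (hK2 s).trans ((le_max_right _ _).trans (le_max_right _ _))⟩⟩

lemma DD_chain {f : ℝ → ℝ} (hf : ContDiff ℝ (⊤ : ℕ∞) f) {P : 𝔽 d} (hP : Sm P) (v : Pt d) :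
    DD v (fun z ↦ f (P z)) = fun z ↦ deriv f (P z) * DD v P z := by
  ext z
  have h1 := ((hf.differentiable (by simp)).differentiableAt (x := P z)).hasDerivAt.comp_hasFDerivAt z (hP.diff z).hasFDerivAt
  have h2 := h1.fderiv
  simp only [Function.comp_def] at h2
  simp [DD, h2]

lemma DD_coord (v : Pt d) (j : Fin d) : DD v (fun z : Pt d ↦ z.2 j) = fun _ ↦ v.2 j := by
  ext z
  have := ((EuclideanSpace.proj j : Spc d →L[ℝ] ℝ).comp (ContinuousLinearMap.snd ℝ ℝ (Spc d))).hasFDerivAt (x := z)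
  exact congrFun (congrArg DFunLike.coe this.fderiv) v

lemma DD_nsq (v : Pt d) (c : ℝ) : DD v (fun z : Pt d ↦ ‖z.2‖ ^ 2 - c) = fun z ↦ 2 * inner ℝ z.2 v.2 := by
  ext z
  have := ((hasFDerivAt_snd (𝕜 := ℝ) (p := z)).norm_sq).sub_const c
  simp [DD, this.fderiv]

lemma cutoff {A B : ℝ} (hA : 0 < A) : ∃ K : ℝ, 0 < K ∧ ∀ r R, A ≤ r → r < R → R ≤ B → ∃ ζ : Pt d → ℝ, Sm ζ ∧
    (∀ z, 0 ≤ ζ z ∧ ζ z ≤ 1) ∧ (∀ z ∈ QQ r (0 : Pt d), ζ z = 1) ∧ (∀ z, ζ z ≠ 0 → z ∈ QQ R (0 : Pt d)) ∧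
    (∀ z, |Dt ζ z| ≤ K / (R - r) ^ 2) ∧ (∀ i z, |Dx i ζ z| ≤ K / (R - r)) ∧ (∀ i j z, |Dxx i j ζ z| ≤ K / (R - r) ^ 2) := by
  obtain ⟨K, hK0, hK⟩ := thet_bd
  refine ⟨(2 * B ^ 2 * K / A ^ 2 + 2 * B * K / A + (4 * B ^ 2 * K / A ^ 2 + 2 * K)) + 1, ?_, fun r R hr hrR hRB ↦ ?_⟩
  · rcases le_or_gt 0 B with h | h
    · positivity
    · have : 2 * B * K / A + 4 * B ^ 2 * K / A ^ 2 + K= K * ((2 * B / A + 1/2) ^ 2 + 3/4) := by field_simp; ring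
      have h2 : 0 < K * ((2 * B / A + 1/2) ^ 2 + 3/4) := by positivity
      have h3 : 0 ≤ 2 * B ^ 2 * K / A ^ 2 := by positivity
      linarith
  have hr0 : 0 < r := by linarith
  have hR0 : 0 < R := by linarith
  have hB0 : 0 < B := by linarith
  have hD : 0 < R - r := by linarith
  set lam := 1 / (R ^ 2 - r ^ 2) with hlam
  set mu := 1 / (R ^ 4 - r ^ 4) with hmu
  have hl0 : 0 < R ^ 2 - r ^ 2 := by nlinarith
  have hm0 : 0 < R ^ 4 - r ^ 4 := by
    have : R ^ 4 - r ^ 4 = (R ^ 2 - r ^ 2) * (R ^ 2 + r ^ 2) := by ring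
    rw [this]; positivity
  have hlam0 : 0 < lam := by positivity
  have hmu0 : 0 < mu := by positivity
  have hlam1 : lam ≤ 1 / (R - r) / A := by
    rw [hlam, div_div]
    refine one_div_le_one_div_of_le (by positivity) ?_
    nlinarith
  have hlam2 : lam ≤ 1 / (R - r) ^ 2 := one_div_le_one_div_of_le (by positivity) (by nlinarith)
  have hmu1 : mu ≤ 1 / (R - r) ^ 2 / A ^ 2 := by
    rw [hmu, div_div]
    refine one_div_le_one_div_of_le (by positivity) ?_
    have e : R ^ 4 - r ^ 4 = (R ^ 2 - r ^ 2) * (R ^ 2 + r ^ 2) := by ring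
    rw [e]
    exact mul_le_mul (by nlinarith) (by nlinarith) (by positivity) hl0.le
  set P : Pt d → ℝ := fun z ↦ ‖z.2‖ ^ 2 - r ^ 2 with hP
  set Q : Pt d → ℝ := fun z ↦ z.1 ^ 2 - r ^ 4 with hQ
  have hPs : Sm P := (contDiff_snd.norm_sq ℝ).sub contDiff_const
  have hQs : Sm Q := (contDiff_fst.pow 2).sub contDiff_const
  have hf : ∀ c : ℝ, ContDiff ℝ (⊤ : ℕ∞) fun s ↦ thet (c * s) := fun c ↦ thet_sm.comp (contDiff_const.mul contDiff_id)
  have hfd : ∀ c : ℝ, deriv (fun s ↦ thet (c * s)) = fun s ↦ c * deriv thet (c * s) := fun c ↦ by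
    ext s
    have := deriv_comp_mul_left c thet s
    simpa using this
  have hfd1 : ContDiff ℝ (⊤ : ℕ∞) (deriv thet) := ((contDiff_infty_iff_deriv (𝕜 := ℝ)).1 thet_sm).2
  set al : Pt d → ℝ := fun z ↦ thet (lam * P z) with hal
  set be : Pt d → ℝ := fun z ↦ thet (mu * Q z) with hbe
  have hals : Sm al := (hf lam).comp hPs
  have hbes : Sm be := (hf mu).comp hQs
  have th01 : ∀ s, 0 ≤ thet s ∧ thet s ≤ 1 := fun s ↦ by
    have := Real.smoothTransition.nonneg s
    have := Real.smoothTransition.le_one s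
    constructor <;> (simp only [thet]; linarith)
  have bex : ∀ v : Pt d, v.1 = 0 → DD v be = fun _ ↦ 0 := by
    intro v hv
    have h1 : DD v Q = fun _ ↦ 0 := by
      ext z
      have := ((hasFDerivAt_fst (𝕜 := ℝ) (p := z)).pow 2).sub_const (r ^ 4)
      simp [DD, hQ, this.fderiv, hv]
    rw [hbe, DD_chain (hf mu) hQs, h1]; simp
  have bet : DD (et d) be = fun z ↦ mu * deriv thet (mu * Q z) * (2 * z.1) := by
    have h1 : DD (et d) Q = fun z ↦ 2 * z.1 := by
      ext z
      have := ((hasFDerivAt_fst (𝕜 := ℝ) (p := z)).pow 2).sub_const (r ^ 4)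
      simp [DD, hQ, this.fderiv, et]
    rw [hbe, DD_chain (hf mu) hQs, h1, hfd]
  have alv : ∀ v, DD v al = fun z ↦ lam * deriv thet (lam * P z) * (2 * inner ℝ z.2 v.2) := by
    intro v
    rw [hal, DD_chain (hf lam) hPs, hP, DD_nsq, hfd]
  have alt : DD (et d) al = fun _ ↦ 0 := by rw [alv]; simp [et]
  have alx : ∀ j, DD (ex j) al = fun z ↦ lam * (deriv thet (lam * P z) * (2 * z.2 j)) := by
    intro j; rw [alv]; ext z; simp [ex, EuclideanSpace.inner_single_right]; ring
  have g1 : Sm fun z : Pt d ↦ deriv thet (lam * P z) := hfd1.comp (contDiff_const.mul hPs)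
  have cj : ∀ j, Sm fun z : Pt d ↦ z.2 j := fun j ↦ ((EuclideanSpace.proj j : Spc d →L[ℝ] ℝ).comp (ContinuousLinearMap.snd ℝ ℝ (Spc d))).contDiff
  have g2 : ∀ j, Sm fun z : Pt d ↦ 2 * z.2 j := fun j ↦ contDiff_const.mul (cj j)
  have alxx : ∀ i j, DD (ex i) (DD (ex j) al) = fun z ↦ lam * ((lam * deriv (deriv thet) (lam * P z) * (2 * z.2 i)) * (2 * z.2 j) +
      deriv thet (lam * P z) * (2 * (ex i : Pt d).2 j)) := by
    intro i j
    have hx : DD (ex i) (fun z : Pt d ↦ deriv thet (lam * P z)) = fun z ↦ lam * deriv (deriv thet) (lam * P z) * (2 * z.2 i) := by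
      have := DD_chain (hfd1.comp (contDiff_const (c := lam).mul contDiff_id)) hPs (ex i)
      simp only [Function.comp_def, id] at this
      rw [this, hP, DD_nsq]
      ext z
      have h3 := deriv_comp_mul_left lam (deriv thet) (P z)
      simp only [smul_eq_mul] at h3
      rw [← hP, h3]; simp [ex, EuclideanSpace.inner_single_right]
    rw [alx, DD_cmul']
    ext z
    rw [DD_mul _ g1 (g2 j), hx, DD_cmul', DD_coord]
  set ze : Pt d → ℝ := fun z ↦ al z * be z with hze
  have hzes : Sm ze := hals.mul hbes
  have supp : ∀ z, ze z ≠ 0 → z ∈ QQ R (0 : Pt d) := by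
    intro z hz
    have h1 : ‖z.2‖ ^ 2 < R ^ 2 := by
      by_contra hc
      apply hz
      have : al z = 0 := by
        have : 1 ≤ lam * P z := by
          rw [hlam, one_div, inv_mul_eq_div, le_div_iff₀ hl0]; simp only [hP]; linarith [not_lt.1 hc]
        simp [hal, thet, Real.smoothTransition.one_of_one_le this]
      simp [hze, this]
    have h2 : z.1 ^ 2 < R ^ 4 := by
      by_contra hc
      apply hz
      have : be z = 0 := by
        have : 1 ≤ mu * Q z := by
          rw [hmu, one_div, inv_mul_eq_div, le_div_iff₀ hm0]; simp only [hQ]; linarith [not_lt.1 hc]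
        simp [hbe, thet, Real.smoothTransition.one_of_one_le this]
      simp [hze, this]
    rw [mem_QQ]
    refine ⟨?_, ?_⟩
    · simp only [Prod.fst_zero, sub_zero]
      exact abs_lt_of_sq_lt_sq (by nlinarith) (by positivity)
    · simp only [Prod.snd_zero, dist_zero_right]
      exact lt_of_pow_lt_pow_left₀ 2 hR0.le h1
  have hcl : IsClosed (closedBall 0 (B ^ 2) ×ˢ closedBall 0 B : Set (Pt d)) := isClosed_closedBall.prod isClosed_closedBall
  have supB : ∀ z, ze z ≠ 0 → z ∈ (closedBall 0 (B ^ 2) ×ˢ closedBall 0 B : Set (Pt d)) := by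
    intro z hz
    have := mem_QQ.1 (supp z hz)
    simp only [Prod.fst_zero, sub_zero, Prod.snd_zero, dist_zero_right] at this
    refine ⟨?_, by simpa using this.2.le.trans hRB⟩
    rw [mem_closedBall, Real.dist_eq, sub_zero]
    exact this.1.le.trans (by gcongr)
  have b0 : ∀ z, |be z| ≤ 1 := fun z ↦ by rw [abs_of_nonneg (th01 _).1]; exact (th01 _).2
  have a0 : ∀ z, |al z| ≤ 1 := fun z ↦ by rw [abs_of_nonneg (th01 _).1]; exact (th01 _).2
  have hj : ∀ {z : Pt d}, z ∈ (closedBall 0 (B ^ 2) ×ˢ closedBall 0 B : Set (Pt d)) → ∀ j, |z.2 j| ≤ B := fun hz j ↦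
    (PiLp.norm_apply_le _ j).trans (by simpa using hz.2)
  refine ⟨ze, hzes, fun z ↦ ⟨mul_nonneg (th01 _).1 (th01 _).1, mul_le_one₀ (th01 _).2 (th01 _).1 (th01 _).2⟩, ?_, supp, ?_, ?_, ?_⟩
  · intro z hz
    have := mem_QQ.1 hz
    simp only [Prod.fst_zero, sub_zero, Prod.snd_zero, dist_zero_right] at this
    have h1 : lam * P z ≤ 0 := mul_nonpos_of_nonneg_of_nonpos hlam0.le (by simp only [hP]; nlinarith [norm_nonneg z.2])
    have h2 : mu * Q z ≤ 0 := mul_nonpos_of_nonneg_of_nonpos hmu0.le (by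
      simp only [hQ]; nlinarith [abs_nonneg z.1, sq_abs z.1])
    simp [hze, hal, hbe, thet, Real.smoothTransition.zero_of_nonpos h1, Real.smoothTransition.zero_of_nonpos h2]
  · intro z
    rw [Dt_eq hzes]
    by_cases hz : DD (et d) ze z = 0
    · rw [hz, abs_zero]; positivity
    have hzb := DD_supp_sub hcl supB _ z hz
    have h1 : |z.1| ≤ B ^ 2 := by have := hzb.1; rwa [mem_closedBall, Real.dist_eq, sub_zero] at this
    rw [hze, DD_mul _ hals hbes, alt, bet]
    simp only [zero_mul, zero_add, add_zero, mul_zero]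
    calc _ = |al z| * (mu * |deriv thet (mu * Q z)| * (2 * |z.1|)) := by simp [abs_mul, abs_of_pos hmu0]
      _ ≤ 1 * ((1 / (R - r) ^ 2 / A ^ 2) * K * (2 * B ^ 2)) := by
        gcongr
        · exact a0 z
        · exact (hK _).1
      _ = (2 * B ^ 2 * K / A ^ 2) / (R - r) ^ 2 := by ring
      _ ≤ _ := by
        refine div_le_div_of_nonneg_right ?_ (by positivity)
        have : 0 ≤ 2 * B * K / A + (4 * B ^ 2 * K / A ^ 2 + 2 * K) := by positivity
        linarith
  · intro i z
    rw [Dx_eq hzes]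
    by_cases hz : DD (ex i) ze z = 0
    · rw [hz, abs_zero]; positivity
    have hzb := DD_supp_sub hcl supB _ z hz
    rw [hze, DD_mul _ hals hbes, bex _ (by simp [ex]), alx]
    simp only [zero_mul, zero_add, add_zero, mul_zero]
    calc _ = lam * (|deriv thet (lam * P z)| * (2 * |z.2 i|)) * |be z| := by simp [abs_mul, abs_of_pos hlam0]
      _ ≤ (1 / (R - r) / A) * (K * (2 * B)) * 1 := by
        gcongr
        · exact (hK _).1
        · exact hj hzb i
        · exact b0 z
      _ = (2 * B * K / A) / (R - r) := by ring
      _ ≤ _ := by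
        refine div_le_div_of_nonneg_right ?_ (by positivity)
        have : 0 ≤ 2 * B ^ 2 * K / A ^ 2 + (4 * B ^ 2 * K / A ^ 2 + 2 * K) := by positivity
        linarith
  · intro i j z
    rw [Dxx_eq hzes]
    by_cases hz : DD (ex i) (DD (ex j) ze) z = 0
    · rw [hz, abs_zero]; positivity
    have hzb := DD_supp_sub hcl (DD_supp_sub hcl supB (ex j)) _ z hz
    have e1 : DD (ex j) ze = fun z ↦ DD (ex j) al z * be z := by
      ext z; rw [hze, DD_mul _ hals hbes, bex _ (by simp [ex])]; simp
    rw [e1, DD_mul _ (hals.dd _) hbes, bex _ (by simp [ex]), alxx]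
    simp only [zero_mul, zero_add, add_zero, mul_zero]
    have e01 : |(ex i : Pt d).2 j| ≤ 1 := by
      refine (PiLp.norm_apply_le (EuclideanSpace.single i (1:ℝ)) j).trans ?_
      rw [EuclideanSpace.norm_single]; simp
    have hll : lam * lam ≤ 1 / (R - r) ^ 2 / A ^ 2 := by
      calc lam * lam ≤ (1 / (R - r) / A) * (1 / (R - r) / A) := by gcongr
        _ = _ := by field_simp
    calc _ = |(lam * lam) * (deriv (deriv thet) (lam * P z) * (2 * z.2 i) * (2 * z.2 j)) + lam * (deriv thet (lam * P z) * (2 * (ex i : Pt d).2 j))| * |be z| := by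
          rw [← abs_mul]; congr 1; ring
      _ ≤ (|(lam * lam) * (deriv (deriv thet) (lam * P z) * (2 * z.2 i) * (2 * z.2 j))| + |lam * (deriv thet (lam * P z) * (2 * (ex i : Pt d).2 j))|) * |be z| := by
          gcongr; exact abs_add_le _ _
      _ = ((lam * lam) * (|deriv (deriv thet) (lam * P z)| * (2 * |z.2 i|) * (2 * |z.2 j|)) + lam * (|deriv thet (lam * P z)| * (2 * |(ex i : Pt d).2 j|))) * |be z| := by
          simp [abs_mul, abs_of_pos hlam0]
      _ ≤ ((1 / (R - r) ^ 2 / A ^ 2) * (K * (2 * B) * (2 * B)) + 1 / (R - r) ^ 2 * (K * (2 * 1))) * 1 := by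
        gcongr
        · exact (hK _).2
        · exact hj hzb i
        · exact hj hzb j
        · exact (hK _).1
        · exact b0 z
      _ = (4 * B ^ 2 * K / A ^ 2 + 2 * K) / (R - r) ^ 2 := by ring
      _ ≤ _ := by
        refine div_le_div_of_nonneg_right ?_ (by positivity)
        have : 0 ≤ 2 * B ^ 2 * K / A ^ 2 + 2 * B * K / A := by positivity
        linarith

lemma iter_E {E : ℕ → ℝ≥0∞} {b m : ℝ≥0∞} (hm : m ≠ ⊤) (h1 : ∀ k, E k ≤ b * 4 ^ k + 8⁻¹ * E (k + 1)) (h2 : ∀ k, E k ≤ m * 4 ^ k) :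
    E 0 ≤ 2 * b := by
  rcases eq_or_ne b ⊤ with hb | hb
  · simp [hb]
  have hE : ∀ k, E k ≠ ⊤ := fun k ↦ ne_top_of_le_ne_top (by finiteness) (h2 k)
  lift E to ℕ → ℝ≥0 using hE
  lift b to ℝ≥0 using hb
  lift m to ℝ≥0 using hm
  have g1 : ∀ k, (E k : ℝ) ≤ b * 4 ^ k + 8⁻¹ * E (k + 1) := fun k ↦ by
    have := h1 k
    beta_reduce at this
    rw [show (8⁻¹ : ℝ≥0∞) = ((8⁻¹ : ℝ≥0) : ℝ≥0∞) by rw [ENNReal.coe_inv (by norm_num)]; rfl, show (4:ℝ≥0∞) = ((4:ℝ≥0) : ℝ≥0∞) by rfl] at this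
    exact_mod_cast this
  have g2 : ∀ k, (E k : ℝ) ≤ m * 4 ^ k := fun k ↦ by
    have := h2 k
    beta_reduce at this
    rw [show (4:ℝ≥0∞) = ((4:ℝ≥0) : ℝ≥0∞) by rfl] at this
    exact_mod_cast this
  have g3 : ∀ n k : ℕ, (E k : ℝ) ≤ (2 * b + m * (1 / 2) ^ n) * 4 ^ k := by
    intro n
    induction n with
    | zero => intro k; refine (g2 k).trans ?_; gcongr; simp
    | succ n ih =>
      intro k
      have := ih (k + 1)
      refine (g1 k).trans ?_
      rw [pow_succ] at this ⊢
      nlinarith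
  have g4 : (E 0 : ℝ) ≤ 2 * b := by
    have ht : Filter.Tendsto (fun n : ℕ ↦ 2 * (b:ℝ) + m * (1 / 2) ^ n) Filter.atTop (nhds (2 * b + m * 0)) :=
      ((tendsto_pow_atTop_nhds_zero_of_lt_one (by norm_num) (by norm_num)).const_mul _).const_add _
    rw [mul_zero, add_zero] at ht
    exact ge_of_tendsto' ht fun n ↦ by simpa using g3 n 0
  beta_reduce
  rw [show (2:ℝ≥0∞) = ((2:ℝ≥0) : ℝ≥0∞) by rfl]
  exact_mod_cast g4

lemma eLp_cmul (c : ℝ) (f : 𝔽 d) (p : ℝ≥0∞) (μ : Measure (Pt d)) :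
    eLpNorm (fun z ↦ c * f z) p μ = ℓ |c| * eLpNorm f p μ := by
  have := eLpNorm_const_smul c f p μ
  rw [Real.enorm_eq_ofReal_abs] at this
  exact this

lemma LOC_pt {δ : ℝ} (hδ : 0 < δ) {K : ℝ} (hK : 0 < K) {a : 𝔸 d} (ham : Measurable a) (ha : ∀ z, inS d δ (a z))
    {B M T s : ℝ} (hs : 1 ≤ s) (hM : 0 < M) {V ζ : 𝔽 d} (hV : CinfC V) (hζ : Sm ζ) (h01 : ∀ z, 0 ≤ ζ z ∧ ζ z ≤ 1)
    (hsup : ∀ z, z ∉ QQ B (0 : Pt d) → ζ z = 0 ∧ Dt ζ z = 0 ∧ (∀ i j, Dxx i j ζ z = 0))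
    (hDt : ∀ z, |Dt ζ z| ≤ K * M ^ 2) (hDx : ∀ i z, |Dx i ζ z| ≤ K * M) (hDxx : ∀ i j z, |Dxx i j ζ z| ≤ K * M ^ 2)
    {G : Fin d → Pt d → ℝ} (hG : ∀ i, CinfC (G i)) (hGV : ∀ i j z, Dx j ζ z ≠ 0 → Dx i V z = G i z) :
    eLpNorm (Lop a (fun z ↦ V z * ζ z)) (ℓ s) (muT d T) ≤
      eLpNorm (Lop a V) (ℓ s) ((muT d T).restrict (QQ B 0)) +
      ℓ (K * (1 + d ^ 2 * δ⁻¹) * M ^ 2) * eLpNorm V (ℓ s) ((muT d T).restrict (QQ B 0)) +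
      ℓ (2 * d * δ⁻¹ * K * M) * ∑ i, eLpNorm (G i) (ℓ s) (muT d T) := by
  have hs' : (1:ℝ≥0∞) ≤ ℓ s := by simpa using hs
  set c1 := K * (1 + d ^ 2 * δ⁻¹) * M ^ 2 with hc1
  set c2 := 2 * d * δ⁻¹ * K * M with hc2
  have hc10 : 0 ≤ c1 := by positivity
  have hc20 : 0 ≤ c2 := by positivity
  set f1 : Pt d → ℝ := (QQ B (0 : Pt d)).indicator (Lop a V) with hf1
  set f2 : Pt d → ℝ := (QQ B (0 : Pt d)).indicator V with hf2
  have m1 : Measurable f1 := (Lop_meas ham hV).indicator (QQ_meas _ _)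
  have m2 : Measurable f2 := hV.meas.indicator (QQ_meas _ _)
  have mG : Continuous fun z ↦ ∑ i, |G i z| := continuous_finsetSum _ fun i _ ↦ (hG i).cont.abs
  have hab : ∀ z i j, |a z i j| ≤ δ⁻¹ := fun z i j ↦ (ha z).bound hδ i j
  have pt : ∀ z, ‖Lop a (fun z ↦ V z * ζ z) z‖ ≤ ‖|f1 z| + c1 * |f2 z| + c2 * ∑ i, |G i z|‖ := by
    intro z
    rw [Lop_mul ha hV.1 hζ, Real.norm_eq_abs]
    refine le_trans ?_ (le_abs_self _)
    refine (abs_add_le _ _).trans (add_le_add ((abs_add_le _ _).trans (add_le_add ?_ ?_)) ?_)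
    · by_cases hz : z ∈ QQ B (0 : Pt d)
      · rw [hf1, indicator_of_mem hz, abs_mul, abs_of_nonneg (h01 z).1]
        exact mul_le_of_le_one_right (abs_nonneg _) (h01 z).2
      · simp [(hsup z hz).1]
    · by_cases hz : z ∈ QQ B (0 : Pt d)
      · rw [hf2, indicator_of_mem hz, abs_mul, mul_comm]
        refine mul_le_mul_of_nonneg_right ?_ (abs_nonneg _)
        unfold Lop
        calc _ ≤ |Dt ζ z| + ∑ i, ∑ j, |a z i j * Dxx i j ζ z| := by
              refine (abs_add_le _ _).trans (add_le_add le_rfl ((Finset.abs_sum_le_sum_abs _ _).trans (Finset.sum_le_sum fun i _ ↦ Finset.abs_sum_le_sum_abs _ _)))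
          _ ≤ K * M ^ 2 + ∑ i : Fin d, ∑ j : Fin d, δ⁻¹ * (K * M ^ 2) := by
              refine add_le_add (hDt z) (Finset.sum_le_sum fun i _ ↦ Finset.sum_le_sum fun j _ ↦ ?_)
              rw [abs_mul]
              exact mul_le_mul (hab z i j) (hDxx i j z) (abs_nonneg _) (by positivity)
          _ = _ := by simp [hc1]; ring
      · have h := hsup z hz
        simp only [Lop, h.2.1, h.2.2, mul_zero, Finset.sum_const_zero, add_zero, abs_zero]; positivity
    · rw [abs_mul, abs_two]
      calc _ ≤ 2 * ∑ i, ∑ j, |a z i j * (Dx i V z * Dx j ζ z)| := by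
            gcongr
            exact (Finset.abs_sum_le_sum_abs _ _).trans (Finset.sum_le_sum fun i _ ↦ Finset.abs_sum_le_sum_abs _ _)
        _ ≤ 2 * ∑ i : Fin d, ∑ j : Fin d, δ⁻¹ * |G i z| * (K * M) := by
            gcongr with i _ j _
            by_cases h0 : Dx j ζ z = 0
            · rw [h0, mul_zero, mul_zero, abs_zero]; positivity
            rw [hGV i j z h0, ← mul_assoc, abs_mul, abs_mul]
            gcongr
            · exact hab z i j
            · exact hDx j z
        _ = _ := by
            simp only [Finset.sum_const, Finset.card_univ, Fintype.card_fin, nsmul_eq_mul, hc2, Finset.mul_sum]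
            refine Finset.sum_congr rfl fun i _ ↦ by ring
  refine (eLpNorm_mono pt).trans ?_
  have n1 : eLpNorm (fun z ↦ |f1 z|) (ℓ s) (muT d T) = eLpNorm (Lop a V) (ℓ s) ((muT d T).restrict (QQ B 0)) := by
    rw [← eLpNorm_indicator_eq_eLpNorm_restrict (QQ_meas _ _)]; exact eLpNorm_norm f1
  have n2 : eLpNorm (fun z ↦ |f2 z|) (ℓ s) (muT d T) = eLpNorm V (ℓ s) ((muT d T).restrict (QQ B 0)) := by
    rw [← eLpNorm_indicator_eq_eLpNorm_restrict (QQ_meas _ _)]; exact eLpNorm_norm f2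
  refine (eLpNorm_add_le (f := fun z ↦ |f1 z| + c1 * |f2 z|) (g := fun z ↦ c2 * ∑ i, |G i z|) (m1.abs.add (m2.abs.const_mul c1)).aestronglyMeasurable
    (mG.const_mul c2).aestronglyMeasurable hs').trans (add_le_add ?_ ?_)
  · refine (eLpNorm_add_le (f := fun z ↦ |f1 z|) (g := fun z ↦ c1 * |f2 z|) m1.abs.aestronglyMeasurable (m2.abs.const_mul c1).aestronglyMeasurable hs').trans (add_le_add n1.le ?_)
    rw [eLp_cmul, n2, abs_of_nonneg hc10]
  · rw [eLp_cmul, abs_of_nonneg hc20]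
    gcongr
    have : (fun z ↦ ∑ i, |G i z|) = ∑ i, fun z ↦ |G i z| := by ext z; simp
    rw [this]
    refine (eLpNorm_sum_le (fun i _ ↦ (hG i).cont.abs.aestronglyMeasurable) hs').trans (Finset.sum_le_sum fun i _ ↦ ?_)
    exact (eLpNorm_norm (G i)).le

lemma QQ_closed_sub {R R' : ℝ} (h0 : 0 ≤ R) (h : R < R') : (closedBall 0 (R ^ 2) ×ˢ closedBall 0 R : Set (Pt d)) ⊆ QQ R' 0 := by
  rintro z ⟨h1, h2⟩
  rw [mem_closedBall, Real.dist_eq, sub_zero] at h1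
  rw [mem_closedBall, dist_zero_right] at h2
  rw [mem_QQ]
  exact ⟨by simpa using lt_of_le_of_lt h1 (by nlinarith), by simpa using h2.trans_lt h⟩

lemma QQ_sub_closed {R : ℝ} {z : Pt d} (h : z ∈ QQ R (0 : Pt d)) : z ∈ (closedBall 0 (R ^ 2) ×ˢ closedBall 0 R : Set (Pt d)) := by
  have := mem_QQ.1 h
  simp only [Prod.fst_zero, sub_zero, Prod.snd_zero, dist_zero_right] at this
  exact ⟨by rw [mem_closedBall, Real.dist_eq, sub_zero]; exact this.1.le, by simpa using this.2.le⟩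

lemma box_closed (R : ℝ) : IsClosed (closedBall 0 (R ^ 2) ×ˢ closedBall 0 R : Set (Pt d)) := isClosed_closedBall.prod isClosed_closedBall

lemma DD_congr_open {u v : 𝔽 d} {S : Set (Pt d)} (hS : IsOpen S) (h : ∀ z ∈ S, u z = v z) (w : Pt d) {z : Pt d} (hz : z ∈ S) : DD w u z = DD w v z := by
  have : u =ᶠ[nhds z] v := by filter_upwards [hS.mem_nhds hz] with y hy using h y hy
  simp [DD, this.fderiv_eq]

theorem LOC (hd : 1 ≤ d) {δ : ℝ} (hδ : 0 < δ) {s : ℝ} (hs : 1 ≤ s) (N : ℝ≥0) {A B : ℝ} (hA : 0 < A) (hAB : A < B) :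
    ∃ C : ℝ≥0, ∀ a : Pt d → 𝕄 d, Measurable a → (∀ z, inS d δ (a z)) → AP s a N → ∀ (T : ℝ) (V : 𝔽 d), CinfC V →
      eLpNorm V (ℓ ((d + 1) / d * s)) ((muT d T).restrict (QQ A 0)) ≤
        C * (eLpNorm V (ℓ s) ((muT d T).restrict (QQ B 0)) + eLpNorm (Lop a V) (ℓ s) ((muT d T).restrict (QQ B 0))) := by
  have hs' : (1:ℝ≥0∞) ≤ ℓ s := by simpa using hs
  have hd0 : (0:ℝ) < d := by exact_mod_cast hd
  obtain ⟨K, hK, hcut⟩ := cutoff (d := d) (A := A) (B := B) hA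
  obtain ⟨C1, hC1⟩ := Sob hd hs B
  set ρ : ℕ → ℝ := fun k ↦ B - (B - A) * (1 / 2) ^ k with hρ
  set M : ℕ → ℝ := fun k ↦ 4 * 2 ^ k / (B - A) with hMdef
  have hBA : 0 < B - A := by linarith
  have hM0 : ∀ k, 0 < M k := fun k ↦ by positivity
  have hp : ∀ k : ℕ, (0:ℝ) < (1 / 2) ^ k ∧ ((1:ℝ) / 2) ^ k ≤ 1 := fun k ↦ ⟨by positivity, pow_le_one₀ (by norm_num) (by norm_num)⟩
  have hρ1 : ∀ k, ρ (k + 1) - ρ k = (B - A) * (1 / 2) ^ k / 2 := fun k ↦ by simp only [hρ, pow_succ]; ring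
  have hρA : ∀ k, A ≤ ρ k := fun k ↦ by simp only [hρ]; nlinarith [hp k]
  have hρB : ∀ k, ρ k < B := fun k ↦ by simp only [hρ]; nlinarith [hp k]
  have hρlt : ∀ k, ρ k < ρ (k + 1) := fun k ↦ by have := hρ1 k; nlinarith [hp k]
  have hgap : ∀ k, 1 / ((ρ k + ρ (k + 1)) / 2 - ρ k) = M k := fun k ↦ by
    have : (ρ k + ρ (k + 1)) / 2 - ρ k = (B - A) * (1 / 2) ^ k / 4 := by have := hρ1 k; linarith
    rw [this, hMdef]
    simp only [one_div, inv_pow]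
    field_simp
  have hex : ∀ k, ∃ ζ : Pt d → ℝ, Sm ζ ∧ (∀ z, 0 ≤ ζ z ∧ ζ z ≤ 1) ∧ (∀ z ∈ QQ (ρ k) (0 : Pt d), ζ z = 1) ∧
      (∀ z, ζ z ≠ 0 → z ∈ QQ ((ρ k + ρ (k + 1)) / 2) (0 : Pt d)) ∧ (∀ z, |Dt ζ z| ≤ K * M k ^ 2) ∧
      (∀ i z, |Dx i ζ z| ≤ K * M k) ∧ (∀ i j z, |Dxx i j ζ z| ≤ K * M k ^ 2) := by
    intro k
    obtain ⟨ζ, h1, h2, h3, h4, h5, h6, h7⟩ := hcut (ρ k) ((ρ k + ρ (k + 1)) / 2) (hρA k) (by linarith [hρlt k]) (by linarith [hρB k, hρB (k+1)])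
    refine ⟨ζ, h1, h2, h3, h4, fun z ↦ (h5 z).trans (le_of_eq ?_), fun i z ↦ (h6 i z).trans (le_of_eq ?_), fun i j z ↦ (h7 i j z).trans (le_of_eq ?_)⟩ <;>
    · rw [← hgap k]; simp only [one_div, div_eq_mul_inv, inv_pow, one_mul]
  choose ζ z1 z2 z3 z4 z5 z6 z7 using hex
  have hin : ∀ k {z}, z ∈ (closedBall 0 (((ρ k + ρ (k + 1)) / 2) ^ 2) ×ˢ closedBall 0 ((ρ k + ρ (k + 1)) / 2) : Set (Pt d)) → z ∈ QQ (ρ (k+1)) (0 : Pt d) :=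
    fun k z hz ↦ QQ_closed_sub (by linarith [hρA k, hρA (k+1)]) (by linarith [hρlt k]) hz
  have hcb := fun k ↦ box_closed (d := d) ((ρ k + ρ (k + 1)) / 2)
  have hs0 : ∀ k z, ζ k z ≠ 0 → z ∈ QQ (ρ (k+1)) (0 : Pt d) := fun k z hz ↦ hin k (QQ_sub_closed (z4 k z hz))
  have hsd : ∀ k v z, DD v (ζ k) z ≠ 0 → z ∈ QQ (ρ (k+1)) (0 : Pt d) := fun k v z hz ↦
    hin k (DD_supp_sub (hcb k) (fun z hz ↦ QQ_sub_closed (z4 k z hz)) v z hz)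
  have hsdd : ∀ k v v' z, DD v (DD v' (ζ k)) z ≠ 0 → z ∈ QQ (ρ (k+1)) (0 : Pt d) := fun k v v' z hz ↦
    hin k (DD_supp_sub (hcb k) (DD_supp_sub (hcb k) (fun z hz ↦ QQ_sub_closed (z4 k z hz)) v') v z hz)
  have hQsub : ∀ k, QQ (ρ k) (0 : Pt d) ⊆ QQ B 0 := fun k ↦ QQ_mono (by linarith [hρA k]) (hρB k).le 0
  have hsup : ∀ k z, z ∉ QQ B (0 : Pt d) → ζ k z = 0 ∧ Dt (ζ k) z = 0 ∧ (∀ i j, Dxx i j (ζ k) z = 0) := by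
    intro k z hz
    have hz' : z ∉ QQ (ρ (k+1)) (0 : Pt d) := fun h ↦ hz (hQsub _ h)
    refine ⟨?_, ?_, fun i j ↦ ?_⟩
    · by_contra h; exact hz' (hs0 k z h)
    · rw [Dt_eq (z1 k)]; by_contra h; exact hz' (hsd k _ z h)
    · rw [Dxx_eq (z1 k)]; by_contra h; exact hz' (hsdd k _ _ z h)
  set c1 := K * (1 + d ^ 2 * δ⁻¹) with hc1
  set c2 := 2 * d * δ⁻¹ * K with hc2
  have hc10 : 0 < c1 := by positivity
  have hc20 : 0 < c2 := by positivity
  set c3 : ℝ := (1 + c1 + c2 * (16 * c2 * d * (N + 1)) * d) * (1 + (4 / (B - A)) ^ 2) with hc3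
  have hc30 : 0 < c3 := by positivity
  have hN0 : (0:ℝ) ≤ N := N.2
  refine ⟨C1 * (((1 + d ^ 2 * δ⁻¹ * N) * (2 * c3) + d * (2 + N * (2 * c3))).toNNReal), fun a ham ha hAP T V hV ↦ ?_⟩
  set ν := (muT d T).restrict (QQ B 0) with hν
  set X1 := eLpNorm V (ℓ s) ν with hX1
  set X2 := eLpNorm (Lop a V) (ℓ s) ν with hX2
  have hVζ : ∀ k, CinfC fun z ↦ V z * ζ k z := fun k ↦ hV.mul_sm (z1 k)
  set E : ℕ → ℝ≥0∞ := fun k ↦ eLpNorm (Lop a fun z ↦ V z * ζ k z) (ℓ s) (muT d T) with hE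
  have hVn : ∀ k, eLpNorm (fun z ↦ V z * ζ k z) (ℓ s) (muT d T) ≤ X1 := by
    intro k
    rw [hX1, hν, ← eLpNorm_indicator_eq_eLpNorm_restrict (QQ_meas _ _)]
    refine eLpNorm_mono fun z ↦ ?_
    by_cases hz : z ∈ QQ B (0 : Pt d)
    · rw [indicator_of_mem hz, norm_mul, Real.norm_eq_abs (ζ k z), abs_of_nonneg (z2 k z).1]
      exact mul_le_of_le_one_right (norm_nonneg _) (z2 k z).2
    · simp [(hsup k z hz).1]
  have hM4 : ∀ k, M k ^ 2 = (4 / (B - A)) ^ 2 * 4 ^ k := fun k ↦ by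
    simp only [hMdef]; rw [show (4:ℝ) ^ k = (2 ^ k) ^ 2 by rw [← pow_mul, mul_comm, pow_mul]; norm_num]; ring
  have h4k : ∀ k : ℕ, (1:ℝ) ≤ 4 ^ k := fun k ↦ one_le_pow₀ (by norm_num)
  have step : ∀ k, E k ≤ ℓ c3 * (X1 + X2) * 4 ^ k + 8⁻¹ * E (k + 1) := by
    intro k
    have hM := hM0 k
    have h1 := LOC_pt (T := T) (B := B) hδ hK ham ha hs (hM0 k) hV (z1 k) (z2 k) (hsup k) (z5 k) (z6 k) (z7 k)
      (G := fun i ↦ Dx i fun z ↦ V z * ζ (k+1) z) (fun i ↦ (hVζ (k+1)).dx i) (by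
        intro i j z hz
        rw [Dx_eq (z1 k)] at hz
        rw [Dx_eq hV.1, Dx_eq (hVζ _).1]
        exact DD_congr_open (QQ_open _ _) (fun y hy ↦ by rw [z3 (k+1) y hy, mul_one]) _ (hsd k _ z hz))
    set H : ℝ := 1 / (8 * c2 * M k * d * (N + 1)) with hH
    have hH0 : 0 < H := by positivity
    have h2 : ∀ i : Fin d, eLpNorm (Dx i fun z ↦ V z * ζ (k+1) z) (ℓ s) (muT d T) ≤ ℓ (2 / H) * X1 + ℓ H * (N * E (k+1)) := by
      intro i
      refine (interp (hVζ (k+1)) i hH0 T hs).trans ?_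
      gcongr
      · exact hVn _
      · exact hAP T _ (hVζ (k+1)) i i
    have r1 : c1 * M k ^ 2 + c2 * M k * (d * (2 / H)) ≤ c3 * 4 ^ k := by
      have e1 : c2 * M k * (d * (2 / H)) = c2 * (16 * c2 * d * (N + 1)) * d * M k ^ 2 := by rw [hH]; field_simp; ring
      rw [e1, hM4, hc3]
      have : 0 ≤ c2 * (16 * c2 * d * (N + 1)) * d := by positivity
      generalize c2 * (16 * c2 * d * (N + 1)) * d = y at *
      have h5 := h4k k
      have : 0 ≤ (4 / (B - A)) ^ 2 := by positivity
      generalize (4 / (B - A)) ^ 2 = x at *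
      generalize (4:ℝ) ^ k = q at *
      have : 0 ≤ q := by linarith
      have e : (1 + c1 + y) * (1 + x) * q - (c1 * (x * q) + y * (x * q)) = q + x * q + c1 * q + y * q := by ring
      have : 0 ≤ q + x * q + c1 * q + y * q := by positivity
      linarith
    have r2 : c2 * M k * (d * (H * N)) ≤ 8⁻¹ := by
      have e1 : c2 * M k * (d * (H * N)) = 8⁻¹ * (N / (N + 1)) := by rw [hH]; field_simp
      rw [e1]
      exact mul_le_of_le_one_right (by norm_num) ((div_le_one (by positivity)).2 (by linarith))
    have r3 : 1 ≤ c3 * 4 ^ k := by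
      have : 1 ≤ c3 := by
        rw [hc3]
        exact one_le_mul_of_one_le_of_one_le (by have : 0 ≤ c2 * (16 * c2 * d * (N + 1)) * d := by positivity
                                                 linarith) (by have := sq_nonneg (4 / (B - A)); linarith)
      exact one_le_mul_of_one_le_of_one_le this (h4k k)
    calc E k ≤ X2 + ℓ (c1 * M k ^ 2) * X1 + ℓ (c2 * M k) * ∑ i : Fin d, (ℓ (2 / H) * X1 + ℓ H * (N * E (k+1))) := by
          refine h1.trans ?_
          gcongr with i
          exact h2 i
      _ = X2 + ℓ (c1 * M k ^ 2 + c2 * M k * (d * (2 / H))) * X1 + ℓ (c2 * M k * (d * (H * N))) * E (k+1) := by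
          rw [ENNReal.ofReal_add (by positivity) (by positivity), ENNReal.ofReal_mul (p := c2 * M k) (by positivity), ENNReal.ofReal_mul (p := c2 * M k) (by positivity), ENNReal.ofReal_mul (p := (d:ℝ)) (by positivity),
            ENNReal.ofReal_mul (p := (d:ℝ)) (by positivity), ENNReal.ofReal_mul (p := H) (by positivity), ENNReal.ofReal_coe_nnreal, ENNReal.ofReal_natCast]
          simp only [Finset.sum_const, Finset.card_univ, Fintype.card_fin, nsmul_eq_mul]
          ring
      _ ≤ ℓ (c3 * 4 ^ k) * X2 + ℓ (c3 * 4 ^ k) * X1 + ℓ 8⁻¹ * E (k+1) := by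
          gcongr
          exact le_mul_of_one_le_left (zero_le) (by simpa using r3)
      _ = _ := by
          rw [ENNReal.ofReal_mul hc30.le, ENNReal.ofReal_pow (by norm_num), ENNReal.ofReal_inv_of_pos (by norm_num)]
          simp only [ENNReal.ofReal_ofNat]
          ring
  have hfin : ∀ {f : 𝔽 d}, BC f → eLpNorm f (ℓ s) (muT d T) ≠ ⊤ := fun hf ↦
    ne_top_of_le_ne_top (hf.memLp _).2.ne (eLpNorm_mono_measure _ (muT_le T))
  have hνle : ν ≤ muT d T := Measure.restrict_le_self
  have apr : ∃ m : ℝ≥0∞, m ≠ ⊤ ∧ ∀ k, E k ≤ m * 4 ^ k := by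
    refine ⟨X2 + ℓ (c1 * (4 / (B - A)) ^ 2) * X1 + ℓ (c2 * (4 / (B - A))) * ∑ i, eLpNorm (Dx i V) (ℓ s) (muT d T), ?_, fun k ↦ ?_⟩
    · have f1 : X1 ≠ ⊤ := ne_top_of_le_ne_top (hfin hV.bc) (eLpNorm_mono_measure _ hνle)
      have f2 : X2 ≠ ⊤ := ne_top_of_le_ne_top (hfin (Lop_BC hδ ham ha hV)) (eLpNorm_mono_measure _ hνle)
      have f3 : ∑ i, eLpNorm (Dx i V) (ℓ s) (muT d T) ≠ ⊤ := ENNReal.sum_ne_top.2 fun i _ ↦ hfin (hV.dx i).bc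
      finiteness
    · have h1 := LOC_pt (T := T) (B := B) hδ hK ham ha hs (hM0 k) hV (z1 k) (z2 k) (hsup k) (z5 k) (z6 k) (z7 k)
        (G := fun i ↦ Dx i V) (fun i ↦ hV.dx i) (fun i j z _ ↦ rfl)
      refine h1.trans ?_
      have e4 : (4:ℝ≥0∞) ^ k = ℓ (4 ^ k) := by rw [ENNReal.ofReal_pow (by norm_num)]; simp
      have e5 : (1:ℝ≥0∞) ≤ ℓ (4 ^ k) := ENNReal.one_le_ofReal.2 (h4k k)
      rw [e4, add_mul, add_mul]
      refine add_le_add (add_le_add (le_mul_of_one_le_right zero_le e5) ?_) ?_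
      · rw [mul_right_comm (ℓ (c1 * (4/(B-A))^2)) X1, ← ENNReal.ofReal_mul (by positivity), mul_assoc c1, ← hM4]
      · rw [mul_right_comm (ℓ (c2 * (4/(B-A)))) (∑ i, _), ← ENNReal.ofReal_mul (by positivity)]
        gcongr ℓ ?_ * _
        rw [mul_assoc c2]
        refine mul_le_mul_of_nonneg_left ?_ hc20.le
        simp only [hMdef]
        rw [mul_div_right_comm]
        gcongr
        norm_num
  obtain ⟨m, hm, hEm⟩ := apr
  have hE0 : E 0 ≤ 2 * (ℓ c3 * (X1 + X2)) := iter_E hm step hEm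
  have hE0' : E 0 ≤ ℓ (2 * c3) * (X1 + X2) := by
    rw [ENNReal.ofReal_mul (by norm_num), mul_assoc]; simpa using hE0
  set w : Pt d → ℝ := fun z ↦ V z * ζ 0 z with hw
  have hwC : CinfC w := hVζ 0
  have hwxx : ∀ i j, eLpNorm (Dxx i j w) (ℓ s) (muT d T) ≤ N * E 0 := fun i j ↦ hAP T w hwC i j
  have hρ0 : ρ 0 = A := by simp [hρ]
  have f1 : eLpNorm V (ℓ ((d + 1) / d * s)) ((muT d T).restrict (QQ A 0)) ≤ eLpNorm w (ℓ ((d + 1) / d * s)) (muT d T) := by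
    rw [← eLpNorm_indicator_eq_eLpNorm_restrict (QQ_meas _ _)]
    refine eLpNorm_mono fun z ↦ ?_
    by_cases hz : z ∈ QQ A (0 : Pt d)
    · rw [indicator_of_mem hz, hw]; simp only; rw [z3 0 z (by rwa [hρ0]), mul_one]
    · rw [indicator_of_notMem hz]; simp
  have f2 := hC1 T w hwC (fun z hz ↦ hQsub 1 (hs0 0 z fun h ↦ hz (by simp [hw, h])))
  have f3 : eLpNorm (Dt w) (ℓ s) (muT d T) ≤ ℓ (1 + d ^ 2 * δ⁻¹ * N) * E 0 := by
    have e : Dt w = fun z ↦ Lop a w z - ∑ p : Fin d × Fin d, a z p.1 p.2 * Dxx p.1 p.2 w z := by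
      ext z; simp [Lop, Fintype.sum_prod_type]
    have me : ∀ p : Fin d × Fin d, AEStronglyMeasurable (fun z ↦ a z p.1 p.2 * Dxx p.1 p.2 w z) (muT d T) := fun p ↦
      ((meas_entry ham p.1 p.2).mul (hwC.dxx p.1 p.2).meas).aestronglyMeasurable
    have hsum : (fun z ↦ ∑ p : Fin d × Fin d, a z p.1 p.2 * Dxx p.1 p.2 w z) = ∑ p : Fin d × Fin d, fun z ↦ a z p.1 p.2 * Dxx p.1 p.2 w z := by ext z; simp
    rw [e]
    refine (eLpNorm_sub_le (Lop_meas ham hwC).aestronglyMeasurable (by rw [hsum]; exact Finset.aestronglyMeasurable_sum _ fun p _ ↦ me p) hs').trans ?_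
    rw [hsum]
    calc _ ≤ E 0 + ∑ p : Fin d × Fin d, ℓ δ⁻¹ * (N * E 0) := by
          refine add_le_add le_rfl ((eLpNorm_sum_le (fun p _ ↦ me p) hs').trans (Finset.sum_le_sum fun p _ ↦ ?_))
          refine le_trans ?_ (mul_le_mul_right (hwxx p.1 p.2) _)
          refine eLpNorm_le_mul_eLpNorm_of_ae_le_mul (ae_of_all _ fun z ↦ ?_) _
          rw [norm_mul]; exact mul_le_mul_of_nonneg_right ((ha z).bound hδ _ _) (norm_nonneg _)
      _ = _ := by
          rw [ENNReal.ofReal_add (by positivity) (by positivity), ENNReal.ofReal_mul (by positivity), ENNReal.ofReal_mul (by positivity), ENNReal.ofReal_coe_nnreal,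
            ENNReal.ofReal_pow (by positivity), ENNReal.ofReal_natCast]
          simp; ring
  have f4 : ∀ i, eLpNorm (Dx i w) (ℓ s) (muT d T) ≤ 2 * X1 + N * E 0 := by
    intro i
    refine (interp hwC i one_pos T hs).trans ?_
    simp only [div_one, ENNReal.ofReal_ofNat, ENNReal.ofReal_one, one_mul]
    gcongr
    · exact hVn 0
    · exact hwxx i i
  refine f1.trans (f2.trans ?_)
  rw [ENNReal.coe_mul, mul_assoc]
  gcongr
  have hX : X1 ≤ X1 + X2 := le_self_add
  calc _ ≤ ℓ (1 + d ^ 2 * δ⁻¹ * N) * (ℓ (2 * c3) * (X1 + X2)) + ∑ i : Fin d, (2 * (X1 + X2) + N * (ℓ (2 * c3) * (X1 + X2))) := by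
        refine add_le_add (f3.trans (mul_le_mul_right hE0' _)) (Finset.sum_le_sum fun i _ ↦ (f4 i).trans ?_)
        gcongr
    _ = _ := by
        change _ = ℓ _ * _
        rw [ENNReal.ofReal_add (p := (1 + d ^ 2 * δ⁻¹ * N) * (2 * c3)) (by positivity) (by positivity), ENNReal.ofReal_mul (p := (1 + d ^ 2 * δ⁻¹ * N)) (by positivity), ENNReal.ofReal_mul (p := (d:ℝ)) (by positivity),
          ENNReal.ofReal_add (p := 2) (by positivity) (by positivity), ENNReal.ofReal_mul (p := (N:ℝ)) (by positivity), ENNReal.ofReal_natCast, ENNReal.ofReal_coe_nnreal]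
        simp only [Finset.sum_const, Finset.card_univ, Fintype.card_fin, nsmul_eq_mul, ENNReal.ofReal_ofNat]
        ring

def gx (y : Spc d) : Pt d := (0, y)
lemma gx_meas : Measurable (gx (d := d)) := measurable_const.prodMk measurable_id

lemma moll_ex {f : 𝔽 d} (hf : CinfC f) : ∃ ψ : Spc d → ℝ, ContDiff ℝ (⊤ : ℕ∞) ψ ∧ tsupport ψ ⊆ ball 0 1 ∧ HasCompactSupport ψ ∧
    ∫⁻ y, ‖ψ y‖ₑ = 1 ∧ ∀ z, |f z - Av volume ψ gx f z| ≤ 1 := by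
  obtain ⟨C, hC⟩ := ContDiff.lipschitzWith_of_hasCompactSupport hf.2 hf.1 (by simp)
  set h : ℝ := min (1 / 2) (1 / (C + 1)) with hh
  have hC0 : (0:ℝ) ≤ C := C.2
  have h0 : 0 < h := lt_min (by norm_num) (by positivity)
  have hh1 : h < 1 := (min_le_left _ _).trans_lt (by norm_num)
  let φ : ContDiffBump (0 : Spc d) := ⟨h / 2, h, by positivity, by linarith⟩
  have hts : tsupport (φ.normed volume) ⊆ ball (0 : Spc d) 1 := by
    rw [φ.tsupport_normed_eq]; exact closedBall_subset_ball hh1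
  refine ⟨φ.normed volume, φ.contDiff_normed, hts, φ.hasCompactSupport_normed, ?_, fun z ↦ ?_⟩
  · have := ofReal_integral_eq_lintegral_ofReal (φ.integrable_normed (μ := volume)) (ae_of_all _ fun y ↦ φ.nonneg_normed y)
    rw [φ.integral_normed, ENNReal.ofReal_one] at this
    rw [this]
    exact lintegral_congr fun y ↦ by rw [Real.enorm_eq_ofReal (φ.nonneg_normed y)]
  · have e1 : f z = ∫ y, φ.normed volume y * f z := by rw [integral_mul_const, φ.integral_normed, one_mul]
    have i1 : Integrable (fun y ↦ φ.normed volume y * f z) := φ.integrable_normed.mul_const _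
    have i2 := Av_int (k := φ.normed volume) φ.integrable_normed gx_meas hf z
    unfold Av
    nth_rw 1 [e1]
    rw [← integral_sub i1 i2]
    rw [← Real.norm_eq_abs]
    refine (norm_integral_le_of_norm_le (φ.integrable_normed (μ := volume)) (ae_of_all _ fun y ↦ ?_)).trans φ.integral_normed.le
    rw [← mul_sub, norm_mul, Real.norm_eq_abs, abs_of_nonneg (φ.nonneg_normed y)]
    by_cases hy : φ.normed volume y = 0
    · simp [hy]
    refine mul_le_of_le_one_right (φ.nonneg_normed y) ?_
    have hy' : y ∈ ball (0 : Spc d) h := by rw [← show φ.rOut = h from rfl, ← φ.support_normed_eq (μ := volume)]; exact hy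
    rw [mem_ball_zero_iff] at hy'
    have := hC.dist_le_mul z (z - gx y)
    rw [dist_eq_norm, dist_eq_norm, sub_sub_cancel] at this
    have e : ‖gx y‖ = ‖y‖ := by simp [gx, Prod.norm_def]
    rw [e] at this
    refine this.trans ?_
    calc (C:ℝ) * ‖y‖ ≤ C * (1 / (C + 1)) := mul_le_mul_of_nonneg_left (hy'.le.trans (min_le_right _ _)) hC0
      _ ≤ 1 := by rw [mul_one_div, div_le_one (by positivity)]; linarith

lemma Av_ibp {ψ : Spc d → ℝ} (hψ : ContDiff ℝ (⊤ : ℕ∞) ψ) (hc : HasCompactSupport ψ) {f : 𝔽 d} (hf : CinfC f) (i : Fin d) :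
    Av volume ψ gx (Dx i f) = Av volume (fun y ↦ fderiv ℝ ψ y (EuclideanSpace.single i 1)) gx f := by
  ext z
  have hk : Integrable ψ := hψ.continuous.integrable_of_hasCompactSupport hc
  have hψ' : ContDiff ℝ (⊤ : ℕ∞) fun y ↦ fderiv ℝ ψ y (EuclideanSpace.single i 1) :=
    (hψ.fderiv_right (m := (⊤ : ℕ∞)) (by simp)).clm_apply contDiff_const
  have hc' : HasCompactSupport fun y ↦ fderiv ℝ ψ y (EuclideanSpace.single i 1) := hc.fderiv_apply ℝ _
  have hk' := hψ'.continuous.integrable_of_hasCompactSupport (μ := volume) hc'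
  have hfd : ∀ y, HasFDerivAt (fun y ↦ f (z - gx y)) (-(fderiv ℝ f (z - gx y)).comp (ContinuousLinearMap.inr ℝ ℝ (Spc d))) y := by
    intro y
    have h1 : HasFDerivAt (fun y : Spc d ↦ z - gx y) (-(ContinuousLinearMap.inr ℝ ℝ (Spc d))) y := by
      have := (ContinuousLinearMap.inr ℝ ℝ (Spc d)).hasFDerivAt (x := y)
      exact this.const_sub z
    have := (hf.sm.diff (z - gx y)).hasFDerivAt.comp y h1
    rw [ContinuousLinearMap.comp_neg] at this
    exact this
  have e : ∀ y, fderiv ℝ (fun y ↦ f (z - gx y)) y (EuclideanSpace.single i 1) = - Dx i f (z - gx y) := by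
    intro y; rw [(hfd y).fderiv, Dx_eq hf.sm]; simp [DD, ex]
  have h2 := integral_mul_fderiv_eq_neg_fderiv_mul_of_integrable (μ := volume) (f := ψ) (g := fun y ↦ f (z - gx y)) (v := EuclideanSpace.single i 1)
    (Av_int hk' gx_meas hf z) (by
      simp only [e, mul_neg]
      exact (Av_int hk gx_meas (hf.dx i) z).neg) (Av_int hk gx_meas hf z) (fun y _ ↦ hψ.differentiable (by simp) y) (fun y _ ↦ (hfd y).differentiableAt)
  simp only [e, mul_neg, integral_neg, neg_inj] at h2
  exact h2

lemma Av_ibp2 {ψ : Spc d → ℝ} (hψ : ContDiff ℝ (⊤ : ℕ∞) ψ) (hs : tsupport ψ ⊆ ball 0 1) (hc : HasCompactSupport ψ) (i j : Fin d) :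
    ∃ k : Spc d → ℝ, Continuous k ∧ HasCompactSupport k ∧ (∀ y, k y ≠ 0 → ‖y‖ < 1) ∧
      ∀ f : Pt d → ℝ, CinfC f → Av volume ψ gx (Dxx i j f) = Av volume k gx f := by
  have hψ1 : ContDiff ℝ (⊤ : ℕ∞) fun y ↦ fderiv ℝ ψ y (EuclideanSpace.single i 1) :=
    (hψ.fderiv_right (m := (⊤ : ℕ∞)) (by simp)).clm_apply contDiff_const
  have hc1 : HasCompactSupport fun y ↦ fderiv ℝ ψ y (EuclideanSpace.single i 1) := hc.fderiv_apply ℝ _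
  refine ⟨_, ((hψ1.fderiv_right (m := (⊤ : ℕ∞)) (by simp)).clm_apply contDiff_const).continuous, hc1.fderiv_apply ℝ (EuclideanSpace.single j 1), fun y hy ↦ ?_,
    fun f hf ↦ by rw [Dxx, Av_ibp hψ hc (hf.dx j), Av_ibp hψ1 hc1 hf]⟩
  have h1 : y ∈ tsupport ψ := tsupport_fderiv_apply_subset ℝ _ (tsupport_fderiv_apply_subset ℝ _ (subset_tsupport _ hy))
  simpa using hs h1

lemma Av_Lop {ψ : Spc d → ℝ} {k : Spc d → ℝ} (hk' : Integrable k) {i j : Fin d}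
    (H : ∀ f : Pt d → ℝ, CinfC f → Av volume ψ gx (Dxx i j f) = Av volume k gx f) (b : ℝ → 𝕄 d) {v : 𝔽 d} (hv : CinfC v) :
    Lop (fun z ↦ b z.1) (Av volume ψ gx (Dxx i j v)) = Av volume k gx (Lop (fun z ↦ b z.1) v) := by
  ext z
  rw [H v hv, Lop, Dt_Av hk' gx_meas hv]
  simp only [Dxx_Av hk' gx_meas hv]
  unfold Av Lop
  simp only [mul_add, Finset.mul_sum]
  have e : ∀ y : Spc d, (z - gx y).1 = z.1 := fun y ↦ by simp [gx]
  simp only [e]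
  have I : ∀ m l, Integrable fun y ↦ k y * (b z.1 m l * Dxx m l v (z - gx y)) := fun m l ↦ by
    refine ((Av_int hk' gx_meas (hv.dxx m l) z).const_mul (b z.1 m l)).congr (ae_of_all _ fun y ↦ by simp only; ring)
  rw [integral_add (Av_int hk' gx_meas (hv.dt) z) (integrable_finsetSum _ fun m _ ↦ integrable_finsetSum _ fun l _ ↦ I m l),
    integral_finsetSum _ fun m _ ↦ integrable_finsetSum _ fun l _ ↦ I m l]
  congr 1
  refine Finset.sum_congr rfl fun m _ ↦ ?_
  rw [integral_finsetSum _ fun l _ ↦ I m l]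
  refine Finset.sum_congr rfl fun l _ ↦ ?_
  rw [← integral_const_mul]
  exact integral_congr_ae (ae_of_all _ fun y ↦ by simp only; ring)

lemma muT_restrict (T : ℝ) {S : Set (Pt d)} (hS : MeasurableSet S) : (muT d T).restrict S = volume.restrict (S ∩ {z | T < z.1}) := by
  rw [muT, Measure.restrict_restrict hS]

lemma cheb {p c C : ℝ} (hp : 0 < p) (hc : 0 < c) (hC : 0 ≤ C) {f : 𝔽 d} (hf : Continuous f) {μ : Measure (Pt d)}
    (h : eLpNorm f (ℓ p) μ ≤ ℓ C) : μ {z | c < |f z|} ≤ ℓ ((C / c) ^ p) := by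
  have h1 := meas_ge_le_mul_pow_eLpNorm_enorm μ (p := ℓ p) (by simpa using hp) (by simp) hf.aestronglyMeasurable (ε := ℓ c) (by simpa using hc) (by simp)
  rw [ENNReal.toReal_ofReal hp.le] at h1
  calc _ ≤ μ {x | ℓ c ≤ ‖f x‖ₑ} := measure_mono fun z hz ↦ by
        simp only [mem_setOf_eq, Real.enorm_eq_ofReal_abs] at *
        exact ENNReal.ofReal_le_ofReal (le_of_lt hz)
    _ ≤ _ := h1
    _ ≤ (ℓ c)⁻¹ ^ p * (ℓ C) ^ p := by gcongr
    _ = _ := by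
        rw [← ENNReal.ofReal_inv_of_pos hc, ENNReal.ofReal_rpow_of_nonneg (by positivity) hp.le, ENNReal.ofReal_rpow_of_nonneg hC hp.le, ← ENNReal.ofReal_mul (by positivity),
          ← Real.mul_rpow (by positivity) hC, div_eq_inv_mul]

theorem unit_ij (hd : 1 ≤ d) {δ : ℝ} (hδ : 0 < δ) (hδ1 : δ ≤ 1) {s : ℝ} (hs : 1 ≤ s) (H : Hb d δ s) (X0 : ℝ) (hX0 : 0 ≤ X0) :
    ∃ C0 : ℝ, 0 < C0 ∧ ∀ b : ℝ → 𝕄 d, Measurable b → (∀ t, inS d δ (b t)) → ∀ (T : ℝ) (w : 𝔽 d), CinfC w →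
      (∀ i j, eLpNorm (Dxx i j w) (ℓ s) ((muT d T).restrict (QQ 4 0)) ≤ ℓ X0) → ∀ Θ : ℝ, 0 < Θ → Θ ≤ 1 →
      eLpNorm (Lop (fun z ↦ b z.1) w) (ℓ s) ((muT d T).restrict (QQ 4 0)) ≤ ℓ Θ → ∀ i j, ∀ c : ℝ, 1 ≤ c →
      ((muT d T).restrict (QQ 1 0)) {z | 3 * c < |Dxx i j w z|} ≤ ℓ ((C0 / c) ^ ((d + 1) / d * s)) + ℓ ((C0 * Θ / c) ^ s) := by
  have hs0 : 0 < s := by linarith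
  have hs' : (1:ℝ≥0∞) ≤ ℓ s := by simpa using hs
  have hd0 : (0:ℝ) < d := by exact_mod_cast hd
  obtain ⟨N, hN⟩ := id H
  obtain ⟨CL, hCL⟩ := LOC hd hδ hs N (A := 1) (B := 2) (by norm_num) (by norm_num)
  have hN0 : (0:ℝ) ≤ N := N.2
  have hCL0 : (0:ℝ) ≤ CL := CL.2
  refine ⟨CL * (X0 + 2 * N + 1) + 2 * N + 1, by positivity, ?_⟩
  intro b hbm hb T w hw hX Θ hΘ hΘ1 hL i j c hc
  have hc0 : 0 < c := by linarith
  have hbm' : Measurable fun z : Pt d ↦ b z.1 := hbm.comp measurable_fst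
  have hAP := hN b hbm hb
  obtain ⟨ψ, p1, p2, p3, p4, p5⟩ := moll_ex (hw.dxx i j)
  obtain ⟨k, k1, k2, k3, k4⟩ := Av_ibp2 p1 p2 p3 i j
  have hψi : Integrable ψ := p1.continuous.integrable_of_hasCompactSupport p3
  have hki : Integrable k := k1.integrable_of_hasCompactSupport k2
  set M := ∫⁻ y, ‖k y‖ₑ with hM
  have hMt : M ≠ ⊤ := hki.2.ne
  obtain ⟨e, he, hCe⟩ := ofReal_pick (C := M + 1) (by finiteness) (ε := ℓ Θ) (by simpa using hΘ)
  set f : Pt d → ℝ := (QQ 4 (0 : Pt d)).indicator (Lop (fun z ↦ b z.1) w) with hf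
  obtain ⟨g1, ⟨M', g2⟩, g3⟩ := Lop_BC hδ hbm' (fun z ↦ hb z.1) hw
  have hfBC : BC f := by
    refine ⟨g1.indicator (QQ_meas _ _), ⟨M', fun z ↦ ?_⟩, g3.mono' ?_⟩
    · by_cases hz : z ∈ QQ 4 (0 : Pt d)
      · rw [hf, indicator_of_mem hz]; exact g2 z
      · rw [hf, indicator_of_notMem hz, abs_zero]; exact (abs_nonneg _).trans (g2 z)
    · intro z hz
      refine subset_tsupport _ fun h ↦ hz ?_
      rw [hf]; simp [indicator, h]
  have hf0 : ∀ z : Pt d, (16:ℝ) ≤ z.1 → f z = 0 := fun z hz ↦ by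
    rw [hf, indicator_of_notMem]
    intro h; rw [mem_QQ] at h
    have := (abs_lt.1 h.1).2
    simp at this; linarith
  obtain ⟨wn, n1, -, n2, -⟩ := Dn_b hd hδ hδ1 hs hs H H hbm hb T 16 f hfBC hf0 (ℓ e) (by simpa using he)
  have hfn : eLpNorm f (ℓ s) (muT d T) ≤ ℓ Θ := by
    rw [hf, eLpNorm_indicator_eq_eLpNorm_restrict (QQ_meas _ _)]; exact hL
  have hLm := fun {w : 𝔽 d} (hw : CinfC w) ↦ Lop_meas hbm' hw
  have fm : Measurable f := (hLm hw).indicator (QQ_meas _ _)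
  have heΘ : ℓ e ≤ ℓ Θ := le_trans (le_mul_of_one_le_left zero_le le_add_self) hCe
  have hwn : ∀ i j, eLpNorm (Dxx i j wn) (ℓ s) (muT d T) ≤ ℓ (2 * N * Θ) := by
    intro i j
    refine (hAP T wn n1 i j).trans ?_
    have : eLpNorm (Lop (fun z ↦ b z.1) wn) (ℓ s) (muT d T) ≤ ℓ Θ + ℓ Θ := by
      have e1 : Lop (fun z ↦ b z.1) wn = (fun z ↦ Lop (fun z ↦ b z.1) wn z - f z) + f := by ext z; simp
      rw [e1]
      exact (eLpNorm_add_le ((hLm n1).sub fm).aestronglyMeasurable fm.aestronglyMeasurable hs').trans (add_le_add (n2.trans heΘ) hfn)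
    calc (N:ℝ≥0∞) * _ ≤ N * (ℓ Θ + ℓ Θ) := by gcongr
      _ = _ := by rw [← ENNReal.ofReal_add hΘ.le hΘ.le, ← ENNReal.ofReal_coe_nnreal, ← ENNReal.ofReal_mul hN0]; ring_nf
  set v : Pt d → ℝ := fun z ↦ w z - wn z with hv
  have hvC : CinfC v := hw.sub n1
  have hvxx : Dxx i j v = fun z ↦ Dxx i j w z - Dxx i j wn z := by
    rw [Dxx_eq hvC.sm, Dxx_eq hw.sm, Dxx_eq n1.sm]
    ext z
    have e2 : ∀ v', DD v' v = fun z ↦ DD v' w z - DD v' wn z := fun v' ↦ by ext z; exact DD_sub v' hw.sm n1.sm z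
    rw [e2]; exact DD_sub _ (hw.sm.dd _) (n1.sm.dd _) z
  set V := Av volume ψ gx (Dxx i j v) with hV
  have hVC : CinfC V := ⟨Av_sm hψi gx_meas (hvC.dxx i j), Av_hcs (K := gx '' closedBall 0 1) ((isCompact_closedBall 0 1).image (by unfold gx; fun_prop))
    (fun y hy ↦ ⟨y, ball_subset_closedBall (p2 (subset_tsupport _ hy)), rfl⟩) (hvC.dxx i j).2⟩
  have hVe : ∀ z, V z = Av volume ψ gx (Dxx i j w) z - Av volume ψ gx (Dxx i j wn) z := by
    intro z
    rw [hV, hvxx]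
    unfold Av
    rw [← integral_sub (Av_int hψi gx_meas (hw.dxx i j) z) (Av_int hψi gx_meas (n1.dxx i j) z)]
    simp only [mul_sub]
  have hsh : ∀ y : Spc d, ‖y‖ < 1 → ∀ z ∈ QQ 2 (0 : Pt d) ∩ {z | T < z.1}, z - gx y ∈ QQ 3 (0 : Pt d) ∩ {z | T < z.1} := by
    rintro y hy z ⟨hz, hzT⟩
    rw [mem_QQ] at hz
    simp only [Prod.fst_zero, sub_zero, Prod.snd_zero, dist_zero_right] at hz
    refine ⟨?_, by simpa [gx] using hzT⟩
    rw [mem_QQ]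
    simp only [gx, Prod.fst_zero, sub_zero, Prod.snd_zero, dist_zero_right, Prod.fst_sub, Prod.snd_sub]
    exact ⟨hz.1.trans (by norm_num), (norm_sub_le _ _).trans_lt (by linarith [hz.2])⟩
  have ψs : ∀ y, ψ y ≠ 0 → ‖y‖ < 1 := fun y hy ↦ by simpa using p2 (subset_tsupport _ hy)
  have hVn : eLpNorm V (ℓ s) ((muT d T).restrict (QQ 2 0)) ≤ ℓ (X0 + 2 * N) := by
    rw [muT_restrict _ (QQ_meas _ _)]
    refine (Av_norm (S' := QQ 3 (0 : Pt d) ∩ {z | T < z.1}) p1.continuous.measurable gx_meas (hvC.dxx i j).meas ((QQ_meas _ _).inter (measSet_T T)) ((QQ_meas _ _).inter (measSet_T T))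
      (fun y hy ↦ hsh y (ψs y hy)) hs (by rw [p4]; simp)).trans ?_
    rw [p4, one_mul, ← muT_restrict _ (QQ_meas _ _), hvxx]
    refine (eLpNorm_sub_le (hw.dxx i j).meas.aestronglyMeasurable (n1.dxx i j).meas.aestronglyMeasurable hs').trans ?_
    rw [ENNReal.ofReal_add hX0 (by positivity)]
    refine add_le_add (le_trans (eLpNorm_mono_measure _ (Measure.restrict_mono_set _ (QQ_mono (by norm_num) (by norm_num) 0))) (hX i j)) ?_
    refine (eLpNorm_mono_measure _ Measure.restrict_le_self).trans ((hwn i j).trans (ENNReal.ofReal_le_ofReal ?_))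
    exact mul_le_of_le_one_right (by positivity) hΘ1
  have hLV : eLpNorm (Lop (fun z ↦ b z.1) V) (ℓ s) ((muT d T).restrict (QQ 2 0)) ≤ ℓ 1 := by
    rw [hV, Av_Lop hki k4 b hvC, muT_restrict _ (QQ_meas _ _)]
    refine (Av_norm (S' := QQ 3 (0 : Pt d) ∩ {z | T < z.1}) k1.measurable gx_meas (hLm hvC) ((QQ_meas _ _).inter (measSet_T T)) ((QQ_meas _ _).inter (measSet_T T))
      (fun y hy ↦ hsh y (k3 y hy)) hs hMt).trans ?_
    rw [← hM, ← muT_restrict _ (QQ_meas _ _)]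
    have : eLpNorm (Lop (fun z ↦ b z.1) v) (ℓ s) ((muT d T).restrict (QQ 3 0)) ≤ ℓ e := by
      refine le_trans ?_ n2
      rw [← eLpNorm_indicator_eq_eLpNorm_restrict (QQ_meas _ _)]
      refine eLpNorm_mono fun z ↦ ?_
      by_cases hz : z ∈ QQ 3 (0 : Pt d)
      · rw [indicator_of_mem hz, Lop_sub _ hw.sm n1.sm, hf, indicator_of_mem (QQ_mono (by norm_num) (by norm_num) 0 hz), norm_sub_rev]
      · rw [indicator_of_notMem hz, norm_zero]; positivity
    calc _ ≤ (M + 1) * ℓ e := by gcongr; exact le_self_add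
      _ ≤ _ := hCe.trans (ENNReal.ofReal_le_ofReal hΘ1)
  have hV2 : eLpNorm V (ℓ ((d + 1) / d * s)) ((muT d T).restrict (QQ 1 0)) ≤ ℓ (CL * (X0 + 2 * N + 1)) := by
    refine (hCL _ hbm' (fun z ↦ hb z.1) hAP T V hVC).trans ?_
    rw [ENNReal.ofReal_mul hCL0, ENNReal.ofReal_coe_nnreal, ENNReal.ofReal_add (by positivity) (by norm_num)]
    gcongr
  have hW : eLpNorm (Av volume ψ gx (Dxx i j wn)) (ℓ s) ((muT d T).restrict (QQ 1 0)) ≤ ℓ (2 * N * Θ) := by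
    refine le_trans (eLpNorm_mono_measure _ Measure.restrict_le_self) (le_trans ?_ (hwn i j))
    have := Av_norm (S := {z : Pt d | T < z.1}) (S' := {z | T < z.1}) (ν := volume) p1.continuous.measurable gx_meas (n1.dxx i j).meas (measSet_T T) (measSet_T T)
      (fun y hy z hz ↦ by simpa [gx] using hz) hs (by rw [p4]; simp)
    rwa [p4, one_mul] at this
  have c1 := cheb (p := (d + 1) / d * s) (by positivity) hc0 (by positivity) hVC.cont hV2
  have c2 := cheb hs0 hc0 (by positivity) (Av_sm hψi gx_meas (n1.dxx i j)).continuous hW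
  calc _ ≤ ((muT d T).restrict (QQ 1 0)) ({z | c < |V z|} ∪ {z | c < |Av volume ψ gx (Dxx i j wn) z|}) := by
        refine measure_mono fun z hz ↦ ?_
        by_contra h
        simp only [mem_union, mem_setOf_eq, not_or, not_lt] at h hz
        have h5 := p5 z
        have e3 : Dxx i j w z = (Dxx i j w z - Av volume ψ gx (Dxx i j w) z) + V z + Av volume ψ gx (Dxx i j wn) z := by rw [hVe z]; ring
        rw [e3] at hz
        have := (abs_add_le ((Dxx i j w z - Av volume ψ gx (Dxx i j w) z) + V z) (Av volume ψ gx (Dxx i j wn) z)).trans (add_le_add (abs_add_le _ _) le_rfl)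
        linarith [h.1, h.2]
    _ ≤ _ := (measure_union_le _ _).trans (add_le_add c1 c2)
    _ ≤ _ := by
        gcongr ℓ (?_ ^ _) + ℓ (?_ ^ _)
        · gcongr; linarith
        · gcongr; have : 0 ≤ CL * (X0 + 2 * N + 1) := by positivity
          linarith

lemma eLp_eq {s : ℝ} (hs : 0 < s) (h : 𝔽 d) (μ : Measure (Pt d)) : eLpNorm h (ℓ s) μ = (∫⁻ z, ℓ (|h z| ^ s) ∂μ) ^ (1 / s) := by
  rw [eLpNorm_eq_lintegral_rpow_enorm_toReal (by simpa using hs) (by simp), ENNReal.toReal_ofReal hs.le]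
  simp only [Real.enorm_eq_ofReal_abs, ENNReal.ofReal_rpow_of_nonneg (abs_nonneg _) hs.le]

def FF (T : ℝ) (w : 𝔽 d) : Pt d → ℝ := {z : Pt d | T < z.1}.indicator fun z ↦ ∑ i, ∑ j, |Dxx i j w z|

lemma FF_nonneg (T : ℝ) (w : 𝔽 d) (z : Pt d) : 0 ≤ FF T w z :=
  indicator_nonneg (fun _ _ ↦ Finset.sum_nonneg fun _ _ ↦ Finset.sum_nonneg fun _ _ ↦ abs_nonneg _) z

lemma le_FF {T : ℝ} (w : 𝔽 d) (i j : Fin d) {z : Pt d} (hz : T < z.1) : |Dxx i j w z| ≤ FF T w z := by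
  rw [FF, indicator_of_mem (by exact hz)]
  exact (Finset.single_le_sum (f := fun j ↦ |Dxx i j w z|) (fun _ _ ↦ abs_nonneg _) (Finset.mem_univ j)).trans
    (Finset.single_le_sum (f := fun i ↦ ∑ j, |Dxx i j w z|) (fun _ _ ↦ Finset.sum_nonneg fun _ _ ↦ abs_nonneg _) (Finset.mem_univ i))

lemma FF_big {T N1 : ℝ} (hN1 : 0 < N1) {w : 𝔽 d} {z : Pt d} (h : N1 < FF T w z) : T < z.1 ∧ ∃ i j, N1 / d ^ 2 < |Dxx i j w z| := by
  have hz : T < z.1 := by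
    by_contra hz
    rw [FF, indicator_of_notMem (by exact hz)] at h; linarith
  refine ⟨hz, ?_⟩
  by_contra! hn
  rw [FF, indicator_of_mem (by exact hz)] at h
  have := Finset.sum_le_sum fun i (_ : i ∈ Finset.univ) ↦ Finset.sum_le_sum fun j (_ : j ∈ Finset.univ) ↦ hn i j
  simp only [Finset.sum_const, Finset.card_univ, Fintype.card_fin, nsmul_eq_mul] at this
  rcases Nat.eq_zero_or_pos d with rfl | hd
  · simp at h; linarith
  have hd0 : (0:ℝ) < d := by exact_mod_cast hd
  have e : (d:ℝ) * (d * (N1 / d ^ 2)) = N1 := by field_simp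
  linarith

lemma unit_norm {δ : ℝ} (hδ : 0 < δ) {s σ : ℝ} (hs : 1 ≤ s) (hσ : s < σ) {Θ : ℝ} (hΘ : 0 < Θ) :
    ∃ K α : ℝ, 1 ≤ K ∧ 0 < α ∧ ∀ (a : 𝔸 d) (b : ℝ → 𝕄 d), Measurable a → (∀ z, inS d δ (a z)) →
      Measurable b → (∀ t, inS d δ (b t)) → ∀ T w, CinfC w →
      ∫⁻ z in QQ 4 0, ℓ (FF T w z ^ σ) ≤ volume (QQ 4 (0 : Pt d)) →
      ∫⁻ z in QQ 4 0, ℓ ((K * |{z : Pt d | T < z.1}.indicator (Lop a w) z|) ^ σ) ≤ volume (QQ 4 (0 : Pt d)) →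
      (∀ i j, ∫⁻ z in QQ 4 (0 : Pt d), ℓ |a z i j - b z.1 i j| ≤ ℓ α) →
      (∀ i j, eLpNorm (Dxx i j w) (ℓ s) ((muT d T).restrict (QQ 4 0)) ≤ ℓ ((volume (QQ 4 (0 : Pt d))).toReal ^ (1 / s))) ∧
      eLpNorm (Lop (fun z ↦ b z.1) w) (ℓ s) ((muT d T).restrict (QQ 4 0)) ≤ ℓ Θ := by
  have hs0 : 0 < s := by linarith
  have hσ0 : 0 < σ := by linarith
  have hs' : (1:ℝ≥0∞) ≤ ℓ s := by simpa using hs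
  set v := volume (QQ 4 (0 : Pt d)) with hv
  have hvt : v ≠ ⊤ := vol_QQ_top (by norm_num) 0
  have hv0 : v ≠ 0 := ((QQ_open 4 0).measure_pos volume ⟨0, QQ_self (by norm_num) 0⟩).ne'
  set X0 := v.toReal ^ (1 / s) with hX0
  have hX00 : 0 ≤ X0 := by positivity
  have hX0' : ℓ X0 = v ^ (1 / s) := by
    rw [hX0, ← ENNReal.ofReal_rpow_of_nonneg (by positivity) (by positivity), ENNReal.ofReal_toReal hvt]
  set ν := (1 / s - 1 / σ)⁻¹ with hν
  have hν' : 0 < 1 / s - 1 / σ := sub_pos.2 (one_div_lt_one_div_of_lt hs0 hσ)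
  have hν0 : 0 < ν := by positivity
  have hν1 : 1 ≤ ν := by
    rw [hν]; refine (one_le_inv₀ hν').2 ?_
    have : 1 / s ≤ 1 := by rw [div_le_one hs0]; exact hs
    have : 0 < 1 / σ := by positivity
    linarith
  have hνinv : ν⁻¹ = 1 / s - 1 / σ := by rw [hν, inv_inv]
  obtain ⟨e, he, hCe⟩ := ofReal_pick (C := (d:ℝ≥0∞) * (d * v ^ (1 / σ))) (by finiteness) (ε := ℓ (Θ / 2)) (by simpa using hΘ)
  refine ⟨1 + 2 * X0 / Θ, e ^ ν / (2 * δ⁻¹) ^ (ν - 1), by have : 0 ≤ 2 * X0 / Θ := by positivity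
                                                          linarith, by positivity, ?_⟩
  set K := 1 + 2 * X0 / Θ with hK
  have hK0 : 0 < K := by positivity
  intro a b ham ha hbm hb T w hw hA hB hC
  have hbm' : Measurable fun z : Pt d ↦ b z.1 := hbm.comp measurable_fst
  set μ := (muT d T).restrict (QQ 4 (0 : Pt d)) with hμ
  have hμv : μ univ ≤ v := by
    rw [hμ, Measure.restrict_apply_univ]; exact muT_le T _
  have hμe : μ = volume.restrict (QQ 4 0 ∩ {z | T < z.1}) := muT_restrict T (QQ_meas _ _)
  have hμle : μ ≤ volume.restrict (QQ 4 0) := by rw [hμe]; exact Measure.restrict_mono_set _ inter_subset_left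
  have hae : ∀ᵐ z ∂μ, T < z.1 := by
    rw [hμe]; filter_upwards [ae_restrict_mem ((QQ_meas _ _).inter (measSet_T T))] with z hz using hz.2
  have key : ∀ h : Pt d → ℝ, Measurable h → ∀ G : Pt d → ℝ, (∀ z, T < z.1 → |h z| ≤ G z) → (∫⁻ z in QQ 4 0, ℓ (G z ^ σ) ≤ v) →
      eLpNorm h (ℓ σ) μ ≤ v ^ (1 / σ) := by
    intro h hm G hG hGi
    rw [eLp_eq hσ0]
    refine ENNReal.rpow_le_rpow ?_ (by positivity)
    calc _ ≤ ∫⁻ z, ℓ (G z ^ σ) ∂μ := lintegral_mono_ae (hae.mono fun z hz ↦ ENNReal.ofReal_le_ofReal (Real.rpow_le_rpow (abs_nonneg _) (hG z hz) hσ0.le))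
      _ ≤ _ := (lintegral_mono' hμle le_rfl).trans hGi
  have key2 : ∀ h : Pt d → ℝ, Measurable h → eLpNorm h (ℓ σ) μ ≤ v ^ (1 / σ) → eLpNorm h (ℓ s) μ ≤ ℓ X0 := by
    intro h hm hh
    refine (eLpNorm_le_eLpNorm_mul_rpow_measure_univ (ENNReal.ofReal_le_ofReal hσ.le) hm.aestronglyMeasurable).trans ?_
    rw [ENNReal.toReal_ofReal hs0.le, ENNReal.toReal_ofReal hσ0.le, hX0']
    calc _ ≤ v ^ (1 / σ) * v ^ (1 / s - 1 / σ) := by gcongr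
      _ = _ := by rw [← ENNReal.rpow_add _ _ hv0 hvt]; ring_nf
  have kD : ∀ i j, eLpNorm (Dxx i j w) (ℓ σ) μ ≤ v ^ (1 / σ) := fun i j ↦
    key _ (hw.dxx i j).meas (FF T w) (fun z hz ↦ le_FF w i j hz) hA
  refine ⟨fun i j ↦ key2 _ (hw.dxx i j).meas (kD i j), ?_⟩
  have kL : eLpNorm (Lop a w) (ℓ s) μ ≤ ℓ (Θ / 2) := by
    have h1 : eLpNorm (fun z ↦ K * Lop a w z) (ℓ s) μ ≤ ℓ X0 := by
      refine key2 _ ((Lop_meas ham hw).const_mul K) (key _ ((Lop_meas ham hw).const_mul K) _ (fun z hz ↦ ?_) hB)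
      rw [indicator_of_mem (by exact hz), abs_mul, abs_of_pos hK0]
    rw [eLp_cmul, abs_of_pos hK0] at h1
    have h2 : ℓ X0 ≤ ℓ K * ℓ (Θ / 2) := by
      rw [← ENNReal.ofReal_mul hK0.le]; refine ENNReal.ofReal_le_ofReal ?_
      rw [hK]; have : (1 + 2 * X0 / Θ) * (Θ / 2) = Θ / 2 + X0 := by field_simp
      linarith
    exact (ENNReal.mul_le_mul_iff_right (by simpa using hK0) (by simp)).1 (h1.trans h2)
  have kab : ∀ i j, eLpNorm (fun z ↦ a z i j - b z.1 i j) (ℓ ν) μ ≤ ℓ e := by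
    intro i j
    have hM : ∀ z, |a z i j - b z.1 i j| ≤ 2 * δ⁻¹ := fun z ↦ by
      have h1 := (ha z).bound hδ i j
      have h2 := (hb z.1).bound hδ i j
      exact (abs_sub _ _).trans (by linarith)
    rw [eLp_eq hν0]
    have : ∫⁻ z, ℓ (|a z i j - b z.1 i j| ^ ν) ∂μ ≤ ℓ (e ^ ν) := by
      calc _ ≤ ∫⁻ z, ℓ ((2 * δ⁻¹) ^ (ν - 1)) * ℓ |a z i j - b z.1 i j| ∂μ := by
            refine lintegral_mono fun z ↦ ?_
            rw [← ENNReal.ofReal_mul (by positivity)]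
            refine ENNReal.ofReal_le_ofReal ?_
            have e1 : |a z i j - b z.1 i j| ^ ν = |a z i j - b z.1 i j| ^ (ν - 1) * |a z i j - b z.1 i j| := by
              nth_rw 3 [← Real.rpow_one |a z i j - b z.1 i j|]
              rw [← Real.rpow_add_of_nonneg (abs_nonneg _) (by linarith) (by norm_num)]; ring_nf
            rw [e1]
            exact mul_le_mul_of_nonneg_right (Real.rpow_le_rpow (abs_nonneg _) (hM z) (by linarith)) (abs_nonneg _)
        _ = ℓ ((2 * δ⁻¹) ^ (ν - 1)) * ∫⁻ z, ℓ |a z i j - b z.1 i j| ∂μ := lintegral_const_mul' _ _ (by simp)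
        _ ≤ ℓ ((2 * δ⁻¹) ^ (ν - 1)) * ℓ (e ^ ν / (2 * δ⁻¹) ^ (ν - 1)) := by
            gcongr; exact (lintegral_mono' hμle le_rfl).trans (hC i j)
        _ = _ := by rw [← ENNReal.ofReal_mul (by positivity)]; congr 1; field_simp
    calc _ ≤ (ℓ (e ^ ν)) ^ (1 / ν) := by gcongr
      _ = _ := by
        rw [ENNReal.ofReal_rpow_of_nonneg (by positivity) (by positivity), ← Real.rpow_mul he.le, mul_one_div_cancel hν0.ne', Real.rpow_one]
  have tri : ENNReal.HolderTriple (ℓ ν) (ℓ σ) (ℓ s) := ⟨by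
    rw [← ENNReal.ofReal_inv_of_pos hν0, ← ENNReal.ofReal_inv_of_pos hσ0, ← ENNReal.ofReal_inv_of_pos hs0, ← ENNReal.ofReal_add (by positivity) (by positivity), hνinv]
    congr 1; simp⟩
  have kprod : ∀ p : Fin d × Fin d, eLpNorm (fun z ↦ (a z p.1 p.2 - b z.1 p.1 p.2) * Dxx p.1 p.2 w z) (ℓ s) μ ≤ ℓ e * v ^ (1 / σ) := by
    intro p
    refine (eLpNorm_smul_le_mul_eLpNorm (p := ℓ ν) (q := ℓ σ) (hw.dxx p.1 p.2).meas.aestronglyMeasurable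
      (((meas_entry ham p.1 p.2).sub (meas_entry hbm' p.1 p.2)).aestronglyMeasurable)).trans ?_
    gcongr
    · exact kab p.1 p.2
    · exact kD p.1 p.2
  have eL : Lop (fun z ↦ b z.1) w = fun z ↦ Lop a w z - (∑ p : Fin d × Fin d, fun z ↦ (a z p.1 p.2 - b z.1 p.1 p.2) * Dxx p.1 p.2 w z) z := by
    ext z
    simp only [Lop, Finset.sum_apply, Fintype.sum_prod_type, sub_mul, Finset.sum_sub_distrib]
    ring
  have mp : ∀ p : Fin d × Fin d, AEStronglyMeasurable (fun z ↦ (a z p.1 p.2 - b z.1 p.1 p.2) * Dxx p.1 p.2 w z) μ := fun p ↦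
    (((meas_entry ham p.1 p.2).sub (meas_entry hbm' p.1 p.2)).mul (hw.dxx p.1 p.2).meas).aestronglyMeasurable
  rw [eL]
  refine (eLpNorm_sub_le (Lop_meas ham hw).aestronglyMeasurable (Finset.aestronglyMeasurable_sum _ fun p _ ↦ mp p) hs').trans ?_
  calc _ ≤ ℓ (Θ / 2) + ∑ p : Fin d × Fin d, ℓ e * v ^ (1 / σ) :=
        add_le_add kL ((eLpNorm_sum_le (fun p _ ↦ mp p) hs').trans (Finset.sum_le_sum fun p _ ↦ kprod p))
    _ ≤ ℓ (Θ / 2) + ℓ (Θ / 2) := by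
        gcongr
        refine le_trans (le_of_eq ?_) hCe
        simp; ring
    _ = _ := by rw [← ENNReal.ofReal_add (by positivity) (by positivity)]; ring_nf

theorem unit_F (hd : 1 ≤ d) {δ : ℝ} (hδ : 0 < δ) (hδ1 : δ ≤ 1) {s σ P : ℝ} (hs : 1 ≤ s) (hσ : s < σ) (hP : σ < P) (hPs : P < (d + 1) / d * s) (H : Hb d δ s) :
    ∃ N1 η K α : ℝ, 1 ≤ N1 ∧ 0 ≤ η ∧ N1 ^ P * P * (η * 5 ^ (d + 2) * 2) * (4 ^ (P - σ) / (P - σ)) ≤ 1 / 2 ∧ 1 ≤ K ∧ 0 < α ∧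
      ∀ (a : 𝔸 d) (b : ℝ → 𝕄 d), Measurable a → (∀ z, inS d δ (a z)) →
      Measurable b → (∀ t, inS d δ (b t)) → ∀ T w, CinfC w →
      ∫⁻ z in QQ 4 0, ℓ (FF T w z ^ σ) ≤ volume (QQ 4 (0 : Pt d)) →
      ∫⁻ z in QQ 4 0, ℓ ((K * |{z : Pt d | T < z.1}.indicator (Lop a w) z|) ^ σ) ≤ volume (QQ 4 (0 : Pt d)) →
      (∀ i j, ∫⁻ z in QQ 4 (0 : Pt d), ℓ |a z i j - b z.1 i j| ≤ ℓ α) →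
      volume ({z | N1 < FF T w z} ∩ QQ 1 0) ≤ ℓ η * volume (QQ 1 (0 : Pt d)) := by
  have hs0 : 0 < s := by linarith
  have hd0 : (0:ℝ) < d := by exact_mod_cast hd
  obtain ⟨C0, hC0, hU⟩ := unit_ij hd hδ hδ1 hs H ((volume (QQ 4 (0 : Pt d))).toReal ^ (1 / s)) (by positivity)
  set q := ((d:ℝ) + 1) / d * s with hq
  have hq0 : 0 < q := by linarith
  set v1 := (volume (QQ 1 (0 : Pt d))).toReal with hv1
  have hv10 : 0 < v1 := ENNReal.toReal_pos vol_Q1_pos vol_Q1_top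
  have hPσ : 0 < P - σ := by linarith
  set G : ℝ := P * ((2 * d ^ 2 * (3 * d ^ 2 * C0) ^ q / v1) * 5 ^ (d + 2) * 2) * (4 ^ (P - σ) / (P - σ)) with hG
  have hP0 : 0 < P := by linarith
  have hG0 : 0 < G := by positivity
  have ht : Filter.Tendsto (fun x : ℝ ↦ G * x ^ (-(q - P))) Filter.atTop (nhds (G * 0)) :=
    (tendsto_rpow_neg_atTop (by linarith)).const_mul _
  rw [mul_zero] at ht
  obtain ⟨N1, hN1, hN2⟩ := ((ht.eventually (gt_mem_nhds (show (0:ℝ) < 1 / 2 by norm_num))).and (Filter.eventually_ge_atTop (3 * (d:ℝ) ^ 2))).exists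
  have hd1 : (1:ℝ) ≤ d := by exact_mod_cast hd
  have hN3 : 1 ≤ N1 := by nlinarith
  have hN0 : 0 < N1 := by linarith
  set c := N1 / (3 * d ^ 2) with hc
  have hc1 : 1 ≤ c := by rw [hc, le_div_iff₀ (by positivity)]; linarith
  have hc0 : 0 < c := by linarith
  set Θ := min 1 ((C0 / c) ^ (((d:ℝ) + 1) / d) * c / C0) with hΘ
  have hΘ0 : 0 < Θ := lt_min one_pos (by positivity)
  obtain ⟨K, α, hK, hα, hU2⟩ := unit_norm (d := d) hδ hs hσ hΘ0
  refine ⟨N1, 2 * d ^ 2 * (C0 / c) ^ q / v1, K, α, hN3, by positivity, ?_, hK, hα, ?_⟩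
  · have e1 : (C0 / c) ^ q = (3 * d ^ 2 * C0) ^ q * N1 ^ (-q) := by
      rw [Real.rpow_neg hN0.le, ← Real.inv_rpow hN0.le, ← Real.mul_rpow (by positivity) (by positivity)]
      congr 1; rw [hc]; field_simp
    have e2 : N1 ^ (-(q - P)) = N1 ^ P * N1 ^ (-q) := by rw [← Real.rpow_add hN0]; ring_nf
    rw [e2] at hN1
    rw [e1]
    refine le_of_eq_of_le ?_ hN1.le
    rw [hG]; ring
  · intro a b ham ha hbm hb T w hw hA hB hC
    obtain ⟨u1, u2⟩ := hU2 a b ham ha hbm hb T w hw hA hB hC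
    have u3 := fun i j ↦ hU b hbm hb T w hw u1 Θ hΘ0 (min_le_left _ _) u2 i j c hc1
    have e3 : (C0 * Θ / c) ^ s ≤ (C0 / c) ^ q := by
      rw [hq, Real.rpow_mul (by positivity)]
      refine Real.rpow_le_rpow (by positivity) ?_ hs0.le
      have : Θ ≤ (C0 / c) ^ (((d:ℝ) + 1) / d) * c / C0 := min_le_right _ _
      calc C0 * Θ / c ≤ C0 * ((C0 / c) ^ (((d:ℝ) + 1) / d) * c / C0) / c := by gcongr
        _ = _ := by field_simp
    have e4 : 3 * c = N1 / d ^ 2 := by rw [hc]; field_simp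
    calc volume ({z | N1 < FF T w z} ∩ QQ 1 0) ≤ ((muT d T).restrict (QQ 1 0)) (⋃ p : Fin d × Fin d, {z | 3 * c < |Dxx p.1 p.2 w z|}) := by
          rw [muT_restrict _ (QQ_meas _ _), Measure.restrict_apply' ((QQ_meas _ _).inter (measSet_T T))]
          refine measure_mono ?_
          rintro z ⟨hz, hzQ⟩
          obtain ⟨h1, i, j, hij⟩ := FF_big hN0 hz
          exact ⟨mem_iUnion.2 ⟨(i, j), by rw [mem_setOf_eq, e4]; exact hij⟩, hzQ, h1⟩
      _ ≤ ∑ p : Fin d × Fin d, (ℓ ((C0 / c) ^ q) + ℓ ((C0 / c) ^ q)) := by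
          refine (measure_iUnion_fintype_le _ _).trans (Finset.sum_le_sum fun p _ ↦ (u3 p.1 p.2).trans ?_)
          gcongr
      _ = ℓ (d * (d * ((C0 / c) ^ q + (C0 / c) ^ q))) := by
          rw [ENNReal.ofReal_mul (by positivity), ENNReal.ofReal_mul (by positivity), ENNReal.ofReal_add (by positivity) (by positivity), ENNReal.ofReal_natCast]
          simp [mul_assoc, mul_add]
      _ = _ := by
          rw [← ENNReal.ofReal_toReal (a := volume (QQ 1 (0 : Pt d))) vol_Q1_top, ← hv1, ← ENNReal.ofReal_mul (by positivity)]
          congr 1; field_simp; ring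

def Sc (ρ : ℝ) (z0 z : Pt d) : Pt d := (z0.1 + ρ ^ 2 * z.1, z0.2 + ρ • z.2)

lemma Sc_cont (ρ : ℝ) (z0 : Pt d) : Continuous (Sc ρ z0) := by unfold Sc; fun_prop

lemma Sc_map {ρ : ℝ} (hρ : 0 < ρ) (z0 : Pt d) : Measure.map (Sc ρ z0) volume = ℓ (ρ ^ (d + 2))⁻¹ • volume := by
  have h1 : Measure.map (fun t : ℝ ↦ z0.1 + ρ ^ 2 * t) volume = ℓ ((ρ ^ 2)⁻¹) • volume := by
    have e : (fun t : ℝ ↦ z0.1 + ρ ^ 2 * t) = (fun t ↦ z0.1 + t) ∘ fun t ↦ (ρ ^ 2) • t := by ext t; simp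
    rw [e, ← Measure.map_map (by fun_prop) (by fun_prop), Measure.map_addHaar_smul volume (by positivity), Measure.map_smul, map_add_left_eq_self]
    simp
  have h2 : Measure.map (fun t : Spc d ↦ z0.2 + ρ • t) volume = ℓ ((ρ ^ d)⁻¹) • volume := by
    have e : (fun t : Spc d ↦ z0.2 + ρ • t) = (fun t ↦ z0.2 + t) ∘ fun t ↦ ρ • t := by ext t; simp
    rw [e, ← Measure.map_map (by fun_prop) (by fun_prop), Measure.map_addHaar_smul volume hρ.ne', Measure.map_smul, map_add_left_eq_self]
    simp [abs_of_pos hρ]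
  have h3 : Sc ρ z0 = Prod.map (fun t : ℝ ↦ z0.1 + ρ ^ 2 * t) (fun t : Spc d ↦ z0.2 + ρ • t) := rfl
  rw [h3, Measure.volume_eq_prod, ← Measure.map_prod_map _ _ (by fun_prop) (by fun_prop), h1, h2, Measure.prod_smul_left, Measure.prod_smul_right, smul_smul,
    ← ENNReal.ofReal_mul (by positivity)]
  congr 2; rw [pow_add, mul_inv, mul_comm]

lemma Sc_mem {ρ : ℝ} (hρ : 0 < ρ) {r : ℝ} {z0 z : Pt d} : Sc ρ z0 z ∈ QQ (r * ρ) z0 ↔ z ∈ QQ r 0 := by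
  simp only [mem_QQ, Sc, Prod.fst_zero, Prod.snd_zero, sub_zero, dist_zero_right, add_sub_cancel_left, dist_self_add_left, abs_mul, norm_smul, mul_pow]
  rw [abs_of_pos (show 0 < ρ ^ 2 by positivity), Real.norm_eq_abs, abs_of_pos hρ, mul_comm (r ^ 2), mul_comm r]
  exact and_congr (mul_lt_mul_iff_right₀ (by positivity)) (mul_lt_mul_iff_right₀ hρ)

lemma Sc_lint {ρ : ℝ} (hρ : 0 < ρ) (z0 : Pt d) (r : ℝ) {f : Pt d → ℝ≥0∞} (hf : Measurable f) :
    ∫⁻ z in QQ r 0, f (Sc ρ z0 z) = ℓ (ρ ^ (d + 2))⁻¹ * ∫⁻ z in QQ (r * ρ) z0, f z := by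
  rw [← lintegral_indicator (QQ_meas _ _), ← lintegral_indicator (QQ_meas _ _), ← smul_eq_mul, ← lintegral_smul_measure, ← Sc_map hρ z0,
    lintegral_map (hf.indicator (QQ_meas _ _)) (Sc_cont ρ z0).measurable]
  refine lintegral_congr fun z ↦ ?_
  by_cases hz : z ∈ QQ r (0 : Pt d)
  · rw [indicator_of_mem hz, indicator_of_mem ((Sc_mem hρ).2 hz)]
  · rw [indicator_of_notMem hz, indicator_of_notMem (fun h ↦ hz ((Sc_mem hρ).1 h))]

section
variable {ρ lam : ℝ} (hρ : 0 < ρ) (z0 : Pt d) {w : 𝔽 d}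

lemma Sc_DD (hw : Sm w) (m : ℝ) (v : Pt d) :
    DD v (fun z ↦ m * w (Sc ρ z0 z)) = fun z ↦ m * DD ((ρ ^ 2 * v.1, ρ • v.2) : Pt d) w (Sc ρ z0 z) := by
  ext z
  have h1 : HasFDerivAt (Sc ρ z0) (((ρ ^ 2) • ContinuousLinearMap.fst ℝ ℝ (Spc d)).prod (ρ • ContinuousLinearMap.snd ℝ ℝ (Spc d))) z := by
    have := (((ρ ^ 2) • ContinuousLinearMap.fst ℝ ℝ (Spc d)).prod (ρ • ContinuousLinearMap.snd ℝ ℝ (Spc d))).hasFDerivAt (x := z)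
    exact this.const_add z0
  have h2 := ((hw.diff (Sc ρ z0 z)).hasFDerivAt.comp z h1).const_mul m
  simp only [DD]
  have := congrArg (fun L ↦ L v) h2.fderiv
  simpa using this

include hρ in
lemma Sc_C (hw : CinfC w) (m : ℝ) : CinfC fun z ↦ m * w (Sc ρ z0 z) := by
  constructor
  · exact contDiff_const.mul (hw.1.comp (by unfold Sc; fun_prop))
  · refine HasCompactSupport.mul_left (f := fun _ ↦ m) ?_
    have hc : Continuous fun y : Pt d ↦ (((ρ ^ 2)⁻¹ * (y.1 - z0.1), ρ⁻¹ • (y.2 - z0.2)) : Pt d) := by fun_prop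
    refine HasCompactSupport.intro (hw.2.isCompact.image hc) fun z hz ↦ ?_
    by_contra h
    refine hz ⟨Sc ρ z0 z, subset_tsupport _ h, ?_⟩
    have : ρ ^ 2 ≠ 0 := by positivity
    simp [Sc, hρ.ne', smul_smul]

include hρ in
lemma Sc_Dxx (hw : CinfC w) (i j : Fin d) (z : Pt d) : Dxx i j (fun z ↦ (lam * ρ ^ 2)⁻¹ * w (Sc ρ z0 z)) z = lam⁻¹ * Dxx i j w (Sc ρ z0 z) := by
  have e : ∀ i : Fin d, ((ρ ^ 2 * (ex i : Pt d).1, ρ • (ex i : Pt d).2) : Pt d) = ρ • ex i := fun i ↦ by simp [ex]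
  rw [Dxx_eq (Sc_C hρ z0 hw _).sm, Dxx_eq hw.sm, Sc_DD z0 hw.sm, Sc_DD z0 (hw.sm.dd _), e, e]
  simp only [DD_smul, DD_cmul']
  field_simp

include hρ in
lemma Sc_Dt (hw : CinfC w) (z : Pt d) : Dt (fun z ↦ (lam * ρ ^ 2)⁻¹ * w (Sc ρ z0 z)) z = lam⁻¹ * Dt w (Sc ρ z0 z) := by
  have e : ((ρ ^ 2 * (et d).1, ρ • (et d).2) : Pt d) = (ρ ^ 2) • et d := by simp [et]
  rw [Dt_eq (Sc_C hρ z0 hw _).sm, Dt_eq hw.sm, Sc_DD z0 hw.sm, e]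
  simp only [DD_smul]
  field_simp

include hρ in
lemma Sc_Lop (hw : CinfC w) (a : 𝔸 d) (z : Pt d) :
    Lop (fun z ↦ a (Sc ρ z0 z)) (fun z ↦ (lam * ρ ^ 2)⁻¹ * w (Sc ρ z0 z)) z = lam⁻¹ * Lop a w (Sc ρ z0 z) := by
  simp only [Lop, Sc_Dxx hρ z0 hw, Sc_Dt hρ z0 hw, mul_add, Finset.mul_sum]
  congr 1
  exact Finset.sum_congr rfl fun i _ ↦ Finset.sum_congr rfl fun j _ ↦ by ring

include hρ in
lemma Sc_T {T : ℝ} (z : Pt d) : (T - z0.1) / ρ ^ 2 < z.1 ↔ T < (Sc ρ z0 z).1 := by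
  rw [div_lt_iff₀ (by positivity)]; simp only [Sc]
  constructor <;> intro h <;> linarith

include hρ in
lemma Sc_FF (hw : CinfC w) (hl : 0 < lam) (T : ℝ) (z : Pt d) : FF ((T - z0.1) / ρ ^ 2) (fun z ↦ (lam * ρ ^ 2)⁻¹ * w (Sc ρ z0 z)) z = lam⁻¹ * FF T w (Sc ρ z0 z) := by
  unfold FF
  simp only [Sc_Dxx hρ z0 hw, abs_mul, ← Finset.mul_sum, abs_of_pos (inv_pos.2 hl)]
  by_cases h : T < (Sc ρ z0 z).1
  · rw [indicator_of_mem (by exact (Sc_T hρ z0 z).2 h), indicator_of_mem (by exact h)]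
  · rw [indicator_of_notMem (by exact fun h' ↦ h ((Sc_T hρ z0 z).1 h')), indicator_of_notMem (by exact h), mul_zero]
end

section
variable {δ : ℝ} (hδ : 0 < δ) {a : 𝔸 d} (ham : Measurable a) (ha : ∀ z, inS d δ (a z))

lemma aTilde_meas (ham : Measurable a) (R : ℝ) (x0 : Spc d) : Measurable fun t ↦ (fun i j ↦ aTilde a R x0 t i j : 𝕄 d) := by
  refine measurable_pi_lambda _ fun i ↦ measurable_pi_lambda _ fun j ↦ ?_
  unfold aTilde average
  exact ((meas_entry ham i j).stronglyMeasurable.integral_prod_right').measurable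

include hδ ham ha in
lemma aTilde_inS {R : ℝ} (hR : 0 < R) (x0 : Spc d) (t : ℝ) : inS d δ (fun i j ↦ aTilde a R x0 t i j) := by
  unfold aTilde average
  set ν := (volume.restrict (ball x0 R) univ)⁻¹ • volume.restrict (ball x0 R) with hν
  have hp : IsProbabilityMeasure ν := by
    constructor
    rw [hν, Measure.smul_apply, Measure.restrict_apply_univ, smul_eq_mul]
    exact ENNReal.inv_mul_cancel (measure_ball_pos _ _ hR).ne' measure_ball_lt_top.ne
  clear_value ν
  have hi : ∀ i j, Integrable (fun y ↦ a (t, y) i j) ν := fun i j ↦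
    Integrable.of_bound ((meas_entry ham i j).comp measurable_prodMk_left).aestronglyMeasurable δ⁻¹
      (Filter.Eventually.of_forall fun y ↦ by simpa using (ha (t, y)).bound hδ i j)
  refine ⟨?_, fun ξ ↦ ?_⟩
  · ext i j
    simp only [Matrix.transpose_apply]
    exact integral_congr_ae (Filter.Eventually.of_forall fun y ↦ (ha (t, y)).symm' j i)
  · have hi2 : ∀ i j, Integrable (fun y ↦ a (t, y) i j * ξ i * ξ j) ν := fun i j ↦ ((hi i j).mul_const _).mul_const _
    have e : ∑ i, ∑ j, (∫ y, a (t, y) i j ∂ν) * ξ i * ξ j = ∫ y, ∑ i, ∑ j, a (t, y) i j * ξ i * ξ j ∂ν := by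
      rw [integral_finsetSum _ fun i _ ↦ integrable_finsetSum _ fun j _ ↦ hi2 i j]
      refine Finset.sum_congr rfl fun i _ ↦ ?_
      rw [integral_finsetSum _ fun j _ ↦ hi2 i j]
      refine Finset.sum_congr rfl fun j _ ↦ ?_
      rw [integral_mul_const, integral_mul_const]
    have hI : Integrable (fun y ↦ ∑ i, ∑ j, a (t, y) i j * ξ i * ξ j) ν := integrable_finsetSum _ fun i _ ↦ integrable_finsetSum _ fun j _ ↦ hi2 i j
    rw [e]
    constructor
    · have := integral_mono (μ := ν) (integrable_const _) hI fun y ↦ ((ha (t, y)).2 ξ).1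
      simpa using this
    · have := integral_mono (μ := ν) hI (integrable_const _) fun y ↦ ((ha (t, y)).2 ξ).2
      simpa using this
end

lemma FF_memLp {w : 𝔽 d} (hw : CinfC w) (T : ℝ) (p : ℝ≥0∞) : MemLp (FF T w) p :=
  (memLp_finsetSum _ fun i _ ↦ memLp_finsetSum _ fun j _ ↦ ((hw.dxx i j).memLp p).abs).indicator (measSet_T T)

lemma FF_lsc {w : 𝔽 d} (hw : CinfC w) (T : ℝ) : LowerSemicontinuous (FF T w) := by
  have hc : Continuous fun z ↦ ∑ i, ∑ j, |Dxx i j w z| :=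
    continuous_finsetSum _ fun i _ ↦ continuous_finsetSum _ fun j _ ↦ (hw.dxx i j).cont.abs
  intro z c hc'
  by_cases hz : T < z.1
  · rw [FF, indicator_of_mem (by exact hz)] at hc'
    have h1 : ∀ᶠ y in nhds z, T < y.1 := (isOpen_lt continuous_const continuous_fst).mem_nhds hz
    filter_upwards [h1, hc.continuousAt.eventually (lt_mem_nhds hc')] with y hy hy2
    rw [FF, indicator_of_mem (by exact hy)]; exact hy2
  · rw [FF, indicator_of_notMem (by exact hz)] at hc'
    exact Filter.Eventually.of_forall fun y ↦ hc'.trans_le (FF_nonneg T w y)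

lemma lint_pow_ne_top {s : ℝ} (hs : 0 < s) {h : 𝔽 d} {μ : Measure (Pt d)} (hh : MemLp h (ℓ s) μ) : ∫⁻ z, ℓ (|h z| ^ s) ∂μ ≠ ⊤ := by
  have := hh.eLpNorm_ne_top
  rw [eLp_eq hs] at this
  contrapose! this
  rw [this, ENNReal.top_rpow_of_pos (by positivity)]

section
variable {ρ lam : ℝ} (hρ : 0 < ρ) (z0 : Pt d)
include hρ

lemma Sc_set (r : ℝ) {S : Set (Pt d)} (hS : MeasurableSet S) :
    volume ({z | Sc ρ z0 z ∈ S} ∩ QQ r 0) = ℓ (ρ ^ (d + 2))⁻¹ * volume (S ∩ QQ (r * ρ) z0) := by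
  have := Sc_lint hρ z0 r (measurable_one.indicator hS : Measurable (S.indicator (1 : Pt d → ℝ≥0∞)))
  rw [lintegral_indicator_one hS, Measure.restrict_apply hS] at this
  have hp : {z | Sc ρ z0 z ∈ S} = Sc ρ z0 ⁻¹' S := rfl
  rw [← this, hp, ← Measure.restrict_apply (hS.preimage (Sc_cont ρ z0).measurable), ← lintegral_indicator_one (hS.preimage (Sc_cont ρ z0).measurable)]
  rfl

lemma Sc_vol (r : ℝ) : ℓ (ρ ^ (d + 2))⁻¹ * volume (QQ (r * ρ) z0) = volume (QQ r (0 : Pt d)) := by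
  have := Sc_set hρ z0 r MeasurableSet.univ
  simpa using this.symm

lemma Sc_sig (hl : 0 < lam) {σ : ℝ} {G : 𝔽 d} (hG : ∀ z, 0 ≤ G z) (hGm : Measurable G)
    (h : ∫⁻ y in QQ (4 * ρ) z0, ℓ (G y ^ σ) ≤ ℓ (lam ^ σ) * volume (QQ (4 * ρ) z0)) :
    ∫⁻ z in QQ 4 0, ℓ ((lam⁻¹ * G (Sc ρ z0 z)) ^ σ) ≤ volume (QQ 4 (0 : Pt d)) := by
  have hm : Measurable fun z ↦ ℓ (G z ^ σ) := ENNReal.measurable_ofReal.comp (hGm.pow_const σ)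
  have e : ∀ z, ℓ ((lam⁻¹ * G (Sc ρ z0 z)) ^ σ) = ℓ (lam ^ σ)⁻¹ * ℓ (G (Sc ρ z0 z) ^ σ) := fun z ↦ by
    rw [Real.mul_rpow (by positivity) (hG _), Real.inv_rpow hl.le, ENNReal.ofReal_mul (by positivity)]
  simp only [e]
  rw [lintegral_const_mul' _ _ ENNReal.ofReal_ne_top, Sc_lint hρ z0 4 hm, ← Sc_vol hρ z0 4]
  calc _ ≤ ℓ (lam ^ σ)⁻¹ * (ℓ (ρ ^ (d + 2))⁻¹ * (ℓ (lam ^ σ) * volume (QQ (4 * ρ) z0))) := by gcongr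
    _ = (ℓ (lam ^ σ)⁻¹ * ℓ (lam ^ σ)) * (ℓ (ρ ^ (d + 2))⁻¹ * volume (QQ (4 * ρ) z0)) := by ring
    _ = _ := by
      rw [← ENNReal.ofReal_mul (by positivity), inv_mul_cancel₀ (by positivity), ENNReal.ofReal_one, one_mul]

lemma Sc_osc {a : 𝔸 d} (ham : Measurable a) (i j : Fin d) :
    ∫⁻ z in QQ 4 (0 : Pt d), ℓ |a (Sc ρ z0 z) i j - aTilde a (8 * ρ) z0.2 (Sc ρ z0 z).1 i j| ≤ volume (QQ 8 (0 : Pt d)) * aSharp a := by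
  have hm : Measurable fun z : Pt d ↦ ℓ |a z i j - aTilde a (8 * ρ) z0.2 z.1 i j| := by
    have h2 : Measurable fun z : Pt d ↦ aTilde a (8 * ρ) z0.2 z.1 i j :=
      (meas_entry (a := fun z : Pt d ↦ (fun i j ↦ aTilde a (8 * ρ) z0.2 z.1 i j : 𝕄 d)) ((aTilde_meas ham (8 * ρ) z0.2).comp measurable_fst) i j)
    exact ENNReal.measurable_ofReal.comp (continuous_abs.measurable.comp ((meas_entry ham i j).sub h2))
  rw [Sc_lint hρ z0 4 hm, ← Sc_vol hρ z0 8, mul_assoc]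
  gcongr
  set Cy := cyl d (8 * ρ) (z0.1 - 16 * ρ ^ 2) z0.2 with hCy
  have hρ2 : 0 < ρ ^ 2 := by positivity
  have s1 : QQ (4 * ρ) z0 ⊆ Cy := by
    intro y hy
    obtain ⟨h1, h2⟩ := mem_QQ.1 hy
    rw [abs_lt] at h1
    refine ⟨⟨by nlinarith, by nlinarith⟩, ?_⟩
    rw [mem_ball]; linarith
  have s2 : Cy ⊆ QQ (8 * ρ) z0 := by
    rintro y ⟨⟨h1, h2⟩, h3⟩
    refine mem_QQ.2 ⟨abs_lt.2 ⟨by nlinarith, by nlinarith⟩, h3⟩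
  have hV0 : volume Cy ≠ 0 := by
    refine (measure_mono s1 |>.trans_lt' ?_).ne'
    rw [vol_QQ (by positivity)]
    exact ENNReal.mul_pos (by simp; positivity) vol_Q1_pos
  have hVt : volume Cy ≠ ⊤ := ((measure_mono s2).trans_lt (vol_QQ_top (by positivity) _).lt_top).ne
  calc _ ≤ ∫⁻ z in Cy, ℓ |a z i j - aTilde a (8 * ρ) z0.2 z.1 i j| := lintegral_mono_set s1
    _ ≤ ∫⁻ z in Cy, ℓ (mnorm (fun i j ↦ a z i j - aTilde a (8 * ρ) z0.2 z.1 i j)) := by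
      refine lintegral_mono fun z ↦ ENNReal.ofReal_le_ofReal ?_
      unfold mnorm
      rw [← Real.sqrt_sq_eq_abs]
      refine Real.sqrt_le_sqrt ?_
      exact (Finset.single_le_sum (f := fun j ↦ (a z i j - aTilde a (8 * ρ) z0.2 z.1 i j) ^ 2) (fun _ _ ↦ sq_nonneg _) (Finset.mem_univ j)).trans
        (Finset.single_le_sum (f := fun i ↦ ∑ j, (a z i j - aTilde a (8 * ρ) z0.2 z.1 i j) ^ 2) (fun _ _ ↦ Finset.sum_nonneg fun _ _ ↦ sq_nonneg _) (Finset.mem_univ i))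
    _ = volume Cy * aSharpCyl a (8 * ρ) (z0.1 - 16 * ρ ^ 2) z0.2 := by
      rw [aSharpCyl, ← hCy, ← mul_assoc, ENNReal.mul_inv_cancel hV0 hVt, one_mul]
    _ ≤ volume (QQ (8 * ρ) z0) * aSharp a := by
      gcongr
      unfold aSharp
      exact le_iSup_of_le (8 * ρ) (le_iSup_of_le (by positivity) (le_iSup_of_le _ (le_iSup_of_le z0.2 le_rfl)))
end

theorem Step (hd : 1 ≤ d) {δ : ℝ} (hδ : 0 < δ) (hδ1 : δ ≤ 1) {s P : ℝ} (hs : 1 ≤ s) (hP : s < P) (hPs : P < (d + 1) / d * s) (H : Hb d δ s) :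
    ∃ aHat : ℝ, 0 < aHat ∧ ∃ N : ℝ≥0, ∀ a : Pt d → 𝕄 d, Measurable a → (∀ z, inS d δ (a z)) →
      aSharp a ≤ ℓ aHat → AP P a N := by
  have hσ1 : s < (s + P) / 2 := by linarith
  have hσ2 : (s + P) / 2 < P := by linarith
  generalize (s + P) / 2 = σ at hσ1 hσ2
  obtain ⟨N1, η, K, α, hN1, hη, hsm, hK, hα, HU⟩ := unit_F hd hδ hδ1 hs hσ1 hσ2 hPs H
  have hV0 : 0 < (volume (QQ 8 (0 : Pt d))).toReal := by
    refine ENNReal.toReal_pos ?_ (vol_QQ_top (by norm_num) _)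
    rw [vol_QQ (by norm_num)]
    exact (ENNReal.mul_pos (by simp) vol_Q1_pos).ne'
  refine ⟨α / (volume (QQ 8 (0 : Pt d))).toReal, by positivity, K.toNNReal, fun a ham ha hsh T w hw i j ↦ ?_⟩
  set g : Pt d → ℝ := fun z ↦ K * |{z : Pt d | T < z.1}.indicator (Lop a w) z| with hg
  have hgm : Measurable g := ((((Lop_meas ham hw).indicator (measSet_T T)).abs)).const_mul K
  have hgL : ∀ p, MemLp g p := fun p ↦ ((((Lop_BC hδ ham ha hw).memLp p).indicator (measSet_T T)).abs).const_mul K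
  have hg0 : ∀ z, 0 ≤ g z := fun z ↦ by simp only [hg]; positivity
  have hσ0 : 0 < σ := by linarith
  have hP0 : 0 < P := by linarith
  have fin : ∀ (h : 𝔽 d) (x : ℝ), 0 < x → (∀ z, 0 ≤ h z) → (∀ p, MemLp h p) → ∫⁻ z, ℓ (h z ^ x) ≠ ⊤ := by
    intro h x hx h0 hL
    have := lint_pow_ne_top hx (hL (ℓ x))
    simpa only [abs_of_nonneg (h0 _)] using this
  have key := RV (by linarith) hσ2 hN1 hη hsm (FF_nonneg T w) hg0 (FF_lsc hw T) hgm
    (fin _ _ hσ0 (FF_nonneg T w) (FF_memLp hw T)) (fin _ _ hσ0 hg0 hgL) (fin _ _ hP0 (FF_nonneg T w) (FF_memLp hw T)) ?_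
  · rw [eLp_eq hP0, eLp_eq hP0]
    have e1 : ∫⁻ z, ℓ (|Dxx i j w z| ^ P) ∂(muT d T) ≤ ∫⁻ z, ℓ (FF T w z ^ P) := by
      refine (setLIntegral_mono' (measSet_T T) fun z hz ↦ ?_).trans (setLIntegral_le_lintegral _ _)
      exact ENNReal.ofReal_le_ofReal (Real.rpow_le_rpow (abs_nonneg _) (le_FF w i j hz) hP0.le)
    have e2 : ∫⁻ z, ℓ (g z ^ P) = ℓ (K ^ P) * ∫⁻ z, ℓ (|Lop a w z| ^ P) ∂(muT d T) := by
      rw [← lintegral_const_mul' _ _ ENNReal.ofReal_ne_top, muT, ← lintegral_indicator (measSet_T T)]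
      refine lintegral_congr fun z ↦ ?_
      simp only [hg]
      by_cases hz : z ∈ {z : Pt d | T < z.1}
      · rw [indicator_of_mem hz, indicator_of_mem hz, Real.mul_rpow (by positivity) (abs_nonneg _), ENNReal.ofReal_mul (by positivity)]
      · rw [indicator_of_notMem hz, indicator_of_notMem hz, abs_zero, mul_zero, Real.zero_rpow hP0.ne', ENNReal.ofReal_zero]
    calc _ ≤ (ℓ (K ^ P) * ∫⁻ z, ℓ (|Lop a w z| ^ P) ∂(muT d T)) ^ (1 / P) :=
          ENNReal.rpow_le_rpow (e1.trans (key.trans e2.le)) (by positivity)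
      _ = _ := by
        rw [ENNReal.mul_rpow_of_nonneg _ _ (by positivity), ENNReal.ofReal_rpow_of_nonneg (by positivity) (by positivity), ← Real.rpow_mul (by positivity),
          mul_one_div_cancel hP0.ne', Real.rpow_one]
        rfl
  · intro z0 ρ lam hρ hl h1 h2
    have h3 := HU (fun z ↦ a (Sc ρ z0 z)) (fun t ↦ (fun i j ↦ aTilde a (8 * ρ) z0.2 (z0.1 + ρ ^ 2 * t) i j)) (ham.comp (Sc_cont ρ z0).measurable)
      (fun z ↦ ha _) ((aTilde_meas ham (8 * ρ) z0.2).comp (by fun_prop)) (fun t ↦ aTilde_inS hδ ham ha (by positivity) _ _)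
      ((T - z0.1) / ρ ^ 2) (fun z ↦ (lam * ρ ^ 2)⁻¹ * w (Sc ρ z0 z)) (Sc_C hρ z0 hw _) ?_ ?_ ?_
    · simp only [Sc_FF hρ z0 hw hl] at h3
      have e : {z | N1 < lam⁻¹ * FF T w (Sc ρ z0 z)} = {z | Sc ρ z0 z ∈ {y | N1 * lam < FF T w y}} := by
        ext z; simp only [mem_ofPred_eq]
        rw [inv_mul_eq_div, lt_div_iff₀ hl]
      rw [e, Sc_set hρ z0 1 ((measurableSet_lt measurable_const (FF_lsc hw T).measurable)), ← Sc_vol hρ z0 1, one_mul, mul_left_comm] at h3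
      rwa [ENNReal.mul_le_mul_iff_right (by simp; positivity) ENNReal.ofReal_ne_top] at h3
    · simp only [Sc_FF hρ z0 hw hl]
      exact Sc_sig hρ z0 hl (FF_nonneg T w) (FF_lsc hw T).measurable h1
    · have e : ∀ z, K * |{z : Pt d | (T - z0.1) / ρ ^ 2 < z.1}.indicator (Lop (fun z ↦ a (Sc ρ z0 z)) fun z ↦ (lam * ρ ^ 2)⁻¹ * w (Sc ρ z0 z)) z| = lam⁻¹ * g (Sc ρ z0 z) := by
        intro z
        simp only [hg]
        by_cases hz : T < (Sc ρ z0 z).1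
        · rw [indicator_of_mem (by exact (Sc_T hρ z0 z).2 hz), indicator_of_mem (by exact hz), Sc_Lop hρ z0 hw, abs_mul, abs_of_pos (inv_pos.2 hl)]; ring
        · rw [indicator_of_notMem (by exact fun h' ↦ hz ((Sc_T hρ z0 z).1 h')), indicator_of_notMem (by exact hz)]; simp
      simp only [e]
      exact Sc_sig hρ z0 hl hg0 hgm h2
    · intro i j
      refine (Sc_osc hρ z0 ham i j).trans ?_
      calc _ ≤ volume (QQ 8 (0 : Pt d)) * ℓ (α / (volume (QQ 8 (0 : Pt d))).toReal) := by gcongr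
        _ = _ := by
          rw [← ENNReal.ofReal_toReal (vol_QQ_top (show (0:ℝ) < 8 by norm_num) (0 : Pt d)), ENNReal.toReal_ofReal (by positivity), ← ENNReal.ofReal_mul (by positivity), mul_div_cancel₀ _ hV0.ne']

lemma aSharp_b (b : ℝ → 𝕄 d) : aSharp (fun z : Pt d ↦ b z.1) = 0 := by
  unfold aSharp
  simp only [ENNReal.iSup_eq_zero]
  intro R hR t x
  unfold aSharpCyl aTilde
  have : ∀ (t : ℝ) i j, ⨍ y in ball x R, b ((t, y) : Pt d).1 i j = b t i j := fun t i j ↦ by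
    simp only
    exact setAverage_const (measure_ball_pos volume _ hR).ne' measure_ball_lt_top.ne (b t i j)
  simp only [this, sub_self]
  simp [mnorm]

lemma Hb_step (hd : 1 ≤ d) {δ : ℝ} (hδ : 0 < δ) (hδ1 : δ ≤ 1) {s P : ℝ} (hs : 1 ≤ s) (hP : s < P) (hPs : P < (d + 1) / d * s) (H : Hb d δ s) : Hb d δ P := by
  obtain ⟨c, hc, N, h⟩ := Step hd hδ hδ1 hs hP hPs H
  exact ⟨N, fun b hbm hb ↦ h _ (hbm.comp measurable_fst) (fun z ↦ hb _) (by rw [aSharp_b]; exact zero_le)⟩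

lemma kap (hd : 1 ≤ d) : (1:ℝ) < (d + 1) / d := by
  have : (0:ℝ) < d := by exact_mod_cast hd
  rw [lt_div_iff₀ this]; linarith

lemma Hb_all (hd : 1 ≤ d) {δ : ℝ} (hδ : 0 < δ) (hδ1 : δ ≤ 1) {s : ℝ} (hs : 1 < s) : Hb d δ s := by
  have hk := kap hd
  set κ : ℝ := ((d:ℝ) + 1) / d with hκ
  set l : ℝ := (1 + κ) / 2 with hl
  have hl1 : 1 < l := by linarith
  have hl2 : l < κ := by linarith
  have up : ∀ n : ℕ, ∀ s : ℝ, 2 ≤ s → s ≤ 2 * l ^ n → Hb d δ s := by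
    intro n
    induction n with
    | zero =>
      intro s h1 h2
      have : s = 2 := by simp at h2; linarith
      rw [this]; exact AP_two hδ
    | succ n ih =>
      intro s h1 h2
      by_cases h3 : s ≤ 2 * l ^ n
      · exact ih s h1 h3
      push Not at h3
      have h4 : 1 ≤ l ^ n := one_le_pow₀ hl1.le
      have h5 : s / l ≤ 2 * l ^ n := by rw [div_le_iff₀ (by linarith)]; rw [pow_succ] at h2; linarith
      refine Hb_step hd hδ hδ1 (s := max 2 (s / l)) (le_max_of_le_left (by norm_num)) (max_lt (by linarith) (div_lt_self (by linarith) hl1)) ?_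
        (ih _ (le_max_left _ _) (max_le (by linarith) h5))
      have h6 : s / l ≤ max 2 (s / l) := le_max_right _ _
      rw [div_le_iff₀ (by linarith)] at h6
      have h7 : (0:ℝ) < max 2 (s / l) := lt_max_of_lt_left (by norm_num)
      nlinarith
  have up2 : ∀ s : ℝ, 2 ≤ s → Hb d δ s := by
    intro s h
    obtain ⟨n, hn⟩ := pow_unbounded_of_one_lt s hl1
    have : 0 ≤ l ^ n := by positivity
    exact up n s h (by linarith)
  by_cases h2 : 2 ≤ s
  · exact up2 s h2
  push Not at h2
  have hc := Real.HolderConjugate.conjExponent hs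
  refine duality hd hδ hδ1 hc.symm (up2 _ ?_)
  unfold Real.conjExponent
  rw [le_div_iff₀ (by linarith)]; linarith

lemma AP.mono {s : ℝ} {a : 𝔸 d} {N M : ℝ≥0} (h : AP s a N) (hNM : N ≤ M) : AP s a M :=
  fun T w hw i j ↦ (h T w hw i j).trans (by gcongr)

lemma Ha (hd : 1 ≤ d) {δ : ℝ} (hδ : 0 < δ) (hδ1 : δ ≤ 1) {r : ℝ} (hr : 1 < r) :
    ∃ aHat : ℝ, 0 < aHat ∧ ∃ N : ℝ≥0, ∀ a : Pt d → 𝕄 d, Measurable a → (∀ z, inS d δ (a z)) →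
      aSharp a ≤ ℓ aHat → AP r a N := by
  have hk := kap hd
  have h1 : max 1 (r / (((d:ℝ) + 1) / d)) < r := max_lt hr (div_lt_self (by linarith) hk)
  have h2 : r / (((d:ℝ) + 1) / d) ≤ max 1 (r / (((d:ℝ) + 1) / d)) := le_max_right _ _
  have h3 : 1 ≤ max 1 (r / (((d:ℝ) + 1) / d)) := le_max_left _ _
  rw [div_le_iff₀ (by linarith)] at h2
  generalize max 1 (r / (((d:ℝ) + 1) / d)) = m at *
  refine Step hd hδ hδ1 (s := (m + r) / 2) (by linarith) (by linarith) (by nlinarith) (Hb_all hd hδ hδ1 (by linarith))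

lemma Ha_fin (hd : 1 ≤ d) {δ : ℝ} (hδ : 0 < δ) (hδ1 : δ ≤ 1) {r : ℝ} (hr : 1 < r) (n : ℕ) :
    ∃ aHat : ℝ, 0 < aHat ∧ ∃ N : ℝ≥0, ∀ a : Pt d → 𝕄 d, Measurable a → (∀ z, inS d δ (a z)) →
      aSharp a ≤ ℓ aHat → ∀ k ≤ n, AP (((d + 1) / d : ℝ) ^ k * r) a N := by
  induction n with
  | zero =>
    obtain ⟨c, hc, N, h⟩ := Ha hd hδ hδ1 hr
    refine ⟨c, hc, N, fun a h1 h2 h3 k hk ↦ ?_⟩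
    obtain rfl : k = 0 := by omega
    simpa using h a h1 h2 h3
  | succ n ih =>
    obtain ⟨c, hc, N, h⟩ := ih
    have : 1 < ((d + 1) / d : ℝ) ^ (n + 1) * r := by
      have := one_le_pow₀ (n := n + 1) (kap hd).le
      nlinarith
    obtain ⟨c', hc', N', h'⟩ := Ha hd hδ hδ1 this
    refine ⟨min c c', lt_min hc hc', max N N', fun a h1 h2 h3 k hk ↦ ?_⟩
    by_cases hkn : k ≤ n
    · exact (h a h1 h2 (h3.trans (ENNReal.ofReal_le_ofReal (min_le_left _ _))) k hkn).mono (le_max_left _ _)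
    · obtain rfl : k = n + 1 := by omega
      exact (h' a h1 h2 (h3.trans (ENNReal.ofReal_le_ofReal (min_le_right _ _)))).mono (le_max_right _ _)

lemma aSharp_path {δ : ℝ} (hδ : 0 < δ) {a : 𝔸 d} (ham : Measurable a) (ha : ∀ z, inS d δ (a z)) {τ : ℝ} (h0 : 0 ≤ τ) (h1 : τ ≤ 1) :
    aSharp (pathM a τ) ≤ aSharp a := by
  unfold aSharp
  refine iSup_mono fun R ↦ iSup_mono fun hR ↦ iSup_mono fun t0 ↦ iSup_mono fun x0 ↦ ?_
  unfold aSharpCyl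
  gcongr with z
  have hV : IsFiniteMeasure (volume.restrict (ball x0 R)) := ⟨by rw [Measure.restrict_apply_univ]; exact measure_ball_lt_top⟩
  have hi : ∀ t i j, Integrable (fun y ↦ a (t, y) i j) (volume.restrict (ball x0 R)) := fun t i j ↦
    Integrable.of_bound ((meas_entry ham i j).comp measurable_prodMk_left).aestronglyMeasurable δ⁻¹
      (Filter.Eventually.of_forall fun y ↦ by simpa using (ha (t, y)).bound hδ i j)
  have e : ∀ i j, pathM a τ z i j - aTilde (pathM a τ) R x0 z.1 i j = τ * (a z i j - aTilde a R x0 z.1 i j) := by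
    intro i j
    have : aTilde (pathM a τ) R x0 z.1 i j = (1 - τ) * oneM d 0 i j + τ * aTilde a R x0 z.1 i j := by
      unfold aTilde
      have hc : volume.real (ball x0 R) ≠ 0 := (ENNReal.toReal_pos (measure_ball_pos _ _ hR).ne' measure_ball_lt_top.ne).ne'
      rw [setAverage_eq, setAverage_eq]
      have : ∀ y, pathM a τ (z.1, y) i j = (1 - τ) * oneM d 0 i j + τ * a (z.1, y) i j := fun y ↦ by simp [pathM, oneM]
      simp only [this]
      rw [integral_add (integrable_const _) ((hi _ _ _).const_mul _), integral_const_mul τ]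
      simp
      field_simp
    rw [this]
    simp [pathM, oneM]; ring
  simp only [e, mnorm, mul_pow, ← Finset.mul_sum]
  refine Real.sqrt_le_sqrt ?_
  have : τ ^ 2 ≤ 1 := by nlinarith
  have h2 : 0 ≤ ∑ i, ∑ j, (a z i j - aTilde a R x0 z.1 i j) ^ 2 := Finset.sum_nonneg fun _ _ ↦ Finset.sum_nonneg fun _ _ ↦ sq_nonneg _
  nlinarith

theorem pack (hd : 1 ≤ d) {δ : ℝ} (hδ : 0 < δ) (hδ1 : δ ≤ 1) {r : ℝ} (hr : 1 < r) (n : ℕ) :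
    ∃ aHat : ℝ, 0 < aHat ∧ ∃ N : ℝ≥0, ∀ a : Pt d → 𝕄 d, Measurable a → (∀ z, inS d δ (a z)) →
      aSharp a ≤ ℓ aHat → (∀ k ≤ n, AP (((d + 1) / d : ℝ) ^ k * r) a N) ∧ ∀ T T0, Dn T T0 r (((d + 1) / d : ℝ) ^ n * r) a := by
  obtain ⟨c, hc, N, h⟩ := Ha_fin hd hδ hδ1 hr n
  refine ⟨c, hc, N, fun a ham ha hs ↦ ⟨h a ham ha hs, fun T T0 ↦ ?_⟩⟩
  have h1 := one_le_pow₀ (n := n) (kap hd).le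
  have hp : ∀ τ, 0 ≤ τ → τ ≤ 1 → ∀ k ≤ n, AP (((d + 1) / d : ℝ) ^ k * r) (pathM a τ) N := fun τ h0 h1 ↦
    h _ (pathM_meas ham τ) (pathM_inS hδ hδ1 ha h0 h1) ((aSharp_path hδ ham ha h0 h1).trans hs)
  refine Dn_cont hd hδ hδ1 ham ha T T0 hr.le (by nlinarith) (N1 := N) (N2 := N) (fun τ h0 h1 ↦ ?_) (fun τ h0 h1 ↦ hp τ h0 h1 n le_rfl)
  simpa using hp τ h0 h1 0 (Nat.zero_le _)

def Moll (ε : ℝ) (φ : 𝔽 d) : Prop := CinfC φ ∧ (∀ y, 0 ≤ φ y) ∧ tsupport φ ⊆ closedBall 0 ε ∧ ∫ y, φ y = 1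

def WD (O : Set (Pt d)) (v : Pt d) (g gv : 𝔽 d) : Prop := ∀ ψ, CinfC ψ → tsupport ψ ⊆ O → ∫ z, g z * DD v ψ z = - ∫ z, gv z * ψ z

def Mo (φ g : 𝔽 d) : Pt d → ℝ := Av volume φ id g

lemma Moll_ex {ε : ℝ} (hε : 0 < ε) : ∃ φ : Pt d → ℝ, Moll ε φ := by
  let φ : ContDiffBump (0 : Pt d) := ⟨ε / 2, ε, by positivity, by linarith⟩
  exact ⟨φ.normed volume, ⟨φ.contDiff_normed, φ.hasCompactSupport_normed⟩, fun y ↦ φ.nonneg_normed y, φ.tsupport_normed_eq.le, φ.integral_normed⟩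

section
variable {ε : ℝ} {φ : 𝔽 d} (hφ : Moll ε φ)
include hφ

lemma Moll.small {y : Pt d} (hy : φ y ≠ 0) : ‖y‖ ≤ ε := by simpa using hφ.2.2.1 (subset_tsupport _ hy)

lemma Moll.one : ∫⁻ y, ‖φ y‖ₑ = 1 := by
  have := ofReal_integral_eq_lintegral_ofReal hφ.1.integrable (ae_of_all _ hφ.2.1)
  rw [hφ.2.2.2, ENNReal.ofReal_one] at this
  rw [this]
  exact lintegral_congr fun y ↦ by rw [Real.enorm_eq_ofReal (hφ.2.1 y)]

lemma Mo_int {g : 𝔽 d} (hg : LocallyIntegrable g volume) (z : Pt d) : Integrable fun y ↦ φ y * g (z - y) := by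
  have := (hφ.1.2.convolutionExists_left (ContinuousLinearMap.lsmul ℝ ℝ) hφ.1.cont hg) z
  simpa [ConvolutionExistsAt] using this

lemma Mo_eq (g : 𝔽 d) (z : Pt d) : Mo φ g z = ∫ y, g y * φ (z - y) := by
  rw [← integral_sub_left_eq_self _ _ z]
  simp only [Mo, Av, id, sub_sub_cancel]
  exact integral_congr_ae (ae_of_all _ fun y ↦ mul_comm _ _)

lemma Mo_conv (g : 𝔽 d) : Mo φ g = convolution g φ (ContinuousLinearMap.lsmul ℝ ℝ) volume := by
  ext z; rw [Mo_eq hφ]; simp [convolution]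

lemma Mo_sm {g : 𝔽 d} (hg : LocallyIntegrable g volume) : Sm (Mo φ g) := by
  rw [Mo_conv hφ]; exact hφ.1.2.contDiff_convolution_right _ hg hφ.1.1

lemma Mo_DD {g : 𝔽 d} (hg : LocallyIntegrable g volume) (v z : Pt d) : DD v (Mo φ g) z = ∫ y, g y * DD v φ (z - y) := by
  have h := hφ.1.2.hasFDerivAt_convolution_right (ContinuousLinearMap.lsmul ℝ ℝ) hg (hφ.1.1.of_le (by simp)) z
  rw [Mo_conv hφ, DD, h.fderiv, convolution_precompR_apply _ hg (hφ.1.2.fderiv ℝ) (hφ.1.1.continuous_fderiv (by simp))]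
  simp [convolution, DD]

lemma Mo_WD {g gv : 𝔽 d} (hg : LocallyIntegrable g volume) {O : Set (Pt d)} {v : Pt d} (h : WD O v g gv) {z : Pt d} (hz : ∀ y, ‖y‖ ≤ ε → z - y ∈ O) :
    DD v (Mo φ g) z = Mo φ gv z := by
  have hc : CinfC fun y ↦ φ (z - y) := by
    refine ⟨hφ.1.1.comp (by fun_prop), ?_⟩
    exact hφ.1.2.comp_homeomorph (Homeomorph.subLeft z)
  have hd : ∀ y, DD v (fun y ↦ φ (z - y)) y = - DD v φ (z - y) := by
    intro y
    have h1 : HasFDerivAt (fun y : Pt d ↦ z - y) (-ContinuousLinearMap.id ℝ (Pt d)) y := (hasFDerivAt_id y).const_sub z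
    have := ((hφ.1.sm.diff (z - y)).hasFDerivAt.comp y h1).fderiv
    simp only [DD]
    have e := congrArg (fun L ↦ L v) this
    simpa [Function.comp_def] using e
  have := h _ hc ?_
  · rw [Mo_DD hφ hg, Mo_eq hφ]
    simp only [hd, mul_neg, integral_neg] at this
    linarith
  · have hs : tsupport (fun y ↦ φ (z - y)) ⊆ (fun y ↦ z - y) ⁻¹' closedBall 0 ε := by
      refine closure_minimal (fun y hy ↦ ?_) (isClosed_closedBall.preimage (by fun_prop))
      simpa using hφ.small hy
    intro y hy
    have := hz (z - y) (by simpa using hs hy)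
    simpa using this

lemma Mo_norm {g : 𝔽 d} (hg : Measurable g) {s : ℝ} (hs : 1 ≤ s) : eLpNorm (Mo φ g) (ℓ s) volume ≤ eLpNorm g (ℓ s) volume := by
  have := Av_norm (ν := volume) hφ.1.meas measurable_id hg MeasurableSet.univ MeasurableSet.univ (fun _ _ _ _ ↦ mem_univ _) hs (by rw [hφ.one]; simp)
  simpa [hφ.one, Mo] using this

end

lemma CinfC.li {g : 𝔽 d} (hg : CinfC g) : LocallyIntegrable g volume := hg.integrable.locallyIntegrable

lemma MemLp.li {g : 𝔽 d} {s : ℝ} (hs : 1 ≤ s) (hg : MemLp g (ℓ s) volume) : LocallyIntegrable g volume :=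
  hg.locallyIntegrable (by simpa using hs)

lemma Mo_tendsto {g : 𝔽 d} (hgm : Measurable g) {s : ℝ} (hs : 1 ≤ s) (hg : MemLp g (ℓ s) volume) {η : ℝ} (hη : 0 < η) :
    ∀ᶠ ε in nhdsWithin (0:ℝ) (Ioi 0), ∀ φ : Pt d → ℝ, Moll ε φ → eLpNorm (fun z ↦ Mo φ g z - g z) (ℓ s) volume ≤ ℓ η := by
  have hs' : (1:ℝ≥0∞) ≤ ℓ s := by simpa using hs
  obtain ⟨g', hg1, hg2, hg3⟩ := hg.exist_eLpNorm_sub_le (by simp) hs' (show 0 < η / 3 by positivity)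
  have hgC : CinfC g' := ⟨hg2, hg1⟩
  obtain ⟨C, hC⟩ := ContDiff.lipschitzWith_of_hasCompactSupport hg1 hg2 (by simp)
  obtain ⟨R, hR⟩ := hg1.isCompact.isBounded.subset_closedBall (0 : Pt d)
  have hKf : volume (closedBall (0 : Pt d) (R + 1)) ≠ ⊤ := measure_closedBall_lt_top.ne
  obtain ⟨e, he, hCe⟩ := ofReal_pick (C := volume (closedBall (0 : Pt d) (R + 1)) ^ (ℓ s).toReal⁻¹ * ℓ C) (ε := ℓ (η / 3))
    (by finiteness) (by simpa using hη)
  have hev : ∀ᶠ ε in nhdsWithin (0:ℝ) (Ioi 0), 0 < ε ∧ ε < min e 1 :=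
    Ioo_mem_nhdsGT (lt_min he one_pos)
  filter_upwards [hev] with ε hε φ hφ
  have hε1 := hε.2.trans_le (min_le_left _ _)
  have hε2 := hε.2.trans_le (min_le_right _ _)
  have hb : ∀ z, |Mo φ g' z - g' z| ≤ C * ε := by
    intro z
    have e1 : Mo φ g' z - g' z = ∫ y, φ y * (g' (z - y) - g' z) := by
      have : ∀ y, φ y * (g' (z - y) - g' z) = φ y * g' (z - y) - φ y * g' z := fun y ↦ by ring
      simp only [this]
      rw [integral_sub (Mo_int hφ hgC.li z) (hφ.1.integrable.mul_const _), integral_mul_const, hφ.2.2.2, one_mul]; rfl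
    rw [e1, ← Real.norm_eq_abs]
    calc _ ≤ ∫ y, φ y * (C * ε) := by
          refine norm_integral_le_of_norm_le (hφ.1.integrable.mul_const _) (ae_of_all _ fun y ↦ ?_)
          by_cases hy : φ y = 0
          · simp [hy]
          rw [norm_mul, Real.norm_of_nonneg (hφ.2.1 y)]
          refine mul_le_mul_of_nonneg_left ?_ (hφ.2.1 y)
          have := hC.dist_le_mul (z - y) z
          rw [dist_eq_norm, dist_eq_norm, sub_sub_cancel_left, norm_neg] at this
          exact this.trans (mul_le_mul_of_nonneg_left (hφ.small hy) C.2)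
      _ = _ := by rw [integral_mul_const, hφ.2.2.2, one_mul]
  have hsup : Function.support (fun z ↦ Mo φ g' z - g' z) ⊆ closedBall (0 : Pt d) (R + 1) := by
    intro z hz
    by_contra hc
    simp only [mem_closedBall, dist_zero_right, not_le] at hc
    have h0 : ∀ y, ‖y‖ ≤ ε → g' (z - y) = 0 := by
      intro y hy
      by_contra h
      have h1 : ‖z - y‖ ≤ R := by simpa using hR (subset_tsupport _ h)
      have := norm_sub_norm_le z y
      linarith
    refine hz ?_
    have h1 : Mo φ g' z = 0 := by
      refine integral_eq_zero_of_ae (ae_of_all _ fun y ↦ ?_)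
      by_cases hy : φ y = 0
      · simp [hy]
      · simp [h0 y (hφ.small hy)]
    have h2 := h0 0 (by simp [hε.1.le])
    rw [sub_zero] at h2
    simp [h1, h2]
  have n2 : eLpNorm (fun z ↦ Mo φ g' z - g' z) (ℓ s) volume ≤ ℓ (η / 3) := by
    rw [← eLpNorm_restrict_eq_of_support_subset hsup]
    refine (eLpNorm_le_of_ae_bound (C := C * ε) (ae_of_all _ hb)).trans (le_trans ?_ hCe)
    rw [Measure.restrict_apply_univ, mul_assoc, ← ENNReal.ofReal_mul NNReal.zero_le_coe]
    gcongr
  have hgg := hgm.sub hgC.meas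
  have n1 : eLpNorm (Mo φ (g - g')) (ℓ s) volume ≤ ℓ (η / 3) := (Mo_norm hφ hgg hs).trans hg3
  have e : (fun z ↦ Mo φ g z - g z) = (Mo φ (g - g') + fun z ↦ Mo φ g' z - g' z) + (g' - g) := by
    ext z
    have : Mo φ (g - g') z = Mo φ g z - Mo φ g' z := by
      simp only [Mo, Av, id, Pi.sub_apply, mul_sub]
      exact integral_sub (Mo_int hφ (MemLp.li hs hg) z) (Mo_int hφ hgC.li z)
    simp [this]
  have m1 : AEStronglyMeasurable (Mo φ (g - g')) volume := (Mo_sm hφ ((MemLp.li hs hg).sub hgC.li)).continuous.aestronglyMeasurable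
  have m2 : AEStronglyMeasurable (fun z ↦ Mo φ g' z - g' z) volume := ((Mo_sm hφ hgC.li).continuous.sub hgC.cont).aestronglyMeasurable
  have hg3' : eLpNorm (g' - g) (ℓ s) volume ≤ ℓ (η / 3) := by rw [eLpNorm_sub_comm]; exact hg3
  rw [e]
  calc _ ≤ ℓ (η / 3) + ℓ (η / 3) + ℓ (η / 3) :=
        (eLpNorm_add_le (m1.add m2) (hgC.meas.sub hgm).aestronglyMeasurable hs').trans (add_le_add ((eLpNorm_add_le m1 m2 hs').trans (add_le_add n1 n2)) hg3')
    _ = _ := by rw [← ENNReal.ofReal_add (by positivity) (by positivity), ← ENNReal.ofReal_add (by positivity) (by positivity)]; congr 1; ring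

def Gf (u ut : 𝔽 d) (ui : Fin d → Pt d → ℝ) (uij : Fin d → Fin d → Pt d → ℝ) : (Unit ⊕ Unit) ⊕ (Fin d ⊕ Fin d × Fin d) → Pt d → ℝ :=
  Sum.elim (Sum.elim (fun _ ↦ u) (fun _ ↦ ut)) (Sum.elim ui (fun p ↦ uij p.1 p.2))

structure Sol (r : ℝ) (a : 𝔸 d) (u ut : 𝔽 d) (ui : Fin d → Pt d → ℝ) (uij : Fin d → Fin d → Pt d → ℝ) : Prop where
  m : ∀ k, Measurable (Gf u ut ui uij k)
  l : ∀ k, MemLp (Gf u ut ui uij k) (ℓ r) volume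
  wt : WD (cyl d 2 0 0) (et d) u ut
  wx : ∀ i, WD (cyl d 2 0 0) (ex i) u (ui i)
  wxx : ∀ i j, WD (cyl d 2 0 0) (ex j) (ui i) (uij i j)
  eq : ∀ᵐ z, z ∈ cyl d 2 0 0 → ut z + ∑ i, ∑ j, a z i j * uij i j z = 0

lemma dsum_le {x : Fin d → Fin d → ℝ} {B : ℝ} (h : ∀ i j, |x i j| ≤ B) : |∑ i, ∑ j, x i j| ≤ d * (d * B) := by
  refine (Finset.abs_sum_le_sum_abs _ _).trans ((Finset.sum_le_card_nsmul _ _ (d * B) fun i _ ↦ ?_).trans (by simp))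
  exact (Finset.abs_sum_le_sum_abs _ _).trans ((Finset.sum_le_card_nsmul _ _ B fun j _ ↦ h i j).trans (by simp))

def Fr (a : 𝔸 d) (u : 𝔽 d) (ui : Fin d → Pt d → ℝ) (ζ : 𝔽 d) (z : Pt d) : ℝ :=
  u z * Lop a ζ z + 2 * ∑ i, ∑ j, a z i j * (ui i z * Dx j ζ z)

lemma approx_V {δ : ℝ} (hδ : 0 < δ) {r : ℝ} (hr : 1 ≤ r) {a : 𝔸 d} (ha : ∀ z, inS d δ (a z))
    {u ut : 𝔽 d} {ui : Fin d → Pt d → ℝ} {uij : Fin d → Fin d → Pt d → ℝ} (S : Sol r a u ut ui uij)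
    {ζ : 𝔽 d} (hζ : CinfC ζ) (hζ1 : ∀ z, 0 ≤ ζ z ∧ ζ z ≤ 1) (hζs : ∀ z, ζ z ≠ 0 → z ∈ QQ (7/4) (0 : Pt d))
    {h : ℝ} (hh : 0 < h) {η : ℝ} (hη : 0 < η) :
    ∃ V, CinfC V ∧ (∀ z, 4 ≤ z.1 → V z = 0) ∧ eLpNorm (fun z ↦ V z - u z * ζ z) (ℓ r) (muT d h) ≤ ℓ η ∧
      eLpNorm (fun z ↦ Lop a V z - Fr a u ui ζ z) (ℓ r) (muT d h) ≤ ℓ η := by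
  obtain ⟨M1, hM1⟩ := Lop_bdd hδ ha hζ
  have : ∃ M2, ∀ j z, |Dx j ζ z| ≤ M2 := by
    choose M hM using fun j ↦ (hζ.dx j).bdd
    refine ⟨∑ j, |M j|, fun j z ↦ ((hM j z).trans (le_abs_self _)).trans (Finset.single_le_sum (f := fun j ↦ |M j|) (fun _ _ ↦ abs_nonneg _) (Finset.mem_univ j))⟩
  obtain ⟨M2', hM2'⟩ := this
  obtain ⟨M2, hM20, hM2⟩ : ∃ M2, 0 ≤ M2 ∧ ∀ j z, |Dx j ζ z| ≤ M2 := ⟨|M2'|, abs_nonneg _, fun j z ↦ (hM2' j z).trans (le_abs_self _)⟩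
  have hM10 : 0 ≤ M1 := (abs_nonneg _).trans (hM1 0)
  have hδ' : 0 < δ⁻¹ := inv_pos.2 hδ
  set C : ℝ := 1 + d * (d * δ⁻¹) + M1 + 2 * (d * (d * (δ⁻¹ * M2))) with hC
  have hC1 : 1 ≤ C := by rw [hC]; have : 0 ≤ d * (d * δ⁻¹) := by positivity
                         have : 0 ≤ 2 * (d * (d * (δ⁻¹ * M2))) := by positivity
                         linarith
  set n : ℝ := (Fintype.card ((Unit ⊕ Unit) ⊕ (Fin d ⊕ Fin d × Fin d)) : ℝ) with hn
  have hn0 : 0 < n := by rw [hn]; exact_mod_cast Fintype.card_pos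
  have hη' : 0 < η / (C * n) := by positivity
  have ev1 : ∀ᶠ ε in nhdsWithin (0:ℝ) (Ioi 0), ∀ k, ∀ φ : Pt d → ℝ, Moll ε φ → eLpNorm (fun z ↦ Mo φ (Gf u ut ui uij k) z - Gf u ut ui uij k z) (ℓ r) volume ≤ ℓ (η / (C * n)) :=
    Filter.eventually_all.2 fun k ↦ Mo_tendsto (S.m k) hr (S.l k) hη'
  have ev2 : ∀ᶠ ε in nhdsWithin (0:ℝ) (Ioi 0), 0 < ε ∧ ε < min h (1/16) := Ioo_mem_nhdsGT (lt_min hh (by norm_num))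
  obtain ⟨ε, h1, hε0, hε⟩ := (ev1.and ev2).exists
  obtain ⟨φ, hφ⟩ := Moll_ex (d := d) hε0
  have hεh := hε.trans_le (min_le_left _ _)
  have hε6 := hε.trans_le (min_le_right _ _)
  replace h1 := fun k ↦ h1 k φ hφ
  set G := Gf u ut ui uij with hG
  set e : (Unit ⊕ Unit) ⊕ (Fin d ⊕ Fin d × Fin d) → Pt d → ℝ := fun k z ↦ Mo φ (G k) z - G k z with he
  set E : Pt d → ℝ := fun z ↦ ∑ k, |e k z| with hE
  have hE0 : ∀ z, 0 ≤ E z := fun z ↦ Finset.sum_nonneg fun _ _ ↦ abs_nonneg _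
  have hek : ∀ k z, |e k z| ≤ E z := fun k z ↦ Finset.single_le_sum (f := fun k ↦ |e k z|) (fun _ _ ↦ abs_nonneg _) (Finset.mem_univ k)
  have hli : ∀ k, LocallyIntegrable (G k) volume := fun k ↦ MemLp.li hr (S.l k)
  have hem : ∀ k, Measurable (e k) := fun k ↦ (Mo_sm hφ (hli k)).continuous.measurable.sub (S.m k)
  have hEn : eLpNorm (fun z ↦ C * E z) (ℓ r) (muT d h) ≤ ℓ η := by
    rw [eLp_cmul, abs_of_pos (by linarith)]
    have : eLpNorm E (ℓ r) volume ≤ ℓ (n * (η / (C * n))) := by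
      have e1 : E = ∑ k, fun z ↦ |e k z| := by ext z; simp [hE]
      rw [e1]
      refine (eLpNorm_sum_le (fun k _ ↦ ((hem k).abs).aestronglyMeasurable) (by simpa using hr)).trans ?_
      refine (Finset.sum_le_card_nsmul _ _ (ℓ (η / (C * n))) fun k _ ↦ ?_).trans ?_
      · have := eLpNorm_norm (e k) (p := ℓ r) (μ := volume)
        simp only [Real.norm_eq_abs] at this
        rw [this]; exact h1 k
      · rw [nsmul_eq_mul, ENNReal.ofReal_mul hn0.le, hn, ENNReal.ofReal_natCast, Finset.card_univ]
    calc _ ≤ ℓ C * ℓ (n * (η / (C * n))) := mul_le_mul_right ((eLpNorm_mono_measure _ (muT_le h)).trans this) _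
      _ = _ := by rw [← ENNReal.ofReal_mul (by linarith)]; congr 1; field_simp
  have hU : Sm (Mo φ u) := Mo_sm hφ (hli (.inl (.inl ())))
  have hV : CinfC fun z ↦ Mo φ u z * ζ z := hζ.sm_mul hU

  have hin : ∀ z : Pt d, h < z.1 → z ∈ QQ (15/8) (0 : Pt d) → ∀ y, ‖y‖ ≤ ε → z - y ∈ cyl d 2 0 0 := by
    intro z hz1 hz2 y hy
    have h3 := mem_QQ.1 hz2
    simp only [Prod.fst_zero, sub_zero, Prod.snd_zero, dist_zero_right] at h3
    have y1 : |y.1| ≤ ε := (norm_fst_le y).trans hy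
    have y2 : ‖y.2‖ ≤ ε := (norm_snd_le y).trans hy
    have y3 := abs_le.1 y1
    have z3 := abs_lt.1 h3.1
    refine ⟨⟨?_, ?_⟩, ?_⟩
    · simp only [Prod.fst_sub]; linarith
    · simp only [Prod.fst_sub]; norm_num at z3 ⊢; linarith
    · simp only [Prod.snd_sub, mem_ball, dist_zero_right]
      have := norm_sub_le z.2 y.2
      linarith
  set O : Set (Pt d) := {z | h < z.1} ∩ QQ (15/8) (0 : Pt d) with hO
  have hOo : IsOpen O := (isOpen_lt continuous_const continuous_fst).inter (QQ_open _ _)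
  have dT : ∀ z ∈ O, Dt (Mo φ u) z = Mo φ ut z := fun z hz ↦ by
    rw [Dt_eq hU]; exact Mo_WD hφ (hli (.inl (.inl ()))) S.wt (hin z hz.1 hz.2)
  have dX : ∀ i, ∀ z ∈ O, Dx i (Mo φ u) z = Mo φ (ui i) z := fun i z hz ↦ by
    rw [Dx_eq hU]; exact Mo_WD hφ (hli (.inl (.inl ()))) (S.wx i) (hin z hz.1 hz.2)
  have dXX : ∀ i j, ∀ z ∈ O, Dxx i j (Mo φ u) z = Mo φ (uij i j) z := fun i j z hz ↦ by
    rw [Dxx_symm hU, Dxx, Dx_eq (hU.dx i)]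
    rw [DD_congr_open hOo (dX i) _ hz]
    exact Mo_WD hφ (hli (.inr (.inl i))) (S.wxx i j) (hin z hz.1 hz.2)
  have off : ∀ z, z ∉ QQ (15/8) (0 : Pt d) → ζ z = 0 ∧ Lop a ζ z = 0 ∧ ∀ j, Dx j ζ z = 0 := by
    intro z hz
    have hz' : z ∉ (closedBall 0 ((7/4:ℝ) ^ 2) ×ˢ closedBall 0 (7/4) : Set (Pt d)) := fun hc ↦ hz (QQ_closed_sub (by norm_num) (by norm_num) hc)
    have s0 : ∀ z, ζ z ≠ 0 → z ∈ (closedBall 0 ((7/4:ℝ) ^ 2) ×ˢ closedBall 0 (7/4) : Set (Pt d)) := fun z hz ↦ QQ_sub_closed (hζs z hz)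
    have s1 : ∀ v, DD v ζ z = 0 := fun v ↦ by_contra fun hc ↦ hz' (DD_supp_sub (box_closed _) s0 v z hc)
    have s2 : ∀ v v', DD v (DD v' ζ) z = 0 := fun v v' ↦ by_contra fun hc ↦ hz' (DD_supp_sub (box_closed _) (DD_supp_sub (box_closed _) s0 v') v z hc)
    refine ⟨by_contra fun hc ↦ hz' (s0 z hc), ?_, fun j ↦ by rw [Dx_eq hζ.sm]; exact s1 _⟩
    simp only [Lop, Dt_eq hζ.sm, Dxx_eq hζ.sm, s1, s2]; simp
  have key : ∀ᵐ z ∂(muT d h), |Lop a (fun z ↦ Mo φ u z * ζ z) z - Fr a u ui ζ z| ≤ C * E z := by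
    rw [muT, ae_restrict_iff' (measSet_T h)]
    filter_upwards [S.eq] with z hz hzh
    rw [Lop_mul ha hU hζ.sm]
    by_cases hzO : z ∈ QQ (15/8) (0 : Pt d)
    swap
    · obtain ⟨o1, o2, o3⟩ := off z hzO
      simp only [Fr, o1, o2, o3]
      simp; exact mul_nonneg (by linarith) (hE0 z)
    have hz' : z ∈ O := ⟨hzh, hzO⟩
    replace hz := hz (by simpa using hin z hzh hzO 0 (by simpa using hε0.le))
    have eL : Lop a (Mo φ u) z = e (.inl (.inr ())) z + ∑ i, ∑ j, a z i j * e (.inr (.inr (i, j))) z := by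
      simp only [Lop, dT z hz', dXX _ _ z hz', he, hG, Gf, Sum.elim_inl, Sum.elim_inr, mul_sub, Finset.sum_sub_distrib]
      linarith
    have eD : Lop a (Mo φ u) z * ζ z + Mo φ u z * Lop a ζ z + 2 * ∑ i, ∑ j, a z i j * (Dx i (Mo φ u) z * Dx j ζ z) - Fr a u ui ζ z
        = (e (.inl (.inr ())) z + ∑ i, ∑ j, a z i j * e (.inr (.inr (i, j))) z) * ζ z + e (.inl (.inl ())) z * Lop a ζ z + 2 * ∑ i, ∑ j, a z i j * (e (.inr (.inl i)) z * Dx j ζ z) := by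
      rw [eL]
      simp only [Fr, dX _ z hz', he, hG, Gf, Sum.elim_inl, Sum.elim_inr, mul_sub, sub_mul, Finset.sum_sub_distrib]
      ring
    rw [eD]
    have b1 : |∑ i, ∑ j, a z i j * e (.inr (.inr (i, j))) z| ≤ d * (d * (δ⁻¹ * E z)) := dsum_le fun i j ↦ by
      rw [abs_mul]; exact mul_le_mul ((ha z).bound hδ i j) (hek _ z) (abs_nonneg _) hδ'.le
    have b2 : |∑ i, ∑ j, a z i j * (e (.inr (.inl i)) z * Dx j ζ z)| ≤ d * (d * (δ⁻¹ * (E z * M2))) := dsum_le fun i j ↦ by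
      rw [abs_mul, abs_mul]
      exact mul_le_mul ((ha z).bound hδ i j) (mul_le_mul (hek _ z) (hM2 j z) (abs_nonneg _) (hE0 z)) (by positivity) hδ'.le
    have b3 : |e (.inl (.inl ())) z * Lop a ζ z| ≤ E z * M1 := by
      rw [abs_mul]; exact mul_le_mul (hek _ z) (hM1 z) (abs_nonneg _) (hE0 z)
    have b4 : |(e (.inl (.inr ())) z + ∑ i, ∑ j, a z i j * e (.inr (.inr (i, j))) z) * ζ z| ≤ E z + d * (d * (δ⁻¹ * E z)) := by
      rw [abs_mul, abs_of_nonneg (hζ1 z).1]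
      refine (mul_le_of_le_one_right (abs_nonneg _) (hζ1 z).2).trans ((abs_add_le _ _).trans (add_le_add (hek _ z) b1))
    have b5 : C * E z = (E z + d * (d * (δ⁻¹ * E z))) + E z * M1 + 2 * (d * (d * (δ⁻¹ * (E z * M2)))) := by rw [hC]; ring
    rw [b5]
    refine (abs_add_le _ _).trans (add_le_add ((abs_add_le _ _).trans (add_le_add b4 b3)) ?_)
    rw [abs_mul, abs_two]; linarith
  refine ⟨fun z ↦ Mo φ u z * ζ z, hV, fun z hz ↦ ?_, ?_, ?_⟩
  · have : ζ z = 0 := by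
      by_contra hc
      have h3 := (mem_QQ.1 (hζs z hc)).1
      have h4 := (abs_lt.1 h3).2
      simp only [Prod.fst_zero, sub_zero] at h4; linarith
    simp [this]
  · refine le_trans (eLpNorm_mono_ae_real (ae_of_all _ fun z ↦ ?_)) hEn
    rw [Real.norm_eq_abs, ← sub_mul, abs_mul, abs_of_nonneg (hζ1 z).1]
    refine (mul_le_of_le_one_right (abs_nonneg _) (hζ1 z).2).trans ((hek (.inl (.inl ())) z).trans ?_)
    exact le_mul_of_one_le_left (hE0 z) hC1
  · exact le_trans (eLpNorm_mono_ae_real key) hEn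

lemma poinc {s : ℝ} (hs : 1 ≤ s) {h : ℝ} (hh : 0 ≤ h) {g : 𝔽 d} (hg : CinfC g) (hg4 : ∀ z : Pt d, 4 ≤ z.1 → g z = 0) :
    eLpNorm g (ℓ s) (muT d h) ≤ 4 * eLpNorm (Dt g) (ℓ s) (muT d h) := by
  have hki : ∫⁻ y : ℝ, ‖(Ioc (0:ℝ) 4).indicator (fun _ ↦ (1:ℝ)) y‖ₑ = 4 := by
    have : ∀ y : ℝ, ‖(Ioc (0:ℝ) 4).indicator (fun _ ↦ (1:ℝ)) y‖ₑ = (Ioc (0:ℝ) 4).indicator (fun _ ↦ (1:ℝ≥0∞)) y := fun y ↦ by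
      by_cases hy : y ∈ Ioc (0:ℝ) 4 <;> simp [hy, Set.indicator]
    simp_rw [this]
    rw [lintegral_indicator measurableSet_Ioc]
    simp
  have := Av_norm (ν := (volume : Measure ℝ)) (k := (Ioc (0:ℝ) 4).indicator fun _ ↦ (1:ℝ)) (g := fun y : ℝ ↦ ((-y, 0) : Pt d))
    (measurable_const.indicator measurableSet_Ioc) (by fun_prop) hg.dt.meas (measSet_T h) (measSet_T h) (fun y hy z hz ↦ ?_) hs (by rw [hki]; finiteness)
  · rw [hki] at this
    refine le_trans (le_of_eq ?_) this
    rw [← eLpNorm_neg]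
    refine eLpNorm_congr_ae ?_
    filter_upwards [ae_restrict_mem (measSet_T h)] with z hz
    have hz' : h < z.1 := hz
    have e1 : ∫ y in (0:ℝ)..4, DD (et d) g (z + y • et d) = g (z + (4:ℝ) • et d) - g (z + (0:ℝ) • et d) :=
      intervalIntegral.integral_eq_sub_of_hasDerivAt (f := fun θ : ℝ ↦ g (z + θ • et d)) (fun θ _ ↦ hasDeriv_line hg.1 z _ θ)
        (((hg.dd _).cont.comp (by fun_prop)).intervalIntegrable _ _)
    have e2 : g (z + (4:ℝ) • et d) = 0 := hg4 _ (by simp [et]; linarith)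
    rw [e2, zero_smul, add_zero, zero_sub] at e1
    rw [Pi.neg_apply, ← e1, intervalIntegral.integral_of_le (by norm_num), ← integral_indicator measurableSet_Ioc, Av]
    refine integral_congr_ae (ae_of_all _ fun y ↦ ?_)
    have e3 : z - ((-y, 0) : Pt d) = z + y • et d := by ext <;> simp [et]
    by_cases hy : y ∈ Ioc (0:ℝ) 4
    · simp only [indicator_of_mem hy, one_mul, e3, Dt_eq hg.1]
    · simp only [indicator_of_notMem hy, zero_mul]
  · have hy' : y ∈ Ioc (0:ℝ) 4 := by
      by_contra hc; exact hy (indicator_of_notMem hc _)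
    have hz' : h < z.1 := hz
    show h < z.1 - -y
    linarith [hy'.1]

lemma Dt_bd {δ : ℝ} (hδ : 0 < δ) {s : ℝ} (hs : 1 ≤ s) {a : 𝔸 d} (ham : Measurable a) (ha : ∀ z, inS d δ (a z)) {N : ℝ≥0} (hA : AP s a N)
    {g : 𝔽 d} (hg : CinfC g) (T : ℝ) :
    eLpNorm (Dt g) (ℓ s) (muT d T) ≤ (1 + d * (d * (ℓ δ⁻¹ * N))) * eLpNorm (Lop a g) (ℓ s) (muT d T) := by
  have hs' : (1:ℝ≥0∞) ≤ ℓ s := by simpa using hs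
  have e : Dt g = fun z ↦ Lop a g z - ∑ i, ∑ j, a z i j * Dxx i j g z := by ext z; simp [Lop]
  have hm : ∀ i j, AEStronglyMeasurable (fun z ↦ a z i j * Dxx i j g z) (muT d T) := fun i j ↦
    ((meas_entry ham i j).mul (hg.dxx i j).meas).aestronglyMeasurable
  have b : ∀ i j, eLpNorm (fun z ↦ a z i j * Dxx i j g z) (ℓ s) (muT d T) ≤ ℓ δ⁻¹ * N * eLpNorm (Lop a g) (ℓ s) (muT d T) := by
    intro i j
    have h1 : eLpNorm (fun z ↦ a z i j * Dxx i j g z) (ℓ s) (muT d T) ≤ eLpNorm (fun z ↦ δ⁻¹ * Dxx i j g z) (ℓ s) (muT d T) := by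
      refine eLpNorm_mono fun z ↦ ?_
      rw [norm_mul, norm_mul]
      refine mul_le_mul_of_nonneg_right ?_ (norm_nonneg _)
      rw [Real.norm_eq_abs, Real.norm_of_nonneg (inv_pos.2 hδ).le]; exact (ha z).bound hδ i j
    rw [eLp_cmul, abs_of_pos (inv_pos.2 hδ)] at h1
    refine h1.trans ?_
    rw [mul_assoc]; exact mul_le_mul_right (hA T g hg i j) _
  have c : eLpNorm (fun z ↦ ∑ i, ∑ j, a z i j * Dxx i j g z) (ℓ s) (muT d T) ≤ d * (d * (ℓ δ⁻¹ * N * eLpNorm (Lop a g) (ℓ s) (muT d T))) := by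
    have e1 : (fun z ↦ ∑ i, ∑ j, a z i j * Dxx i j g z) = ∑ i, ∑ j, fun z ↦ a z i j * Dxx i j g z := by ext z; simp
    rw [e1]
    refine (eLpNorm_sum_le (fun i _ ↦ Finset.aestronglyMeasurable_sum _ fun j _ ↦ hm i j) hs').trans ?_
    refine (Finset.sum_le_card_nsmul _ _ _ fun i _ ↦ (eLpNorm_sum_le (fun j _ ↦ hm i j) hs').trans (Finset.sum_le_card_nsmul _ _ _ fun j _ ↦ b i j)).trans ?_
    simp
  rw [e]
  refine (eLpNorm_sub_le (Lop_meas ham hg).aestronglyMeasurable ?_ hs').trans ?_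
  · exact (Finset.measurable_sum _ fun i _ ↦ Finset.measurable_sum _ fun j _ ↦ (meas_entry ham i j).mul (hg.dxx i j).meas).aestronglyMeasurable
  · rw [add_mul, one_mul]
    refine add_le_add le_rfl (c.trans (le_of_eq (by ring)))

lemma lemA {δ : ℝ} (hδ : 0 < δ) {r m : ℝ} (hr : 1 ≤ r) {a : 𝔸 d} (ham : Measurable a) (ha : ∀ z, inS d δ (a z))
    {N : ℝ≥0} (hA : AP r a N) {h : ℝ} (hh : 0 ≤ h) (hD : Dn h 4 r m a) {f v : 𝔽 d} (hfm : Measurable f) (hvm : Measurable v)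
    (hf : MemLp f (ℓ r) volume) (hf4 : ∀ z : Pt d, 4 ≤ z.1 → f z = 0) (hfc : HasCompactSupport f)
    (hfQ : ∀ z ∈ QQ (3/2) (0 : Pt d), f z = 0)
    (hV : ∀ η : ℝ, 0 < η → ∃ V, CinfC V ∧ (∀ z : Pt d, 4 ≤ z.1 → V z = 0) ∧ eLpNorm (fun z ↦ V z - v z) (ℓ r) (muT d h) ≤ ℓ η ∧
      eLpNorm (fun z ↦ Lop a V z - f z) (ℓ r) (muT d h) ≤ ℓ η) {ε : ℝ≥0∞} (hε : ε ≠ 0) :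
    ∃ w, CinfC w ∧ eLpNorm (fun z ↦ w z - v z) (ℓ r) (muT d h) ≤ ε ∧
      eLpNorm (Lop a w) (ℓ m) ((muT d h).restrict (QQ (3/2) (0 : Pt d))) ≤ ε := by
  have hs' : (1:ℝ≥0∞) ≤ ℓ r := by simpa using hr
  set K : ℝ≥0∞ := 4 * ((1 + d * (d * (ℓ δ⁻¹ * N))) * 3) + 1 with hK
  obtain ⟨η, hη, hKη⟩ := ofReal_pick (C := K) (ε := ε) (by rw [hK]; finiteness) hε
  have hK1 : 1 ≤ K := by rw [hK]; exact le_add_self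
  have hηε : ℓ η ≤ ε := le_trans (by simpa using mul_le_mul_left hK1 (ℓ η)) hKη
  obtain ⟨V, hVc, hV4, hV1, hV2⟩ := hV η hη
  obtain ⟨M, hM0, hM⟩ := hf.eLpNorm_indicator_norm_ge_pos_le hfm.stronglyMeasurable hη
  set A : Set (Pt d) := {x | M ≤ ‖f x‖₊} with hAd
  have hAm : MeasurableSet A := measurableSet_le measurable_const (by fun_prop)
  set f' : Pt d → ℝ := Aᶜ.indicator f with hf'
  have hf'0 : ∀ z, f z = 0 → f' z = 0 := fun z hz ↦ by simp [hf', Set.indicator, hz]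
  have hf'm : Measurable f' := hfm.indicator hAm.compl
  have hBC : BC f' := by
    refine ⟨hf'm.aestronglyMeasurable, ⟨M, fun z ↦ ?_⟩, hfc.mono fun z hz hc ↦ hz (hf'0 z hc)⟩
    by_cases hz : z ∈ A
    · simp [hf', hz, hM0.le]
    · simp only [hf', indicator_of_mem (show z ∈ Aᶜ from hz)]
      have : ¬ (M ≤ ‖f z‖) := hz
      rw [Real.norm_eq_abs] at this; linarith
  obtain ⟨w, hw, hw4, hw1, hw2⟩ := hD f' hBC (fun z hz ↦ hf'0 z (hf4 z hz)) (ℓ η) (by simpa using hη)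
  refine ⟨w, hw, ?_, ?_⟩
  · have hg : CinfC fun z ↦ w z - V z := hw.sub hVc
    have hLg : eLpNorm (Lop a fun z ↦ w z - V z) (ℓ r) (muT d h) ≤ 3 * ℓ η := by
      have e : (Lop a fun z ↦ w z - V z) = (fun z ↦ Lop a w z - f' z) + ((fun z ↦ - A.indicator f z) + (fun z ↦ - (Lop a V z - f z))) := by
        ext z
        simp only [Lop_sub a hw.sm hVc.sm, Pi.add_apply, hf']
        have := congrFun (indicator_self_add_compl A f) z
        simp only [Pi.add_apply] at this
        linarith
      have m1 := ((Lop_meas ham hw).sub hf'm).aestronglyMeasurable (μ := muT d h)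
      have m2 := (hfm.indicator hAm).neg.aestronglyMeasurable (μ := muT d h)
      have m3 := ((Lop_meas ham hVc).sub hfm).neg.aestronglyMeasurable (μ := muT d h)
      rw [e]
      have n2 : eLpNorm (fun z ↦ - A.indicator f z) (ℓ r) (muT d h) ≤ ℓ η :=
        (eLpNorm_neg (A.indicator f) _ _).le.trans ((eLpNorm_mono_measure _ (muT_le h)).trans hM)
      have n3 : eLpNorm (fun z ↦ - (Lop a V z - f z)) (ℓ r) (muT d h) ≤ ℓ η :=
        (eLpNorm_neg (fun z ↦ Lop a V z - f z) _ _).le.trans hV2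
      refine (eLpNorm_add_le m1 (m2.add m3) hs').trans ?_
      refine (add_le_add hw1 ((eLpNorm_add_le m2 m3 hs').trans (add_le_add n2 n3))).trans (le_of_eq (by ring))
    have hP := poinc hr hh hg fun z hz ↦ by rw [hw4 z hz, hV4 z hz, sub_zero]
    have hDt := Dt_bd hδ hr ham ha hA hg h
    have e : (fun z ↦ w z - v z) = (fun z ↦ w z - V z) + fun z ↦ V z - v z := by ext z; simp
    rw [e]
    refine (eLpNorm_add_le hg.meas.aestronglyMeasurable (hVc.meas.sub hvm).aestronglyMeasurable hs').trans ?_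
    refine le_trans (add_le_add (hP.trans (mul_le_mul_right (hDt.trans (mul_le_mul_right hLg _)) _)) hV1) (le_trans (le_of_eq ?_) hKη)
    rw [hK]; ring
  · refine le_trans (le_of_eq (eLpNorm_congr_ae ?_)) (((eLpNorm_mono_measure _ Measure.restrict_le_self).trans hw2).trans hηε)
    filter_upwards [ae_restrict_mem (QQ_meas _ _)] with z hz
    rw [hf'0 z (hfQ z hz), sub_zero]

lemma chain (hd : 1 ≤ d) {δ : ℝ} (hδ : 0 < δ) {r : ℝ} (hr : 1 ≤ r) (N : ℝ≥0) (n : ℕ) : ∀ A B : ℝ, 0 < A → A < B →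
    ∃ C : ℝ≥0, ∀ a : Pt d → 𝕄 d, Measurable a → (∀ z, inS d δ (a z)) → (∀ k ≤ n, AP (((d + 1) / d : ℝ) ^ k * r) a N) → ∀ (T : ℝ) (V : 𝔽 d), CinfC V →
      eLpNorm V (ℓ (((d + 1) / d : ℝ) ^ n * r)) ((muT d T).restrict (QQ A 0)) ≤
        C * (eLpNorm V (ℓ r) ((muT d T).restrict (QQ B 0)) + eLpNorm (Lop a V) (ℓ (((d + 1) / d : ℝ) ^ n * r)) ((muT d T).restrict (QQ B 0))) := by
  have hk := kap hd
  induction n with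
  | zero =>
    intro A B hA hAB
    refine ⟨1, fun a _ _ _ T V _ ↦ ?_⟩
    simp only [pow_zero, one_mul, ENNReal.coe_one]
    exact (eLpNorm_mono_measure _ (Measure.restrict_mono_set _ (QQ_mono hA.le hAB.le 0))).trans le_self_add
  | succ n ih =>
    intro A B hA hAB
    set M := (A + B) / 2 with hM
    have hAM : A < M := by rw [hM]; linarith
    have hMB : M < B := by rw [hM]; linarith
    have hs : 1 ≤ ((d + 1) / d : ℝ) ^ n * r := one_le_mul_of_one_le_of_one_le (one_le_pow₀ hk.le) hr
    obtain ⟨C2, h2⟩ := ih M B (hA.trans hAM) hMB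
    obtain ⟨C1, h1⟩ := LOC hd hδ hs N hA hAM
    set s := ((d + 1) / d : ℝ) ^ n * r with hsd
    have es : ((d + 1) / d : ℝ) ^ (n + 1) * r = (d + 1) / d * s := by rw [hsd]; ring
    rw [es]
    set s' := (d + 1) / d * s with hs'd
    have hss : s ≤ s' := le_mul_of_one_le_left (by linarith) hk.le
    have hs'0 : 0 < s' := by linarith
    set H : ℝ≥0∞ := volume (QQ B (0 : Pt d)) ^ (1 / s - 1 / s') with hH
    have hee : 0 ≤ 1 / s - 1 / s' := sub_nonneg.2 (one_div_le_one_div_of_le (by linarith) hss)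
    have hHt : H ≠ ⊤ := ENNReal.rpow_ne_top_of_nonneg hee (vol_QQ_top (by linarith) 0)
    clear_value H
    lift H to ℝ≥0 using hHt
    refine ⟨C1 * (C2 + C2 * H + H), fun a ham ha hAP T V hV ↦ ?_⟩
    have i1 := h1 a ham ha (hAP n (Nat.le_succ n)) T V hV
    have i2 := h2 a ham ha (fun k hk ↦ hAP k (hk.trans (Nat.le_succ n))) T V hV
    have i3 : eLpNorm (Lop a V) (ℓ s) ((muT d T).restrict (QQ B 0)) ≤ H * eLpNorm (Lop a V) (ℓ s') ((muT d T).restrict (QQ B 0)) := by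
      refine (eLpNorm_le_eLpNorm_mul_rpow_measure_univ (ENNReal.ofReal_le_ofReal hss) (Lop_meas ham hV).aestronglyMeasurable).trans ?_
      rw [mul_comm, ENNReal.toReal_ofReal (by linarith), ENNReal.toReal_ofReal (by linarith), hH]
      refine mul_le_mul_left (ENNReal.rpow_le_rpow ?_ hee) _
      rw [Measure.restrict_apply_univ]; exact muT_le T _
    have i4 : eLpNorm (Lop a V) (ℓ s) ((muT d T).restrict (QQ M 0)) ≤ eLpNorm (Lop a V) (ℓ s) ((muT d T).restrict (QQ B 0)) :=
      eLpNorm_mono_measure _ (Measure.restrict_mono_set _ (QQ_mono (by linarith) hMB.le 0))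
    set X := eLpNorm V (ℓ r) ((muT d T).restrict (QQ B 0))
    set Y := eLpNorm (Lop a V) (ℓ s') ((muT d T).restrict (QQ B 0))
    refine i1.trans ?_
    push_cast
    rw [mul_assoc]
    refine mul_le_mul_right ?_ _
    calc _ ≤ C2 * (X + H * Y) + H * Y := add_le_add (i2.trans (mul_le_mul_right (add_le_add le_rfl i3) _)) (i4.trans i3)
      _ ≤ (C2 + C2 * H + H) * (X + Y) := by
        have : (C2 + C2 * H + H) * (X + Y) = (C2 * (X + H * Y) + H * Y) + (C2 * Y + (C2 * H + H) * X) := by ring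
        rw [this]; exact le_self_add

lemma fatou {α : Type*} [MeasurableSpace α] {μ : Measure α} {p : ℝ≥0∞} {f : ℕ → α → ℝ} {g : α → ℝ} (hf : ∀ k, AEStronglyMeasurable (f k) μ)
    {B : ℕ → ℝ≥0∞} {b : ℝ≥0∞} (hB : Filter.Tendsto B Filter.atTop (nhds b)) (h : ∀ k, eLpNorm (f k) p μ ≤ B k)
    (hl : ∀ᵐ x ∂μ, Filter.Tendsto (fun k ↦ f k x) Filter.atTop (nhds (g x))) : eLpNorm g p μ ≤ b := by
  refine (Lp.eLpNorm_lim_le_liminf_eLpNorm hf g hl).trans ?_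
  rw [← hB.liminf_eq]
  exact Filter.liminf_le_liminf (Filter.Eventually.of_forall h)

lemma main_h (hd : 1 ≤ d) {δ : ℝ} (hδ : 0 < δ) {r : ℝ} (hr : 1 ≤ r) {n : ℕ} {N C : ℝ≥0}
    (hC : ∀ a : Pt d → 𝕄 d, Measurable a → (∀ z, inS d δ (a z)) → (∀ k ≤ n, AP (((d + 1) / d : ℝ) ^ k * r) a N) → ∀ (T : ℝ) (V : 𝔽 d), CinfC V →
      eLpNorm V (ℓ (((d + 1) / d : ℝ) ^ n * r)) ((muT d T).restrict (QQ 1 0)) ≤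
        C * (eLpNorm V (ℓ r) ((muT d T).restrict (QQ (3/2) 0)) + eLpNorm (Lop a V) (ℓ (((d + 1) / d : ℝ) ^ n * r)) ((muT d T).restrict (QQ (3/2) 0))))
    {a : 𝔸 d} (ham : Measurable a) (ha : ∀ z, inS d δ (a z))
    (hAP : ∀ k ≤ n, AP (((d + 1) / d : ℝ) ^ k * r) a N) (hDn : ∀ T T0, Dn T T0 r (((d + 1) / d : ℝ) ^ n * r) a)
    {u ut : 𝔽 d} {ui : Fin d → Pt d → ℝ} {uij : Fin d → Fin d → Pt d → ℝ} (S : Sol r a u ut ui uij) {h : ℝ} (hh : 0 < h) :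
    eLpNorm u (ℓ (((d + 1) / d : ℝ) ^ n * r)) ((muT d h).restrict (QQ 1 0)) ≤ C * eLpNorm u (ℓ r) (volume.restrict (cyl d 2 0 0)) := by
  have hr' : (1:ℝ≥0∞) ≤ ℓ r := by simpa using hr
  set m := ((d + 1) / d : ℝ) ^ n * r with hm
  obtain ⟨K, hK0, hcut⟩ := cutoff (d := d) (A := 3/2) (B := 7/4) (by norm_num)
  obtain ⟨ζ, hζ, hζ1, hζQ, hζs, -, -, -⟩ := hcut (3/2) (7/4) le_rfl (by norm_num) le_rfl
  have hbox : IsCompact (closedBall 0 ((7/4:ℝ) ^ 2) ×ˢ closedBall 0 (7/4) : Set (Pt d)) := (isCompact_closedBall _ _).prod (isCompact_closedBall _ _)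
  have hζc : CinfC ζ := ⟨hζ, HasCompactSupport.of_support_subset_isCompact hbox fun z hz ↦ QQ_sub_closed (hζs z hz)⟩
  have hu := S.m (.inl (.inl ()))
  have huL := S.l (.inl (.inl ()))
  have hui := fun i ↦ S.m (.inr (.inl i))
  have huiL := fun i ↦ S.l (.inr (.inl i))
  simp only [Gf, Sum.elim_inl, Sum.elim_inr] at hu huL hui huiL
  have s0 : ∀ z, ζ z ≠ 0 → z ∈ (closedBall 0 ((7/4:ℝ) ^ 2) ×ˢ closedBall 0 (7/4) : Set (Pt d)) := fun z hz ↦ QQ_sub_closed (hζs z hz)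
  have off : ∀ z, z ∉ (closedBall 0 ((7/4:ℝ) ^ 2) ×ˢ closedBall 0 (7/4) : Set (Pt d)) → Fr a u ui ζ z = 0 := by
    intro z hz'
    have s1 : ∀ v, DD v ζ z = 0 := fun v ↦ by_contra fun hc ↦ hz' (DD_supp_sub (box_closed _) s0 v z hc)
    have s2 : ∀ v v', DD v (DD v' ζ) z = 0 := fun v v' ↦ by_contra fun hc ↦ hz' (DD_supp_sub (box_closed _) (DD_supp_sub (box_closed _) s0 v') v z hc)
    simp only [Fr, Lop, Dt_eq hζ, Dxx_eq hζ, Dx_eq hζ, s1, s2]; simp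
  have inn : ∀ z ∈ QQ (3/2) (0 : Pt d), Fr a u ui ζ z = 0 := by
    have c0 : ∀ v, ∀ z ∈ QQ (3/2) (0 : Pt d), DD v ζ z = 0 := fun v z hz ↦ by
      rw [DD_congr_open (v := fun _ ↦ 1) (QQ_open _ _) hζQ v hz]; simp [DD]
    have c1 : ∀ v v', ∀ z ∈ QQ (3/2) (0 : Pt d), DD v (DD v' ζ) z = 0 := fun v v' z hz ↦ by
      rw [DD_congr_open (v := fun _ ↦ 0) (QQ_open _ _) (c0 v') v hz]; simp [DD]
    intro z hz
    simp only [Fr, Lop, Dt_eq hζ, Dxx_eq hζ, Dx_eq hζ, c0 _ z hz, c1 _ _ z hz]; simp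
  have hFm : Measurable (Fr a u ui ζ) := by
    refine (hu.mul (Lop_meas ham hζc)).add (Measurable.const_mul (Finset.measurable_sum _ fun i _ ↦ Finset.measurable_sum _ fun j _ ↦ ?_) 2)
    exact (meas_entry ham i j).mul ((hui i).mul (hζc.dx j).meas)
  have hFL : MemLp (Fr a u ui ζ) (ℓ r) volume := by
    have bm : ∀ {f g : 𝔽 d}, MemLp f (ℓ r) volume → Measurable g → (∃ M, ∀ z, |g z| ≤ M) → MemLp (fun z ↦ f z * g z) (ℓ r) volume := by
      rintro f g hf hg ⟨M, hM⟩
      refine (hf.const_mul M).mono (hf.1.mul hg.aestronglyMeasurable) (ae_of_all _ fun z ↦ ?_)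
      rw [norm_mul, norm_mul, mul_comm]
      exact mul_le_mul_of_nonneg_right ((hM z).trans (le_abs_self M)) (norm_nonneg _)
    have t1 := bm huL (Lop_meas ham hζc) (Lop_bdd hδ ha hζc)
    have t2 : ∀ i j, MemLp (fun z ↦ a z i j * (ui i z * Dx j ζ z)) (ℓ r) volume := fun i j ↦ by
      obtain ⟨M, hM⟩ := (hζc.dx j).bdd
      have := bm (huiL i) ((meas_entry ham i j).mul (hζc.dx j).meas) ⟨δ⁻¹ * M, fun z ↦ ?_⟩
      · refine this.congr_norm ((meas_entry ham i j).mul ((hui i).mul (hζc.dx j).meas)).aestronglyMeasurable (ae_of_all _ fun z ↦ ?_)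
        simp only [Pi.mul_apply]
        congr 1; ring
      · simp only [Pi.mul_apply]
        rw [abs_mul]; exact mul_le_mul ((ha z).bound hδ i j) (hM z) (abs_nonneg _) (inv_pos.2 hδ).le
    have t3 : MemLp (fun z ↦ ∑ i, ∑ j, a z i j * (ui i z * Dx j ζ z)) (ℓ r) volume :=
      memLp_finsetSum _ fun i _ ↦ memLp_finsetSum _ fun j _ ↦ t2 i j
    have t4 := t3.const_mul 2
    have t5 := t1.add t4
    exact t5
  have hF4 : ∀ z : Pt d, 4 ≤ z.1 → Fr a u ui ζ z = 0 := fun z hz ↦ off z fun hc ↦ by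
    have := hc.1
    rw [mem_closedBall, Real.dist_eq, sub_zero] at this
    have := (abs_le.1 this).2
    norm_num at this; linarith
  have hFc : HasCompactSupport (Fr a u ui ζ) := HasCompactSupport.of_support_subset_isCompact hbox fun z hz ↦ by_contra fun hc ↦ hz (off z hc)
  have hvm : Measurable fun z ↦ u z * ζ z := hu.mul hζc.meas
  have hAP0 : AP r a N := by simpa using hAP 0 (Nat.zero_le _)
  have hk0 : ∀ k : ℕ, ((k:ℝ≥0∞) + 1)⁻¹ ≠ 0 := fun k ↦ by simp
  choose w hw hw1 hw2 using fun k : ℕ ↦ lemA hδ hr ham ha hAP0 hh.le (hDn h 4) hFm hvm hFL hF4 hFc inn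
    (fun η hη ↦ approx_V hδ hr ha S hζc hζ1 hζs hh hη) (hk0 k)
  have hlim : Filter.Tendsto (fun k : ℕ ↦ ((k:ℝ≥0∞) + 1)⁻¹) Filter.atTop (nhds 0) := by
    have := (Filter.tendsto_add_atTop_iff_nat 1).2 ENNReal.tendsto_inv_nat_nhds_zero
    simpa using this
  set μ := (muT d h).restrict (QQ 1 (0 : Pt d)) with hμ
  have hLr : Filter.Tendsto (fun k ↦ eLpNorm (w k - fun z ↦ u z * ζ z) (ℓ r) μ) Filter.atTop (nhds 0) :=
    tendsto_of_tendsto_of_tendsto_of_le_of_le tendsto_const_nhds hlim (fun _ ↦ zero_le) fun k ↦ (eLpNorm_mono_measure _ Measure.restrict_le_self).trans (hw1 k)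
  have hTM := tendstoInMeasure_of_tendsto_eLpNorm (by simpa using (by linarith : 0 < r)) (fun k ↦ (hw k).meas.aestronglyMeasurable) hvm.aestronglyMeasurable hLr
  obtain ⟨ns, hns, hae⟩ := hTM.exists_seq_tendsto_ae
  set D := eLpNorm u (ℓ r) (volume.restrict (cyl d 2 0 0)) with hD
  have hvD : eLpNorm (fun z ↦ u z * ζ z) (ℓ r) ((muT d h).restrict (QQ (3/2) (0 : Pt d))) ≤ D := by
    have : eLpNorm (fun z ↦ u z * ζ z) (ℓ r) ((muT d h).restrict (QQ (3/2) (0 : Pt d))) ≤ eLpNorm u (ℓ r) ((muT d h).restrict (QQ (3/2) (0 : Pt d))) := by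
      refine eLpNorm_mono fun z ↦ ?_
      rw [norm_mul, Real.norm_of_nonneg (hζ1 z).1]
      exact mul_le_of_le_one_right (norm_nonneg _) (hζ1 z).2
    refine this.trans ?_
    rw [muT_restrict h (QQ_meas _ _)]
    refine eLpNorm_mono_measure _ (Measure.restrict_mono_set _ ?_)
    rintro z ⟨h1, h2⟩
    have h2' : h < z.1 := h2
    have h3 := mem_QQ.1 h1
    simp only [Prod.fst_zero, sub_zero, Prod.snd_zero] at h3
    have h4 := (abs_lt.1 h3.1).2
    refine ⟨⟨by linarith, by norm_num at h4 ⊢; linarith⟩, ?_⟩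
    rw [mem_ball]; linarith [h3.2]
  have hwb : ∀ k, eLpNorm (w k) (ℓ m) μ ≤ C * (D + ((k:ℝ≥0∞) + 1)⁻¹ + ((k:ℝ≥0∞) + 1)⁻¹) := by
    intro k
    refine (hC a ham ha hAP h (w k) (hw k)).trans (mul_le_mul_right (add_le_add ?_ (hw2 k)) _)
    have e : w k = (fun z ↦ u z * ζ z) + fun z ↦ w k z - u z * ζ z := by ext z; simp
    rw [e]
    refine (eLpNorm_add_le hvm.aestronglyMeasurable ((hw k).meas.sub hvm).aestronglyMeasurable hr').trans (add_le_add hvD ?_)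
    exact (eLpNorm_mono_measure _ Measure.restrict_le_self).trans (hw1 k)
  have hBt : Filter.Tendsto (fun k : ℕ ↦ C * (D + ((k:ℝ≥0∞) + 1)⁻¹ + ((k:ℝ≥0∞) + 1)⁻¹)) Filter.atTop (nhds (C * D)) := by
    have := ENNReal.Tendsto.const_mul ((tendsto_const_nhds (x := D)).add hlim |>.add hlim) (Or.inr (ENNReal.coe_ne_top (r := C)))
    simpa using this
  have fin := fatou (p := ℓ m) (fun k ↦ (hw (ns k)).meas.aestronglyMeasurable) (hBt.comp hns.tendsto_atTop) (fun k ↦ hwb (ns k)) hae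
  refine le_trans (le_of_eq (eLpNorm_congr_ae ?_)) fin
  filter_upwards [ae_restrict_mem (QQ_meas _ _)] with z hz
  rw [hζQ z (QQ_mono (by norm_num) (by norm_num) 0 hz), mul_one]

theorem main_m (hd : 1 ≤ d) {δ : ℝ} (hδ : 0 < δ) (hδ1 : δ ≤ 1) {r : ℝ} (hr : 1 < r) (n : ℕ) :
    ∃ aHat : ℝ, 0 < aHat ∧ ∃ C : ℝ≥0, ∀ a : Pt d → 𝕄 d, Measurable a → (∀ z, inS d δ (a z)) → aSharp a ≤ ℓ aHat →
      ∀ (u ut : 𝔽 d) (ui : Fin d → Pt d → ℝ) (uij : Fin d → Fin d → Pt d → ℝ), Sol r a u ut ui uij →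
      eLpNorm u (ℓ (((d + 1) / d : ℝ) ^ n * r)) (volume.restrict (cyl d 1 0 0)) ≤ C * eLpNorm u (ℓ r) (volume.restrict (cyl d 2 0 0)) := by
  obtain ⟨aHat, h0, N, hp⟩ := pack hd hδ hδ1 hr n
  obtain ⟨C, hC⟩ := chain hd hδ hr.le N n 1 (3/2) one_pos (by norm_num)
  refine ⟨aHat, h0, C, fun a ham ha has u ut ui uij S ↦ ?_⟩
  obtain ⟨hAP, hDn⟩ := hp a ham ha has
  have hu := S.m (.inl (.inl ()))
  simp only [Gf, Sum.elim_inl] at hu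
  have hpos : ∀ k : ℕ, (0:ℝ) < 1 / ((k:ℝ) + 1) := fun k ↦ by positivity
  refine fatou (f := fun k ↦ {z : Pt d | 1 / ((k:ℝ) + 1) < z.1}.indicator u) (fun k ↦ (hu.indicator (measSet_T _)).aestronglyMeasurable) tendsto_const_nhds (fun k ↦ ?_) ?_
  · rw [eLpNorm_indicator_eq_eLpNorm_restrict (measSet_T _), Measure.restrict_restrict (measSet_T _)]
    refine le_trans (eLpNorm_mono_measure _ ?_) (main_h hd hδ hr.le hC ham ha hAP hDn S (hpos k))
    rw [muT_restrict _ (QQ_meas _ _)]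
    refine Measure.restrict_mono_set _ ?_
    rintro z ⟨h1, h2⟩
    refine ⟨?_, h1⟩
    rw [mem_QQ]
    have h3 := h2.1
    have h4 := h2.2
    simp only [mem_Ioo] at h3
    refine ⟨?_, h4⟩
    simp only [Prod.fst_zero, sub_zero]
    rw [abs_of_pos h3.1]; linarith [h3.2]
  · have hm : MeasurableSet (cyl d 1 0 0) := (isOpen_Ioo.prod isOpen_ball).measurableSet
    filter_upwards [ae_restrict_mem hm] with z hz
    refine tendsto_const_nhds.congr' ?_
    have h3 : 0 < z.1 := hz.1.1
    filter_upwards [(tendsto_one_div_add_atTop_nhds_zero_nat (𝕜 := ℝ)).eventually_lt_const h3] with k hk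
    exact (indicator_of_mem (show z ∈ {z : Pt d | 1 / ((k:ℝ) + 1) < z.1} from hk) u).symm

def Mx (q p : ℝ) (μ : Measure ℝ) (ν : Measure (Spc d)) (G : Pt d → ℝ≥0∞) : ℝ≥0∞ := (∫⁻ x, (∫⁻ t, G (t, x) ^ q ∂μ) ^ (p / q) ∂ν) ^ (1 / p)

lemma hol {α : Type*} [MeasurableSpace α] (μ : Measure α) {F : α → ℝ≥0∞} (hF : Measurable F) {s q : ℝ} (hs : 0 < s) (h : s ≤ q) :
    (∫⁻ x, F x ^ s ∂μ) ^ (1 / s) ≤ (∫⁻ x, F x ^ q ∂μ) ^ (1 / q) * μ univ ^ (1 / s - 1 / q) := by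
  have := eLpNorm'_le_eLpNorm'_mul_rpow_measure_univ hs h (f := F) (μ := μ) hF.aestronglyMeasurable
  simpa [eLpNorm'] using this

lemma Mx_mono {μ : Measure ℝ} {ν : Measure (Spc d)} [SFinite μ] {G : Pt d → ℝ≥0∞} (hG : Measurable G) {q p q' p' : ℝ} (hq : 0 < q) (hp : 0 < p)
    (hqq : q ≤ q') (hpp : p ≤ p') : Mx q p μ ν G ≤ μ univ ^ (1 / q - 1 / q') * ν univ ^ (1 / p - 1 / p') * Mx q' p' μ ν G := by
  have e : ∀ {q p : ℝ}, Mx q p μ ν G = (∫⁻ x, ((∫⁻ t, G (t, x) ^ q ∂μ) ^ (1 / q)) ^ p ∂ν) ^ (1 / p) := by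
    intro q p
    simp only [Mx, ← ENNReal.rpow_mul]
    congr 2; ext x; congr 1; ring
  rw [e, e]
  have hFm : Measurable fun x : Spc d ↦ (∫⁻ t, G (t, x) ^ q' ∂μ) ^ (1 / q') := (Measurable.lintegral_prod_left' (hG.pow_const q')).pow_const _
  set F := fun x : Spc d ↦ (∫⁻ t, G (t, x) ^ q' ∂μ) ^ (1 / q') with hF
  set c := μ univ ^ (1 / q - 1 / q') with hc
  calc _ ≤ (∫⁻ x, (F x * c) ^ p ∂ν) ^ (1 / p) := by
        refine ENNReal.rpow_le_rpow (lintegral_mono fun x ↦ ENNReal.rpow_le_rpow ?_ hp.le) (by positivity)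
        exact hol μ (hG.comp (by fun_prop : Measurable fun t : ℝ ↦ ((t, x) : Pt d))) hq hqq
    _ = (∫⁻ x, F x ^ p ∂ν) ^ (1 / p) * c := by
        simp only [ENNReal.mul_rpow_of_nonneg _ _ hp.le]
        rw [lintegral_mul_const _ (hFm.pow_const p), ENNReal.mul_rpow_of_nonneg _ _ (by positivity), ← ENNReal.rpow_mul, mul_one_div_cancel hp.ne', ENNReal.rpow_one]
    _ ≤ ((∫⁻ x, F x ^ p' ∂ν) ^ (1 / p') * ν univ ^ (1 / p - 1 / p')) * c := mul_le_mul_left (hol ν hFm hp hpp) _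
    _ = _ := by ring

lemma cyl_meas (R : ℝ) : MeasurableSet (cyl d R 0 0) := (isOpen_Ioo.prod isOpen_ball).measurableSet

lemma mixed_congr {q p : ℝ} {Γ : Set (Pt d)} (hΓ : MeasurableSet Γ) {f g : 𝔽 d} (h : f =ᵐ[volume.restrict Γ] g) : mixedNormLe q p Γ f = mixedNormLe q p Γ g := by
  have h1 : ∀ᵐ z : Pt d, Γ.indicator f z = Γ.indicator g z := by
    have := (ae_restrict_iff' hΓ).1 h
    filter_upwards [this] with z hz
    by_cases hc : z ∈ Γ
    · simp [hc, hz hc]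
    · simp [hc]
  have h2 : ∀ᵐ w : Spc d × ℝ, Γ.indicator f w.swap = Γ.indicator g w.swap :=
    (Measure.measurePreserving_swap (μ := (volume : Measure (Spc d))) (ν := (volume : Measure ℝ))).quasiMeasurePreserving.ae h1
  have h3 := Measure.ae_ae_of_ae_prod h2
  unfold mixedNormLe
  congr 1
  refine lintegral_congr_ae ?_
  filter_upwards [h3] with x hx
  congr 1
  refine lintegral_congr_ae ?_
  filter_upwards [hx] with t ht
  have ht' : Γ.indicator f (t, x) = Γ.indicator g (t, x) := ht
  simp only [ht']

lemma mixed_eq {q p : ℝ} (hq : 0 < q) (hp : 0 < p) (R : ℝ) (f : 𝔽 d) :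
    mixedNormLe q p (cyl d R 0 0) f = Mx q p (volume.restrict (Ioo 0 (0 + R ^ 2))) (volume.restrict (ball 0 R)) fun z ↦ ℓ |f z| := by
  unfold mixedNormLe Mx
  congr 1
  rw [← lintegral_indicator measurableSet_ball]
  refine lintegral_congr fun x ↦ ?_
  by_cases hx : x ∈ ball (0 : Spc d) R
  · rw [indicator_of_mem hx, ← lintegral_indicator measurableSet_Ioo]
    congr 1
    refine lintegral_congr fun t ↦ ?_
    by_cases ht : t ∈ Ioo (0:ℝ) (0 + R ^ 2)
    · rw [indicator_of_mem ht, indicator_of_mem (show ((t, x) : Pt d) ∈ cyl d R 0 0 from ⟨ht, hx⟩)]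
    · rw [indicator_of_notMem ht, indicator_of_notMem (show ((t, x) : Pt d) ∉ cyl d R 0 0 from fun hc ↦ ht hc.1)]
      simp [hq]
  · rw [indicator_of_notMem hx]
    have : ∀ t : ℝ, ((t, x) : Pt d) ∉ cyl d R 0 0 := fun t hc ↦ hx hc.2
    simp [indicator_of_notMem (this _), hq, div_pos hp hq]

lemma Mx_diag {s : ℝ} (hs : 0 < s) (R : ℝ) {f : 𝔽 d} (hf : Measurable f) :
    Mx s s (volume.restrict (Ioo 0 (0 + R ^ 2))) (volume.restrict (ball 0 R)) (fun z ↦ ℓ |f z|) = eLpNorm f (ℓ s) (volume.restrict (cyl d R 0 0)) := by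
  rw [eLp_eq hs, Mx]
  have e : (volume.restrict (cyl d R 0 0) : Measure (Pt d)) = (volume.restrict (Ioo (0:ℝ) (0 + R ^ 2))).prod (volume.restrict (ball (0 : Spc d) R)) := by
    rw [Measure.prod_restrict]; rfl
  rw [e, lintegral_prod_symm _ (by fun_prop)]
  simp only [div_self hs.ne', ENNReal.rpow_one, ENNReal.ofReal_rpow_of_nonneg (abs_nonneg _) hs.le]

lemma rep {q p r : ℝ} (hr : 1 < r) (hrq : r ≤ q) (hrp : r ≤ p) {f : 𝔽 d} (hf : LocallyIntegrableOn f (cyl d 2 0 0) volume) (hm : mixedNormLe q p (cyl d 2 0 0) f < ⊤) :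
    ∃ g, Measurable g ∧ MemLp g (ℓ r) volume ∧ f =ᵐ[volume.restrict (cyl d 2 0 0)] g := by
  have ha := hf.aestronglyMeasurable
  set g := (cyl d 2 0 0).indicator (ha.mk f) with hg
  have hgm : Measurable g := ha.stronglyMeasurable_mk.measurable.indicator (cyl_meas 2)
  have hfg : f =ᵐ[volume.restrict (cyl d 2 0 0)] g := by
    filter_upwards [ha.ae_eq_mk, ae_restrict_mem (cyl_meas 2)] with z hz hz'
    rw [hz, hg, indicator_of_mem hz']
  refine ⟨g, hgm, ⟨hgm.aestronglyMeasurable, ?_⟩, hfg⟩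
  have e : eLpNorm g (ℓ r) volume = eLpNorm g (ℓ r) (volume.restrict (cyl d 2 0 0)) := by
    rw [← eLpNorm_indicator_eq_eLpNorm_restrict (cyl_meas 2)]
    congr 1; rw [hg, indicator_indicator, inter_self]
  rw [e, ← Mx_diag (by linarith) 2 hgm]
  refine (Mx_mono (by fun_prop) (by linarith) (by linarith) hrq hrp).trans_lt ?_
  rw [← mixed_eq (by linarith) (by linarith), ← mixed_congr (cyl_meas 2) hfg]
  have c1 : 0 ≤ 1 / r - 1 / q := sub_nonneg.2 (one_div_le_one_div_of_le (by linarith) hrq)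
  have c2 : 0 ≤ 1 / r - 1 / p := sub_nonneg.2 (one_div_le_one_div_of_le (by linarith) hrp)
  refine ENNReal.mul_lt_top (ENNReal.mul_lt_top ?_ ?_) hm
  · exact ENNReal.rpow_lt_top_of_nonneg c1 (by simp)
  · exact ENNReal.rpow_lt_top_of_nonneg c2 (by rw [Measure.restrict_apply_univ]; exact measure_ball_lt_top.ne)

lemma WD_of {v : Pt d} {f g f' g' : 𝔽 d} (hf : f =ᵐ[volume.restrict (cyl d 2 0 0)] f') (hg : g =ᵐ[volume.restrict (cyl d 2 0 0)] g')
    (H : ∀ ψ, IsTest (cyl d 2 0 0) ψ → ∫ z in cyl d 2 0 0, f z * DD v ψ z = - ∫ z in cyl d 2 0 0, g z * ψ z) : WD (cyl d 2 0 0) v f' g' := by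
  intro ψ hψ hs
  have h1 := H ψ ⟨hψ.1, hψ.2, hs⟩
  have z1 : ∀ z, z ∉ cyl d 2 0 0 → f' z * DD v ψ z = 0 := fun z hz ↦ by
    have : DD v ψ z = 0 := by_contra fun hc ↦ hz (hs (DD_supp_sub (isClosed_tsupport ψ) (fun z hz ↦ subset_tsupport _ hz) v z hc))
    rw [this, mul_zero]
  have z2 : ∀ z, z ∉ cyl d 2 0 0 → g' z * ψ z = 0 := fun z hz ↦ by
    rw [image_eq_zero_of_notMem_tsupport fun hc ↦ hz (hs hc), mul_zero]
  rw [← setIntegral_eq_integral_of_forall_compl_eq_zero z1, ← setIntegral_eq_integral_of_forall_compl_eq_zero z2]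
  have e1 : ∫ z in cyl d 2 0 0, f z * DD v ψ z = ∫ z in cyl d 2 0 0, f' z * DD v ψ z := integral_congr_ae (by filter_upwards [hf] with z hz; rw [hz])
  have e2 : ∫ z in cyl d 2 0 0, g z * ψ z = ∫ z in cyl d 2 0 0, g' z * ψ z := integral_congr_ae (by filter_upwards [hg] with z hz; rw [hz])
  rw [← e1, ← e2, h1]

theorem fin15 (hd : 1 ≤ d) (δ : ℝ) (hδ0 : 0 < δ) (hδ1 : δ ≤ 1)
    (p q r : ℝ) (hp : 1 < p) (hq : 1 < q) (hr1 : 1 < r) (hr : r ≤ min p q) :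
    ∃ aHat N : ℝ, 0 < aHat ∧ 0 < N ∧
      ∀ a : Pt d → 𝕄 d, Measurable a → (∀ z, inS d δ (a z)) →
        aSharp a ≤ ℓ aHat →
      ∀ u ut : Pt d → ℝ, ∀ ui : Fin d → Pt d → ℝ, ∀ uij : Fin d → Fin d → Pt d → ℝ,
        LocallyIntegrableOn u (cyl d 2 0 0) volume →
        LocallyIntegrableOn ut (cyl d 2 0 0) volume →
        (∀ i, LocallyIntegrableOn (ui i) (cyl d 2 0 0) volume) →
        (∀ i j, LocallyIntegrableOn (uij i j) (cyl d 2 0 0) volume) →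
        WeakDtOn (cyl d 2 0 0) u ut →
        (∀ i, WeakDxOn (cyl d 2 0 0) i u (ui i)) →
        (∀ i j, WeakDxOn (cyl d 2 0 0) j (ui i) (uij i j)) →
        mixedNormLe q p (cyl d 2 0 0) u < ⊤ →
        mixedNormLe q p (cyl d 2 0 0) ut < ⊤ →
        (∀ i, mixedNormLe q p (cyl d 2 0 0) (ui i) < ⊤) →
        (∀ i j, mixedNormLe q p (cyl d 2 0 0) (uij i j) < ⊤) →
        (∀ᵐ z ∂(volume.restrict (cyl d 2 0 0)),
          ut z + ∑ i, ∑ j, a z i j * uij i j z = 0) →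
        mixedNormLe q p (cyl d 1 0 0) u ≤
          ℓ N * (∫⁻ z in cyl d 2 0 0, ℓ |u z| ^ r) ^ (1 / r) := by
  have hrp : r ≤ p := hr.trans (min_le_left _ _)
  have hrq : r ≤ q := hr.trans (min_le_right _ _)
  obtain ⟨n, hn⟩ := pow_unbounded_of_one_lt (max p q) (kap hd)
  set m := ((d + 1) / d : ℝ) ^ n * r with hm
  have hmm : max p q ≤ m := hn.le.trans (le_mul_of_one_le_right (by linarith [le_max_left p q]) hr1.le)
  have hpm : p ≤ m := (le_max_left _ _).trans hmm
  have hqm : q ≤ m := (le_max_right _ _).trans hmm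
  obtain ⟨aHat, h0, C, hC⟩ := main_m hd hδ0 hδ1 hr1 n
  set K : ℝ≥0∞ := (volume.restrict (Ioo (0:ℝ) (0 + 1 ^ 2))) univ ^ (1 / q - 1 / m) * (volume.restrict (ball (0 : Spc d) 1)) univ ^ (1 / p - 1 / m) with hK
  have c1 : 0 ≤ 1 / q - 1 / m := sub_nonneg.2 (one_div_le_one_div_of_le (by linarith) hqm)
  have c2 : 0 ≤ 1 / p - 1 / m := sub_nonneg.2 (one_div_le_one_div_of_le (by linarith) hpm)
  have hKt : K ≠ ⊤ := by
    refine (ENNReal.mul_lt_top ?_ ?_).ne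
    · exact ENNReal.rpow_lt_top_of_nonneg c1 (by simp)
    · exact ENNReal.rpow_lt_top_of_nonneg c2 (by rw [Measure.restrict_apply_univ]; exact measure_ball_lt_top.ne)
  refine ⟨aHat, (K * C).toReal + 1, h0, by positivity, fun a ham ha has u ut ui uij lu lt li lij wt wx wxx mu mt mi mij heq ↦ ?_⟩
  obtain ⟨u', u1, u2, u3⟩ := rep hr1 hrq hrp lu mu
  obtain ⟨ut', t1, t2, t3⟩ := rep hr1 hrq hrp lt mt
  choose ui' i1 i2 i3 using fun i ↦ rep hr1 hrq hrp (li i) (mi i)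
  choose uij' j1 j2 j3 using fun i j ↦ rep hr1 hrq hrp (lij i j) (mij i j)
  have S : Sol r a u' ut' ui' uij' := by
    refine ⟨?_, ?_, ?_, fun i ↦ ?_, fun i j ↦ ?_, ?_⟩
    · rintro ((_ | _) | (i | i))
      exacts [u1, t1, i1 i, j1 _ _]
    · rintro ((_ | _) | (i | i))
      exacts [u2, t2, i2 i, j2 _ _]
    · exact WD_of u3 t3 fun ψ hψ ↦ by rw [← Dt_eq hψ.1]; exact wt ψ hψ
    · exact WD_of u3 (i3 i) fun ψ hψ ↦ by rw [← Dx_eq hψ.1]; exact wx i ψ hψ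
    · exact WD_of (i3 i) (j3 i j) fun ψ hψ ↦ by rw [← Dx_eq hψ.1]; exact wxx i j ψ hψ
    · refine (ae_restrict_iff' (cyl_meas 2)).1 ?_
      have j3' : ∀ᵐ z ∂(volume.restrict (cyl d 2 0 0)), ∀ i j, uij i j z = uij' i j z := ae_all_iff.2 fun i ↦ ae_all_iff.2 fun j ↦ j3 i j
      filter_upwards [heq, t3, j3'] with z h1 h2 h3
      simp only [← h2, ← h3]; exact h1
  have key := hC a ham ha has u' ut' ui' uij' S
  have sub : cyl d 1 0 0 ⊆ cyl d 2 0 0 := prod_mono (Ioo_subset_Ioo le_rfl (by norm_num)) (ball_subset_ball (by norm_num))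
  have e2 : eLpNorm u' (ℓ r) (volume.restrict (cyl d 2 0 0)) = (∫⁻ z in cyl d 2 0 0, ℓ |u z| ^ r) ^ (1 / r) := by
    rw [← eLpNorm_congr_ae u3, eLp_eq (by linarith)]
    simp only [ENNReal.ofReal_rpow_of_nonneg (abs_nonneg _) (by linarith : 0 ≤ r)]
  rw [← e2, mixed_congr (cyl_meas 1) (ae_restrict_of_ae_restrict_of_subset sub u3), mixed_eq (by linarith) (by linarith)]
  refine (Mx_mono (by fun_prop) (by linarith) (by linarith) hqm hpm).trans ?_
  rw [← hK, Mx_diag (by linarith) 1 u1]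
  refine (mul_le_mul_right key _).trans ?_
  rw [← mul_assoc]
  refine mul_le_mul_left ?_ _
  rw [ENNReal.ofReal_add ENNReal.toReal_nonneg zero_le_one, ENNReal.ofReal_toReal (ENNReal.mul_ne_top hKt ENNReal.coe_ne_top)]
  exact le_self_add

end Aux15

theorem stmt15 (d : ℕ) (hd : 1 ≤ d) (δ : ℝ) (hδ0 : 0 < δ) (hδ1 : δ ≤ 1)
    (p q r : ℝ) (hp : 1 < p) (hq : 1 < q) (hr1 : 1 < r) (hr : r ≤ min p q) :
    ∃ aHat N : ℝ, 0 < aHat ∧ 0 < N ∧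
      ∀ a : Pt d → Matrix (Fin d) (Fin d) ℝ, Measurable a → (∀ z, inS d δ (a z)) →
        aSharp a ≤ ENNReal.ofReal aHat →
      ∀ u ut : Pt d → ℝ, ∀ ui : Fin d → Pt d → ℝ, ∀ uij : Fin d → Fin d → Pt d → ℝ,
        LocallyIntegrableOn u (cyl d 2 0 0) volume →
        LocallyIntegrableOn ut (cyl d 2 0 0) volume →
        (∀ i, LocallyIntegrableOn (ui i) (cyl d 2 0 0) volume) →
        (∀ i j, LocallyIntegrableOn (uij i j) (cyl d 2 0 0) volume) →
        WeakDtOn (cyl d 2 0 0) u ut →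
        (∀ i, WeakDxOn (cyl d 2 0 0) i u (ui i)) →
        (∀ i j, WeakDxOn (cyl d 2 0 0) j (ui i) (uij i j)) →
        mixedNormLe q p (cyl d 2 0 0) u < ⊤ →
        mixedNormLe q p (cyl d 2 0 0) ut < ⊤ →
        (∀ i, mixedNormLe q p (cyl d 2 0 0) (ui i) < ⊤) →
        (∀ i j, mixedNormLe q p (cyl d 2 0 0) (uij i j) < ⊤) →
        (∀ᵐ z ∂(volume.restrict (cyl d 2 0 0)),
          ut z + ∑ i, ∑ j, a z i j * uij i j z = 0) →
        mixedNormLe q p (cyl d 1 0 0) u ≤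
          ENNReal.ofReal N * (∫⁻ z in cyl d 2 0 0, ENNReal.ofReal |u z| ^ r) ^ (1 / r) := by
  exact fin15 hd δ hδ0 hδ1 p q r hp hq hr1 hr
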